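/- Let r be a positive integer and let G be a graph with Euler genus g such that bw(G) > 4r(g+1). Then G contains the (r × r)-grid as a minor. -/

import Mathlib

open SimpleGraph Set

universe u

/-- A branch-decomposition of a graph `G`: a ternary tree `T` (internal vertices of
degree 3) together with a bijection from the edges of `G` to the leaves of `T`. -/
structure BranchDecomp {V : Type u} (G : SimpleGraph V) : Type (u + 1) where
  t : Type
  fin : Fintype t
  T : SimpleGraph t
  isTree : T.IsTree
  ternary : ∀ v : t, (T.neighborSet v).ncard ≤ 1 ∨ (T.neighborSet v).ncard = 3
  τ : G.edgeSet ≃ {v : t // (T.neighborSet v).ncard ≤ 1}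

namespace BranchDecomp

variable {V : Type u} {G : SimpleGraph V} (B : BranchDecomp G)

/-- The edges of `G` whose leaves lie on the `a`-side of the tree edge `ab`. -/
def side (a b : B.t) : Set G.edgeSet :=
  {e | (B.T.deleteEdges {s(a, b)}).Reachable a (B.τ e).1}

/-- The boundary `∂(X_e)` of the bipartition of `E(G)` induced by the tree edge `ab`:
vertices incident to edges on both sides. -/
def bdry (a b : B.t) : Set V :=
  {v | (∃ e : G.edgeSet, e ∈ B.side a b ∧ v ∈ (e : Sym2 V)) ∧
       (∃ e : G.edgeSet, e ∉ B.side a b ∧ v ∈ (e : Sym2 V))}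

/-- The width of a branch-decomposition: the maximum, over edges of the tree, of the
size of the corresponding boundary. -/
noncomputable def width : ℕ :=
  sSup {n | ∃ a b : B.t, B.T.Adj a b ∧ n = (B.bdry a b).ncard}

end BranchDecomp

/-- The branchwidth of a graph: the minimum width of a branch-decomposition. -/
noncomputable def branchwidth {V : Type u} (G : SimpleGraph V) : ℕ :=
  sInf {n | ∃ B : BranchDecomp G, B.width = n}

/-- A tree-decomposition of a graph. -/
structure TreeDecomp {V : Type u} (G : SimpleGraph V) : Type (u + 1) where
  t : Type
  fin : Fintype t
  T : SimpleGraph t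
  isTree : T.IsTree
  β : t → Set V
  covers_edge : ∀ ⦃u v : V⦄, G.Adj u v → ∃ x, u ∈ β x ∧ v ∈ β x
  covers_vert : ∀ v : V, ∃ x, v ∈ β x
  subtree : ∀ v : V, (T.induce {x | v ∈ β x}).Connected

/-- The width of a tree-decomposition: maximum bag size minus one. -/
noncomputable def TreeDecomp.width {V : Type u} {G : SimpleGraph V} (D : TreeDecomp G) : ℕ :=
  sSup {n | ∃ x : D.t, n + 1 = (D.β x).ncard}

/-- The treewidth of a graph. -/
noncomputable def treewidth {V : Type u} (G : SimpleGraph V) : ℕ :=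
  sInf {n | ∃ D : TreeDecomp G, D.width = n}

/-- A minor model of `H` in `G`: disjoint connected branch sets with edges realized. -/
def IsMinorModel {V : Type u} {W : Type*} (G : SimpleGraph V) (H : SimpleGraph W)
    (φ : W → Set V) : Prop :=
  (∀ w, (G.induce (φ w)).Connected) ∧
  (Pairwise fun w₁ w₂ => Disjoint (φ w₁) (φ w₂)) ∧
  (∀ ⦃w₁ w₂ : W⦄, H.Adj w₁ w₂ → ∃ a ∈ φ w₁, ∃ b ∈ φ w₂, G.Adj a b)

/-- `G` has `H` as a minor. -/
def HasMinor {V : Type u} {W : Type*} (G : SimpleGraph V) (H : SimpleGraph W) : Prop :=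
  ∃ φ : W → Set V, IsMinorModel G H φ

/-- The `(k × k)`-grid. -/
def gridGraph (k : ℕ) : SimpleGraph (Fin k × Fin k) :=
  SimpleGraph.fromRel fun p q =>
    (p.1 = q.1 ∧ (p.2 : ℕ) + 1 = (q.2 : ℕ)) ∨ (p.2 = q.2 ∧ (p.1 : ℕ) + 1 = (q.1 : ℕ))

/-- A combinatorial closed surface presented as a flag system ("graph-encoded map"):
three fixed-point-free involutions on a finite set of flags, with `σ₀` and `σ₂`
commuting and `σ₀σ₂` fixed-point free. Vertices, edges, faces of the map are the orbits
of `⟨σ₁,σ₂⟩`, `⟨σ₀,σ₂⟩`, `⟨σ₀,σ₁⟩` respectively. -/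
structure FlagSystem : Type 1 where
  F : Type
  fin : Fintype F
  σ₀ : Equiv.Perm F
  σ₁ : Equiv.Perm F
  σ₂ : Equiv.Perm F
  inv₀ : σ₀ * σ₀ = 1
  inv₁ : σ₁ * σ₁ = 1
  inv₂ : σ₂ * σ₂ = 1
  fpf₀ : ∀ x, σ₀ x ≠ x
  fpf₁ : ∀ x, σ₁ x ≠ x
  fpf₂ : ∀ x, σ₂ x ≠ x
  comm02 : σ₀ * σ₂ = σ₂ * σ₀
  fpf02 : ∀ x, (σ₀ * σ₂) x ≠ x

namespace FlagSystem

variable (M : FlagSystem)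

/-- Two flags lie in a common orbit of the subgroup generated by a set of permutations. -/
def SameOrbit (S : Set (Equiv.Perm M.F)) (x y : M.F) : Prop :=
  ∃ g ∈ Subgroup.closure S, g x = y

/-- The number of orbits of the subgroup generated by `S` on the flags. -/
noncomputable def numOrbits (S : Set (Equiv.Perm M.F)) : ℕ :=
  Nat.card (Quotient (MulAction.orbitRel (Subgroup.closure S) M.F))

/-- Number of vertices of the map. -/
noncomputable def nV : ℕ := M.numOrbits {M.σ₁, M.σ₂}
/-- Number of edges of the map. -/
noncomputable def nE : ℕ := M.numOrbits {M.σ₀, M.σ₂}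
/-- Number of faces of the map. -/
noncomputable def nF : ℕ := M.numOrbits {M.σ₀, M.σ₁}
/-- Number of connected components of the map (= of the underlying surface). -/
noncomputable def nC : ℕ := M.numOrbits {M.σ₀, M.σ₁, M.σ₂}

/-- The flag system `M` is (the flag system of) a 2-cell embedding of the graph `G`:
there are assignments of a (non-isolated) vertex and an edge of `G` to each flag which
identify the vertex orbits with the non-isolated vertices of `G` and the edge orbits
with the edges of `G`, respecting all incidences. -/
def Realizes {V : Type u} (G : SimpleGraph V) : Prop :=
  ∃ (fv : M.F → {v : V // ∃ e ∈ G.edgeSet, v ∈ e}) (fe : M.F → G.edgeSet),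
    (∀ x, ((fv x : V) ∈ (fe x : Sym2 V))) ∧
    (∀ x, fv (M.σ₁ x) = fv x) ∧ (∀ x, fv (M.σ₂ x) = fv x) ∧
    (∀ x, fv (M.σ₀ x) ≠ fv x) ∧
    (∀ x, fe (M.σ₀ x) = fe x) ∧ (∀ x, fe (M.σ₂ x) = fe x) ∧
    (∀ x y, fv x = fv y → M.SameOrbit {M.σ₁, M.σ₂} x y) ∧
    (∀ x y, fe x = fe y → M.SameOrbit {M.σ₀, M.σ₂} x y) ∧
    Function.Surjective fv ∧
    (∀ (e : G.edgeSet) (v : V), v ∈ (e : Sym2 V) → ∃ x, fe x = e ∧ (fv x : V) = v)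

end FlagSystem

/-- The Euler genus of a graph `G`: the least `g` such that some 2-cell embedding of `G`
(given by a flag system `M` realizing `G`) satisfies the Euler formula
`g + v + f = 2·c + e`, i.e. `g = 2c - v + e - f`. -/
noncomputable def eulerGenus {V : Type u} (G : SimpleGraph V) : ℕ :=
  sInf {g | ∃ M : FlagSystem, M.Realizes G ∧ g + M.nV + M.nF = 2 * M.nC + M.nE}

section

open SimpleGraph Set

/-- cut-based connectivity of a nonempty set `A` with respect to a relation `R` -/
def Cn {α : Type*} (R : α → α → Prop) (A : Set α) : Prop :=
  A.Nonempty ∧ ∀ S : Set α, (∃ u ∈ A, u ∈ S) →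
    (∀ x ∈ A, ∀ y ∈ A, R x y → x ∈ S → y ∈ S) → A ⊆ S

namespace Cn

variable {α β : Type*} {R : α → α → Prop} {R' : β → β → Prop} {A B : Set α}

theorem sing (a : α) : Cn R {a} := by
  refine ⟨⟨a, rfl⟩, fun S ⟨u, hu, hs⟩ _ => ?_⟩
  rw [mem_singleton_iff] at hu
  subst hu
  simpa using hs

theorem union (hA : Cn R A) (hB : Cn R B) (h : (A ∩ B).Nonempty) : Cn R (A ∪ B) := by
  obtain ⟨c, hcA, hcB⟩ := h
  refine ⟨⟨c, Or.inl hcA⟩, fun S ⟨u, hu, hs⟩ hc => ?_⟩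
  have h1 : (∃ u ∈ A, u ∈ S) → A ⊆ S := fun h => hA.2 S h
    fun x hx y hy => hc x (Or.inl hx) y (Or.inl hy)
  have h2 : (∃ u ∈ B, u ∈ S) → B ⊆ S := fun h => hB.2 S h
    fun x hx y hy => hc x (Or.inr hx) y (Or.inr hy)
  rcases hu with hu | hu
  · have := h1 ⟨u, hu, hs⟩
    exact union_subset this (h2 ⟨c, hcB, this hcA⟩)
  · have := h2 ⟨u, hu, hs⟩
    exact union_subset (h1 ⟨c, hcA, this hcB⟩) this

theorem mono (hA : Cn R A) {Q : α → α → Prop} (h : ∀ x ∈ A, ∀ y ∈ A, R x y → Q x y) : Cn Q A :=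
  ⟨hA.1, fun S hu hc => hA.2 S hu fun x hx y hy hr => hc x hx y hy (h x hx y hy hr)⟩

theorem pair {a b : α} (hs : ∀ x y, R x y → R y x) (h : R a b) : Cn R {a, b} := by
  refine ⟨⟨a, Or.inl rfl⟩, fun S ⟨u, hu, hS⟩ hc => ?_⟩
  have h1 : a ∈ S → b ∈ S := hc a (Or.inl rfl) b (Or.inr rfl) h
  have h2 : b ∈ S → a ∈ S := hc b (Or.inr rfl) a (Or.inl rfl) (hs _ _ h)
  rintro x (rfl | rfl) <;> rcases hu with rfl | rfl <;> tauto

theorem union_adj (hs : ∀ x y, R x y → R y x) (hA : Cn R A) (hB : Cn R B) {a b : α}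
    (ha : a ∈ A) (hb : b ∈ B) (h : R a b) : Cn R (A ∪ B) := by
  have h1 := (hA.union (pair hs h) ⟨a, ha, Or.inl rfl⟩).union hB ⟨b, Or.inr (Or.inr rfl), hb⟩
  convert h1 using 1
  ext x; simp only [mem_union, mem_insert_iff, mem_singleton_iff]
  constructor
  · tauto
  · rintro ((h | h | h) | h) <;> subst_vars <;> tauto

theorem insert_adj (hs : ∀ x y, R x y → R y x) (hA : Cn R A) {a b : α}
    (ha : a ∈ A) (h : R a b) : Cn R (insert b A) := by
  have := union_adj hs hA (sing b) ha rfl h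
  rwa [union_comm, singleton_union] at this

theorem sUnion {ι : Type*} {F : ι → Set α} (c : α) (hF : ∀ i, Cn R (F i)) (hc : ∀ i, c ∈ F i)
    (hne : Nonempty ι) : Cn R (⋃ i, F i) := by
  obtain ⟨i0⟩ := hne
  refine ⟨⟨c, mem_iUnion.2 ⟨i0, hc i0⟩⟩, fun S ⟨u, hu, hs⟩ hcl => ?_⟩
  obtain ⟨j, hj⟩ := mem_iUnion.1 hu
  have h1 : ∀ i, (∃ u ∈ F i, u ∈ S) → F i ⊆ S := fun i h => (hF i).2 S h
    fun x hx y hy => hcl x (mem_iUnion.2 ⟨i, hx⟩) y (mem_iUnion.2 ⟨i, hy⟩)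
  have hcS := h1 j ⟨u, hj, hs⟩ (hc j)
  exact iUnion_subset fun i => h1 i ⟨c, hc i, hcS⟩

theorem cross (hA : Cn R A) (S : Set α) (h1 : (A ∩ S).Nonempty) (h2 : (A \ S).Nonempty) :
    ∃ x ∈ A ∩ S, ∃ y ∈ A \ S, R x y := by
  by_contra hcon
  push Not at hcon
  obtain ⟨u, hu, hs⟩ := h1
  obtain ⟨v, hv, hvs⟩ := h2
  refine hvs (hA.2 S ⟨u, hu, hs⟩ (fun x hx y hy hr hxs => ?_) hv)
  by_contra hys
  exact hcon x ⟨hx, hxs⟩ y ⟨hy, hys⟩ hr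

theorem image (hA : Cn R A) (f : α → β)
    (h : ∀ x ∈ A, ∀ y ∈ A, R x y → f x = f y ∨ R' (f x) (f y)) : Cn R' (f '' A) := by
  refine ⟨hA.1.image f, fun S ⟨u, ⟨a, ha, hau⟩, hs⟩ hc => ?_⟩
  have := hA.2 (f ⁻¹' S) ⟨a, ha, by rw [mem_preimage, hau]; exact hs⟩ (fun x hx y hy hr hxs => by
    rcases h x hx y hy hr with h | h
    · rw [mem_preimage, ← h]; exact hxs
    · exact hc _ ⟨x, hx, rfl⟩ _ ⟨y, hy, rfl⟩ h hxs)
  exact image_subset_iff.2 this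

/-- preimage under a map with connected fibres through which adjacency lifts -/
theorem preim {B : Set β} (hB : Cn R' B) (f : α → β)
    (hf : ∀ b ∈ B, Cn R (f ⁻¹' {b}))
    (h : ∀ a ∈ B, ∀ b ∈ B, R' a b → ∃ x y, f x = a ∧ f y = b ∧ R x y) : Cn R (f ⁻¹' B) := by
  obtain ⟨b0, hb0⟩ := hB.1
  obtain ⟨x0, hx0⟩ := (hf b0 hb0).1
  refine ⟨⟨x0, by rw [mem_preimage, show f x0 = b0 from hx0]; exact hb0⟩, fun S ⟨u, hu, hs⟩ hc => ?_⟩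
  have hfib : ∀ b ∈ B, (∃ x, f x = b ∧ x ∈ S) → f ⁻¹' {b} ⊆ S := fun b hb ⟨x, hx, hxs⟩ =>
    (hf b hb).2 S ⟨x, hx, hxs⟩ fun x hx y hy =>
      hc x (by rw [mem_preimage, show f x = b from hx]; exact hb) y
        (by rw [mem_preimage, show f y = b from hy]; exact hb)
  have := hB.2 {b | f ⁻¹' {b} ⊆ S} ⟨f u, hu, hfib _ hu ⟨u, rfl, hs⟩⟩ (fun a ha b hb hr has => by
    obtain ⟨x, y, hx, hy, hxy⟩ := h a ha b hb hr
    have hxs : x ∈ S := has hx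
    exact hfib b hb ⟨y, hy, hc x (by rw [mem_preimage, hx]; exact ha) y
      (by rw [mem_preimage, hy]; exact hb) hxy hxs⟩)
  intro x hx
  exact this hx rfl

end Cn

/-- component of `u` in `A` -/
def cpt {α : Type*} (R : α → α → Prop) (A : Set α) (u : α) : Set α :=
  {v | Relation.ReflTransGen (fun x y => x ∈ A ∧ y ∈ A ∧ R x y) u v}

section cpt
variable {α β : Type*} {R : α → α → Prop} {A B : Set α}

theorem mem_cpt_self (u : α) : u ∈ cpt R A u := Relation.ReflTransGen.refl

theorem cpt_sub {u : α} (hu : u ∈ A) : cpt R A u ⊆ A := by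
  intro v hv
  induction hv with
  | refl => exact hu
  | tail _ h _ => exact h.2.1

theorem cpt_closed {u x y : α} (hu : u ∈ A) (hx : x ∈ cpt R A u) (hy : y ∈ A) (h : R x y) :
    y ∈ cpt R A u := Relation.ReflTransGen.tail hx ⟨cpt_sub hu hx, hy, h⟩

theorem cpt_cn (hs : ∀ x y, R x y → R y x) (u : α) : Cn R (cpt R A u) := by
  refine ⟨⟨u, mem_cpt_self u⟩, fun S ⟨w, hw, hS⟩ hc => ?_⟩
  have key : ∀ v, v ∈ cpt R A u → (u ∈ S ↔ v ∈ S) := by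
    intro v hv
    induction hv with
    | refl => rfl
    | @tail b c h1 h2 ih =>
      have hc' : c ∈ cpt R A u := Relation.ReflTransGen.tail h1 h2
      exact ih.trans ⟨hc _ h1 _ hc' h2.2.2, hc _ hc' _ h1 (hs _ _ h2.2.2)⟩
  intro v hv
  exact (key v hv).1 ((key w hw).2 hS)

theorem cn_sub_cpt {u : α} (hB : Cn R B) (hBA : B ⊆ A) (hu : u ∈ B) : B ⊆ cpt R A u :=
  hB.2 _ ⟨u, hu, mem_cpt_self u⟩ fun x hx y hy hr hxs =>
    Relation.ReflTransGen.tail hxs ⟨hBA hx, hBA hy, hr⟩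

theorem cn_sub_cpt' {u v : α} (hB : Cn R B) (hBA : B ⊆ A) (hv : v ∈ B) (hu : v ∈ cpt R A u) :
    B ⊆ cpt R A u :=
  hB.2 _ ⟨v, hv, hu⟩ fun x hx y hy hr hxs =>
    Relation.ReflTransGen.tail hxs ⟨hBA hx, hBA hy, hr⟩

theorem cpt_eq {u v : α} (hs : ∀ x y, R x y → R y x) (hu : u ∈ A) (hv : v ∈ cpt R A u) :
    cpt R A v = cpt R A u :=
  Subset.antisymm (cn_sub_cpt' (cpt_cn hs v) (cpt_sub (cpt_sub hu hv)) (mem_cpt_self v) hv)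
    (cn_sub_cpt (cpt_cn hs u) (cpt_sub hu) hv)

theorem cn_iff_induce {V : Type*} (G : SimpleGraph V) (A : Set V) :
    Cn G.Adj A ↔ (G.induce A).Connected := by
  constructor
  · rintro ⟨⟨a, ha⟩, h⟩
    have : Nonempty A := ⟨⟨a, ha⟩⟩
    refine (SimpleGraph.connected_iff _).2 ⟨fun u v => ?_, this⟩
    have := h {x | ∃ hx : x ∈ A, (G.induce A).Reachable u ⟨x, hx⟩} ⟨u, u.2, u.2, .refl _⟩
      (fun x hx y hy hr ⟨hx', hxr⟩ => ⟨hy, hxr.trans (SimpleGraph.Adj.reachable (by simpa using hr))⟩) v.2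
    exact this.2
  · intro h
    obtain ⟨⟨a, ha⟩⟩ := h.nonempty
    refine ⟨⟨a, ha⟩, fun S ⟨u, hu, hS⟩ hc v hv => ?_⟩
    obtain ⟨w⟩ := h.preconnected ⟨u, hu⟩ ⟨v, hv⟩
    have : ∀ (x y : A) (w : (G.induce A).Walk x y), x.1 ∈ S → y.1 ∈ S := by
      intro x y w
      induction w with
      | nil => exact id
      | @cons a b c hab _ ih => exact fun ha => ih (hc a a.2 b b.2 (by simpa using hab) ha)
    exact this _ _ w hS

end cpt

end

section

open SimpleGraph Set

section menger
variable {V : Type*}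

theorem menger_trim [Finite V] (G : SimpleGraph V) (N X I : Set V) (P : V → Set V)
    (hI : I.ncard = X.ncard) (hc : ∀ s ∈ I, Cn G.Adj (P s)) (hN : ∀ s ∈ I, (P s ∩ N).Nonempty)
    (hX : ∀ s ∈ I, (P s ∩ X).Nonempty)
    (hd : ∀ s ∈ I, ∀ t ∈ I, s ≠ t → Disjoint (P s) (P t)) :
    ∃ L : V → Set V, (∀ s ∈ X, Cn G.Adj (L s) ∧ (L s ∩ N).Nonempty ∧ L s ∩ X = {s} ∧
      ∀ v ∈ L s, v ≠ s → ∃ D, Cn G.Adj D ∧ D ∩ X = ∅ ∧ (D ∩ N).Nonempty ∧ v ∈ D) ∧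
      ∀ s ∈ X, ∀ t ∈ X, s ≠ t → Disjoint (L s) (L t) := by
  have key : ∀ i : I, ∃ x : X, ∃ L : Set V, L ⊆ P i ∧ Cn G.Adj L ∧ (L ∩ N).Nonempty ∧ L ∩ X = {x.1} ∧
      ∀ v ∈ L, v ≠ x → ∃ D, Cn G.Adj D ∧ D ∩ X = ∅ ∧ (D ∩ N).Nonempty ∧ v ∈ D := by
    rintro ⟨i, hi⟩
    obtain ⟨a, haP, haN⟩ := hN i hi
    by_cases haX : a ∈ X
    · refine ⟨⟨a, haX⟩, {a}, by simpa using haP, Cn.sing a, ⟨a, rfl, haN⟩, ?_, ?_⟩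
      · ext z; simp only [mem_inter_iff, mem_singleton_iff]
        exact ⟨fun h => h.1, fun h => ⟨h, h ▸ haX⟩⟩
      · intro v hv hne; exact absurd hv hne
    · set C := cpt G.Adj (P i \ X) a with hC
      have haA : a ∈ P i \ X := ⟨haP, haX⟩
      have hCs := cpt_sub (R := G.Adj) haA
      obtain ⟨b, hbP, hbX⟩ := hX i hi
      obtain ⟨x, ⟨hxP, hxC⟩, y, ⟨hyP, hyC⟩, hxy⟩ := (hc i hi).cross C ⟨a, haP, mem_cpt_self a⟩
        ⟨b, hbP, fun h => (hCs h).2 hbX⟩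
      have hyX : y ∈ X := by
        by_contra hyX
        exact hyC (cpt_closed haA hxC ⟨hyP, hyX⟩ hxy)
      have hCc : Cn G.Adj C := cpt_cn (fun _ _ h => h.symm) a
      refine ⟨⟨y, hyX⟩, insert y C, insert_subset hyP fun z hz => (hCs hz).1,
        hCc.insert_adj (fun _ _ h => h.symm) hxC hxy, ⟨a, Or.inr (mem_cpt_self a), haN⟩, ?_, ?_⟩
      · ext z; simp only [mem_inter_iff, mem_singleton_iff, mem_insert_iff]
        exact ⟨fun h => h.1.resolve_right fun hz => (hCs hz).2 h.2, fun h => ⟨Or.inl h, h ▸ hyX⟩⟩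
      · intro v hv hne
        refine ⟨C, hCc, ?_, ⟨a, mem_cpt_self a, haN⟩, hv.resolve_left hne⟩
        ext z; simp only [mem_inter_iff, mem_empty_iff_false, iff_false]
        exact fun h => (hCs h.1).2 h.2
  choose f L hLP hLc hLN hLX hLD using key
  have hmem : ∀ i, (f i).1 ∈ L i := fun i => by
    have : (f i).1 ∈ L i ∩ X := by rw [hLX]; rfl
    exact this.1
  have finj : Function.Injective f := by
    intro i j hij
    by_contra hne
    have hne' : i.1 ≠ j.1 := fun h => hne (Subtype.ext h)
    have h1 := hLP i (hmem i)
    have h2 := hLP j (hmem j)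
    rw [← hij] at h2
    exact (hd i i.2 j j.2 hne').le_bot ⟨h1, h2⟩
  have fbij : Function.Bijective f := by
    rw [Nat.bijective_iff_injective_and_card]
    exact ⟨finj, by rw [Nat.card_coe_set_eq, Nat.card_coe_set_eq, hI]⟩
  classical
  choose g hg using fbij.2
  refine ⟨fun s => if h : s ∈ X then L (g ⟨s, h⟩) else ∅, fun s hs => ?_, fun s hs t ht hst => ?_⟩
  · simp only [hs, dite_true]
    have := hg ⟨s, hs⟩
    have e : (f (g ⟨s, hs⟩)).1 = s := by rw [this]
    refine ⟨hLc _, hLN _, by rw [hLX, e], ?_⟩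
    have := hLD (g ⟨s, hs⟩)
    rwa [e] at this
  · simp only [hs, ht, dite_true]
    refine Disjoint.mono (hLP _) (hLP _) (hd _ (g _).2 _ (g _).2 fun h => hst ?_)
    have := congrArg f (Subtype.ext h)
    rw [hg, hg] at this
    exact congrArg Subtype.val this

theorem menger_aux [Finite V] (n : ℕ) : ∀ (G : SimpleGraph V), G.edgeSet.ncard = n →
    ∀ (N S : Set V) (r : ℕ), (∀ Y : Set V, Y.ncard < r → ∃ P, Cn G.Adj P ∧ (P ∩ N).Nonempty ∧
      (P ∩ S).Nonempty ∧ Disjoint P Y) → ∃ (I : Set V) (P : V → Set V), I.ncard = r ∧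
      (∀ s ∈ I, Cn G.Adj (P s)) ∧ (∀ s ∈ I, (P s ∩ N).Nonempty) ∧ (∀ s ∈ I, (P s ∩ S).Nonempty) ∧
      (∀ s ∈ I, ∀ t ∈ I, s ≠ t → Disjoint (P s) (P t)) := by
  induction n using Nat.strong_induction_on with
  | _ n ih =>
  intro G hn N B r h
  by_cases hE : ∃ a b, G.Adj a b
  swap
  · push Not at hE
    have hr : r ≤ (N ∩ B).ncard := by
      by_contra hlt
      obtain ⟨P, hP, ⟨a, haP, haN⟩, ⟨b, hbP, hbB⟩, hd⟩ := h (N ∩ B) (not_le.1 hlt)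
      have : b ∈ ({a} : Set V) := hP.2 {a} ⟨a, haP, rfl⟩ (fun x _ y _ hxy => absurd hxy (hE x y)) hbP
      rw [mem_singleton_iff] at this
      subst this
      exact hd.le_bot ⟨haP, haN, hbB⟩
    obtain ⟨I, hI, hIr⟩ := Set.exists_subset_card_eq hr
    exact ⟨I, fun s => {s}, hIr, fun s _ => Cn.sing s, fun s hs => ⟨s, rfl, (hI hs).1⟩,
      fun s hs => ⟨s, rfl, (hI hs).2⟩, fun s _ t _ hst => by simpa using hst⟩
  obtain ⟨a, b, hab⟩ := hE
  set G' := G.deleteEdges {s(a, b)} with hG'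
  have hsub : ∀ x y, G'.Adj x y → G.Adj x y := fun x y h => by
    rw [hG', deleteEdges_adj] at h; exact h.1
  have hlt : G'.edgeSet.ncard < n := by
    rw [← hn]
    refine Set.ncard_lt_ncard ?_ (Set.toFinite _)
    refine ⟨fun e he => ?_, fun hss => ?_⟩
    · rw [hG', edgeSet_deleteEdges] at he; exact he.1
    · have : s(a, b) ∈ G'.edgeSet := hss hab
      rw [hG', edgeSet_deleteEdges] at this
      exact this.2 rfl
  have IH := ih _ hlt G' rfl
  by_cases hs : ∀ Y : Set V, Y.ncard < r → ∃ P, Cn G'.Adj P ∧ (P ∩ N).Nonempty ∧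
      (P ∩ B).Nonempty ∧ Disjoint P Y
  · obtain ⟨I, P, h1, h2, h3⟩ := IH N B r hs
    exact ⟨I, P, h1, fun s hs => (h2 s hs).mono fun x _ y _ => hsub x y, h3⟩
  push Not at hs
  obtain ⟨S, hSr, hS⟩ := hs
  -- symmetric claim
  have big : ∀ (c d : V), s(c, d) = s(a, b) → ∀ T : Set V, insert c S ⊆ T → r ≤ T.ncard := by
    intro c d hcd T hT
    by_contra hlt
    obtain ⟨P, hP, hPN, hPB, hd⟩ := h T (not_le.1 hlt)
    refine hS P (hP.mono fun x hx y hy hxy => ?_) hPN hPB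
      (hd.mono_right ((subset_insert _ _).trans hT))
    rw [hG', deleteEdges_adj]
    refine ⟨hxy, fun hxe => ?_⟩
    rw [mem_singleton_iff, ← hcd] at hxe
    have : c ∈ s(x, y) := by rw [hxe]; exact Sym2.mem_mk_left c d
    have hcT : c ∈ T := hT (mem_insert c S)
    rcases Sym2.mem_iff.1 this with rfl | rfl
    · exact hd.le_bot ⟨hx, hcT⟩
    · exact hd.le_bot ⟨hy, hcT⟩
  have cardc : ∀ (c d : V), s(c, d) = s(a, b) → c ∉ S ∧ (insert c S).ncard = r := by
    intro c d hcd
    have h1 := big c d hcd _ Subset.rfl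
    have hc : c ∉ S := fun hc => by
      rw [insert_eq_of_mem hc] at h1; omega
    refine ⟨hc, ?_⟩
    rw [ncard_insert_of_notMem hc] at h1 ⊢
    omega
  -- generic side
  have side : ∀ (N' B' : Set V) (c d : V), s(c, d) = s(a, b) →
      (∀ P, Cn G'.Adj P → (P ∩ N').Nonempty → (P ∩ B').Nonempty → ¬ Disjoint P S) →
      (∀ P, Cn G'.Adj P → (P ∩ N').Nonempty → d ∈ P → ¬ Disjoint P S) →
      (∀ Y : Set V, Y.ncard < r → ∃ P, Cn G.Adj P ∧ (P ∩ N').Nonempty ∧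
        (P ∩ B').Nonempty ∧ Disjoint P Y) →
      ∃ L : V → Set V, (∀ s ∈ insert c S, Cn G'.Adj (L s) ∧ (L s ∩ N').Nonempty ∧ L s ∩ insert c S = {s} ∧
      ∀ v ∈ L s, v ≠ s → ∃ D, Cn G'.Adj D ∧ D ∩ insert c S = ∅ ∧ (D ∩ N').Nonempty ∧ v ∈ D) ∧
      ∀ s ∈ insert c S, ∀ t ∈ insert c S, s ≠ t → Disjoint (L s) (L t) := by
    intro N' B' c d hcd hS' hdN h'
    have hsep : ∀ Y : Set V, Y.ncard < r → ∃ P, Cn G'.Adj P ∧ (P ∩ N').Nonempty ∧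
      (P ∩ insert c S).Nonempty ∧ Disjoint P Y := by
      intro Y hY
      obtain ⟨P, hP, ⟨p, hpP, hpN⟩, hPB, hd⟩ := h' Y hY
      -- component of p in P in G'
      set C := cpt G'.Adj P p
      have hCP : C ⊆ P := cpt_sub hpP
      have hCc : Cn G'.Adj C := cpt_cn (fun _ _ h => h.symm) p
      refine ⟨C, hCc, ⟨p, mem_cpt_self p, hpN⟩, ?_, hd.mono_left hCP⟩
      by_contra hem
      rw [not_nonempty_iff_eq_empty] at hem
      by_cases hPC : P ⊆ C
      · have := hS' C hCc ⟨p, mem_cpt_self p, hpN⟩ (hPB.mono (inter_subset_inter_left _ hPC))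
        refine this (Set.disjoint_left.2 fun z hz hzS => ?_)
        have : z ∈ C ∩ insert c S := ⟨hz, Or.inr hzS⟩
        rw [hem] at this; exact this
      -- P crosses C by edge ab; d ∈ C
      have edgeC : ∀ x ∈ C, ∀ y ∈ P, y ∉ C → G.Adj x y → s(x, y) = s(a, b) := by
        intro x hx y hy hyC hxy
        by_contra hne
        refine hyC (cpt_closed hpP hx hy ?_)
        rw [hG', deleteEdges_adj]
        exact ⟨hxy, hne⟩
      have hcC : c ∉ C := fun hc => by
        have : c ∈ C ∩ insert c S := ⟨hc, Or.inl rfl⟩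
        rw [hem] at this; exact this
      obtain ⟨z, hzP, hzC⟩ := not_subset.1 hPC
      obtain ⟨x, ⟨hxP, hxC⟩, y, ⟨hyP, hyC⟩, hxy⟩ := hP.cross C ⟨p, hpP, mem_cpt_self p⟩ ⟨z, hzP, hzC⟩
      have hxy' := edgeC x hxC y hyP hyC hxy
      rw [← hcd] at hxy'
      have hc1 : c ∈ s(x, y) := by rw [hxy']; exact Sym2.mem_mk_left c d
      have hcP : c = y := by
        rcases Sym2.mem_iff.1 hc1 with h | h
        · exact absurd (h ▸ hxC) hcC
        · exact h
      have hxd : x = d := by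
        subst hcP
        rw [Sym2.eq_swap] at hxy'
        exact Sym2.congr_right.1 hxy'
      refine hdN C hCc ⟨p, mem_cpt_self p, hpN⟩ (hxd ▸ hxC) (Set.disjoint_left.2 fun z hz hzS => ?_)
      have : z ∈ C ∩ insert c S := ⟨hz, Or.inr hzS⟩
      rw [hem] at this; exact this
    obtain ⟨I, P, h1, h2, h3, h4, h5⟩ := IH N' (insert c S) r hsep
    exact menger_trim G' N' (insert c S) I P (by rw [h1, (cardc c d hcd).2]) h2 h3 h4 h5
  have orient : ∃ c d, s(c, d) = s(a, b) ∧
      (∃ P, Cn G'.Adj P ∧ (P ∩ N).Nonempty ∧ c ∈ P ∧ Disjoint P S) ∧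
      (∃ P, Cn G'.Adj P ∧ (P ∩ B).Nonempty ∧ d ∈ P ∧ Disjoint P S) := by
    obtain ⟨P, hP, ⟨p, hpP, hpN⟩, ⟨q, hqP, hqB⟩, hd⟩ := h S hSr
    have edgeC : ∀ p ∈ P, ∀ x ∈ cpt G'.Adj P p, ∀ y ∈ P, y ∉ cpt G'.Adj P p → G.Adj x y →
        s(x, y) = s(a, b) := by
      intro p hpP x hx y hy hyC hxy
      by_contra hne
      refine hyC (cpt_closed hpP hx hy ?_)
      rw [hG', deleteEdges_adj]
      exact ⟨hxy, hne⟩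
    have c1 : Cn G'.Adj (cpt G'.Adj P p) := cpt_cn (fun _ _ h => h.symm) p
    have c2 : Cn G'.Adj (cpt G'.Adj P q) := cpt_cn (fun _ _ h => h.symm) q
    have hdis : ∀ z, z ∈ cpt G'.Adj P p → z ∉ cpt G'.Adj P q := by
      intro z hz hz'
      refine hS _ (c1.union c2 ⟨z, hz, hz'⟩) ⟨p, Or.inl (mem_cpt_self p), hpN⟩
        ⟨q, Or.inr (mem_cpt_self q), hqB⟩ (hd.mono_left (union_subset (cpt_sub hpP) (cpt_sub hqP)))
    obtain ⟨x, ⟨hxP, hxC⟩, y, ⟨hyP, hyC⟩, hxy⟩ := hP.cross _ ⟨p, hpP, mem_cpt_self p⟩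
      ⟨q, hqP, fun h => hdis q h (mem_cpt_self q)⟩
    obtain ⟨x', ⟨hxP', hxC'⟩, y', ⟨hyP', hyC'⟩, hxy'⟩ := hP.cross _ ⟨q, hqP, mem_cpt_self q⟩
      ⟨p, hpP, fun h => hdis p (mem_cpt_self p) h⟩
    have e1 := edgeC p hpP x hxC y hyP hyC hxy
    have e2 := edgeC q hqP x' hxC' y' hyP' hyC' hxy'
    have hyq : y ∈ cpt G'.Adj P q := by
      rw [← e1, Sym2.eq_iff] at e2
      rcases e2 with ⟨h1, h2⟩ | ⟨h1, h2⟩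
      · exact absurd (h1 ▸ hxC') (hdis x hxC)
      · exact h1 ▸ hxC'
    exact ⟨x, y, e1, ⟨_, c1, ⟨p, mem_cpt_self p, hpN⟩, hxC, hd.mono_left (cpt_sub hpP)⟩,
      ⟨_, c2, ⟨q, mem_cpt_self q, hqB⟩, hyq, hd.mono_left (cpt_sub hqP)⟩⟩
  obtain ⟨c, d, hcd, ⟨Pc, hPc, hPcN, hcPc, hPcS⟩, ⟨Pd, hPd, hPdB, hdPd, hPdS⟩⟩ := orient
  have hdc : s(d, c) = s(a, b) := by rw [← hcd, Sym2.eq_swap]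
  obtain ⟨L, hL, hLd⟩ := side N B c d hcd hS (fun P hP hPN hdP hPS =>
    hS _ (hP.union hPd ⟨d, hdP, hdPd⟩) (hPN.mono (inter_subset_inter_left _ subset_union_left))
      (hPdB.mono (inter_subset_inter_left _ subset_union_right)) (hPS.union_left hPdS)) h
  obtain ⟨M, hM, hMd⟩ := side B N d c hdc (fun P h1 h2 h3 => hS P h1 h3 h2) (fun P hP hPN hdP hPS =>
    hS _ (hP.union hPc ⟨c, hdP, hcPc⟩) (hPcN.mono (inter_subset_inter_left _ subset_union_right))
      (hPN.mono (inter_subset_inter_left _ subset_union_left)) (hPS.union_left hPcS))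
      (fun Y hY => by obtain ⟨P, h1, h2, h3, h4⟩ := h Y hY; exact ⟨P, h1, h3, h2, h4⟩)
  classical
  have hcS := (cardc c d hcd).1
  have hdS := (cardc d c hdc).1
  have key : ∀ s ∈ insert c S, ∀ t ∈ insert d S, ∀ v, v ∈ L s → v ∈ M t → v ∈ S ∧ v = s ∧ v = t := by
    intro s hs t ht v hvs hvt
    have hm1 : v ∈ S → v = s := fun hv => by
      have : v ∈ L s ∩ insert c S := ⟨hvs, Or.inr hv⟩
      rw [(hL s hs).2.2.1] at this; exact this
    have hm2 : v ∈ S → v = t := fun hv => by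
      have : v ∈ M t ∩ insert d S := ⟨hvt, Or.inr hv⟩
      rw [(hM t ht).2.2.1] at this; exact this
    by_cases hv : v ∈ S
    · exact ⟨hv, hm1 hv, hm2 hv⟩
    exfalso
    have h1 : ∃ D, Cn G'.Adj D ∧ Disjoint D S ∧ (D ∩ N).Nonempty ∧ v ∈ D := by
      by_cases hvs' : v = s
      · refine ⟨L s, (hL s hs).1, Set.disjoint_left.2 fun z hz hzS => ?_, (hL s hs).2.1, hvs⟩
        have : z ∈ L s ∩ insert c S := ⟨hz, Or.inr hzS⟩
        rw [(hL s hs).2.2.1] at this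
        exact hv (by rw [hvs', ← show z = s from this]; exact hzS)
      · obtain ⟨D, h1, h2, h3, h4⟩ := (hL s hs).2.2.2 v hvs hvs'
        refine ⟨D, h1, Set.disjoint_left.2 fun z hz hzS => ?_, h3, h4⟩
        have : z ∈ D ∩ insert c S := ⟨hz, Or.inr hzS⟩
        rw [h2] at this; exact this
    have h2 : ∃ D, Cn G'.Adj D ∧ Disjoint D S ∧ (D ∩ B).Nonempty ∧ v ∈ D := by
      by_cases hvs' : v = t
      · refine ⟨M t, (hM t ht).1, Set.disjoint_left.2 fun z hz hzS => ?_, (hM t ht).2.1, hvt⟩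
        have : z ∈ M t ∩ insert d S := ⟨hz, Or.inr hzS⟩
        rw [(hM t ht).2.2.1] at this
        exact hv (by rw [hvs', ← show z = t from this]; exact hzS)
      · obtain ⟨D, h1, h2, h3, h4⟩ := (hM t ht).2.2.2 v hvt hvs'
        refine ⟨D, h1, Set.disjoint_left.2 fun z hz hzS => ?_, h3, h4⟩
        have : z ∈ D ∩ insert d S := ⟨hz, Or.inr hzS⟩
        rw [h2] at this; exact this
    obtain ⟨D1, a1, a2, a3, a4⟩ := h1
    obtain ⟨D2, b1, b2, b3, b4⟩ := h2
    exact hS _ (a1.union b1 ⟨v, a4, b4⟩) (a3.mono (inter_subset_inter_left _ subset_union_left))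
      (b3.mono (inter_subset_inter_left _ subset_union_right)) (a2.union_left b2)
  have hmt : ∀ s ∈ insert c S, (if s = c then d else s) ∈ insert d S := by
    intro s hs
    split_ifs with h
    · exact Or.inl rfl
    · exact Or.inr (hs.resolve_left h)
  have hmL : ∀ s ∈ insert c S, s ∈ L s := fun s hs => by
    have : s ∈ L s ∩ insert c S := by rw [(hL s hs).2.2.1]; rfl
    exact this.1
  have hmM : ∀ s ∈ insert d S, s ∈ M s := fun s hs => by
    have : s ∈ M s ∩ insert d S := by rw [(hM s hs).2.2.1]; rfl
    exact this.1
  have hcdadj : G.Adj c d := by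
    have : s(c, d) ∈ G.edgeSet := by rw [hcd]; exact hab
    exact this
  refine ⟨insert c S, fun s => L s ∪ M (if s = c then d else s), (cardc c d hcd).2, fun s hs => ?_,
    fun s hs => (hL s hs).2.1.mono (inter_subset_inter_left _ subset_union_left),
    fun s hs => (hM _ (hmt s hs)).2.1.mono (inter_subset_inter_left _ subset_union_right), ?_⟩
  · have l1 := (hL s hs).1.mono fun x _ y _ => hsub x y
    have l2 := (hM _ (hmt s hs)).1.mono fun x _ y _ => hsub x y
    by_cases hsc : s = c
    · subst hsc
      simp only [if_true] at l2 ⊢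
      exact l1.union_adj (fun _ _ h => h.symm) l2 (hmL _ hs) (hmM _ (Or.inl rfl)) hcdadj
    · simp only [hsc, if_false] at l2 ⊢
      exact l1.union l2 ⟨s, hmL s hs, hmM s (Or.inr (hs.resolve_left hsc))⟩
  · have cr : ∀ s ∈ insert c S, ∀ t ∈ insert c S, s ≠ t →
        Disjoint (L s) (M (if t = c then d else t)) := by
      intro s hs t ht hst
      refine Set.disjoint_left.2 fun v hv1 hv2 => ?_
      obtain ⟨h1, h2, h3⟩ := key s hs _ (hmt t ht) v hv1 hv2
      split_ifs at h3 with htc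
      · exact hdS (h3 ▸ h1)
      · exact hst (h2.symm.trans h3)
    intro s hs t ht hst
    refine Disjoint.union_left (Disjoint.union_right (hLd s hs t ht hst) (cr s hs t ht hst))
      (Disjoint.union_right (cr t ht s hs hst.symm).symm (hMd _ (hmt s hs) _ (hmt t ht) ?_))
    split_ifs with h1 h2 h2
    · exact absurd (h1.trans h2.symm) hst
    · exact fun h => hdS (h ▸ ht.resolve_left h2)
    · exact fun h => hdS (h ▸ hs.resolve_left h1)
    · exact hst

theorem menger [Finite V] (G : SimpleGraph V) (N S : Set V) (r : ℕ)
    (h : ∀ Y : Set V, Y.ncard < r → ∃ P, Cn G.Adj P ∧ (P ∩ N).Nonempty ∧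
      (P ∩ S).Nonempty ∧ Disjoint P Y) : ∃ P : Fin r → Set V,
      (∀ i, Cn G.Adj (P i)) ∧ (∀ i, (P i ∩ N).Nonempty) ∧ (∀ i, (P i ∩ S).Nonempty) ∧
      Pairwise fun i j => Disjoint (P i) (P j) := by
  obtain ⟨I, P, h1, h2, h3, h4, h5⟩ := menger_aux _ G rfl N S r h
  have e : Fin r ≃ I := (Finite.equivFinOfCardEq (by rw [Nat.card_coe_set_eq, h1])).symm
  exact ⟨fun i => P (e i), fun i => h2 _ (e i).2, fun i => h3 _ (e i).2, fun i => h4 _ (e i).2,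
    fun i j hij => h5 _ (e i).2 _ (e j).2 fun h => hij (e.injective (Subtype.ext h))⟩

end menger

end

section

open SimpleGraph Set

section gridlemma
universe v
variable {V : Type v}

/-- no two disjoint connected sets cross with respect to the labels -/
def NCx (G : SimpleGraph V) (m : ℕ) (lb : ℕ → V) : Prop :=
  ∀ a c b d, a < c → c < b → b < d → d < m → ∀ A C : Set V, Cn G.Adj A → Cn G.Adj C →
    Disjoint A C → lb a ∈ A → lb b ∈ A → lb c ∈ C → lb d ∈ C → False

structure GSys (G : SimpleGraph V) (r : ℕ) (lb : ℕ → V) (P Q : ℕ → Set V) : Prop where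
  nc : NCx G (4 * r) lb
  Pc : ∀ i < r, Cn G.Adj (P i)
  Pn : ∀ i < r, lb i ∈ P i
  Ps : ∀ i < r, lb (3 * r - 1 - i) ∈ P i
  Pd : ∀ i < r, ∀ j < r, i ≠ j → Disjoint (P i) (P j)
  Qc : ∀ i < r, Cn G.Adj (Q i)
  Qe : ∀ i < r, lb (r + i) ∈ Q i
  Qw : ∀ i < r, lb (4 * r - 1 - i) ∈ Q i
  Qd : ∀ i < r, ∀ j < r, i ≠ j → Disjoint (Q i) (Q j)

structure GMin (G : SimpleGraph V) (r : ℕ) (lb : ℕ → V) (P Q : ℕ → Set V) : Prop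
    extends GSys G r lb P Q where
  cP : ∀ i < r, ∀ u ∈ P i, ∀ v ∈ P i, G.Adj u v → ∃ a < r, ∃ b < r, a ≠ b ∧ u ∈ Q a ∧ v ∈ Q b
  cQ : ∀ i < r, ∀ u ∈ Q i, ∀ v ∈ Q i, G.Adj u v → ∃ a < r, ∃ b < r, a ≠ b ∧ u ∈ P a ∧ v ∈ P b
  mP : ∀ i < r, ∀ A ⊆ P i, Cn G.Adj A → lb i ∈ A → lb (3 * r - 1 - i) ∈ A → A = P i
  mQ : ∀ i < r, ∀ A ⊆ Q i, Cn G.Adj A → lb (r + i) ∈ A → lb (4 * r - 1 - i) ∈ A → A = Q i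

variable {G : SimpleGraph V} {r : ℕ} {lb : ℕ → V} {P Q : ℕ → Set V}

theorem GMin.transpose (h : GMin G r lb P Q) : GMin G r (fun p => lb (4 * r - 1 - p)) Q P where
  nc := fun a c b d h1 h2 h3 h4 A C hA hC hd ha hb hc hd' =>
    h.nc (4*r-1-d) (4*r-1-b) (4*r-1-c) (4*r-1-a) (by omega) (by omega) (by omega) (by omega)
      C A hC hA hd.symm hd' hc hb ha
  Pc := h.Qc
  Pn := h.Qw
  Ps := fun i hi => by
    have := h.Qe i hi
    rwa [show r + i = 4 * r - 1 - (3 * r - 1 - i) by omega] at this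
  Pd := h.Qd
  Qc := h.Pc
  Qe := fun i hi => by
    have := h.Ps i hi
    rwa [show 3 * r - 1 - i = 4 * r - 1 - (r + i) by omega] at this
  Qw := fun i hi => by
    show lb (4 * r - 1 - (4 * r - 1 - i)) ∈ P i
    rw [show 4 * r - 1 - (4 * r - 1 - i) = i by omega]; exact h.Pn i hi
  Qd := h.Pd
  cP := h.cQ
  cQ := h.cP
  mP := fun i hi A hA hc h1 h2 => h.mQ i hi A hA hc
    (by rwa [show 4 * r - 1 - (3 * r - 1 - i) = r + i by omega] at h2) h1
  mQ := fun i hi A hA hc h1 h2 => h.mP i hi A hA hc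
    (by rwa [show 4 * r - 1 - (4 * r - 1 - i) = i by omega] at h2)
    (by rwa [show 4 * r - 1 - (r + i) = 3 * r - 1 - i by omega] at h1)

theorem GMin.flip (h : GMin G r lb P Q) : GMin G r
    (fun p => if p < 3 * r then lb (3 * r - 1 - p) else lb (7 * r - 1 - p)) P
    (fun j => Q (r - 1 - j)) where
  nc := by
    intro a c b d h1 h2 h3 h4 A C hA hC hd ha hb hc hd'
    dsimp only at ha hb hc hd'
    by_cases a1 : a < 3 * r <;> by_cases c1 : c < 3 * r <;> by_cases b1 : b < 3 * r <;>
    by_cases d1 : d < 3 * r <;> try omega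
    all_goals simp only [a1, c1, b1, d1, if_true, if_false] at ha hb hc hd'
    · exact h.nc _ _ _ _ (by omega) (by omega) (by omega) (by omega) C A hC hA hd.symm hd' hc hb ha
    · exact h.nc _ _ _ _ (by omega) (by omega) (by omega) (by omega) A C hA hC hd hb ha hc hd'
    · exact h.nc _ _ _ _ (by omega) (by omega) (by omega) (by omega) C A hC hA hd.symm hc hd' ha hb
    · exact h.nc _ _ _ _ (by omega) (by omega) (by omega) (by omega) A C hA hC hd ha hb hd' hc
    · exact h.nc _ _ _ _ (by omega) (by omega) (by omega) (by omega) C A hC hA hd.symm hd' hc hb ha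
  Pc := h.Pc
  Pn := fun i hi => by
    rw [if_pos (by omega)]; exact h.Ps i hi
  Ps := fun i hi => by
    rw [if_pos (by omega), show 3 * r - 1 - (3 * r - 1 - i) = i by omega]; exact h.Pn i hi
  Pd := h.Pd
  Qc := fun i hi => h.Qc _ (by omega)
  Qe := fun i hi => by
    rw [if_pos (by omega), show 3 * r - 1 - (r + i) = r + (r - 1 - i) by omega]
    exact h.Qe _ (by omega)
  Qw := fun i hi => by
    rw [if_neg (by omega), show 7 * r - 1 - (4 * r - 1 - i) = 4 * r - 1 - (r - 1 - i) by omega]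
    exact h.Qw _ (by omega)
  Qd := fun i hi j hj hij => h.Qd _ (by omega) _ (by omega) (by omega)
  cP := fun i hi u hu v hv huv => by
    obtain ⟨a, ha, b, hb, hab, h1, h2⟩ := h.cP i hi u hu v hv huv
    refine ⟨r - 1 - a, by omega, r - 1 - b, by omega, by omega, ?_, ?_⟩
    · rwa [show r - 1 - (r - 1 - a) = a by omega]
    · rwa [show r - 1 - (r - 1 - b) = b by omega]
  cQ := fun i hi => h.cQ _ (by omega)
  mP := fun i hi A hA hc h1 h2 => h.mP i hi A hA hc
    (by rwa [if_pos (by omega), show 3 * r - 1 - (3 * r - 1 - i) = i by omega] at h2)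
    (by rwa [if_pos (by omega)] at h1)
  mQ := fun i hi A hA hc h1 h2 => h.mQ _ (by omega) A hA hc
    (by rwa [if_pos (by omega), show 3 * r - 1 - (r + i) = r + (r - 1 - i) by omega] at h1)
    (by rwa [if_neg (by omega), show 7 * r - 1 - (4 * r - 1 - i) = 4 * r - 1 - (r - 1 - i) by omega] at h2)

theorem cn_erase {A : Set V} (hA : Cn G.Adj A) {v b : V} (hb : b ∈ A) (hbv : b ≠ v)
    (h1 : ∀ x ∈ A, ∀ y ∈ A, G.Adj v x → G.Adj v y → x = y) : Cn G.Adj (A \ {v}) := by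
  refine ⟨⟨b, hb, hbv⟩, fun S ⟨u, ⟨hu, huv⟩, hS⟩ hc => ?_⟩
  -- T = S plus v if some neighbour of v in A is in S
  by_cases hn : ∃ x ∈ A, G.Adj v x ∧ x ∈ S
  · obtain ⟨x, hx, hvx, hxS⟩ := hn
    have := hA.2 (insert v S) ⟨u, hu, Or.inr hS⟩ (fun p hp q hq hpq hpS => by
      by_cases hqv : q = v
      · exact Or.inl hqv
      · right
        by_cases hpv : p = v
        · subst hpv
          rw [h1 q hq x hx hpq hvx]; exact hxS
        · exact hc p ⟨hp, hpv⟩ q ⟨hq, hqv⟩ hpq (hpS.resolve_left hpv))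
    intro z hz
    exact (this hz.1).resolve_left hz.2
  · push Not at hn
    have := hA.2 (S \ {v}) ⟨u, hu, hS, huv⟩ (fun p hp q hq hpq hpS => by
      have hqv : q ≠ v := fun h => hn p hp (h ▸ hpq.symm) hpS.1
      exact ⟨hc p ⟨hp, hpS.2⟩ q ⟨hq, hqv⟩ hpq hpS.1, hqv⟩)
    intro z hz
    exact (this hz.1).1

/-- a minimal connected set containing two points is a path -/
theorem path_of_min {A : Set V} (hA : Cn G.Adj A) {a b : V} (ha : a ∈ A) (hb : b ∈ A)
    (hm : ∀ B ⊆ A, Cn G.Adj B → a ∈ B → b ∈ B → B = A) :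
    ∃ (n : ℕ) (f : ℕ → V), f 0 = a ∧ f n = b ∧ (∀ i ≤ n, ∀ j ≤ n, f i = f j → i = j) ∧
      (∀ x, x ∈ A ↔ ∃ i ≤ n, f i = x) ∧ ∀ i < n, G.Adj (f i) (f (i + 1)) := by
  obtain ⟨w, hw⟩ := ((cn_iff_induce G A).1 hA).exists_isPath ⟨a, ha⟩ ⟨b, hb⟩
  set f : ℕ → V := fun i => (w.getVert i).1
  have hadj : ∀ i < w.length, G.Adj (f i) (f (i + 1)) := fun i hi => by
    have := w.adj_getVert_succ hi
    simpa using this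
  refine ⟨w.length, f, by simp [f], by simp [f], fun i hi j hj hij => ?_, fun x => ?_, hadj⟩
  · exact hw.getVert_injOn hi hj (Subtype.ext hij)
  · have hc : Cn G.Adj {x | ∃ i ≤ w.length, f i = x} := by
      have : ∀ k ≤ w.length, Cn G.Adj {x | ∃ i ≤ k, f i = x} := by
        intro k
        induction k with
        | zero =>
          intro _
          convert Cn.sing (R := G.Adj) (f 0) using 1
          ext x; simp [eq_comm]
        | succ k ih =>
          intro hk
          convert (ih (by omega)).insert_adj (fun _ _ h => h.symm) ⟨k, le_rfl, rfl⟩ (hadj k (by omega)) using 1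
          ext x
          simp only [mem_setOf_eq, mem_insert_iff]
          constructor
          · rintro ⟨i, hi, rfl⟩
            rcases Nat.lt_or_ge k i with h | h
            · left; rw [show i = k + 1 by omega]
            · exact Or.inr ⟨i, h, rfl⟩
          · rintro (rfl | ⟨i, hi, rfl⟩)
            · exact ⟨k + 1, le_rfl, rfl⟩
            · exact ⟨i, by omega, rfl⟩
      exact this _ le_rfl
    have := hm {x | ∃ i ≤ w.length, f i = x} (fun x ⟨i, _, hi⟩ => hi ▸ (w.getVert i).2) hc ⟨0, by omega, by simp [f]⟩
      ⟨w.length, le_rfl, by simp [f]⟩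
    exact (Set.ext_iff.1 this x).symm

theorem cn_seg {n : ℕ} {f : ℕ → V} (hadj : ∀ i < n, G.Adj (f i) (f (i + 1))) {k l : ℕ}
    (hkl : k ≤ l) (hl : l ≤ n) : Cn G.Adj {x | ∃ i, k ≤ i ∧ i ≤ l ∧ f i = x} := by
  induction l with
  | zero =>
    convert Cn.sing (R := G.Adj) (f 0) using 1
    ext x
    simp only [mem_setOf_eq, mem_singleton_iff]
    constructor
    · rintro ⟨i, _, hi, rfl⟩; rw [show i = 0 by omega]
    · rintro rfl; exact ⟨0, by omega, le_rfl, rfl⟩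
  | succ l ih =>
    rcases Nat.lt_or_ge l k with h | h
    · convert Cn.sing (R := G.Adj) (f (l + 1)) using 1
      ext x
      simp only [mem_setOf_eq, mem_singleton_iff]
      constructor
      · rintro ⟨i, _, hi, rfl⟩; rw [show i = l + 1 by omega]
      · rintro rfl; exact ⟨l + 1, by omega, le_rfl, rfl⟩
    · convert (ih h (by omega)).insert_adj (fun _ _ h => h.symm) ⟨l, h, le_rfl, rfl⟩ (hadj l (by omega)) using 1
      ext x
      simp only [mem_setOf_eq, mem_insert_iff]
      constructor
      · rintro ⟨i, h1, hi, rfl⟩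
        rcases Nat.lt_or_ge l i with h | h
        · left; rw [show i = l + 1 by omega]
        · exact Or.inr ⟨i, h1, h, rfl⟩
      · rintro (rfl | ⟨i, h1, hi, rfl⟩)
        · exact ⟨l + 1, by omega, le_rfl, rfl⟩
        · exact ⟨i, h1, by omega, rfl⟩

namespace GMin

theorem Quniq (h : GMin G r lb P Q) {a b : ℕ} (ha : a < r) (hb : b < r) {x : V}
    (h1 : x ∈ Q a) (h2 : x ∈ Q b) : a = b := by
  by_contra hne
  exact (h.Qd a ha b hb hne).le_bot ⟨h1, h2⟩

theorem Puniq (h : GMin G r lb P Q) {a b : ℕ} (ha : a < r) (hb : b < r) {x : V}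
    (h1 : x ∈ P a) (h2 : x ∈ P b) : a = b := by
  by_contra hne
  exact (h.Pd a ha b hb hne).le_bot ⟨h1, h2⟩

theorem meet (h : GMin G r lb P Q) {i j : ℕ} (hi : i < r) (hj : j < r) : (P i ∩ Q j).Nonempty := by
  by_contra hne
  rw [not_nonempty_iff_eq_empty, ← Set.disjoint_iff_inter_eq_empty] at hne
  exact h.nc i (r + j) (3 * r - 1 - i) (4 * r - 1 - j) (by omega) (by omega) (by omega) (by omega) _ _
    (h.Pc i hi) (h.Qc j hj) hne (h.Pn i hi) (h.Ps i hi) (h.Qe j hj) (h.Qw j hj)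

theorem PinQ (h : GMin G r lb P Q) {i : ℕ} (hi : i < r) {x : V} (hx : x ∈ P i) :
    ∃ j < r, x ∈ Q j := by
  by_cases hs : ∃ y ∈ P i, y ≠ x
  · obtain ⟨y, hy, hyx⟩ := hs
    obtain ⟨p, ⟨hp, hpx⟩, q, ⟨hq, hqx⟩, hpq⟩ := (h.Pc i hi).cross {x} ⟨x, hx, rfl⟩ ⟨y, hy, hyx⟩
    obtain ⟨a, ha, b, hb, hab, h1, h2⟩ := h.cP i hi p hp q hq hpq
    exact ⟨a, ha, (show p = x from hpx) ▸ h1⟩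
  · push Not at hs
    obtain ⟨z, hz1, hz2⟩ := h.meet hi hi
    exact ⟨i, hi, hs z hz1 ▸ hz2⟩

theorem QinP (h : GMin G r lb P Q) {i : ℕ} (hi : i < r) {x : V} (hx : x ∈ Q i) :
    ∃ j < r, x ∈ P j := h.transpose.PinQ hi hx

theorem lev1 (h : GMin G r lb P Q) {i a b : ℕ} (hi : i < r) (ha : a < r) (hb : b < r) {u v : V}
    (huv : G.Adj u v) (hua : u ∈ Q a) (hvb : v ∈ Q b) (hab : a < b) : b = a + 1 := by
  by_contra hne
  refine h.nc (r + a) (r + (a + 1)) (r + b) (4 * r - 1 - (a + 1)) (by omega) (by omega) (by omega)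
    (by omega) (Q a ∪ Q b) (Q (a + 1))
    ((h.Qc a ha).union_adj (fun _ _ h => h.symm) (h.Qc b hb) hua hvb huv) (h.Qc _ (by omega)) ?_
    (Or.inl (h.Qe a ha)) (Or.inr (h.Qe b hb)) (h.Qe _ (by omega)) (h.Qw _ (by omega))
  exact Disjoint.union_left (h.Qd _ ha _ (by omega) (by omega)) (h.Qd _ hb _ (by omega) (by omega))

theorem levels (h : GMin G r lb P Q) {i : ℕ} (hi : i < r) {u v : V} (hu : u ∈ P i) (hv : v ∈ P i)
    (huv : G.Adj u v) {j : ℕ} (hj : j < r) (huj : u ∈ Q j) :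
    (j + 1 < r ∧ v ∈ Q (j + 1)) ∨ (1 ≤ j ∧ v ∈ Q (j - 1)) := by
  obtain ⟨a, ha, b, hb, hab, h1, h2⟩ := h.cP i hi u hu v hv huv
  obtain rfl := h.Quniq ha hj h1 huj
  rcases Nat.lt_or_gt_of_ne hab with hlt | hlt
  · obtain rfl := h.lev1 hi ha hb huv h1 h2 hlt
    exact Or.inl ⟨hb, h2⟩
  · obtain rfl := h.lev1 hi hb ha huv.symm h2 h1 hlt
    exact Or.inr ⟨by omega, by simpa using h2⟩

theorem nlab (h : GMin G r lb P Q) {i j : ℕ} (hi : i < r) (hj : j < r) (hm : lb i ∈ Q j) : j = 0 := by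
  by_contra hne
  exact h.nc i r (r + j) (4 * r - 1) (by omega) (by omega) (by omega) (by omega) (Q j) (Q 0)
    (h.Qc j hj) (h.Qc 0 (by omega)) (h.Qd _ hj _ (by omega) hne) hm (h.Qe j hj)
    (by simpa using h.Qe 0 (by omega)) (by simpa using h.Qw 0 (by omega))

theorem slab (h : GMin G r lb P Q) {i j : ℕ} (hi : i < r) (hj : j < r)
    (hm : lb (3 * r - 1 - i) ∈ Q j) : j = r - 1 := by
  have := h.flip.nlab (i := i) (j := r - 1 - j) hi (by omega) (by
    rw [if_pos (by omega), show r - 1 - (r - 1 - j) = j by omega]; exact hm)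
  omega

theorem two_nbr (h : GMin G r lb P Q) {i : ℕ} (hi : i < r) {v : V} (hv : v ∈ P i)
    (h1 : v ≠ lb i) (h2 : v ≠ lb (3 * r - 1 - i)) :
    ∃ x ∈ P i, ∃ y ∈ P i, x ≠ y ∧ G.Adj v x ∧ G.Adj v y := by
  by_contra hcon
  push Not at hcon
  have := h.mP i hi (P i \ {v}) diff_subset
    (cn_erase (h.Pc i hi) (h.Pn i hi) h1.symm fun x hx y hy h1 h2 => by
      by_contra hne; exact hcon x hx y hy hne h1 h2) ⟨h.Pn i hi, h1.symm⟩ ⟨h.Ps i hi, h2.symm⟩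
  rw [← this] at hv
  exact hv.2 rfl

theorem one_nbr (h : GMin G r lb P Q) {i : ℕ} (hi : i < r) {v : V} (hv : v ∈ P i)
    (h1 : v ≠ lb i) : ∃ x ∈ P i, G.Adj v x := by
  obtain ⟨p, ⟨hp, hpx⟩, q, ⟨hq, hqx⟩, hpq⟩ := (h.Pc i hi).cross {v} ⟨v, hv, rfl⟩ ⟨_, h.Pn i hi, h1.symm⟩
  exact ⟨q, hq, (show p = v from hpx) ▸ hpq⟩

theorem no_cap (h : GMin G r lb P Q) : ∀ n j, j + n = r → ∀ i < r, ∀ w ∈ P i, ∀ x ∈ P i, ∀ y ∈ P i,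
    1 ≤ j → j < r → w ∈ Q (j - 1) → x ∈ Q j → y ∈ Q j → G.Adj w x → G.Adj w y → x = y := by
  intro n
  induction n with
  | zero => intros; omega
  | succ n ih =>
  intro j hjn
  by_cases hj1 : 1 ≤ j
  swap
  · intros; omega
  have hj : j < r := by omega
  obtain ⟨nf, f, f0, fn, finj, fA, fadj⟩ := path_of_min (h.Qc j hj) (h.Qw j hj) (h.Qe j hj)
    (fun B hB hc h1 h2 => h.mQ j hj B hB hc h2 h1)
  obtain ⟨ng, g, g0, gn, ginj, gA, gadj⟩ := path_of_min (h.Qc (j-1) (by omega)) (h.Qw (j-1) (by omega))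
    (h.Qe (j-1) (by omega)) (fun B hB hc h1 h2 => h.mQ (j-1) (by omega) B hB hc h2 h1)
  have main : ∀ d, ∀ k l, k + d = l → l ≤ nf → ∀ i < r, ∀ w ∈ P i, f k ∈ P i → f l ∈ P i →
      w ∈ Q (j - 1) → G.Adj w (f k) → G.Adj w (f l) → d = 0 := by
    intro d
    induction d using Nat.strong_induction_on with
    | _ d ihd =>
    intro k l hkl hl i hi w hw hx hy hwQ hwx hwy
    by_contra hd0
    have hxQ : f k ∈ Q j := (fA _).2 ⟨k, by omega, rfl⟩
    have hd1 : d ≠ 1 := by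
      intro hd1
      have hadj := fadj k (by omega)
      rw [show k + 1 = l by omega] at hadj
      obtain ⟨a, ha, b, hb, hab, h1, h2⟩ := h.cQ j hj _ hxQ (f l) ((fA _).2 ⟨l, hl, rfl⟩) hadj
      exact hab ((h.Puniq ha hi h1 hx).trans (h.Puniq hb hi h2 hy).symm)
    set m := k + 1 with hm
    have hvQ : f m ∈ Q j := (fA _).2 ⟨m, by omega, rfl⟩
    obtain ⟨i', hi', hv⟩ := h.QinP hj hvQ
    -- no neighbour in Q (j-1)
    have hno : ∀ u ∈ P i', u ∈ Q (j - 1) → ¬ G.Adj (f m) u := by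
      intro u hu huQ hvu
      obtain ⟨b, hb, rfl⟩ := (gA u).1 huQ
      obtain ⟨c, hc, rfl⟩ := (gA w).1 hwQ
      have hQd := h.Qd j hj (j-1) (by omega) (by omega)
      have hsubf : ∀ k l, l ≤ nf → {x | ∃ i, k ≤ i ∧ i ≤ l ∧ f i = x} ⊆ Q j := by
        rintro k l hl x ⟨i, _, hi, rfl⟩
        exact (fA _).2 ⟨i, by omega, rfl⟩
      have hsubg : ∀ k l, l ≤ ng → {x | ∃ i, k ≤ i ∧ i ≤ l ∧ g i = x} ⊆ Q (j-1) := by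
        rintro k l hl x ⟨i, _, hi, rfl⟩
        exact (gA _).2 ⟨i, by omega, rfl⟩
      have hdf : ∀ k1 l1 k2 l2, l1 < k2 → l2 ≤ nf → Disjoint {x | ∃ i, k1 ≤ i ∧ i ≤ l1 ∧ f i = x}
          {x | ∃ i, k2 ≤ i ∧ i ≤ l2 ∧ f i = x} := by
        intro k1 l1 k2 l2 h1 h2
        refine Set.disjoint_left.2 ?_
        rintro x ⟨i, a1, a2, rfl⟩ ⟨i2, b1, b2, hh⟩
        have := finj i2 (by omega) i (by omega) hh
        omega
      have hdg : ∀ k1 l1 k2 l2, l1 < k2 → l2 ≤ ng → Disjoint {x | ∃ i, k1 ≤ i ∧ i ≤ l1 ∧ g i = x}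
          {x | ∃ i, k2 ≤ i ∧ i ≤ l2 ∧ g i = x} := by
        intro k1 l1 k2 l2 h1 h2
        refine Set.disjoint_left.2 ?_
        rintro x ⟨i, a1, a2, rfl⟩ ⟨i2, b1, b2, hh⟩
        have := ginj i2 (by omega) i (by omega) hh
        omega
      have hs : ∀ x y, G.Adj x y → G.Adj y x := fun _ _ h => h.symm
      rcases Nat.lt_trichotomy c b with hcb | hcb | hcb
      · refine h.nc (r + (j-1)) (r + j) (4*r-1-j) (4*r-1-(j-1)) (by omega) (by omega) (by omega)
          (by omega) ({x | ∃ i, 0 ≤ i ∧ i ≤ m ∧ f i = x} ∪ {x | ∃ i, b ≤ i ∧ i ≤ ng ∧ g i = x})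
          ({x | ∃ i, 0 ≤ i ∧ i ≤ c ∧ g i = x} ∪ {x | ∃ i, l ≤ i ∧ i ≤ nf ∧ f i = x})
          ((cn_seg fadj (by omega) (by omega)).union_adj hs (cn_seg gadj (by omega) (by omega))
            ⟨m, by omega, by omega, rfl⟩ ⟨b, by omega, by omega, rfl⟩ hvu)
          ((cn_seg gadj (by omega) (by omega)).union_adj hs (cn_seg fadj (by omega) (by omega))
            ⟨c, by omega, by omega, rfl⟩ ⟨l, by omega, by omega, rfl⟩ hwy) ?_
          (Or.inr ⟨ng, hb, le_rfl, gn⟩) (Or.inl ⟨0, le_rfl, by omega, f0⟩)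
          (Or.inr ⟨nf, hl, le_rfl, fn⟩) (Or.inl ⟨0, le_rfl, by omega, g0⟩)
        refine Disjoint.union_left (Disjoint.union_right ?_ ?_) (Disjoint.union_right ?_ ?_)
        · exact hQd.mono (hsubf _ _ (by omega)) (hsubg _ _ (by omega))
        · exact hdf _ _ _ _ (by omega) (by omega)
        · exact (hdg _ _ _ _ (by omega) (by omega)).symm
        · exact (hQd.mono (hsubf _ _ (by omega)) (hsubg _ _ (by omega))).symm
      · subst hcb
        obtain rfl := h.Puniq hi hi' hw hu
        exact (by omega : m - k ≠ 0) (ihd (m - k) (by omega) k m (by omega) (by omega) i hi _ hw hx hv hwQ hwx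
          hvu.symm)
      · refine h.nc (r + (j-1)) (r + j) (4*r-1-j) (4*r-1-(j-1)) (by omega) (by omega) (by omega)
          (by omega) ({x | ∃ i, c ≤ i ∧ i ≤ ng ∧ g i = x} ∪ {x | ∃ i, 0 ≤ i ∧ i ≤ k ∧ f i = x})
          ({x | ∃ i, m ≤ i ∧ i ≤ nf ∧ f i = x} ∪ {x | ∃ i, 0 ≤ i ∧ i ≤ b ∧ g i = x})
          ((cn_seg gadj (by omega) (by omega)).union_adj hs (cn_seg fadj (by omega) (by omega))
            ⟨c, by omega, by omega, rfl⟩ ⟨k, by omega, by omega, rfl⟩ hwx)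
          ((cn_seg fadj (by omega) (by omega)).union_adj hs (cn_seg gadj (by omega) (by omega))
            ⟨m, by omega, by omega, rfl⟩ ⟨b, by omega, by omega, rfl⟩ hvu) ?_
          (Or.inl ⟨ng, hc, le_rfl, gn⟩) (Or.inr ⟨0, le_rfl, by omega, f0⟩)
          (Or.inl ⟨nf, by omega, le_rfl, fn⟩) (Or.inr ⟨0, le_rfl, by omega, g0⟩)
        refine Disjoint.union_left (Disjoint.union_right ?_ ?_) (Disjoint.union_right ?_ ?_)
        · exact (hQd.mono (hsubf _ _ (by omega)) (hsubg _ _ (by omega))).symm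
        · exact (hdg _ _ _ _ (by omega) (by omega)).symm
        · exact hdf _ _ _ _ (by omega) (by omega)
        · exact hQd.mono (hsubf _ _ (by omega)) (hsubg _ _ (by omega))
    have hvn : f m ≠ lb i' := fun e => by
      have := h.nlab hi' hj (e ▸ hvQ); omega
    have nxt : ∀ z ∈ P i', G.Adj (f m) z → j + 1 < r ∧ z ∈ Q (j + 1) := fun z hz hvz =>
      (h.levels hi' hv hz hvz hj hvQ).resolve_right fun hh => hno z hz hh.2 hvz
    by_cases hvs : f m = lb (3 * r - 1 - i')
    · obtain ⟨z, hz, hvz⟩ := h.one_nbr hi' hv hvn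
      have h1 := (nxt z hz hvz).1
      have := h.slab hi' hj (hvs ▸ hvQ)
      omega
    · obtain ⟨p, hp, q, hq, hpq, h1, h2⟩ := h.two_nbr hi' hv hvn hvs
      have n1 := nxt p hp h1
      have n2 := nxt q hq h2
      exact hpq (ih (j + 1) (by omega) i' hi' (f m) hv p hp q hq (by omega) n1.1 (by simpa using hvQ)
        n1.2 n2.2 h1 h2)
  intro i hi w hw x hx y hy _ _ hwQ hxQ hyQ hwx hwy
  obtain ⟨k, hk, rfl⟩ := (fA x).1 hxQ
  obtain ⟨l, hl, rfl⟩ := (fA y).1 hyQ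
  rcases Nat.le_total k l with hkl | hkl
  · have := main (l - k) k l (by omega) hl i hi w hw hx hy hwQ hwx hwy
    rw [show k = l by omega]
  · have := main (k - l) l k (by omega) hk i hi w hw hy hx hwQ hwy hwx
    rw [show k = l by omega]

theorem down_uniq (h : GMin G r lb P Q) {i j : ℕ} (hi : i < r) (hj : j + 1 < r) {w x y : V}
    (hw : w ∈ P i) (hx : x ∈ P i) (hy : y ∈ P i) (hwQ : w ∈ Q j) (hxQ : x ∈ Q (j + 1))
    (hyQ : y ∈ Q (j + 1)) (h1 : G.Adj w x) (h2 : G.Adj w y) : x = y :=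
  h.no_cap (r - (j + 1)) (j + 1) (by omega) i hi w hw x hx y hy (by omega) hj (by simpa using hwQ) hxQ hyQ h1 h2

theorem up_uniq (h : GMin G r lb P Q) {i j : ℕ} (hi : i < r) (hj : j + 1 < r) {w x y : V}
    (hw : w ∈ P i) (hx : x ∈ P i) (hy : y ∈ P i) (hwQ : w ∈ Q (j + 1)) (hxQ : x ∈ Q j)
    (hyQ : y ∈ Q j) (h1 : G.Adj w x) (h2 : G.Adj w y) : x = y := by
  refine h.flip.down_uniq (j := r - 1 - (j + 1)) hi (by omega) hw hx hy ?_ ?_ ?_ h1 h2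
  · rwa [show r - 1 - (r - 1 - (j + 1)) = j + 1 by omega]
  · rwa [show r - 1 - (r - 1 - (j + 1) + 1) = j by omega]
  · rwa [show r - 1 - (r - 1 - (j + 1) + 1) = j by omega]

theorem column (h : GMin G r lb P Q) {i : ℕ} (hi : i < r) :
    ∃ p : ℕ → V, (∀ j < r, P i ∩ Q j = {p j}) ∧ ∀ j, j + 1 < r → G.Adj (p j) (p (j + 1)) := by
  classical
  -- chain
  let st : ℕ → V → V := fun k v =>
    if hx : ∃ x ∈ P i, x ∈ Q (k + 1) ∧ G.Adj v x then hx.choose else v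
  let d : ℕ → V := fun k => Nat.rec (motive := fun _ => V) (lb i) st k
  have hdS : ∀ k : ℕ, d (k + 1) = st k (d k) := fun k => rfl
  have hdP : ∀ k, d k ∈ P i := by
    intro k
    induction k with
    | zero => exact h.Pn i hi
    | succ k ih =>
      rw [hdS]; dsimp only [st]
      split_ifs with hx
      · exact hx.choose_spec.1
      · exact ih
  have hds : ∀ k, ∀ x ∈ P i, k + 1 < r → d k ∈ Q k → x ∈ Q (k + 1) → G.Adj (d k) x → x = d (k + 1) := by
    intro k x hx hk hdk hxQ hadj
    have hex : ∃ x ∈ P i, x ∈ Q (k + 1) ∧ G.Adj (d k) x := ⟨x, hx, hxQ, hadj⟩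
    have : d (k + 1) = hex.choose := by
      rw [hdS]; dsimp only [st]; rw [dif_pos hex]
    rw [this]
    exact h.down_uniq hi hk (hdP k) hx hex.choose_spec.1 hdk hxQ hex.choose_spec.2.1 hadj hex.choose_spec.2.2
  have hd0 : d 0 ∈ Q 0 := by
    obtain ⟨j, hj, hjQ⟩ := h.PinQ hi (h.Pn i hi)
    have := h.nlab hi hj hjQ
    subst this
    exact hjQ
  let good : ℕ → Prop := fun k => k < r ∧ d k ∈ Q k ∧ ∀ m < k, d m ∈ Q m ∧ G.Adj (d m) (d (m + 1))
  have key : P i ⊆ {v | ∃ k, good k ∧ v = d k} := by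
    refine (h.Pc i hi).2 _ ⟨lb i, h.Pn i hi, 0, ⟨by omega, hd0, by intros; omega⟩, rfl⟩ ?_
    rintro x hx y hy hxy ⟨k, ⟨hk, hkQ, hkm⟩, rfl⟩
    rcases h.levels hi hx hy hxy hk hkQ with ⟨h1, h2⟩ | ⟨h1, h2⟩
    · have e := hds k y hy h1 hkQ h2 hxy
      refine ⟨k + 1, ⟨h1, e ▸ h2, fun m hm => ?_⟩, e⟩
      rcases Nat.lt_or_ge m k with hmk | hmk
      · exact hkm m hmk
      · obtain rfl : m = k := by omega
        exact ⟨hkQ, e ▸ hxy⟩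
    · obtain ⟨m, rfl⟩ : ∃ m, k = m + 1 := ⟨k - 1, by omega⟩
      simp only [Nat.add_sub_cancel] at h2
      have := hkm m (by omega)
      refine ⟨m, ⟨by omega, this.1, fun m' hm' => hkm m' (by omega)⟩, ?_⟩
      exact h.up_uniq hi hk (hdP (m + 1)) hy (hdP _) hkQ h2 this.1 hxy this.2.symm
  have good_of : ∀ j < r, ∀ v ∈ P i, v ∈ Q j → good j ∧ v = d j := by
    intro j hj v hv hvQ
    obtain ⟨k, hk, rfl⟩ := key hv
    obtain rfl := h.Quniq hk.1 hj hk.2.1 hvQ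
    exact ⟨hk, rfl⟩
  refine ⟨d, fun j hj => ?_, fun j hj => ?_⟩
  · obtain ⟨v, hv, hvQ⟩ := h.meet hi hj
    have := good_of j hj v hv hvQ
    ext x
    exact ⟨fun hx => (good_of j hj x hx.1 hx.2).2, fun hx => by
      rw [show x = d j from hx]; exact ⟨hdP j, this.1.2.1⟩⟩
  · obtain ⟨v, hv, hvQ⟩ := h.meet hi hj
    exact ((good_of _ hj v hv hvQ).1.2.2 j (by omega)).2

theorem grid (h : GMin G r lb P Q) : HasMinor G (gridGraph r) := by
  have : Nonempty V := ⟨lb 0⟩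
  choose! p hp hpa using fun i (hi : i < r) => h.column hi
  choose! q hq hqa using fun i (hi : i < r) => h.transpose.column hi
  have hpq : ∀ i < r, ∀ j < r, q j i = p i j := by
    intro i hi j hj
    have h1 : q j i ∈ Q j ∩ P i := by rw [hq j hj i hi]; rfl
    rw [inter_comm, hp i hi j hj] at h1
    exact h1
  have hmem : ∀ i < r, ∀ j < r, p i j ∈ P i ∩ Q j := fun i hi j hj => by rw [hp i hi j hj]; rfl
  refine ⟨fun w => {p w.1 w.2}, fun w => (cn_iff_induce _ _).1 (Cn.sing _), ?_, ?_⟩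
  · intro w1 w2 hne
    rw [Set.disjoint_singleton]
    intro he
    have m1 := hmem w1.1 w1.1.2 w1.2 w1.2.2
    have m2 := hmem w2.1 w2.1.2 w2.2 w2.2.2
    rw [he] at m1
    exact hne (Prod.ext (Fin.ext (h.Puniq w1.1.2 w2.1.2 m1.1 m2.1))
      (Fin.ext (h.Quniq w1.2.2 w2.2.2 m1.2 m2.2)))
  · have main : ∀ w1 w2 : Fin r × Fin r, (w1.1 = w2.1 ∧ (w1.2 : ℕ) + 1 = (w2.2 : ℕ)) ∨
        (w1.2 = w2.2 ∧ (w1.1 : ℕ) + 1 = (w2.1 : ℕ)) → G.Adj (p w1.1 w1.2) (p w2.1 w2.2) := by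
      rintro ⟨i, j⟩ ⟨i', j'⟩ (⟨h1, h2⟩ | ⟨h1, h2⟩) <;> simp only at h1 h2 ⊢
      · subst h1
        rw [← h2]
        exact hpa i i.2 j (by omega)
      · subst h1
        rw [← h2, ← hpq i i.2 j j.2, ← hpq (i + 1) (by omega) j j.2]
        exact hqa j j.2 i (by omega)
    intro w1 w2 hadj
    rw [gridGraph, fromRel_adj] at hadj
    rcases hadj.2 with h1 | h1
    · exact ⟨_, rfl, _, rfl, main _ _ h1⟩
    · exact ⟨_, rfl, _, rfl, (main _ _ h1).symm⟩

end GMin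
end gridlemma

end

section

open SimpleGraph Set

section gridlemma2
universe v
variable {V : Type v}

theorem HasMinor.lift {V' : Type v} {W : Type*} {G : SimpleGraph V} {G' : SimpleGraph V'} {H : SimpleGraph W}
    (f : V → V') (hf : ∀ b, Cn G.Adj (f ⁻¹' {b}))
    (hl : ∀ a b, G'.Adj a b → ∃ x y, f x = a ∧ f y = b ∧ G.Adj x y) (h : HasMinor G' H) :
    HasMinor G H := by
  obtain ⟨φ, h1, h2, h3⟩ := h
  refine ⟨fun w => f ⁻¹' φ w, fun w => (cn_iff_induce _ _).1 (((cn_iff_induce _ _).2 (h1 w)).preim f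
    (fun b _ => hf b) (fun a _ b _ => hl a b)), fun a b hab => (h2 hab).preimage f, fun a b hab => ?_⟩
  obtain ⟨x, hx, y, hy, hxy⟩ := h3 hab
  obtain ⟨p, q, rfl, rfl, hpq⟩ := hl x y hxy
  exact ⟨p, hx, q, hy, hpq⟩

theorem GSys.contract [Fintype V] {G : SimpleGraph V} {r : ℕ} {lb : ℕ → V} {P Q : ℕ → Set V}
    (h : GSys G r lb P Q) {u v : V} (huv : G.Adj u v)
    (hP : ∀ a < r, ∀ b < r, u ∈ P a → v ∈ P b → a = b)
    (hQ : ∀ a < r, ∀ b < r, u ∈ Q a → v ∈ Q b → a = b) :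
    ∃ (V' : Type v) (_ : Fintype V') (G' : SimpleGraph V') (lb' : ℕ → V') (P' Q' : ℕ → Set V'),
      GSys G' r lb' P' Q' ∧ Fintype.card V' < Fintype.card V ∧ (∀ i, (P' i).ncard ≤ (P i).ncard) ∧
      (∀ i, (Q' i).ncard ≤ (Q i).ncard) ∧ (HasMinor G' (gridGraph r) → HasMinor G (gridGraph r)) := by
  classical
  let V' := {x : V // x ≠ v}
  let f : V → V' := fun x => if hx : x = v then ⟨u, huv.ne⟩ else ⟨x, hx⟩
  have fv : f v = ⟨u, huv.ne⟩ := by simp [f]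
  have fne : ∀ x (hx : x ≠ v), f x = ⟨x, hx⟩ := fun x hx => by simp [f, hx]
  have fu : f u = ⟨u, huv.ne⟩ := fne u huv.ne
  let G' : SimpleGraph V' := SimpleGraph.fromRel fun a b => ∃ x y, f x = a ∧ f y = b ∧ G.Adj x y
  have hl : ∀ a b, G'.Adj a b → ∃ x y, f x = a ∧ f y = b ∧ G.Adj x y := by
    intro a b hab
    rcases ((fromRel_adj _ _ _).1 hab).2 with h | ⟨x, y, h1, h2, h3⟩
    · exact h
    · exact ⟨y, x, h2, h1, h3.symm⟩
  have hi : ∀ x y, G.Adj x y → f x = f y ∨ G'.Adj (f x) (f y) := by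
    intro x y hxy
    by_cases he : f x = f y
    · exact Or.inl he
    · exact Or.inr ((fromRel_adj _ _ _).2 ⟨he, Or.inl ⟨x, y, rfl, rfl, hxy⟩⟩)
  have hf : ∀ b, Cn G.Adj (f ⁻¹' {b}) := by
    rintro ⟨b, hb⟩
    by_cases hbu : b = u
    · subst hbu
      convert Cn.pair (R := G.Adj) (fun _ _ h => h.symm) huv using 1
      ext x
      simp only [mem_preimage, mem_singleton_iff, mem_insert_iff]
      by_cases hx : x = v
      · subst hx; simp [fv]
      · rw [fne x hx]
        exact ⟨fun h => Or.inl (congrArg Subtype.val h), fun h => Subtype.ext (h.resolve_right hx)⟩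
    · convert Cn.sing (R := G.Adj) b using 1
      ext x
      simp only [mem_preimage, mem_singleton_iff]
      by_cases hx : x = v
      · subst hx; simp only [fv]
        exact ⟨fun h => absurd (congrArg Subtype.val h).symm hbu, fun h => absurd h.symm hb⟩
      · rw [fne x hx]
        exact ⟨fun h => congrArg Subtype.val h, fun h => Subtype.ext h⟩
  have feq : ∀ x y, f x = f y → x = y ∨ (x = u ∧ y = v) ∨ (x = v ∧ y = u) := by
    intro x y hxy
    by_cases hx : x = v <;> by_cases hy : y = v
    · exact Or.inl (hx.trans hy.symm)
    · rw [hx, fv, fne y hy] at hxy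
      exact Or.inr (Or.inr ⟨hx, (congrArg Subtype.val hxy).symm⟩)
    · rw [hy, fv, fne x hx] at hxy
      exact Or.inr (Or.inl ⟨(congrArg Subtype.val hxy), hy⟩)
    · rw [fne x hx, fne y hy] at hxy
      exact Or.inl (congrArg Subtype.val hxy)
  have dis : ∀ P : ℕ → Set V, (∀ a < r, ∀ b < r, u ∈ P a → v ∈ P b → a = b) →
      (∀ i < r, ∀ j < r, i ≠ j → Disjoint (P i) (P j)) →
      ∀ i < r, ∀ j < r, i ≠ j → Disjoint (f '' P i) (f '' P j) := by
    intro P hP hd i hir j hj hij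
    refine Set.disjoint_left.2 ?_
    rintro _ ⟨x, hx, rfl⟩ ⟨y, hy, hxy⟩
    rcases feq y x hxy with rfl | ⟨rfl, rfl⟩ | ⟨rfl, rfl⟩
    · exact (hd i hir j hj hij).le_bot ⟨hx, hy⟩
    · exact hij (hP j hj i hir hy hx).symm
    · exact hij (hP i hir j hj hx hy)
  refine ⟨V', inferInstance, G', fun i => f (lb i), fun i => f '' P i, fun i => f '' Q i, ?_, ?_,
    fun i => Set.ncard_image_le (Set.toFinite _), fun i => Set.ncard_image_le (Set.toFinite _),
    fun hm => hm.lift f hf hl⟩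
  · exact
    { nc := fun a c b d h1 h2 h3 h4 A C hA hC hd ha hb hc hd' =>
        h.nc a c b d h1 h2 h3 h4 (f ⁻¹' A) (f ⁻¹' C) (hA.preim f (fun b _ => hf b) (fun a _ b _ => hl a b))
          (hC.preim f (fun b _ => hf b) (fun a _ b _ => hl a b)) (hd.preimage f) ha hb hc hd'
      Pc := fun i hir => (h.Pc i hir).image f fun x _ y _ => hi x y
      Pn := fun i hi => ⟨_, h.Pn i hi, rfl⟩
      Ps := fun i hi => ⟨_, h.Ps i hi, rfl⟩
      Pd := dis P hP h.Pd
      Qc := fun i hir => (h.Qc i hir).image f fun x _ y _ => hi x y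
      Qe := fun i hi => ⟨_, h.Qe i hi, rfl⟩
      Qw := fun i hi => ⟨_, h.Qw i hi, rfl⟩
      Qd := dis Q hQ h.Qd }
  · exact Fintype.card_subtype_lt (x := v) (by simp)

theorem GSys.grid_aux (n : ℕ) : ∀ (V : Type v) [Fintype V] (G : SimpleGraph V) (r : ℕ) (lb : ℕ → V)
    (P Q : ℕ → Set V), GSys G r lb P Q →
    Fintype.card V + ∑ i ∈ Finset.range r, (P i).ncard + ∑ i ∈ Finset.range r, (Q i).ncard = n →
    HasMinor G (gridGraph r) := by
  induction n using Nat.strong_induction_on with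
  | _ n ih =>
  intro V _ G r lb P Q h hn
  by_contra hno
  have con : ∀ u v, G.Adj u v → (∀ a < r, ∀ b < r, u ∈ P a → v ∈ P b → a = b) →
      (∀ a < r, ∀ b < r, u ∈ Q a → v ∈ Q b → a = b) → False := by
    intro u v huv hP hQ
    obtain ⟨V', _, G', lb', P', Q', h1, h2, h3, h4, h5⟩ := h.contract huv hP hQ
    refine hno (h5 (ih _ ?_ V' G' r lb' P' Q' h1 rfl))
    have e1 := Finset.sum_le_sum (s := Finset.range r) fun i _ => h3 i
    have e2 := Finset.sum_le_sum (s := Finset.range r) fun i _ => h4 i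
    omega
  have upd : ∀ (P : ℕ → Set V) (i : ℕ) (A : Set V), i < r → A ⊂ P i →
      ∑ k ∈ Finset.range r, (Function.update P i A k).ncard < ∑ k ∈ Finset.range r, (P k).ncard := by
    intro P i A hi hA
    refine Finset.sum_lt_sum (fun k _ => ?_) ⟨i, Finset.mem_range.2 hi, ?_⟩
    · by_cases hk : k = i
      · subst hk; rw [Function.update_self]; exact Set.ncard_le_ncard hA.1 (Set.toFinite _)
      · rw [Function.update_of_ne hk]
    · rw [Function.update_self]; exact Set.ncard_lt_ncard hA (Set.toFinite _)
  have updd : ∀ (P : ℕ → Set V) (i : ℕ) (A : Set V), A ⊆ P i →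
      (∀ i < r, ∀ j < r, i ≠ j → Disjoint (P i) (P j)) →
      (∀ k < r, ∀ j < r, k ≠ j → Disjoint (Function.update P i A k) (Function.update P i A j)) := by
    intro P i A hA hd k hk j hj hkj
    have : ∀ k, Function.update P i A k ⊆ P k := fun k => by
      by_cases hk : k = i
      · subst hk; rw [Function.update_self]; exact hA
      · rw [Function.update_of_ne hk]
    exact (hd k hk j hj hkj).mono (this k) (this j)
  have updp : ∀ (P : ℕ → Set V) (i : ℕ) (A : Set V) (p : ℕ → Set V → Prop), p i A → (∀ k < r, p k (P k)) →
      ∀ k < r, p k (Function.update P i A k) := by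
    intro P i A p h1 h2 k hk
    by_cases hki : k = i
    · subst hki; rw [Function.update_self]; exact h1
    · rw [Function.update_of_ne hki]; exact h2 k hk
  refine hno (GMin.grid (lb := lb) (P := P) (Q := Q) { h with cP := ?_, cQ := ?_, mP := ?_, mQ := ?_ })
  · intro i hi u hu v hv huv
    by_contra hcon
    push Not at hcon
    refine con u v huv (fun a ha b hb h1 h2 => ?_) (fun a ha b hb h1 h2 => ?_)
    · have e1 : a = i := by
        by_contra hne; exact (h.Pd a ha i hi hne).le_bot ⟨h1, hu⟩
      have e2 : b = i := by
        by_contra hne; exact (h.Pd b hb i hi hne).le_bot ⟨h2, hv⟩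
      omega
    · by_contra hne
      exact hcon a ha b hb hne h1 h2
  · intro i hi u hu v hv huv
    by_contra hcon
    push Not at hcon
    refine con u v huv (fun a ha b hb h1 h2 => ?_) (fun a ha b hb h1 h2 => ?_)
    · by_contra hne
      exact hcon a ha b hb hne h1 h2
    · have e1 : a = i := by
        by_contra hne; exact (h.Qd a ha i hi hne).le_bot ⟨h1, hu⟩
      have e2 : b = i := by
        by_contra hne; exact (h.Qd b hb i hi hne).le_bot ⟨h2, hv⟩
      omega
  · intro i hi A hA hc h1 h2
    by_contra hne
    have hs : A ⊂ P i := hA.ssubset_of_ne hne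
    refine hno (ih _ ?_ V G r lb (Function.update P i A) Q { h with
      Pc := updp P i A (fun k B => Cn G.Adj B) hc h.Pc
      Pn := updp P i A (fun k B => lb k ∈ B) h1 h.Pn
      Ps := updp P i A (fun k B => lb (3 * r - 1 - k) ∈ B) h2 h.Ps
      Pd := updd P i A hA h.Pd } rfl)
    have := upd P i A hi hs
    omega
  · intro i hi A hA hc h1 h2
    by_contra hne
    have hs : A ⊂ Q i := hA.ssubset_of_ne hne
    refine hno (ih _ ?_ V G r lb P (Function.update Q i A) { h with
      Qc := updp Q i A (fun k B => Cn G.Adj B) hc h.Qc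
      Qe := updp Q i A (fun k B => lb (r + k) ∈ B) h1 h.Qe
      Qw := updp Q i A (fun k B => lb (4 * r - 1 - k) ∈ B) h2 h.Qw
      Qd := updd Q i A hA h.Qd } rfl)
    have := upd Q i A hi hs
    omega

/-- reindex a linkage monotonically -/
theorem reindex {r : ℕ} (G : SimpleGraph V) (lb : ℕ → V) (nc : NCx G (4 * r) lb) (p q : ℕ)
    (hpq : p + r ≤ q) (hq : q + r ≤ 4 * r)
    (P : Fin r → Set V) (hc : ∀ i, Cn G.Adj (P i)) (hp : ∀ k, ∃ i < r, lb (p + i) ∈ P k)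
    (hs : ∀ k, ∃ i < r, lb (q + i) ∈ P k) (hd : Pairwise fun i j => Disjoint (P i) (P j)) :
    ∃ P' : ℕ → Set V, (∀ i < r, Cn G.Adj (P' i)) ∧ (∀ i < r, lb (p + i) ∈ P' i) ∧
      (∀ i < r, lb (q + (r - 1 - i)) ∈ P' i) ∧
      ∀ i < r, ∀ j < r, i ≠ j → Disjoint (P' i) (P' j) := by
  choose f hf hfP using hp
  choose g hg hgP using hs
  let F : Fin r → Fin r := fun k => ⟨f k, hf k⟩
  have Finj : Function.Injective F := by
    intro a b hab
    by_contra hne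
    have : f a = f b := congrArg Fin.val hab
    exact (hd hne).le_bot ⟨hfP a, this ▸ hfP b⟩
  have Fsur := Finite.surjective_of_injective Finj
  choose F' hF' using Fsur
  let s : Fin r → Fin r := fun i => ⟨g (F' i), hg _⟩
  have F'inj : Function.Injective F' := fun a b h => by rw [← hF' a, ← hF' b, h]
  have hFm : ∀ i : Fin r, lb (p + i) ∈ P (F' i) := fun i => by
    have := hfP (F' i)
    rwa [show f (F' i) = i from congrArg Fin.val (hF' i)] at this
  have hanti : StrictAnti s := by
    intro a b hab
    by_contra hle
    have hne : F' a ≠ F' b := fun h => hab.ne (F'inj h)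
    have hlt : g (F' a) < g (F' b) := by
      rcases Nat.lt_or_ge (g (F' a)) (g (F' b)) with h | h
      · exact h
      · exfalso
        rcases Nat.eq_or_lt_of_le h with h | h
        · exact (hd hne).le_bot ⟨hgP (F' a), h ▸ hgP (F' b)⟩
        · exact hle h
    have h1 : (a : ℕ) < b := hab
    have := hg (F' b)
    exact nc (p + a) (p + b) (q + g (F' a)) (q + g (F' b)) (by omega) (by omega) (by omega) (by omega)
      _ _ (hc (F' a)) (hc (F' b)) (hd hne) (hFm a) (hgP _) (hFm b) (hgP _)
  have hmono : StrictMono (fun i => (s i).rev) := fun a b h => Fin.rev_lt_rev.2 (hanti h)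
  have hid : ∀ i, (s i).rev = i := by
    intro i
    have h1 : i ≤ (s i).rev := hmono.id_le i
    have hmono2 : StrictMono (fun i : Fin r => s i.rev) := fun a b h => hanti (Fin.rev_lt_rev.2 h)
    have h2 : i.rev ≤ s i.rev.rev := hmono2.id_le i.rev
    rw [Fin.rev_rev] at h2
    have := Fin.rev_le_rev.2 h2
    rw [Fin.rev_rev] at this
    exact le_antisymm this h1
  refine ⟨fun i => if h : i < r then P (F' ⟨i, h⟩) else ∅, fun i hi => ?_, fun i hi => ?_, fun i hi => ?_,
    fun i hi j hj hij => ?_⟩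
  · simp only [hi, dite_true]; exact hc _
  · simp only [hi, dite_true]; exact hFm ⟨i, hi⟩
  · simp only [hi, dite_true]
    have := hid ⟨i, hi⟩
    have e : g (F' ⟨i, hi⟩) = r - 1 - i := by
      have h1 := congrArg Fin.val this
      have h2 := hg (F' ⟨i, hi⟩)
      simp only [Fin.val_rev, s] at h1
      omega
    rw [← e]; exact hgP _
  · simp only [hi, hj, dite_true]
    exact hd fun h => hij (congrArg Fin.val (F'inj h))

/-- grid from two linkages and the non-crossing property -/
theorem grid_of_links [Fintype V] {r : ℕ} (G : SimpleGraph V) (lb : ℕ → V) (nc : NCx G (4 * r) lb)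
    (P Q : Fin r → Set V) (hc : ∀ i, Cn G.Adj (P i)) (hn : ∀ k, ∃ i < r, lb i ∈ P k)
    (hs : ∀ k, ∃ i < r, lb (2 * r + i) ∈ P k) (hd : Pairwise fun i j => Disjoint (P i) (P j))
    (hc' : ∀ i, Cn G.Adj (Q i)) (he : ∀ k, ∃ i < r, lb (r + i) ∈ Q k)
    (hw : ∀ k, ∃ i < r, lb (3 * r + i) ∈ Q k) (hd' : Pairwise fun i j => Disjoint (Q i) (Q j)) :
    HasMinor G (gridGraph r) := by
  obtain ⟨P', p1, p2, p3, p4⟩ := reindex G lb nc 0 (2 * r) (by omega) (by omega) P hc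
    (by simpa using hn) hs hd
  obtain ⟨Q', q1, q2, q3, q4⟩ := reindex G lb nc r (3 * r) (by omega) (by omega) Q hc' he hw hd'
  refine GSys.grid_aux _ V G r lb P' Q' ⟨nc, p1, by simpa using p2, fun i hi => ?_, p4, q1, q2,
    fun i hi => ?_, q4⟩ rfl
  · rw [show 3 * r - 1 - i = 2 * r + (r - 1 - i) by omega]; exact p3 i hi
  · rw [show 4 * r - 1 - i = 3 * r + (r - 1 - i) by omega]; exact q3 i hi

end gridlemma2

end

section

open SimpleGraph Set

section brdef
variable {V : Type*}

def bd (E A : Set (Sym2 V)) : Set V := {v | (∃ e ∈ A, v ∈ e) ∧ ∃ e ∈ E \ A, v ∈ e}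

inductive Br (θ : ℕ) (E : Set (Sym2 V)) : Set (Sym2 V) → Prop
  | single (e : Sym2 V) (he : e ∈ E) (hb : (bd E {e}).ncard ≤ θ) : Br θ E {e}
  | union (A B : Set (Sym2 V)) (hd : Disjoint A B) (hA : Br θ E A) (hB : Br θ E B)
      (hb : (bd E (A ∪ B)).ncard ≤ θ) : Br θ E (A ∪ B)

variable {θ : ℕ} {E A B : Set (Sym2 V)}

theorem Br.sub (h : Br θ E A) : A ⊆ E := by
  induction h with
  | single e he _ => simpa using he
  | union A B _ _ _ _ h1 h2 => exact union_subset h1 h2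

theorem Br.ne (h : Br θ E A) : A.Nonempty := by
  induction h with
  | single e he _ => exact ⟨e, rfl⟩
  | union A B _ _ _ _ h1 h2 => exact h1.mono subset_union_left

theorem Br.bdle (h : Br θ E A) : (bd E A).ncard ≤ θ := by
  cases h with
  | single e he h => exact h
  | union A B _ _ _ h => exact h

theorem bd_compl (hA : A ⊆ E) : bd E (E \ A) = bd E A := by
  ext v
  simp only [bd, mem_setOf_eq, sdiff_sdiff_right_self, inf_eq_inter, inter_eq_self_of_subset_right hA]
  exact and_comm

structure RD (θ : ℕ) (E A : Set (Sym2 V)) (t : Type) (T : SimpleGraph t) (ρ : t) (τ : Sym2 V → t) :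
    Prop where
  conn : Cn T.Adj univ
  inj : ∀ e ∈ A, ∀ f ∈ A, τ e = τ f → e = f
  nodes : ∀ v, v ≠ ρ → (v ∈ τ '' A ∧ (T.neighborSet v).ncard = 1) ∨
    (v ∉ τ '' A ∧ (T.neighborSet v).ncard = 3)
  root : (ρ ∈ τ '' A ∧ (T.neighborSet ρ).ncard = 0) ∨ (ρ ∉ τ '' A ∧ (T.neighborSet ρ).ncard = 2)
  edges : ∀ a b, T.Adj a b → ∃ S : Set t, ρ ∉ S ∧ ((a ∈ S ∧ b ∉ S) ∨ (b ∈ S ∧ a ∉ S)) ∧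
    (∀ x y, T.Adj x y → x ∈ S → y ∉ S → s(x, y) = s(a, b)) ∧ (bd E {e ∈ A | τ e ∈ S}).ncard ≤ θ

/-- adjacency of the combined rooted tree -/
def jadj {t1 t2 : Type} (T1 : SimpleGraph t1) (T2 : SimpleGraph t2) (ρ1 : t1) (ρ2 : t2) :
    Option (t1 ⊕ t2) → Option (t1 ⊕ t2) → Prop
  | some (.inl a), some (.inl b) => T1.Adj a b
  | some (.inr a), some (.inr b) => T2.Adj a b
  | none, some (.inl a) => a = ρ1
  | none, some (.inr a) => a = ρ2
  | some (.inl a), none => a = ρ1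
  | some (.inr a), none => a = ρ2
  | _, _ => False

def jgraph {t1 t2 : Type} (T1 : SimpleGraph t1) (T2 : SimpleGraph t2) (ρ1 : t1) (ρ2 : t2) :
    SimpleGraph (Option (t1 ⊕ t2)) where
  Adj := jadj T1 T2 ρ1 ρ2
  symm := ⟨by
    rintro (_ | a | a) (_ | b | b) h <;> simp only [jadj] at h ⊢ <;>
      first | exact h | exact h.symm⟩
  loopless := ⟨by rintro (_ | a | a) h <;> simp only [jadj] at h <;> exact absurd h (by simp)⟩

/-- adjacency of the final tree -/
def kadj {t1 t2 : Type} (T1 : SimpleGraph t1) (T2 : SimpleGraph t2) (ρ1 : t1) (ρ2 : t2) :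
    (t1 ⊕ t2) → (t1 ⊕ t2) → Prop
  | .inl a, .inl b => T1.Adj a b
  | .inr a, .inr b => T2.Adj a b
  | .inl a, .inr b => a = ρ1 ∧ b = ρ2
  | .inr b, .inl a => a = ρ1 ∧ b = ρ2

def kgraph {t1 t2 : Type} (T1 : SimpleGraph t1) (T2 : SimpleGraph t2) (ρ1 : t1) (ρ2 : t2) :
    SimpleGraph (t1 ⊕ t2) where
  Adj := kadj T1 T2 ρ1 ρ2
  symm := ⟨by
    rintro (a | a) (b | b) h <;> simp only [kadj] at h ⊢ <;>
      first | exact h | exact h.symm⟩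
  loopless := ⟨by rintro (a | a) h <;> simp only [kadj] at h <;> exact absurd h (by simp)⟩

open Classical in
theorem RD.join {t1 t2 : Type} [Finite t1] [Finite t2] {T1 : SimpleGraph t1} {T2 : SimpleGraph t2}
    {ρ1 : t1} {ρ2 : t2} {τ1 : Sym2 V → t1} {τ2 : Sym2 V → t2} (hd : Disjoint A B)
    (h1 : RD θ E A t1 T1 ρ1 τ1) (h2 : RD θ E B t2 T2 ρ2 τ2) (hA : (bd E A).ncard ≤ θ)
    (hB : (bd E B).ncard ≤ θ) :
    RD θ E (A ∪ B) (Option (t1 ⊕ t2)) (jgraph T1 T2 ρ1 ρ2) none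
      (fun e => if e ∈ A then some (.inl (τ1 e)) else some (.inr (τ2 e))) := by
  have hBA : ∀ e ∈ B, e ∉ A := fun e he hA => hd.le_bot ⟨hA, he⟩
  set τ : Sym2 V → Option (t1 ⊕ t2) := fun e => if e ∈ A then some (.inl (τ1 e)) else some (.inr (τ2 e))
  have hτA : ∀ e ∈ A, τ e = some (.inl (τ1 e)) := fun e he => if_pos he
  have hτB : ∀ e ∈ B, τ e = some (.inr (τ2 e)) := fun e he => if_neg (hBA e he)
  have im1 : ∀ a, some (.inl a) ∈ τ '' (A ∪ B) ↔ a ∈ τ1 '' A := by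
    intro a
    constructor
    · rintro ⟨e, he | he, h⟩
      · rw [hτA e he] at h; exact ⟨e, he, by simpa using h⟩
      · rw [hτB e he] at h; simp at h
    · rintro ⟨e, he, rfl⟩; exact ⟨e, Or.inl he, hτA e he⟩
  have im2 : ∀ a, some (.inr a) ∈ τ '' (A ∪ B) ↔ a ∈ τ2 '' B := by
    intro a
    constructor
    · rintro ⟨e, he | he, h⟩
      · rw [hτA e he] at h; simp at h
      · rw [hτB e he] at h; exact ⟨e, he, by simpa using h⟩
    · rintro ⟨e, he, rfl⟩; exact ⟨e, Or.inr he, hτB e he⟩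
  have im0 : none ∉ τ '' (A ∪ B) := by
    rintro ⟨e, he | he, h⟩
    · rw [hτA e he] at h; simp at h
    · rw [hτB e he] at h; simp at h
  set T := jgraph T1 T2 ρ1 ρ2
  have hs : ∀ x y, T.Adj x y → T.Adj y x := fun _ _ h => h.symm
  have c1 : Cn T.Adj ((fun a => some (Sum.inl a)) '' univ) :=
    h1.conn.image (R' := T.Adj) (fun a => some (Sum.inl a)) fun x _ y _ h => Or.inr h
  have c2 : Cn T.Adj ((fun a => some (Sum.inr a)) '' univ) :=
    h2.conn.image (R' := T.Adj) (fun a => some (Sum.inr a)) fun x _ y _ h => Or.inr h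
  have nb1 : ∀ a, a ≠ ρ1 → T.neighborSet (some (.inl a)) = (fun a => some (Sum.inl a)) '' T1.neighborSet a := by
    intro a ha
    ext x
    rcases x with _ | x | x
    · simp [T, jgraph, jadj, ha]
    · simp [T, jgraph, jadj]
    · simp [T, jgraph, jadj]
  have nb2 : ∀ a, a ≠ ρ2 → T.neighborSet (some (.inr a)) = (fun a => some (Sum.inr a)) '' T2.neighborSet a := by
    intro a ha
    ext x
    rcases x with _ | x | x
    · simp [T, jgraph, jadj, ha]
    · simp [T, jgraph, jadj]
    · simp [T, jgraph, jadj]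
  have nr1 : T.neighborSet (some (.inl ρ1)) = insert none ((fun a => some (Sum.inl a)) '' T1.neighborSet ρ1) := by
    ext x
    rcases x with _ | x | x
    · simp [T, jgraph, jadj]
    · simp [T, jgraph, jadj]
    · simp [T, jgraph, jadj]
  have nr2 : T.neighborSet (some (.inr ρ2)) = insert none ((fun a => some (Sum.inr a)) '' T2.neighborSet ρ2) := by
    ext x
    rcases x with _ | x | x
    · simp [T, jgraph, jadj]
    · simp [T, jgraph, jadj]
    · simp [T, jgraph, jadj]
  have inj1 : Function.Injective (fun a : t1 => (some (Sum.inl a) : Option (t1 ⊕ t2))) := fun a b h => by simpa using h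
  have inj2 : Function.Injective (fun a : t2 => (some (Sum.inr a) : Option (t1 ⊕ t2))) := fun a b h => by simpa using h
  refine ⟨?_, ?_, ?_, ?_, ?_⟩
  · have c3 := (c1.insert_adj hs (b := none) ⟨ρ1, trivial, rfl⟩ (show jadj T1 T2 ρ1 ρ2 (some (.inl ρ1)) none from rfl)).union_adj hs
      c2 (Or.inl rfl) ⟨ρ2, trivial, rfl⟩ (show jadj T1 T2 ρ1 ρ2 none (some (.inr ρ2)) from rfl)
    convert c3 using 1
    ext x
    rcases x with _ | x | x <;> simp
  · rintro e (he | he) f (hf | hf) hef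
    · rw [hτA e he, hτA f hf] at hef; exact h1.inj e he f hf (by simpa using hef)
    · rw [hτA e he, hτB f hf] at hef; simp at hef
    · rw [hτB e he, hτA f hf] at hef; simp at hef
    · rw [hτB e he, hτB f hf] at hef; exact h2.inj e he f hf (by simpa using hef)
  · rintro (_ | a | a) hne
    · exact absurd rfl hne
    · rw [im1]
      by_cases ha : a = ρ1
      · subst ha
        rw [nr1, Set.ncard_insert_of_notMem (by simp) (Set.toFinite _), Set.ncard_image_of_injective _ inj1]
        rcases h1.root with h | h <;> simp [h]
      · rw [nb1 a ha, Set.ncard_image_of_injective _ inj1]; exact h1.nodes a ha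
    · rw [im2]
      by_cases ha : a = ρ2
      · subst ha
        rw [nr2, Set.ncard_insert_of_notMem (by simp) (Set.toFinite _), Set.ncard_image_of_injective _ inj2]
        rcases h2.root with h | h <;> simp [h]
      · rw [nb2 a ha, Set.ncard_image_of_injective _ inj2]; exact h2.nodes a ha
  · refine Or.inr ⟨im0, ?_⟩
    have : T.neighborSet none = {some (.inl ρ1), some (.inr ρ2)} := by
      ext x
      rcases x with _ | x | x <;> simp [T, jgraph, jadj]
    rw [this, Set.ncard_pair (by simp)]
  · have E1 : ∀ S1 : Set t1, {e ∈ A ∪ B | τ e ∈ (fun a => some (Sum.inl a)) '' S1} = {e ∈ A | τ1 e ∈ S1} := by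
      intro S1; ext e
      constructor
      · rintro ⟨he | he, h⟩
        · rw [hτA e he] at h; exact ⟨he, by simpa using h⟩
        · rw [hτB e he] at h; simp at h
      · rintro ⟨he, h⟩; exact ⟨Or.inl he, by rw [hτA e he]; exact ⟨_, h, rfl⟩⟩
    have E2 : ∀ S2 : Set t2, {e ∈ A ∪ B | τ e ∈ (fun a => some (Sum.inr a)) '' S2} = {e ∈ B | τ2 e ∈ S2} := by
      intro S1; ext e
      constructor
      · rintro ⟨he | he, h⟩
        · rw [hτA e he] at h; simp at h
        · rw [hτB e he] at h; exact ⟨he, by simpa using h⟩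
      · rintro ⟨he, h⟩; exact ⟨Or.inr he, by rw [hτB e he]; exact ⟨_, h, rfl⟩⟩
    have r1 : ∃ S : Set (Option (t1 ⊕ t2)), none ∉ S ∧ some (.inl ρ1) ∈ S ∧
      (∀ x y, T.Adj x y → x ∈ S → y ∉ S → s(x, y) = s(none, some (.inl ρ1))) ∧
        (bd E {e ∈ A ∪ B | τ e ∈ S}).ncard ≤ θ := by
      refine ⟨(fun a => some (Sum.inl a)) '' univ, by simp, by simp, ?_, by rw [E1]; simpa using hA⟩
      rintro (_ | x | x) (_ | y | y) hxy hx hy <;> simp at hx hy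
      · obtain rfl : x = ρ1 := hxy
        exact Sym2.eq_swap
      · exact absurd hxy (by simp [T, jgraph, jadj])
    have r2 : ∃ S : Set (Option (t1 ⊕ t2)), none ∉ S ∧ some (.inr ρ2) ∈ S ∧
      (∀ x y, T.Adj x y → x ∈ S → y ∉ S → s(x, y) = s(none, some (.inr ρ2))) ∧
        (bd E {e ∈ A ∪ B | τ e ∈ S}).ncard ≤ θ := by
      refine ⟨(fun a => some (Sum.inr a)) '' univ, by simp, by simp, ?_, by rw [E2]; simpa using hB⟩
      rintro (_ | x | x) (_ | y | y) hxy hx hy <;> simp at hx hy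
      · obtain rfl : x = ρ2 := hxy
        exact Sym2.eq_swap
      · exact absurd hxy (by simp [T, jgraph, jadj])
    rintro (_ | a | a) (_ | b | b) hab
    · exact absurd hab (by simp [T, jgraph, jadj])
    · obtain rfl : b = ρ1 := hab
      obtain ⟨S, s1, s2, s3, s4⟩ := r1
      exact ⟨S, s1, Or.inr ⟨s2, s1⟩, s3, s4⟩
    · obtain rfl : b = ρ2 := hab
      obtain ⟨S, s1, s2, s3, s4⟩ := r2
      exact ⟨S, s1, Or.inr ⟨s2, s1⟩, s3, s4⟩
    · obtain rfl : a = ρ1 := hab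
      obtain ⟨S, s1, s2, s3, s4⟩ := r1
      exact ⟨S, s1, Or.inl ⟨s2, s1⟩, fun x y h1 h2 h3 => by rw [s3 x y h1 h2 h3, Sym2.eq_swap], s4⟩
    · obtain ⟨S, s1, s2, s3, s4⟩ := h1.edges a b hab
      refine ⟨(fun a => some (Sum.inl a)) '' S, by simp, by simpa using s2, ?_, by rw [E1]; exact s4⟩
      rintro (_ | x | x) (_ | y | y) hxy hx hy <;> simp at hx hy
      · obtain rfl : x = ρ1 := hxy
        exact absurd hx s1
      · have := s3 x y hxy hx hy
        rw [Sym2.eq_iff] at this ⊢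
        simpa using this
      · exact absurd hxy (by simp [T, jgraph, jadj])
    · exact absurd hab (by simp [T, jgraph, jadj])
    · obtain rfl : a = ρ2 := hab
      obtain ⟨S, s1, s2, s3, s4⟩ := r2
      exact ⟨S, s1, Or.inl ⟨s2, s1⟩, fun x y h1 h2 h3 => by rw [s3 x y h1 h2 h3, Sym2.eq_swap], s4⟩
    · exact absurd hab (by simp [T, jgraph, jadj])
    · obtain ⟨S, s1, s2, s3, s4⟩ := h2.edges a b hab
      refine ⟨(fun a => some (Sum.inr a)) '' S, by simp, by simpa using s2, ?_, by rw [E2]; exact s4⟩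
      rintro (_ | x | x) (_ | y | y) hxy hx hy <;> simp at hx hy
      · obtain rfl : x = ρ2 := hxy
        exact absurd hx s1
      · exact absurd hxy (by simp [T, jgraph, jadj])
      · have := s3 x y hxy hx hy
        rw [Sym2.eq_iff] at this ⊢
        simpa using this

theorem Br.rd (h : Br θ E A) : ∃ (t : Type) (_ : Finite t) (T : SimpleGraph t) (ρ : t) (τ : Sym2 V → t),
    RD θ E A t T ρ τ := by
  induction h with
  | single e he hb =>
    refine ⟨Unit, inferInstance, ⊥, (), fun _ => (), ?_, ?_, ?_, ?_, ?_⟩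
    · convert Cn.sing (R := (⊥ : SimpleGraph Unit).Adj) () using 1
      ext x; simp
    · rintro e rfl f rfl _; rfl
    · intro v hv; exact absurd rfl hv
    · left; refine ⟨⟨e, rfl, rfl⟩, ?_⟩
      rw [Set.ncard_eq_zero (Set.toFinite _)]
      ext x; simp
    · intro a b hab; exact absurd hab (by simp)
  | union A B hd hA hB hb h1 h2 =>
    obtain ⟨t1, _, T1, ρ1, τ1, h1⟩ := h1
    obtain ⟨t2, _, T2, ρ2, τ2, h2⟩ := h2
    classical
    exact ⟨_, inferInstance, _, _, _, h1.join hd h2 hA.bdle hB.bdle⟩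

/-- final (unrooted) decomposition -/
structure FD (θ : ℕ) (E A : Set (Sym2 V)) (t : Type) (T : SimpleGraph t) (τ : Sym2 V → t) :
    Prop where
  conn : Cn T.Adj univ
  inj : ∀ e ∈ A, ∀ f ∈ A, τ e = τ f → e = f
  nodes : ∀ v, (v ∈ τ '' A ∧ (T.neighborSet v).ncard ≤ 1) ∨
    (v ∉ τ '' A ∧ (T.neighborSet v).ncard = 3)
  edges : ∀ a b, T.Adj a b → ∃ S : Set t, ((a ∈ S ∧ b ∉ S) ∨ (b ∈ S ∧ a ∉ S)) ∧
    (∀ x y, T.Adj x y → x ∈ S → y ∉ S → s(x, y) = s(a, b)) ∧ (bd E {e ∈ A | τ e ∈ S}).ncard ≤ θ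

open Classical in
theorem RD.fin {t1 t2 : Type} [Finite t1] [Finite t2] {T1 : SimpleGraph t1} {T2 : SimpleGraph t2}
    {ρ1 : t1} {ρ2 : t2} {τ1 : Sym2 V → t1} {τ2 : Sym2 V → t2} (hd : Disjoint A B)
    (h1 : RD θ E A t1 T1 ρ1 τ1) (h2 : RD θ E B t2 T2 ρ2 τ2) (hA : (bd E A).ncard ≤ θ)
    (hB : (bd E B).ncard ≤ θ) :
    FD θ E (A ∪ B) (t1 ⊕ t2) (kgraph T1 T2 ρ1 ρ2)
      (fun e => if e ∈ A then (.inl (τ1 e)) else (.inr (τ2 e))) := by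
  have hBA : ∀ e ∈ B, e ∉ A := fun e he hA => hd.le_bot ⟨hA, he⟩
  set τ : Sym2 V → t1 ⊕ t2 := fun e => if e ∈ A then (.inl (τ1 e)) else (.inr (τ2 e))
  have hτA : ∀ e ∈ A, τ e = (.inl (τ1 e)) := fun e he => if_pos he
  have hτB : ∀ e ∈ B, τ e = (.inr (τ2 e)) := fun e he => if_neg (hBA e he)
  have im1 : ∀ a, (.inl a) ∈ τ '' (A ∪ B) ↔ a ∈ τ1 '' A := by
    intro a
    constructor
    · rintro ⟨e, he | he, h⟩
      · rw [hτA e he] at h; exact ⟨e, he, by simpa using h⟩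
      · rw [hτB e he] at h; simp at h
    · rintro ⟨e, he, rfl⟩; exact ⟨e, Or.inl he, hτA e he⟩
  have im2 : ∀ a, (.inr a) ∈ τ '' (A ∪ B) ↔ a ∈ τ2 '' B := by
    intro a
    constructor
    · rintro ⟨e, he | he, h⟩
      · rw [hτA e he] at h; simp at h
      · rw [hτB e he] at h; exact ⟨e, he, by simpa using h⟩
    · rintro ⟨e, he, rfl⟩; exact ⟨e, Or.inr he, hτB e he⟩
  set T := kgraph T1 T2 ρ1 ρ2
  have hs : ∀ x y, T.Adj x y → T.Adj y x := fun _ _ h => h.symm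
  have c1 : Cn T.Adj (Sum.inl '' univ) :=
    h1.conn.image (R' := T.Adj) (fun a => (Sum.inl a)) fun x _ y _ h => Or.inr h
  have c2 : Cn T.Adj (Sum.inr '' univ) :=
    h2.conn.image (R' := T.Adj) (fun a => (Sum.inr a)) fun x _ y _ h => Or.inr h
  have nb1 : ∀ a, a ≠ ρ1 → T.neighborSet ((.inl a)) = Sum.inl '' T1.neighborSet a := by
    intro a ha
    ext x
    rcases x with x | x <;> simp [T, kgraph, kadj, ha]
  have nb2 : ∀ a, a ≠ ρ2 → T.neighborSet ((.inr a)) = Sum.inr '' T2.neighborSet a := by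
    intro a ha
    ext x
    rcases x with x | x <;> simp [T, kgraph, kadj, ha]
  have nr1 : T.neighborSet ((.inl ρ1)) = insert (Sum.inr ρ2) (Sum.inl '' T1.neighborSet ρ1) := by
    ext x
    rcases x with x | x <;> simp [T, kgraph, kadj]
  have nr2 : T.neighborSet ((.inr ρ2)) = insert (Sum.inl ρ1) (Sum.inr '' T2.neighborSet ρ2) := by
    ext x
    rcases x with x | x <;> simp [T, kgraph, kadj]
  refine ⟨?_, ?_, ?_, ?_⟩
  · have c3 := c1.union_adj hs c2 ⟨ρ1, trivial, rfl⟩ ⟨ρ2, trivial, rfl⟩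
      (show kadj T1 T2 ρ1 ρ2 (.inl ρ1) (.inr ρ2) from ⟨rfl, rfl⟩)
    convert c3 using 1
    ext x
    rcases x with x | x <;> simp
  · rintro e (he | he) f (hf | hf) hef
    · rw [hτA e he, hτA f hf] at hef; exact h1.inj e he f hf (by simpa using hef)
    · rw [hτA e he, hτB f hf] at hef; simp at hef
    · rw [hτB e he, hτA f hf] at hef; simp at hef
    · rw [hτB e he, hτB f hf] at hef; exact h2.inj e he f hf (by simpa using hef)
  · rintro (a | a)
    · rw [im1]
      by_cases ha : a = ρ1
      · subst ha
        rw [nr1, Set.ncard_insert_of_notMem (by simp) (Set.toFinite _), Set.ncard_image_of_injective _ Sum.inl_injective]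
        rcases h1.root with h | h <;> simp [h]
      · rw [nb1 a ha, Set.ncard_image_of_injective _ Sum.inl_injective]
        exact (h1.nodes a ha).imp_left fun h => ⟨h.1, h.2.le⟩
    · rw [im2]
      by_cases ha : a = ρ2
      · subst ha
        rw [nr2, Set.ncard_insert_of_notMem (by simp) (Set.toFinite _), Set.ncard_image_of_injective _ Sum.inr_injective]
        rcases h2.root with h | h <;> simp [h]
      · rw [nb2 a ha, Set.ncard_image_of_injective _ Sum.inr_injective]
        exact (h2.nodes a ha).imp_left fun h => ⟨h.1, h.2.le⟩
  · have E1 : ∀ S1 : Set t1, {e ∈ A ∪ B | τ e ∈ Sum.inl '' S1} = {e ∈ A | τ1 e ∈ S1} := by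
      intro S1; ext e
      constructor
      · rintro ⟨he | he, h⟩
        · rw [hτA e he] at h; exact ⟨he, by simpa using h⟩
        · rw [hτB e he] at h; simp at h
      · rintro ⟨he, h⟩; exact ⟨Or.inl he, by rw [hτA e he]; exact ⟨_, h, rfl⟩⟩
    have E2 : ∀ S2 : Set t2, {e ∈ A ∪ B | τ e ∈ Sum.inr '' S2} = {e ∈ B | τ2 e ∈ S2} := by
      intro S1; ext e
      constructor
      · rintro ⟨he | he, h⟩
        · rw [hτA e he] at h; simp at h
        · rw [hτB e he] at h; exact ⟨he, by simpa using h⟩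
      · rintro ⟨he, h⟩; exact ⟨Or.inr he, by rw [hτB e he]; exact ⟨_, h, rfl⟩⟩
    have r1 : ∃ S : Set (t1 ⊕ t2), (.inr ρ2) ∉ S ∧ (.inl ρ1) ∈ S ∧
      (∀ x y, T.Adj x y → x ∈ S → y ∉ S → s(x, y) = s(.inl ρ1, .inr ρ2)) ∧
        (bd E {e ∈ A ∪ B | τ e ∈ S}).ncard ≤ θ := by
      refine ⟨Sum.inl '' univ, by simp, by simp, ?_, by rw [E1]; simpa using hA⟩
      rintro (x | x) (y | y) hxy hx hy <;> simp at hx hy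
      obtain ⟨rfl, rfl⟩ : x = ρ1 ∧ y = ρ2 := hxy
      rfl
    rintro (a | a) (b | b) hab
    · obtain ⟨S, s1, s2, s3, s4⟩ := h1.edges a b hab
      refine ⟨Sum.inl '' S, by simpa using s2, ?_, by rw [E1]; exact s4⟩
      rintro (x | x) (y | y) hxy hx hy <;> simp at hx hy
      · have := s3 x y hxy hx hy
        rw [Sym2.eq_iff] at this ⊢
        simpa using this
      · obtain ⟨rfl, rfl⟩ : x = ρ1 ∧ y = ρ2 := hxy
        exact absurd hx s1
    · obtain ⟨rfl, rfl⟩ : a = ρ1 ∧ b = ρ2 := hab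
      obtain ⟨S, s1, s2, s3, s4⟩ := r1
      exact ⟨S, Or.inl ⟨s2, s1⟩, s3, s4⟩
    · obtain ⟨rfl, rfl⟩ : b = ρ1 ∧ a = ρ2 := hab
      obtain ⟨S, s1, s2, s3, s4⟩ := r1
      exact ⟨S, Or.inr ⟨s2, s1⟩, fun x y h1 h2 h3 => by rw [s3 x y h1 h2 h3, Sym2.eq_swap], s4⟩
    · obtain ⟨S, s1, s2, s3, s4⟩ := h2.edges a b hab
      refine ⟨Sum.inr '' S, by simpa using s2, ?_, by rw [E2]; exact s4⟩
      rintro (x | x) (y | y) hxy hx hy <;> simp at hx hy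
      · obtain ⟨rfl, rfl⟩ : y = ρ1 ∧ x = ρ2 := hxy
        exact absurd hx s1
      · have := s3 x y hxy hx hy
        rw [Sym2.eq_iff] at this ⊢
        simpa using this

theorem Br.fd (h : Br θ E A) : ∃ (t : Type) (_ : Finite t) (T : SimpleGraph t) (τ : Sym2 V → t),
    FD θ E A t T τ := by
  cases h with
  | single e he hb =>
    refine ⟨Unit, inferInstance, ⊥, fun _ => (), ?_, ?_, ?_, ?_⟩
    · convert Cn.sing (R := (⊥ : SimpleGraph Unit).Adj) () using 1
      ext x; simp
    · rintro e rfl f rfl _; rfl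
    · intro v
      left; refine ⟨⟨e, rfl, rfl⟩, ?_⟩
      rw [Set.ncard_eq_zero (Set.toFinite _) |>.2 (by ext x; simp)]
      omega
    · intro a b hab; exact absurd hab (by simp)
  | union A B hd hA hB hb =>
    obtain ⟨t1, _, T1, ρ1, τ1, h1⟩ := hA.rd
    obtain ⟨t2, _, T2, ρ2, τ2, h2⟩ := hB.rd
    classical
    exact ⟨_, inferInstance, _, _, h1.fin hd h2 hA.bdle hB.bdle⟩

end brdef

end

section

open SimpleGraph Set

section c2
variable {V : Type*}

theorem cn_univ_conn {t : Type*} {T : SimpleGraph t} (h : Cn T.Adj univ) : T.Connected := by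
  have := (cn_iff_induce T univ).1 h
  exact (induceUnivIso T).connected_iff.1 this

theorem FD.branchwidth_le {θ : ℕ} {V : Type u} {G : SimpleGraph V} {t : Type} [Finite t] {T : SimpleGraph t}
    {τ : Sym2 V → t} (h : FD θ G.edgeSet G.edgeSet t T τ) : branchwidth G ≤ θ := by
  have hconn := cn_univ_conn h.conn
  -- reachability in T - ab
  have key : ∀ a b, ∀ S : Set t, a ∈ S → b ∉ S →
      (∀ x y, T.Adj x y → x ∈ S → y ∉ S → s(x, y) = s(a, b)) →
      ∀ v, (T.deleteEdges {s(a, b)}).Reachable a v ↔ v ∈ S := by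
    intro a b S ha hb hu
    have nocross : ∀ x y, (T.deleteEdges {s(a, b)}).Reachable x y → (x ∈ S ↔ y ∈ S) := by
      rintro x y ⟨p⟩
      induction p with
      | nil => rfl
      | cons h' p ih =>
        rw [deleteEdges_adj] at h'
        rw [← ih]
        by_contra hc
        rcases not_iff.1 hc with hc
        rename_i u v w _
        by_cases hu' : u ∈ S
        · exact h'.2 (hu u v h'.1 hu' (by tauto))
        · exact h'.2 (Sym2.eq_swap.trans (hu v u h'.1.symm (by tauto) hu'))
    have all : ∀ v, (T.deleteEdges {s(a, b)}).Reachable a v ∨ (T.deleteEdges {s(a, b)}).Reachable b v := by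
      intro v
      have := h.conn.2 {v | (T.deleteEdges {s(a, b)}).Reachable a v ∨ (T.deleteEdges {s(a, b)}).Reachable b v}
        ⟨a, trivial, Or.inl (Reachable.refl _)⟩ (by
        intro x _ y _ hxy hx
        by_cases he : s(x, y) = s(a, b)
        · rw [Sym2.eq_iff] at he
          rcases he with ⟨rfl, rfl⟩ | ⟨rfl, rfl⟩
          · right; rfl
          · left; rfl
        · have : (T.deleteEdges {s(a, b)}).Adj x y := by rw [deleteEdges_adj]; exact ⟨hxy, he⟩
          exact hx.imp (fun h => h.trans this.reachable) (fun h => h.trans this.reachable))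
      exact this (mem_univ v)
    intro v
    constructor
    · intro hv; exact (nocross _ _ hv).1 ha
    · intro hv
      rcases all v with h' | h'
      · exact h'
      · exact absurd ((nocross _ _ h').2 hv) hb
  have htree : T.IsTree := by
    refine ⟨hconn, ?_⟩
    rw [isAcyclic_iff_forall_edge_isBridge]
    intro e he
    induction e with | _ a b =>
    rw [mem_edgeSet] at he
    rw [isBridge_iff]
    obtain ⟨S, hS, hu, -⟩ := h.edges a b he
    rcases hS with hS | hS
    · rw [key a b S hS.1 hS.2 hu]; exact hS.2
    · intro hr
      have := (key b a S hS.1 hS.2 (by rw [Sym2.eq_swap]; exact hu) a).1 (by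
        rw [Sym2.eq_swap]; exact hr.symm)
      exact hS.2 this
  have hleaf : ∀ e ∈ G.edgeSet, (T.neighborSet (τ e)).ncard ≤ 1 := by
    intro e he
    rcases h.nodes (τ e) with h' | h'
    · exact h'.2
    · exact absurd ⟨e, he, rfl⟩ h'.1
  let f : G.edgeSet → {v : t // (T.neighborSet v).ncard ≤ 1} := fun e => ⟨τ e, hleaf e e.2⟩
  have hf : Function.Bijective f := by
    constructor
    · intro e e' h'
      exact Subtype.ext (h.inj e e.2 e' e'.2 (by simpa [f] using h'))
    · rintro ⟨v, hv⟩
      rcases h.nodes v with h' | h'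
      · obtain ⟨e, he, rfl⟩ := h'.1
        exact ⟨⟨e, he⟩, rfl⟩
      · omega
  let B : BranchDecomp G := ⟨t, Fintype.ofFinite t, T, htree, fun v => (h.nodes v).imp (fun h => h.2) (fun h => h.2),
    Equiv.ofBijective f hf⟩
  refine (Nat.sInf_le (show B.width ∈ {n | ∃ B : BranchDecomp G, B.width = n} from ⟨B, rfl⟩)).trans ?_
  apply csSup_le'
  rintro n ⟨a, b, hab, rfl⟩
  obtain ⟨S, hS, hu, hbd⟩ := h.edges a b hab
  have main : B.bdry a b = bd G.edgeSet {e ∈ G.edgeSet | τ e ∈ S} := by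
    rcases hS with hS | hS
    · have hs : ∀ e : G.edgeSet, e ∈ B.side a b ↔ τ e ∈ S := fun e => key a b S hS.1 hS.2 hu _
      ext v
      simp only [BranchDecomp.bdry, mem_setOf_eq, hs, bd]
      constructor
      · rintro ⟨⟨e, h1, h2⟩, ⟨e', h3, h4⟩⟩
        exact ⟨⟨e, ⟨e.2, h1⟩, h2⟩, ⟨e', ⟨e'.2, fun h => h3 h.2⟩, h4⟩⟩
      · rintro ⟨⟨e, h1, h2⟩, ⟨e', h3, h4⟩⟩
        exact ⟨⟨⟨e, h1.1⟩, h1.2, h2⟩, ⟨⟨e', h3.1⟩, fun h => h3.2 ⟨h3.1, h⟩, h4⟩⟩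
    · have hs : ∀ e : G.edgeSet, e ∈ B.side a b ↔ τ e ∉ S := by
        intro e
        refine key a b Sᶜ hS.2 (by simpa using hS.1) ?_ _
        intro x y hxy hx hy
        rw [Sym2.eq_swap]
        exact hu y x hxy.symm (by simpa using hy) hx
      ext v
      simp only [BranchDecomp.bdry, mem_setOf_eq, hs, bd]
      constructor
      · rintro ⟨⟨e, h1, h2⟩, ⟨e', h3, h4⟩⟩
        exact ⟨⟨e', ⟨e'.2, by simpa using h3⟩, h4⟩, ⟨e, ⟨e.2, fun h => h1 h.2⟩, h2⟩⟩
      · rintro ⟨⟨e, h1, h2⟩, ⟨e', h3, h4⟩⟩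
        exact ⟨⟨⟨e', h3.1⟩, fun h => h3.2 ⟨h3.1, h⟩, h4⟩, ⟨⟨e, h1.1⟩, by simpa using h1.2, h2⟩⟩
  rw [main]; exact hbd

theorem Br.branchwidth_le {θ : ℕ} {V : Type u} {G : SimpleGraph V} (h : Br θ G.edgeSet G.edgeSet) :
    branchwidth G ≤ θ := by
  obtain ⟨t, _, T, τ, h⟩ := h.fd
  exact h.branchwidth_le

theorem branchwidth_of_empty {V : Type u} {G : SimpleGraph V} (h : G.edgeSet = ∅) : branchwidth G = 0 := by
  have : {n | ∃ B : BranchDecomp G, B.width = n} = ∅ := by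
    ext n
    simp only [mem_setOf_eq, mem_empty_iff_false, iff_false, not_exists]
    intro B _
    have key : ∃ v, (B.T.neighborSet v).ncard ≤ 1 := by
      haveI := B.fin
      classical
      rcases subsingleton_or_nontrivial B.t with hs | hs
      · obtain ⟨v⟩ := B.isTree.1.nonempty
        refine ⟨v, ?_⟩
        exact (Set.ncard_le_one (Set.toFinite _)).2 fun a _ b _ => Subsingleton.elim a b
      · obtain ⟨v, hv⟩ := B.isTree.exists_vert_degree_one_of_nontrivial
        refine ⟨v, ?_⟩
        rw [← card_neighborSet_eq_degree] at hv
        rw [Set.ncard_eq_toFinset_card', Set.toFinset_card, hv]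
    obtain ⟨v, hv⟩ := key
    have := (B.τ.symm ⟨v, hv⟩).2
    exact (h.subset this).elim
  rw [branchwidth, this, Nat.sInf_empty]

/-- Lemma U -/
theorem Br.iUnion {θ : ℕ} {E : Set (Sym2 V)} {W : Set V} (hWf : W.Finite) (hW : W.ncard ≤ θ) {ι : Type*} (s : Finset ι)
    (hs : s.Nonempty) (A : ι → Set (Sym2 V)) (hA : ∀ i ∈ s, Br θ E (A i)) (hb : ∀ i ∈ s, bd E (A i) ⊆ W)
    (hd : ∀ i ∈ s, ∀ j ∈ s, i ≠ j → Disjoint (A i) (A j)) : Br θ E (⋃ i ∈ s, A i) := by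
  classical
  have hbU : ∀ s : Finset ι, (∀ i ∈ s, bd E (A i) ⊆ W) → bd E (⋃ i ∈ s, A i) ⊆ W := by
    rintro s hb v ⟨⟨e, he, hv⟩, ⟨e', he', hv'⟩⟩
    simp only [mem_iUnion, exists_prop] at he
    obtain ⟨i, hi, he⟩ := he
    refine hb i hi ⟨⟨e, he, hv⟩, ⟨e', ⟨he'.1, fun h => he'.2 ?_⟩, hv'⟩⟩
    simp only [mem_iUnion, exists_prop]
    exact ⟨i, hi, h⟩
  induction hs using Finset.Nonempty.cons_induction with
  | singleton a => simpa using hA a (by simp)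
  | cons a s ha hs ih =>
    have ih' := ih (fun i hi => hA i (by simp [hi])) (fun i hi => hb i (by simp [hi]))
      (fun i hi j hj => hd i (by simp [hi]) j (by simp [hj]))
    have he : (⋃ i ∈ Finset.cons a s ha, A i) = A a ∪ ⋃ i ∈ s, A i := by simp
    have := hbU _ hb
    rw [he] at this ⊢
    refine Br.union _ _ ?_ (hA a (by simp)) ih' ((ncard_le_ncard this hWf).trans hW)
    rw [disjoint_iUnion₂_right]
    intro i hi
    exact hd a (by simp) i (by simp [hi]) (by rintro rfl; exact ha hi)

end c2

end

section

open SimpleGraph Set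

section gem
variable {F N : Type*}

structure Gem (F N : Type*) where
  σ : Fin 3 → F → F
  inv : ∀ k x, σ k (σ k x) = x
  fpf : ∀ k x, σ k x ≠ x
  nd : Fin 3 → F → N
  nd_eq : ∀ i k x, i ≠ k → nd i (σ k x) = nd i x
  disj : ∀ i j x y, nd i x = nd j y → i = j
  orb : ∀ i x y, nd i x = nd i y → ∀ P : F → Prop, (∀ z k, i ≠ k → P z → P (σ k z)) → P x → P y

abbrev Ch (F : Type*) := Fin 3 → F → ZMod 2

theorem z2 (a : ZMod 2) : a + a = 0 := CharTwo.add_self_eq_zero a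
theorem z2e {a b : ZMod 2} : a + b = 0 ↔ a = b := by revert a b; decide
theorem z2n {a : ZMod 2} : a ≠ 0 ↔ a = 1 := by revert a; decide

namespace Gem
variable [Fintype F] (M : Gem F N)

open Classical in
noncomputable def rep (k : Fin 3) : Finset F :=
  Finset.univ.filter fun x => Fintype.equivFin F x < Fintype.equivFin F (M.σ k x)

theorem sum_rep (k : Fin 3) (g : F → ZMod 2) :
    ∑ x ∈ M.rep k, (g x + g (M.σ k x)) = ∑ x, g x := by
  classical
  rw [Finset.sum_add_distrib, ← Finset.sum_filter_add_sum_filter_not Finset.univ (fun x => x ∈ M.rep k)]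
  congr 1
  · apply Finset.sum_congr _ (fun _ _ => rfl)
    ext x; simp
  · refine Finset.sum_bij' (fun x _ => M.σ k x) (fun x _ => M.σ k x) ?_ ?_ ?_ ?_ ?_
    · intro x hx
      simp only [rep, Finset.mem_filter, Finset.mem_univ, true_and, M.inv] at hx ⊢
      exact hx.not_gt
    · intro x hx
      simp only [rep, Finset.mem_filter, Finset.mem_univ, true_and, M.inv] at hx ⊢
      refine lt_of_le_of_ne (not_lt.1 hx) ?_
      intro h
      exact M.fpf k x ((Fintype.equivFin F).injective h)
    · intro x _; exact M.inv k x
    · intro x _; exact M.inv k x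
    · intro x _; rfl

theorem rep_or (k : Fin 3) (x : F) : (x ∈ M.rep k ∧ M.σ k x ∉ M.rep k) ∨ (M.σ k x ∈ M.rep k ∧ x ∉ M.rep k) := by
  classical
  simp only [rep, Finset.mem_filter, Finset.mem_univ, true_and, M.inv]
  rcases lt_trichotomy (Fintype.equivFin F x) (Fintype.equivFin F (M.σ k x)) with h | h | h
  · exact Or.inl ⟨h, h.not_gt⟩
  · exact absurd ((Fintype.equivFin F).injective h).symm (M.fpf k x)
  · exact Or.inr ⟨h, h.not_gt⟩

/-- pairing of chains with cochains -/
noncomputable def pr (c t : Ch F) : ZMod 2 := ∑ k, ∑ x ∈ M.rep k, c k x * t k x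

def IsCh (c : Ch F) : Prop := ∀ k x, c k (M.σ k x) = c k x
def cob (y : N → ZMod 2) : Ch F := fun k x => y (M.nd (k+1) x) + y (M.nd (k+2) x)
def tt (s : Ch F) : Ch F := fun k x => s (k+1) x + s (k+2) x
def dl (φ : F → ZMod 2) : Ch F := fun k x => φ x + φ (M.σ k x)
def Shade (s c : Ch F) : Prop := ∀ i k, i ≠ k → ∀ x, s i x + s i (M.σ k x) = c k x
def Ev (c : Ch F) : Prop := M.IsCh c ∧ ∀ y, M.pr c (M.cob y) = 0
def Sup (c : Ch F) (R : Set N) : Prop := ∀ k x, c k x ≠ 0 → ∀ i, i ≠ k → M.nd i x ∈ R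
open Classical in
noncomputable def ed (k : Fin 3) (x : F) : Ch F := fun k' y => if k' = k ∧ (y = x ∨ y = M.σ k x) then 1 else 0

variable {M}

theorem pr_add_left (c c' t : Ch F) : M.pr (c + c') t = M.pr c t + M.pr c' t := by
  simp [pr, add_mul, Finset.sum_add_distrib]
theorem pr_add_right (c t t' : Ch F) : M.pr c (t + t') = M.pr c t + M.pr c t' := by
  simp [pr, mul_add, Finset.sum_add_distrib]
@[simp] theorem pr_zero_left (t : Ch F) : M.pr 0 t = 0 := by simp [pr]
@[simp] theorem pr_zero_right (t : Ch F) : M.pr t 0 = 0 := by simp [pr]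

theorem pr_sum_left {ι : Type*} (s : Finset ι) (c : ι → Ch F) (t : Ch F) :
    M.pr (∑ i ∈ s, c i) t = ∑ i ∈ s, M.pr (c i) t := by
  classical
  induction s using Finset.induction with
  | empty => simp
  | insert a s ha ih => rw [Finset.sum_insert ha, Finset.sum_insert ha, pr_add_left, ih]

theorem pr_ed (k : Fin 3) (x : F) (t : Ch F) (ht : t k (M.σ k x) = t k x) : M.pr (M.ed k x) t = t k x := by
  classical
  unfold pr
  rw [Finset.sum_eq_single k]
  · rcases M.rep_or k x with h | h
    · rw [Finset.sum_eq_single x]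
      · simp [ed]
      · intro y hy hne
        have : y ≠ M.σ k x := by rintro rfl; exact h.2 hy
        simp [ed, hne, this]
      · intro h'; exact absurd h.1 h'
    · rw [Finset.sum_eq_single (M.σ k x)]
      · simp [ed, ht]
      · intro y hy hne
        have : y ≠ x := by rintro rfl; exact h.2 hy
        simp [ed, hne, this]
      · intro h'; exact absurd h.1 h'
  · intro j _ hj
    apply Finset.sum_eq_zero
    intro y _
    simp [ed, hj]
  · simp

theorem pr_zero_of {c t : Ch F} (h : ∀ k x, c k x ≠ 0 → t k x = 0) : M.pr c t = 0 := by
  apply Finset.sum_eq_zero; intro k _; apply Finset.sum_eq_zero; intro x _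
  by_cases hc : c k x = 0
  · rw [hc, zero_mul]
  · rw [h k x hc, mul_zero]

theorem pr_congr {c t t' : Ch F} (h : ∀ k x, c k x ≠ 0 → t k x = t' k x) : M.pr c t = M.pr c t' := by
  apply Finset.sum_congr rfl; intro k _; apply Finset.sum_congr rfl; intro x _
  by_cases hc : c k x = 0
  · rw [hc, zero_mul, zero_mul]
  · rw [h k x hc]

theorem k1 (k : Fin 3) : k + 1 ≠ k := by revert k; decide
theorem k2 (k : Fin 3) : k + 2 ≠ k := by revert k; decide
theorem ki {i k : Fin 3} (h : i ≠ k) : i = k + 1 ∨ i = k + 2 := by revert i k; decide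

theorem IsCh.add {c c' : Ch F} (h : M.IsCh c) (h' : M.IsCh c') : M.IsCh (c + c') := fun k x => by
  simp only [Pi.add_apply, h k x, h' k x]
theorem isCh_zero : M.IsCh (0 : Ch F) := fun k x => rfl
theorem isCh_ed (k : Fin 3) (x : F) : M.IsCh (M.ed k x) := by
  intro j y
  unfold ed
  congr 1
  rw [eq_iff_iff]
  apply and_congr_right
  rintro rfl
  constructor
  · rintro (h | h)
    · right; rw [← h, M.inv]
    · left; rw [← M.inv j y, h, M.inv]
  · rintro (h | h)
    · right; rw [h]
    · left; rw [h, M.inv]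
theorem isCh_cob (y : N → ZMod 2) : M.IsCh (M.cob y) := fun k x => by
  simp only [cob, M.nd_eq _ k x (k1 k), M.nd_eq _ k x (k2 k)]
theorem isCh_dl (φ : F → ZMod 2) : M.IsCh (M.dl φ) := fun k x => by
  simp only [dl, M.inv]; exact add_comm _ _
theorem Shade.isCh {s c : Ch F} (h : M.Shade s c) : M.IsCh c := fun k x => by
  rw [← h _ k (k1 k), ← h _ k (k1 k), M.inv]; exact add_comm _ _
theorem Shade.isCh_tt {s c : Ch F} (h : M.Shade s c) : M.IsCh (tt s) := fun k x => by
  have h1 := h _ k (k1 k) x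
  have h2 := h _ k (k2 k) x
  simp only [tt]
  have := z2 (s (k+1) x); have := z2 (s (k+2) x)
  have := z2 (c k x)
  generalize s (k+1) x = a, s (k+2) x = b, s (k+1) (M.σ k x) = a', s (k+2) (M.σ k x) = b', c k x = d at *
  revert a b a' b' d; decide
theorem Shade.add {s c s' c' : Ch F} (h : M.Shade s c) (h' : M.Shade s' c') : M.Shade (s + s') (c + c') :=
  fun i k hik x => by
    simp only [Pi.add_apply, ← h i k hik x, ← h' i k hik x]; ring
theorem shade_dl (φ : F → ZMod 2) : M.Shade (fun _ => φ) (M.dl φ) := fun _ _ _ _ => rfl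
theorem tt_const (φ : F → ZMod 2) : tt (fun _ => φ) = 0 := by
  ext k x; exact z2 _
theorem tt_add (s s' : Ch F) : tt (s + s') = tt s + tt s' := by
  ext k x; simp only [tt, Pi.add_apply]; ring

theorem Ev.add {c c' : Ch F} (h : M.Ev c) (h' : M.Ev c') : M.Ev (c + c') :=
  ⟨h.1.add h'.1, fun y => by rw [pr_add_left, h.2, h'.2, add_zero]⟩

theorem Shade.ev {s c : Ch F} (h : M.Shade s c) : M.Ev c := by
  refine ⟨h.isCh, fun y => ?_⟩
  have e1 : M.pr c (M.cob y) = ∑ k, (∑ x, s (k+1) x * y (M.nd (k+1) x) + ∑ x, s (k+2) x * y (M.nd (k+2) x)) := by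
    apply Finset.sum_congr rfl; intro k _
    rw [← M.sum_rep k, ← M.sum_rep k, ← Finset.sum_add_distrib]
    apply Finset.sum_congr rfl; intro x _
    rw [M.nd_eq _ k x (k1 k), M.nd_eq _ k x (k2 k)]
    simp only [cob]
    rw [mul_add, ← add_mul, ← add_mul, h _ k (k1 k), h _ k (k2 k)]
  rw [e1, Fin.sum_univ_three]
  simp only [show (0:Fin 3) + 1 = 1 from rfl, show (0:Fin 3) + 2 = 2 from rfl, show (1:Fin 3) + 1 = 2 from rfl,
    show (1:Fin 3) + 2 = 0 from rfl, show (2:Fin 3) + 1 = 0 from rfl, show (2:Fin 3) + 2 = 1 from rfl]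
  generalize (∑ x, s 0 x * y (M.nd 0 x)) = a, (∑ x, s 1 x * y (M.nd 1 x)) = b, (∑ x, s 2 x * y (M.nd 2 x)) = d
  revert a b d; decide

theorem ev_dl (φ : F → ZMod 2) : M.Ev (M.dl φ) := (shade_dl φ).ev

/-- one type shading -/
theorem shade_one (i : Fin 3) {c : Ch F} (hc : M.Ev c) :
    ∃ s : F → ZMod 2, ∀ x, s x + s (M.σ (i+1) x) = c (i+1) x ∧ s x + s (M.σ (i+2) x) = c (i+2) x := by
  classical
  let L : (F → ZMod 2) →ₗ[ZMod 2] (F → ZMod 2) × (F → ZMod 2) :=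
    { toFun := fun s => (fun x => s x + s (M.σ (i+1) x), fun x => s x + s (M.σ (i+2) x))
      map_add' := fun s s' => by
        ext x <;> simp only [Pi.add_apply, Prod.fst_add, Prod.snd_add] <;> ring
      map_smul' := fun a s => by
        ext x <;> simp [mul_add] }
  by_contra hcon
  have hn : ((c (i+1), c (i+2)) : (F → ZMod 2) × (F → ZMod 2)) ∉ LinearMap.range L := by
    rintro ⟨s, hs⟩
    apply hcon
    refine ⟨s, fun x => ⟨congrFun (congrArg Prod.fst hs) x, congrFun (congrArg Prod.snd hs) x⟩⟩
  obtain ⟨f, hf, hker⟩ := Submodule.exists_le_ker_of_notMem hn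
  apply hf
  let α : F → ZMod 2 := fun x => f (Pi.single x 1, 0)
  let β : F → ZMod 2 := fun x => f (0, Pi.single x 1)
  have hrep : ∀ u v, f (u, v) = ∑ x, u x * α x + ∑ x, v x * β x := by
    intro u v
    have h1 : ((u, v) : (F → ZMod 2) × (F → ZMod 2)) =
        ∑ x, u x • (Pi.single x 1, 0) + ∑ x, v x • (0, Pi.single x 1) := by
      ext y
      · simp [Prod.fst_sum, Finset.sum_apply, Pi.single_apply]
      · simp [Prod.snd_sum, Finset.sum_apply, Pi.single_apply]
    rw [h1, map_add, map_sum, map_sum]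
    simp only [map_smul, smul_eq_mul]
    rfl
  have hy : ∀ x, α x + α (M.σ (i+1) x) = β x + β (M.σ (i+2) x) := by
    intro x
    have := hker (LinearMap.mem_range_self L (Pi.single x 1))
    rw [LinearMap.mem_ker] at this
    have h2 : L (Pi.single x 1) = (Pi.single x 1 + Pi.single (M.σ (i+1) x) 1, Pi.single x 1 + Pi.single (M.σ (i+2) x) 1) := by
      have : ∀ k y, (M.σ k y = x) = (y = M.σ k x) := fun k y => by
        rw [eq_iff_iff]; constructor
        · rintro rfl; rw [M.inv]
        · rintro rfl; rw [M.inv]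
      ext y <;> simp [L, Pi.single_apply, this]
    rw [h2, hrep] at this
    simp only [Pi.add_apply, add_mul, Finset.sum_add_distrib] at this
    simp only [Pi.single_apply, ite_mul, one_mul, zero_mul, Finset.sum_ite_eq', Finset.mem_univ, if_true] at this
    exact z2e.1 this
  let y : F → ZMod 2 := fun x => α x + α (M.σ (i+1) x)
  have y1 : ∀ x, y (M.σ (i+1) x) = y x := fun x => by simp only [y, M.inv]; exact add_comm _ _
  have y2 : ∀ x, y (M.σ (i+2) x) = y x := fun x => by
    simp only [y]; rw [hy, hy, M.inv]; exact add_comm _ _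
  have ycon : ∀ x x', M.nd i x = M.nd i x' → y x' = y x := by
    intro x x' h
    refine M.orb i x x' h (fun z => y z = y x) ?_ rfl
    intro z k hik hz
    rcases ki hik.symm with rfl | rfl
    · rw [y1, hz]
    · rw [y2, hz]
  let Y : N → ZMod 2 := fun a => if h : ∃ x, M.nd i x = a then y h.choose else 0
  have hY : ∀ x, Y (M.nd i x) = y x := by
    intro x
    have h : ∃ x', M.nd i x' = M.nd i x := ⟨x, rfl⟩
    simp only [Y, dif_pos h]
    exact (ycon _ _ h.choose_spec).symm
  have hY0 : ∀ j x, j ≠ i → Y (M.nd j x) = 0 := by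
    intro j x hj
    simp only [Y]
    rw [dif_neg]
    rintro ⟨x', h⟩
    exact hj (M.disj _ _ _ _ h).symm
  have key := hc.2 Y
  rw [hrep, ← M.sum_rep (i+1), ← M.sum_rep (i+2), ← key]
  unfold pr
  have e3 : ∀ g : Fin 3 → ZMod 2, ∑ k, g k = g i + g (i+1) + g (i+2) := by
    intro g; rw [Fin.sum_univ_three]
    fin_cases i
    · rfl
    · show g 0 + g 1 + g 2 = g 1 + g 2 + g 0; ring
    · show g 0 + g 1 + g 2 = g 2 + g 0 + g 1; ring
  rw [e3]
  have z0 : ∑ x ∈ M.rep i, c i x * M.cob Y i x = 0 := by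
    apply Finset.sum_eq_zero; intro x _
    simp only [cob, hY0 _ x (k1 i), hY0 _ x (k2 i), add_zero, mul_zero]
  rw [z0, zero_add]
  congr 1
  · apply Finset.sum_congr rfl; intro x _
    have : i + 1 + 2 = i := (by decide : ∀ i : Fin 3, i + 1 + 2 = i) i
    have h' : i + 1 + 1 ≠ i := (by decide : ∀ i : Fin 3, i + 1 + 1 ≠ i) i
    rw [hc.1, ← mul_add, cob, this, hY, hY0 _ _ h', zero_add]
  · apply Finset.sum_congr rfl; intro x _
    have : i + 2 + 1 = i := (by decide : ∀ i : Fin 3, i + 2 + 1 = i) i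
    have h' : i + 2 + 2 ≠ i := (by decide : ∀ i : Fin 3, i + 2 + 2 ≠ i) i
    rw [hc.1, ← mul_add, cob, this, hY, hY0 _ _ h', add_zero, ← hy]

theorem Ev.shade {c : Ch F} (hc : M.Ev c) : ∃ s, M.Shade s c := by
  choose s hs using fun i => shade_one i hc
  refine ⟨s, fun i k hik x => ?_⟩
  rcases ki hik.symm with rfl | rfl
  · exact (hs i x).1
  · exact (hs i x).2

/-- shading which vanishes off a support set -/
theorem Ev.shade_sup {c : Ch F} (hc : M.Ev c) {R : Set N} (hR : M.Sup c R) :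
    ∃ s, M.Shade s c ∧ ∀ i x, M.nd i x ∉ R → s i x = 0 := by
  classical
  obtain ⟨s, hs⟩ := hc.shade
  refine ⟨fun i x => if M.nd i x ∈ R then s i x else 0, fun i k hik x => ?_, fun i x h => if_neg h⟩
  simp only [M.nd_eq i k x hik]
  by_cases h : M.nd i x ∈ R
  · simp only [h, if_true]; exact hs i k hik x
  · simp only [h, if_false, add_zero]
    by_contra hne
    exact h (hR k x (Ne.symm hne) i hik)

/-- symmetry of the intersection form -/
theorem Shade.symm {s c s' c' : Ch F} (h : M.Shade s c) (h' : M.Shade s' c') :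
    M.pr c' (tt s) = M.pr c (tt s') := by
  rw [← z2e]
  have e1 : M.pr c' (tt s) + M.pr c (tt s') =
      ∑ k, (∑ x, s (k+1) x * s' (k+1) x + ∑ x, s (k+2) x * s' (k+2) x) := by
    unfold pr
    rw [← Finset.sum_add_distrib]
    apply Finset.sum_congr rfl; intro k _
    rw [← M.sum_rep k, ← M.sum_rep k, ← Finset.sum_add_distrib, ← Finset.sum_add_distrib]
    apply Finset.sum_congr rfl; intro x _
    have h1 := h _ k (k1 k) x
    have h2 := h _ k (k2 k) x
    have h3 := h' _ k (k1 k) x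
    have h4 := h' _ k (k2 k) x
    simp only [tt]
    have : ∀ a1 a2 b1 b2 a1' a2' b1' b2' d d' : ZMod 2, a1 + a1' = d → a2 + a2' = d → b1 + b1' = d' → b2 + b2' = d' →
      d' * (a1 + a2) + d * (b1 + b2) = a1 * b1 + a1' * b1' + (a2 * b2 + a2' * b2') := by
      intro a1 a2 b1 b2 a1' a2' b1' b2' d d' h1 h2 h3 h4
      have e : (2 : ZMod 2) = 0 := rfl
      obtain rfl : a1' = d + a1 := by rw [← h1]; linear_combination (-a1) * e
      obtain rfl : a2' = d + a2 := by rw [← h2]; linear_combination (-a2) * e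
      obtain rfl : b1' = d' + b1 := by rw [← h3]; linear_combination (-b1) * e
      obtain rfl : b2' = d' + b2 := by rw [← h4]; linear_combination (-b2) * e
      linear_combination (-(a1*b1) - a2*b2 - d*d') * e
    exact this _ _ _ _ _ _ _ _ _ _ h1 h2 h3 h4
  rw [e1, Fin.sum_univ_three]
  simp only [show (0:Fin 3) + 1 = 1 from rfl, show (0:Fin 3) + 2 = 2 from rfl, show (1:Fin 3) + 1 = 2 from rfl,
    show (1:Fin 3) + 2 = 0 from rfl, show (2:Fin 3) + 1 = 0 from rfl, show (2:Fin 3) + 2 = 1 from rfl]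
  generalize (∑ x, s 0 x * s' 0 x) = a, (∑ x, s 1 x * s' 1 x) = b, (∑ x, s 2 x * s' 2 x) = d
  revert a b d; decide

/-- intersection form on even chains -/
def Perp (M : Gem F N) (c w : Ch F) : Prop := ∀ s, M.Shade s c → M.pr w (tt s) = 0

theorem pr_indep {c w s s' : Ch F} (h : M.Shade s c) (h' : M.Shade s' c) (hw : M.Ev w) :
    M.pr w (tt s) = M.pr w (tt s') := by
  obtain ⟨sw, hsw⟩ := hw.shade
  rw [h.symm hsw, h'.symm hsw]

theorem perp_of {c w s : Ch F} (h : M.Shade s c) (hw : M.Ev w) (h0 : M.pr w (tt s) = 0) : M.Perp c w :=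
  fun s' h' => by rw [← h0]; exact pr_indep h' h hw

theorem Perp.symm {c w : Ch F} (hc : M.Ev c) (h : M.Perp c w) : M.Perp w c := by
  intro s hs
  obtain ⟨s', hs'⟩ := hc.shade
  rw [hs.symm hs']
  exact h s' hs'

theorem perp_dl {w : Ch F} (φ : F → ZMod 2) (hw : M.Ev w) : M.Perp (M.dl φ) w :=
  perp_of (shade_dl φ) hw (by rw [tt_const]; simp)

theorem perp_dl' {w : Ch F} (φ : F → ZMod 2) (hw : M.Ev w) : M.Perp w (M.dl φ) :=
  (perp_dl φ hw).symm (ev_dl φ)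

theorem Perp.add_right {c w w' : Ch F} (h : M.Perp c w) (h' : M.Perp c w') : M.Perp c (w + w') := fun s hs => by
  rw [pr_add_left, h s hs, h' s hs, add_zero]

theorem ev_reduce {c : Ch F} (hc : M.Ev c) : ∃ φ, M.Ev (c + M.dl φ) ∧ ∀ k x, k ≠ 2 → (c + M.dl φ) k x = 0 := by
  obtain ⟨s, hs⟩ := hc.shade
  refine ⟨s 2, hc.add (ev_dl _), fun k x hk => ?_⟩
  rw [Pi.add_apply, Pi.add_apply, ← hs 2 k hk.symm x]
  exact z2 _

/-- disjoint supports -/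
theorem perp_of_disj {c w : Ch F} {R : Set N} (hc : M.Ev c) (hw : M.Ev w) (hR : M.Sup c R) (hR' : M.Sup w Rᶜ) :
    M.Perp c w := by
  obtain ⟨s, hs, h0⟩ := hc.shade_sup hR
  refine perp_of hs hw (pr_zero_of fun k x h => ?_)
  rw [tt, h0 _ _ (hR' k x h _ (k1 k)), h0 _ _ (hR' k x h _ (k2 k)), add_zero]

theorem Sup.add {c c' : Ch F} {R : Set N} (h : M.Sup c R) (h' : M.Sup c' R) : M.Sup (c + c') R := by
  intro k x hne i hi
  by_cases h0 : c k x = 0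
  · exact h' k x (by rwa [Pi.add_apply, Pi.add_apply, h0, zero_add] at hne) i hi
  · exact h k x h0 i hi
theorem Sup.mono {c : Ch F} {R R' : Set N} (h : M.Sup c R) (h' : R ⊆ R') : M.Sup c R' :=
  fun k x hne i hi => h' (h k x hne i hi)
theorem sup_ed {R : Set N} {k : Fin 3} {x : F} (h1 : M.nd (k+1) x ∈ R) (h2 : M.nd (k+2) x ∈ R) : M.Sup (M.ed k x) R := by
  intro j y hne i hi
  have : j = k ∧ (y = x ∨ y = M.σ k x) := by
    by_contra h; exact hne (if_neg h)
  obtain ⟨rfl, rfl | rfl⟩ := this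
  · rcases ki hi with rfl | rfl <;> assumption
  · rw [M.nd_eq _ _ _ hi]
    rcases ki hi with rfl | rfl <;> assumption
theorem sup_zero {R : Set N} : M.Sup (0 : Ch F) R := fun k x h => absurd rfl h

/-- boundary condition: `∂ c = a + b` -/
def Bdy (M : Gem F N) (c : Ch F) (a b : N) : Prop := M.IsCh c ∧ ∀ y : N → ZMod 2, M.pr c (M.cob y) = y a + y b

theorem Bdy.add {c c' : Ch F} {a b d : N} (h : M.Bdy c a b) (h' : M.Bdy c' b d) : M.Bdy (c + c') a d :=
  ⟨h.1.add h'.1, fun y => by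
    rw [pr_add_left, h.2, h'.2]; have := z2 (y b); linear_combination this⟩
theorem Bdy.symm {c : Ch F} {a b : N} (h : M.Bdy c a b) : M.Bdy c b a := ⟨h.1, fun y => by rw [h.2, add_comm]⟩
theorem bdy_zero (a : N) : M.Bdy 0 a a := ⟨isCh_zero, fun y => by rw [pr_zero_left, z2]⟩
theorem Bdy.ev {c : Ch F} {a : N} (h : M.Bdy c a a) : M.Ev c := ⟨h.1, fun y => by rw [h.2, z2]⟩
theorem bdy_ed (k : Fin 3) (x : F) : M.Bdy (M.ed k x) (M.nd (k+1) x) (M.nd (k+2) x) :=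
  ⟨isCh_ed k x, fun y => pr_ed k x _ (isCh_cob y k x)⟩

/-- adjacency in the barycentric subdivision -/
def Ad (M : Gem F N) (a b : N) : Prop := ∃ i j x, i ≠ j ∧ M.nd i x = a ∧ M.nd j x = b

theorem Ad.symm {a b : N} (h : M.Ad a b) : M.Ad b a := by
  obtain ⟨i, j, x, h, h1, h2⟩ := h; exact ⟨j, i, x, h.symm, h2, h1⟩

theorem Ad.bdy {a b : N} (h : M.Ad a b) : ∃ k x, M.Bdy (M.ed k x) a b ∧
    ((M.nd (k+1) x = a ∧ M.nd (k+2) x = b) ∨ (M.nd (k+1) x = b ∧ M.nd (k+2) x = a)) := by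
  obtain ⟨i, j, x, hij, rfl, rfl⟩ := h
  rcases (by revert i j; decide : ∀ i j : Fin 3, i ≠ j → ∃ k : Fin 3, (i = k + 1 ∧ j = k + 2) ∨ (j = k + 1 ∧ i = k + 2)) i j hij with ⟨k, ⟨rfl, rfl⟩ | ⟨rfl, rfl⟩⟩
  · exact ⟨k, x, bdy_ed k x, Or.inl ⟨rfl, rfl⟩⟩
  · exact ⟨k, x, (bdy_ed k x).symm, Or.inr ⟨rfl, rfl⟩⟩

end Gem
end gem

end

section

open SimpleGraph Set

theorem dihedral {Ω : Type*} [Finite Ω] (a b : Ω → Ω) (ha : ∀ x, a (a x) = x) (hb : ∀ x, b (b x) = x)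
    (fa : ∀ x, a x ≠ x) (fb : ∀ x, b x ≠ x) (w0 : Ω)
    (tr : ∀ P : Ω → Prop, P w0 → (∀ x, P x → P (a x)) → (∀ x, P x → P (b x)) → ∀ x, P x) :
    ∃ (m : ℕ) (e : ℕ → Ω), (∀ l, e (l+1) = a (b (e l))) ∧ (∀ w, ∃ l < m, e l = w ∨ e l = b w) ∧
      (∀ l < m, ∀ k < m, e l = e k → l = k) ∧ (∀ l k, e l ≠ b (e k)) := by
  let f : Ω → Ω := fun x => b (a x)
  have finj : Function.Injective f := by
    intro x y h
    have := congrArg b h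
    simp only [f, hb] at this
    have := congrArg a this
    rwa [ha, ha] at this
  let η : ℕ → Ω := fun l => f^[l] w0
  have hη : ∀ l, η (l+1) = b (a (η l)) := fun l => Function.iterate_succ_apply' f l w0
  have key : ∀ n l k, k - l ≤ n → l ≤ k → a (η l) ≠ η k := by
    intro n
    induction n using Nat.strong_induction_on with
    | _ n ih =>
    intro l k h1 h2 he
    rcases Nat.lt_or_ge k (l+1) with h | h
    · obtain rfl : k = l := by omega
      exact fa _ he
    rcases Nat.lt_or_ge k (l+2) with h' | h'
    · obtain rfl : k = l + 1 := by omega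
      rw [hη] at he
      exact fb _ he.symm
    obtain ⟨k, rfl⟩ : ∃ k', k = k' + 1 := ⟨k - 1, by omega⟩
    have : a (η (l+1)) = η k := by
      rw [hη, he, hη, hb, ha]
    exact ih (n-1) (by omega) (l+1) k (by omega) (by omega) this
  have key' : ∀ l k, a (η l) ≠ η k := by
    intro l k he
    rcases le_total l k with h | h
    · exact key _ l k le_rfl h he
    · exact key _ k l le_rfl h (by rw [← he, ha])
  have hper : ∃ m, 0 < m ∧ η m = w0 := by
    have := Function.Injective.mem_periodicPts finj w0
    obtain ⟨m, hm, h⟩ := this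
    exact ⟨m, hm, h⟩
  classical
  let m := Nat.find hper
  obtain ⟨m0, hm⟩ : 0 < m ∧ η m = w0 := Nat.find_spec hper
  have hmin : ∀ l, l < m → 0 < l → η l ≠ w0 := fun l hl h0 h => Nat.find_min hper hl ⟨h0, h⟩
  refine ⟨m, fun l => a (η l), ?_, ?_, ?_, ?_⟩
  · intro l; show a (η (l+1)) = _; rw [hη]
  · suffices H : ∀ w, ∃ l < m, a (η l) = w ∨ b (a (η l)) = w by
      intro w
      obtain ⟨l, hl, h⟩ := H w
      exact ⟨l, hl, h.imp_right fun h => by rw [← h, hb]⟩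
    apply tr
    · refine ⟨m-1, by omega, Or.inr ?_⟩
      rw [← hη, Nat.sub_add_cancel m0, hm]
    · rintro x ⟨l, hl, rfl | rfl⟩
      · rw [ha]
        rcases Nat.eq_zero_or_pos l with rfl | h
        · exact ⟨m-1, by omega, Or.inr (by rw [← hη, Nat.sub_add_cancel m0, hm]; rfl)⟩
        · refine ⟨l-1, by omega, Or.inr ?_⟩
          rw [← hη, Nat.sub_add_cancel h]
      · rw [← hη]
        rcases Nat.lt_or_ge (l+1) m with h | h
        · exact ⟨l+1, h, Or.inl rfl⟩
        · obtain h : l + 1 = m := by omega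
          exact ⟨0, m0, Or.inl (by rw [h, hm]; rfl)⟩
    · rintro x ⟨l, hl, rfl | rfl⟩
      · exact ⟨l, hl, Or.inr rfl⟩
      · exact ⟨l, hl, Or.inl (hb _).symm⟩
  · have : ∀ l k, l < k → k < m → a (η l) ≠ a (η k) := by
      intro l k hlk hk h
      have h := congrArg a h
      rw [ha, ha] at h
      obtain ⟨d, rfl⟩ : ∃ d, k = l + d := ⟨k - l, by omega⟩
      refine hmin d (by omega) (by omega) ?_
      have e : η (l + d) = f^[l] (η d) := Function.iterate_add_apply f l d w0
      rw [e] at h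
      exact (finj.iterate l h).symm
    intro l hl k hk h
    rcases lt_trichotomy l k with h' | h' | h'
    · exact absurd h (this l k h' hk)
    · exact h'
    · exact absurd h.symm (this k l h' hl)
  · intro l k h
    rw [← hη] at h
    exact key' l (k+1) h

namespace Gem
variable {F N : Type*} [Fintype F] {M : Gem F N}

structure Tree (M : Gem F N) (Z : Set N) (z0 : N) (T : Fin 3 → F → Prop) : Prop where
  root : z0 ∈ Z
  inv : ∀ k x, T k x → T k (M.σ k x)
  ends : ∀ k x, T k x → ∀ i, i ≠ k → M.nd i x ∈ Z
  indep : ∀ c : Ch F, M.Ev c → (∀ k x, c k x ≠ 0 → T k x) → c = 0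
  conn : ∀ z ∈ Z, ∃ τ, M.Bdy τ z z0 ∧ ∀ k x, τ k x ≠ 0 → T k x

theorem exists_tree {Z : Set N} (hZ : Cn M.Ad Z) {z0 : N} (h0 : z0 ∈ Z) : ∃ T, M.Tree Z z0 T := by
  classical
  let P : Set (Fin 3 × F) → Prop := fun T => (∀ k x, (k, x) ∈ T → (k, M.σ k x) ∈ T) ∧
    (∀ k x, (k, x) ∈ T → ∀ i, i ≠ k → M.nd i x ∈ Z) ∧
    (∀ c : Ch F, M.Ev c → (∀ k x, c k x ≠ 0 → (k, x) ∈ T) → c = 0)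
  have hP0 : P ∅ := by
    refine ⟨by simp, by simp, fun c _ h => ?_⟩
    ext k x
    by_contra hne
    exact h k x hne
  obtain ⟨T, hT⟩ := (Set.toFinite {T | P T}).exists_maximal ⟨∅, hP0⟩
  obtain ⟨t1, t2, t3⟩ := hT.prop
  have link : ∀ k x, M.nd (k+1) x ∈ Z → M.nd (k+2) x ∈ Z →
      ∃ τ, M.Bdy τ (M.nd (k+1) x) (M.nd (k+2) x) ∧ ∀ k x, τ k x ≠ 0 → (k, x) ∈ T := by
    intro k x h1 h2
    by_cases hx : (k, x) ∈ T
    · refine ⟨M.ed k x, bdy_ed k x, fun k' x' h => ?_⟩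
      have : k' = k ∧ (x' = x ∨ x' = M.σ k x) := by by_contra h'; exact h (if_neg h')
      obtain ⟨rfl, rfl | rfl⟩ := this
      · exact hx
      · exact t1 _ _ hx
    let T' : Set (Fin 3 × F) := insert (k, x) (insert (k, M.σ k x) T)
    have hn : ¬ P T' := by
      intro hP
      have := hT.le_of_ge hP (fun y hy => Or.inr (Or.inr hy))
      exact hx (this (Or.inl rfl))
    have hex : ∃ c : Ch F, M.Ev c ∧ (∀ k x, c k x ≠ 0 → (k, x) ∈ T') ∧ c ≠ 0 := by
      by_contra hcon
      apply hn
      refine ⟨?_, ?_, ?_⟩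
      · rintro k' x' (h | h | h)
        · obtain ⟨rfl, rfl⟩ := Prod.mk.inj h; exact Or.inr (Or.inl rfl)
        · obtain ⟨rfl, rfl⟩ := Prod.mk.inj h; rw [M.inv]; exact Or.inl rfl
        · exact Or.inr (Or.inr (t1 _ _ h))
      · rintro k' x' (h | h | h) i hi
        · obtain ⟨rfl, rfl⟩ := Prod.mk.inj h
          rcases ki hi with rfl | rfl <;> assumption
        · obtain ⟨rfl, rfl⟩ := Prod.mk.inj h
          rw [M.nd_eq _ _ _ hi]
          rcases ki hi with rfl | rfl <;> assumption
        · exact t2 _ _ h i hi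
      · intro c hc hs
        by_contra hne
        exact hcon ⟨c, hc, hs, hne⟩
    obtain ⟨c, hc, hs, hne⟩ := hex
    have hcx : c k x = 1 := by
      rw [← z2n]
      intro hcx
      apply hne
      apply t3 c hc
      intro k' x' h
      rcases hs k' x' h with h' | h' | h'
      · obtain ⟨rfl, rfl⟩ := Prod.mk.inj h'; exact absurd hcx h
      · obtain ⟨rfl, rfl⟩ := Prod.mk.inj h'; rw [hc.1] at h; exact absurd hcx h
      · exact h'
    refine ⟨c + M.ed k x, ⟨hc.1.add (isCh_ed k x), fun y => ?_⟩, ?_⟩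
    · rw [pr_add_left, hc.2, zero_add, (bdy_ed k x).2]
    · intro k' x' h
      by_cases h' : k' = k ∧ (x' = x ∨ x' = M.σ k x)
      · exfalso
        apply h
        rw [Pi.add_apply, Pi.add_apply]
        unfold ed
        rw [if_pos h']
        obtain ⟨rfl, rfl | rfl⟩ := h'
        · rw [hcx]; rfl
        · rw [hc.1, hcx]; rfl
      · rw [Pi.add_apply, Pi.add_apply] at h
        unfold ed at h
        rw [if_neg h', add_zero] at h
        rcases hs k' x' h with h1 | h1 | h1
        · obtain ⟨rfl, rfl⟩ := Prod.mk.inj h1; exact absurd ⟨rfl, Or.inl rfl⟩ h'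
        · obtain ⟨rfl, rfl⟩ := Prod.mk.inj h1; exact absurd ⟨rfl, Or.inr rfl⟩ h'
        · exact h1
  refine ⟨fun k x => (k, x) ∈ T, h0, t1, t2, t3, ?_⟩
  have := hZ.2 {z | ∃ τ, M.Bdy τ z z0 ∧ ∀ k x, τ k x ≠ 0 → (k, x) ∈ T}
    ⟨z0, h0, 0, bdy_zero z0, fun k x h => absurd rfl h⟩ ?_
  · exact fun z hz => this hz
  · rintro z hz z' hz' hadj ⟨τ, hτ, hs⟩
    obtain ⟨k, x, -, h⟩ := hadj.bdy
    have : ∃ τ', M.Bdy τ' z' z ∧ ∀ k x, τ' k x ≠ 0 → (k, x) ∈ T := by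
      rcases h with ⟨rfl, rfl⟩ | ⟨rfl, rfl⟩
      · obtain ⟨τ', h1, h2⟩ := link k x hz hz'
        exact ⟨τ', h1.symm, h2⟩
      · exact link k x hz' hz
    obtain ⟨τ', h1, h2⟩ := this
    refine ⟨τ' + τ, h1.add hτ, fun k x h => ?_⟩
    by_cases hh : τ k x = 0
    · exact h2 k x (by rwa [Pi.add_apply, Pi.add_apply, hh, add_zero] at h)
    · exact hs k x hh

theorem Tree.shade {Z : Set N} {z0 : N} {T : Fin 3 → F → Prop} (hT : M.Tree Z z0 T) {n : Ch F} (hn : M.Ev n)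
    {R : Set N} (hR : M.Sup n R) : ∃ s, M.Shade s n ∧ (∀ k x, T k x → tt s k x = 0) ∧
      ∀ i x, M.nd i x ∉ R → M.nd i x ∉ Z → s i x = 0 := by
  classical
  obtain ⟨s0, hs0, hz⟩ := hn.shade_sup hR
  choose! τ hτ using hT.conn
  let u : N → ZMod 2 := fun z => if z ∈ Z then M.pr (τ z) (tt s0) else 0
  refine ⟨fun i x => s0 i x + u (M.nd i x), ?_, ?_, ?_⟩
  · intro i k hik x
    show s0 i x + u (M.nd i x) + (s0 i (M.σ k x) + u (M.nd i (M.σ k x))) = _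
    rw [M.nd_eq _ _ _ hik, ← hs0 i k hik x]
    linear_combination z2 (u (M.nd i x))
  · intro k x hx
    have h1 := hT.ends k x hx _ (k1 k)
    have h2 := hT.ends k x hx _ (k2 k)
    have e0 : (τ (M.nd (k+1) x) + τ (M.nd (k+2) x)) + M.ed k x = 0 := by
      apply hT.indep
      · exact (((hτ _ h1).1.add (hτ _ h2).1.symm).add (bdy_ed k x).symm).ev
      · intro k' x' h
        by_contra hcon
        apply h
        have a1 : τ (M.nd (k+1) x) k' x' = 0 := by by_contra h; exact hcon ((hτ _ h1).2 _ _ h)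
        have a2 : τ (M.nd (k+2) x) k' x' = 0 := by by_contra h; exact hcon ((hτ _ h2).2 _ _ h)
        have a3 : M.ed k x k' x' = 0 := by
          unfold ed
          rw [if_neg]
          rintro ⟨rfl, rfl | rfl⟩
          · exact hcon hx
          · exact hcon (hT.inv _ _ hx)
        simp only [Pi.add_apply, a1, a2, a3, add_zero]
    have := congrArg (fun c => M.pr c (tt s0)) e0
    simp only [pr_add_left, pr_zero_left] at this
    rw [pr_ed k x _ (hs0.isCh_tt k x)] at this
    simp only [tt, u, if_pos h1, if_pos h2] at this ⊢
    linear_combination this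
  · intro i x h1 h2
    simp only [hz i x h1, u, if_neg h2, add_zero]

/-! ### contour -/

def th (i j : Fin 3) : Fin 3 := -(i + j)
theorem th_spec {i j : Fin 3} (h : i ≠ j) : th i j ≠ i ∧ th i j ≠ j := by revert i j; decide
theorem th_th {i j : Fin 3} : th i (th i j) = j ∧ th (th i j) j = i := by revert i j; decide
theorem tt_th (s : Ch F) {i j : Fin 3} (h : i ≠ j) (x : F) : tt s j x = s i x + s (th i j) x := by
  have : (i = j + 1 ∧ th i j = j + 2) ∨ (i = j + 2 ∧ th i j = j + 1) := by revert i j; decide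
  rcases this with ⟨h1, h2⟩ | ⟨h1, h2⟩
  · rw [h2, h1]; rfl
  · rw [h2, h1, add_comm]; rfl
theorem cob_th (y : N → ZMod 2) {i j : Fin 3} (h : i ≠ j) (x : F) : M.cob y j x = y (M.nd i x) + y (M.nd (th i j) x) := by
  have : (i = j + 1 ∧ th i j = j + 2) ∨ (i = j + 2 ∧ th i j = j + 1) := by revert i j; decide
  rcases this with ⟨h1, h2⟩ | ⟨h1, h2⟩
  · rw [h2, h1]; rfl
  · rw [h2, h1, add_comm]; rfl

/-- corners -/
abbrev Cor (M : Gem F N) (Z : Set N) := {p : F × Fin 3 × Fin 3 // p.2.1 ≠ p.2.2 ∧ M.nd p.2.1 p.1 ∈ Z}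

def cra {Z : Set N} (p : M.Cor Z) : M.Cor Z :=
  ⟨(p.1.1, p.1.2.1, th p.1.2.1 p.1.2.2), (th_spec p.2.1).1.symm, p.2.2⟩

open Classical in
noncomputable def Tree.b {Z : Set N} {z0 : N} {T : Fin 3 → F → Prop} (hT : M.Tree Z z0 T) (p : M.Cor Z) : M.Cor Z :=
  if h : T p.1.2.2 p.1.1 then ⟨(p.1.1, th p.1.2.1 p.1.2.2, p.1.2.2), (th_spec p.2.1).2,
    hT.ends _ _ h _ (th_spec p.2.1).2⟩
  else ⟨(M.σ p.1.2.2 p.1.1, p.1.2.1, p.1.2.2), p.2.1, by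
    show M.nd p.1.2.1 (M.σ p.1.2.2 p.1.1) ∈ Z
    rw [M.nd_eq _ _ _ p.2.1]; exact p.2.2⟩

theorem Tree.b_pos {Z : Set N} {z0 : N} {T : Fin 3 → F → Prop} (hT : M.Tree Z z0 T) (p : M.Cor Z)
    (h : T p.1.2.2 p.1.1) : (hT.b p).1 = (p.1.1, th p.1.2.1 p.1.2.2, p.1.2.2) := by
  unfold Tree.b; rw [dif_pos h]
theorem Tree.b_neg {Z : Set N} {z0 : N} {T : Fin 3 → F → Prop} (hT : M.Tree Z z0 T) (p : M.Cor Z)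
    (h : ¬ T p.1.2.2 p.1.1) : (hT.b p).1 = (M.σ p.1.2.2 p.1.1, p.1.2.1, p.1.2.2) := by
  unfold Tree.b; rw [dif_neg h]

theorem Tree.not_inv {Z : Set N} {z0 : N} {T : Fin 3 → F → Prop} (hT : M.Tree Z z0 T) {k : Fin 3} {x : F}
    (h : ¬ T k x) : ¬ T k (M.σ k x) := fun h' => h (by have := hT.inv _ _ h'; rwa [M.inv] at this)

theorem Tree.contour {Z : Set N} {z0 : N} {T : Fin 3 → F → Prop} (hT : M.Tree Z z0 T) (w0 : M.Cor Z) :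
    ∃ (m : ℕ) (e : ℕ → M.Cor Z), (∀ l, e (l+1) = cra (hT.b (e l))) ∧ (∀ w, ∃ l < m, e l = w ∨ e l = hT.b w) ∧
      (∀ l < m, ∀ k < m, e l = e k → l = k) ∧ (∀ l k, e l ≠ hT.b (e k)) := by
  classical
  haveI : Finite (M.Cor Z) := by unfold Cor; infer_instance
  refine dihedral (fun p => cra p) hT.b ?_ ?_ ?_ ?_ w0 ?_
  · rintro ⟨⟨x, i, j⟩, h, h'⟩
    apply Subtype.ext
    show (x, i, th i (th i j)) = (x, i, j)
    rw [th_th.1]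
  · intro p
    apply Subtype.ext
    by_cases h : T p.1.2.2 p.1.1
    · have e := hT.b_pos p h
      rw [hT.b_pos _ (by rw [e]; exact h), e]
      obtain ⟨⟨x, i, j⟩, h1, h2⟩ := p
      show (x, th (th i j) j, j) = (x, i, j)
      rw [th_th.2]
    · have e := hT.b_neg p h
      rw [hT.b_neg _ (by rw [e]; exact hT.not_inv h), e]
      obtain ⟨⟨x, i, j⟩, h1, h2⟩ := p
      show (M.σ j (M.σ j x), i, j) = (x, i, j)
      rw [M.inv]
  · rintro ⟨⟨x, i, j⟩, h, h'⟩ he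
    have := congrArg (fun p : M.Cor Z => p.1.2.2) he
    exact (th_spec h).2 this
  · intro p he
    by_cases h : T p.1.2.2 p.1.1
    · have e := hT.b_pos p h
      rw [he] at e
      exact (th_spec p.2.1).1 (congrArg (fun q => q.2.1) e).symm
    · have e := hT.b_neg p h
      rw [he] at e
      exact M.fpf _ _ (congrArg (fun q => q.1) e).symm
  · intro P h0 hPa hPb
    -- u is the indicator of P, independent of j
    let u : Ch F := fun i x => if ∃ (j : Fin 3) (h : i ≠ j ∧ M.nd i x ∈ Z), P ⟨(x, i, j), h⟩ then 1 else 0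
    have hu : ∀ p : M.Cor Z, P p ↔ u p.1.2.1 p.1.1 = 1 := by
      rintro ⟨⟨x, i, j⟩, h⟩
      simp only [u]
      constructor
      · intro hp; rw [if_pos ⟨j, h, hp⟩]
      · intro hp
        by_contra hcon
        rw [if_neg] at hp
        · exact absurd hp (by decide)
        · rintro ⟨j', h', hp'⟩
          by_cases hj : j' = j
          · subst hj; exact hcon hp'
          · apply hcon
            have := hPa _ hp'
            convert this using 1
            apply Subtype.ext
            show (x, i, j) = (x, i, th i j')
            have : j = th i j' := by
              have h1 := h'.1; have h2 : i ≠ j := h.1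
              clear * - h1 h2 hj
              revert i j j'; decide
            rw [← this]
    have huZ : ∀ i x, M.nd i x ∉ Z → u i x = 0 := by
      intro i x h
      simp only [u]
      rw [if_neg]
      rintro ⟨j, h', -⟩; exact h h'.2
    have two : ∀ a b : ZMod 2, (a = 1 → b = 1) → (b = 1 → a = 1) → a = b := by decide
    have hub : ∀ p : M.Cor Z, u (hT.b p).1.2.1 (hT.b p).1.1 = u p.1.2.1 p.1.1 := by
      intro p
      have hbb : hT.b (hT.b p) = p := by
        apply Subtype.ext
        by_cases h : T p.1.2.2 p.1.1
        · have e := hT.b_pos p h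
          rw [hT.b_pos _ (by rw [e]; exact h), e]
          obtain ⟨⟨x, i, j⟩, h1, h2⟩ := p
          show (x, th (th i j) j, j) = (x, i, j)
          rw [th_th.2]
        · have e := hT.b_neg p h
          rw [hT.b_neg _ (by rw [e]; exact hT.not_inv h), e]
          obtain ⟨⟨x, i, j⟩, h1, h2⟩ := p
          show (M.σ j (M.σ j x), i, j) = (x, i, j)
          rw [M.inv]
      apply two
      · rw [← hu, ← hu]; intro h; rw [← hbb]; exact hPb _ h
      · rw [← hu, ← hu]; exact hPb p
    have h1 : ∀ j x, T j x → ∀ i, i ≠ j → u (th i j) x = u i x := by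
      intro j x hx i hij
      have := hub ⟨(x, i, j), hij, hT.ends _ _ hx _ hij⟩
      rwa [hT.b_pos _ (show T j x from hx)] at this
    have h2 : ∀ j x, ¬ T j x → ∀ i, i ≠ j → u i (M.σ j x) = u i x := by
      intro j x hx i hij
      by_cases hZ : M.nd i x ∈ Z
      · have := hub ⟨(x, i, j), hij, hZ⟩
        rwa [hT.b_neg _ (show ¬ T j x from hx)] at this
      · rw [huZ _ _ hZ, huZ]; rw [M.nd_eq _ _ _ hij]; exact hZ
    let c : Ch F := fun j x => u (j+1) x + u (j+1) (M.σ j x)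
    have hsh : M.Shade u c := by
      intro i j hij x
      by_cases hx : T j x
      · rcases ki hij with rfl | rfl
        · rfl
        · have e1 := h1 j x hx _ (k2 j)
          have e2 := h1 j _ (hT.inv _ _ hx) _ (k2 j)
          have : th (j+2) j = j + 1 := (by decide : ∀ j : Fin 3, th (j+2) j = j + 1) j
          rw [this] at e1 e2
          simp only [c, e1, e2]
      · simp only [c]
        rw [h2 j x hx i hij, h2 j x hx _ (k1 j), z2, z2]
    have hc0 : c = 0 := by
      apply hT.indep c hsh.ev
      intro j x hne
      by_contra hx
      apply hne
      simp only [c]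
      rw [h2 j x hx _ (k1 j), z2]
    have hconst : ∀ i j x, i ≠ j → u i (M.σ j x) = u i x := by
      intro i j x hij
      have := hsh i j hij x
      rw [hc0] at this
      exact (z2e.1 this).symm
    let y : N → ZMod 2 := fun a => if ∃ i x, M.nd i x = a ∧ u i x = 1 then 1 else 0
    have hy : ∀ i x, y (M.nd i x) = u i x := by
      intro i x
      have ho : ∀ i' x', M.nd i' x' = M.nd i x → u i' x' = u i x := by
        intro i' x' h
        obtain rfl := M.disj _ _ _ _ h
        exact M.orb i' x x' h.symm (fun z => u i' z = u i' x) (fun z k hk hz => by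
          show u i' (M.σ k z) = u i' x
          rw [hconst _ _ _ hk, hz]) rfl
      simp only [y]
      by_cases h : u i x = 1
      · rw [if_pos ⟨i, x, rfl, h⟩, h]
      · rw [if_neg]
        · by_contra hne
          exact h (z2n.1 (Ne.symm hne))
        · rintro ⟨i', x', e, h'⟩
          exact h (by rw [← ho i' x' e, h'])
    have hroot : ∀ z ∈ Z, y z = y z0 := by
      intro z hz
      obtain ⟨τ, hτ, hs⟩ := hT.conn z hz
      have e := hτ.2 y
      rw [pr_zero_of] at e
      · exact z2e.1 e.symm
      · intro k x hne
        rw [cob_th y (k1 k), hy, hy, h1 k x (hs k x hne) _ (k1 k), z2]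
    intro p
    rw [hu, ← hy, hroot _ p.2.2, ← hroot _ w0.2.2, hy, ← hu]
    exact h0

/-- values of a tree shading along the contour -/
theorem Tree.step {Z : Set N} {z0 : N} {T : Fin 3 → F → Prop} (hT : M.Tree Z z0 T) {n s : Ch F} (hs : M.Shade s n)
    (h0 : ∀ k x, T k x → tt s k x = 0) (p : M.Cor Z) (d : ZMod 2)
    (hd : (T p.1.2.2 p.1.1 ∧ d = 0) ∨ (¬ T p.1.2.2 p.1.1 ∧ d = n p.1.2.2 p.1.1)) :
    s (cra (hT.b p)).1.2.1 (cra (hT.b p)).1.1 = s p.1.2.1 p.1.1 + d := by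
  show s (hT.b p).1.2.1 (hT.b p).1.1 = _
  rcases hd with ⟨h, rfl⟩ | ⟨h, rfl⟩
  · rw [hT.b_pos p h, add_zero]
    have := h0 _ _ h
    rw [tt_th s p.2.1] at this
    exact (z2e.1 this).symm
  · rw [hT.b_neg p h, ← hs _ _ p.2.1]
    linear_combination -z2 (s p.1.2.1 p.1.1)

end Gem

end

section

open SimpleGraph Set

inductive Nd (V F : Type*)
  | v (a : V) : Nd V F
  | e (a : Sym2 V) : Nd V F
  | f (a : Set F) : Nd V F

structure Mp {V : Type*} (G : SimpleGraph V) (F : Type*) where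
  σ : Fin 3 → F → F
  inv : ∀ k x, σ k (σ k x) = x
  fpf : ∀ k x, σ k x ≠ x
  comm : ∀ x, σ 0 (σ 2 x) = σ 2 (σ 0 x)
  fv : F → V
  fv1 : ∀ x, fv (σ 1 x) = fv x
  fv2 : ∀ x, fv (σ 2 x) = fv x
  adj : ∀ x, G.Adj (fv x) (fv (σ 0 x))
  vorb : ∀ x y, fv x = fv y → ∀ P : F → Prop, (∀ z, P z → P (σ 1 z)) → (∀ z, P z → P (σ 2 z)) → P x → P y
  eorb : ∀ x y, s(fv x, fv (σ 0 x)) = s(fv y, fv (σ 0 y)) →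
    ∀ P : F → Prop, (∀ z, P z → P (σ 0 z)) → (∀ z, P z → P (σ 2 z)) → P x → P y
  esurj : ∀ u v, G.Adj u v → ∃ x, fv x = u ∧ fv (σ 0 x) = v

namespace Mp
variable {V F : Type*} {G : SimpleGraph V} (M : Mp G F)

def fe (x : F) : Sym2 V := s(M.fv x, M.fv (M.σ 0 x))
def fc (x : F) : Set F := {y | ∀ P : F → Prop, (∀ z, P z → P (M.σ 0 z)) → (∀ z, P z → P (M.σ 1 z)) → P x → P y}

theorem fe0 (x : F) : M.fe (M.σ 0 x) = M.fe x := by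
  simp only [fe, M.inv]; exact Sym2.eq_swap
theorem fe2 (x : F) : M.fe (M.σ 2 x) = M.fe x := by
  simp only [fe, M.comm, M.fv2]
theorem fe_mem (x : F) : M.fe x ∈ G.edgeSet := M.adj x
theorem fv_mem (x : F) : M.fv x ∈ M.fe x := Sym2.mem_mk_left _ _

theorem fc_self (x : F) : x ∈ M.fc x := fun P _ _ h => h
theorem fc_sub {x y : F} (h : y ∈ M.fc x) : M.fc y ⊆ M.fc x := fun z hz P h0 h1 hx => hz P h0 h1 (h P h0 h1 hx)
theorem fc0 (x : F) : M.fc (M.σ 0 x) = M.fc x := by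
  have h : ∀ x, M.fc (M.σ 0 x) ⊆ M.fc x := fun x => M.fc_sub fun P h0 _ hx => h0 _ hx
  apply Subset.antisymm (h x)
  have := h (M.σ 0 x); rwa [M.inv] at this
theorem fc1 (x : F) : M.fc (M.σ 1 x) = M.fc x := by
  have h : ∀ x, M.fc (M.σ 1 x) ⊆ M.fc x := fun x => M.fc_sub fun P _ h1 hx => h1 _ hx
  apply Subset.antisymm (h x)
  have := h (M.σ 1 x); rwa [M.inv] at this

theorem eorb' {x y : F} (h : M.fe x = M.fe y) : y = x ∨ y = M.σ 0 x ∨ y = M.σ 2 x ∨ y = M.σ 0 (M.σ 2 x) := by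
  refine M.eorb x y h (fun y => y = x ∨ y = M.σ 0 x ∨ y = M.σ 2 x ∨ y = M.σ 0 (M.σ 2 x)) ?_ ?_ (Or.inl rfl)
  · rintro z (rfl | rfl | rfl | rfl) <;> simp [M.inv]
  · rintro z (rfl | rfl | rfl | rfl) <;> simp [M.inv, M.comm]

theorem vorb_eq {x y : F} (h : M.fe x = M.fe y) (hv : M.fv x = M.fv y) : y = x ∨ y = M.σ 2 x := by
  rcases M.eorb' h with h | h | h | h
  · exact Or.inl h
  · rw [h] at hv; exact absurd hv (M.adj x).ne
  · exact Or.inr h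
  · rw [h, M.comm, M.fv2] at hv; exact absurd hv (M.adj x).ne

theorem fesurj {e : Sym2 V} (he : e ∈ G.edgeSet) {v : V} (hv : v ∈ e) : ∃ x, M.fe x = e ∧ M.fv x = v := by
  induction e with | _ a b =>
  rw [mem_edgeSet] at he
  rw [Sym2.mem_iff] at hv
  rcases hv with rfl | rfl
  · obtain ⟨x, h1, h2⟩ := M.esurj v b he
    exact ⟨x, by rw [fe, h1, h2], h1⟩
  · obtain ⟨x, h1, h2⟩ := M.esurj v a he.symm
    exact ⟨x, by rw [fe, h1, h2, Sym2.eq_swap], h1⟩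

/-- nodes of the barycentric subdivision -/
def nd : Fin 3 → F → Nd V F := fun i x => match i with
  | 0 => .v (M.fv x)
  | 1 => .e (M.fe x)
  | 2 => .f (M.fc x)

@[simp] theorem nd0 (x : F) : M.nd 0 x = .v (M.fv x) := rfl
@[simp] theorem nd1 (x : F) : M.nd 1 x = .e (M.fe x) := rfl
@[simp] theorem nd2 (x : F) : M.nd 2 x = .f (M.fc x) := rfl

def gem : Gem F (Nd V F) where
  σ := M.σ
  inv := M.inv
  fpf := M.fpf
  nd := M.nd
  nd_eq := by
    intro i k x h
    fin_cases i <;> fin_cases k <;> simp [M.fv1, M.fv2, M.fe0, M.fe2, M.fc0, M.fc1] at h ⊢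
  disj := by
    intro i j x y h
    fin_cases i <;> fin_cases j <;> simp at h ⊢
  orb := by
    intro i x y h P hP hx
    fin_cases i
    · exact M.vorb x y (by simpa using h) P (fun z => hP z 1 (by decide)) (fun z => hP z 2 (by decide)) hx
    · exact M.eorb x y (by simpa [fe] using h) P (fun z => hP z 0 (by decide)) (fun z => hP z 2 (by decide)) hx
    · have h : M.fc x = M.fc y := by simpa using h
      have : y ∈ M.fc x := by rw [h]; exact M.fc_self y
      exact this P (fun z => hP z 0 (by decide)) (fun z => hP z 1 (by decide)) hx

@[simp] theorem gem_σ : M.gem.σ = M.σ := rfl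
@[simp] theorem gem_nd : M.gem.nd = M.nd := rfl

/-- the chain of the subdivision of a set of graph edges -/
def emb (γ : Sym2 V → ZMod 2) : Ch F := fun k x => if k = 2 then γ (M.fe x) else 0

theorem emb2 (γ : Sym2 V → ZMod 2) (x : F) : M.emb γ 2 x = γ (M.fe x) := rfl
theorem emb_ne (γ : Sym2 V → ZMod 2) {k : Fin 3} (h : k ≠ 2) (x : F) : M.emb γ k x = 0 := if_neg h
theorem emb_add (γ γ' : Sym2 V → ZMod 2) : M.emb (γ + γ') = M.emb γ + M.emb γ' := by
  ext k x
  by_cases h : k = 2 <;> simp [emb, h]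

section
variable [Fintype F] [Fintype V]
open Classical in
noncomputable def _root_.dg {V : Type*} [Fintype V] (γ : Sym2 V → ZMod 2) (v : V) : ZMod 2 := ∑ e, if v ∈ e then γ e else 0

theorem isCh_emb (γ : Sym2 V → ZMod 2) : M.gem.IsCh (M.emb γ) := by
  intro k x
  by_cases h : k = 2
  · subst h; simp [emb, M.fe2]
  · simp [emb, h]

theorem pr_emb {γ : Sym2 V → ZMod 2} (hγ : ∀ e, e ∉ G.edgeSet → γ e = 0) (y : Nd V F → ZMod 2) :
    M.gem.pr (M.emb γ) (M.gem.cob y) = ∑ v, dg γ v * y (.v v) := by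
  classical
  have e1 : M.gem.pr (M.emb γ) (M.gem.cob y) =
      ∑ x ∈ M.gem.rep 2, γ (M.fe x) * (y (.v (M.fv x)) + y (.e (M.fe x))) := by
    unfold Gem.pr
    rw [Fin.sum_univ_three]
    simp only [emb, Gem.cob]
    simp
  have e2 : ∀ g : V × Sym2 V → ZMod 2, ∑ x ∈ M.gem.rep 2, g (M.fv x, M.fe x) =
      ∑ p ∈ Finset.univ.filter (fun p : V × Sym2 V => p.2 ∈ G.edgeSet ∧ p.1 ∈ p.2), g p := by
    intro g
    refine Finset.sum_bij (fun x _ => (M.fv x, M.fe x)) ?_ ?_ ?_ ?_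
    · intro x _; simp [M.fe_mem, M.fv_mem]
    · intro x hx y hy h
      obtain ⟨h1, h2⟩ := Prod.mk.inj h
      rcases M.vorb_eq h2 h1 with h | h
      · exact h.symm
      · rcases M.gem.rep_or 2 x with h' | h'
        · rw [h] at hy; exact absurd hy h'.2
        · exact absurd hx h'.2
    · rintro ⟨v, e⟩ hp
      simp only [Finset.mem_filter, Finset.mem_univ, true_and] at hp
      obtain ⟨x, h1, h2⟩ := M.fesurj hp.1 hp.2
      rcases M.gem.rep_or 2 x with h' | h'
      · exact ⟨x, h'.1, by rw [h1, h2]⟩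
      · refine ⟨M.σ 2 x, h'.1, ?_⟩
        rw [M.fv2, M.fe2, h1, h2]
    · intro x _; rfl
  rw [e1, e2 (fun p => γ p.2 * (y (.v p.1) + y (.e p.2))), Finset.sum_filter, Fintype.sum_prod_type]
  have e3 : ∀ v, ∀ e : Sym2 V, (if e ∈ G.edgeSet ∧ v ∈ e then γ e * (y (.v v) + y (.e e)) else 0) =
      (if v ∈ e then γ e else 0) * y (.v v) + (if v ∈ e then γ e else 0) * y (.e e) := by
    intro v e
    by_cases he : e ∈ G.edgeSet
    · by_cases hv : v ∈ e <;> simp [he, hv, mul_add]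
    · simp [he, hγ e he]
  simp only [e3, Finset.sum_add_distrib]
  have e4 : ∑ v : V, ∑ e : Sym2 V, (if v ∈ e then γ e else 0) * y (.e e) = 0 := by
    rw [Finset.sum_comm]
    apply Finset.sum_eq_zero
    intro e _
    by_cases he : e ∈ G.edgeSet
    · induction e with | _ a b =>
      rw [mem_edgeSet] at he
      rw [← Finset.sum_mul]
      have : ∑ v : V, (if v ∈ s(a, b) then γ s(a, b) else 0) = 0 := by
        rw [← Finset.sum_filter]
        have : Finset.univ.filter (fun v => v ∈ s(a, b)) = {a, b} := by ext v; simp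
        rw [this, Finset.sum_pair he.ne, z2]
      rw [this, zero_mul]
    · simp [hγ e he]
  rw [e4, add_zero]
  apply Finset.sum_congr rfl
  intro v _
  rw [dg, Finset.sum_mul]

/-- cycles -/
def _root_.IsZ {V : Type*} [Fintype V] (G : SimpleGraph V) (γ : Sym2 V → ZMod 2) : Prop :=
  (∀ e, e ∉ G.edgeSet → γ e = 0) ∧ ∀ v, dg γ v = 0

/-- face boundaries -/
def IsB (γ : Sym2 V → ZMod 2) : Prop := (∀ e, e ∉ G.edgeSet → γ e = 0) ∧
  ∃ φ : F → ZMod 2, (∀ x, φ (M.σ 0 x) = φ x) ∧ (∀ x, φ (M.σ 1 x) = φ x) ∧ ∀ x, γ (M.fe x) = φ x + φ (M.σ 2 x)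

theorem ev_emb {γ : Sym2 V → ZMod 2} (h : IsZ G γ) : M.gem.Ev (M.emb γ) := by
  refine ⟨M.isCh_emb γ, fun y => ?_⟩
  rw [M.pr_emb h.1]
  exact Finset.sum_eq_zero fun v _ => by rw [h.2, zero_mul]

theorem emb_B {γ : Sym2 V → ZMod 2} (h : M.IsB γ) : ∃ φ, M.emb γ = M.gem.dl φ := by
  obtain ⟨-, φ, h0, h1, h2⟩ := h
  refine ⟨φ, ?_⟩
  ext k x
  fin_cases k
  · simp [emb, Gem.dl, h0, z2]
  · simp [emb, Gem.dl, h1, z2]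
  · simp [emb, Gem.dl, h2]

theorem isZ_of_ev {γ : Sym2 V → ZMod 2} (hγ : ∀ e, e ∉ G.edgeSet → γ e = 0) (h : M.gem.Ev (M.emb γ)) : IsZ G γ := by
  classical
  refine ⟨hγ, fun v => ?_⟩
  have := h.2 (fun n => match n with | .v u => if u = v then 1 else 0 | _ => 0)
  rw [M.pr_emb hγ] at this
  simpa using this

theorem IsB.isZ {γ : Sym2 V → ZMod 2} (h : M.IsB γ) : IsZ G γ := by
  obtain ⟨φ, hφ⟩ := M.emb_B h
  exact M.isZ_of_ev h.1 (by rw [hφ]; exact Gem.ev_dl φ)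

/-- every even chain is a graph cycle up to a boundary -/
theorem ev_reduce {c : Ch F} (hc : M.gem.Ev c) : ∃ γ φ, IsZ G γ ∧ c = M.emb γ + M.gem.dl φ := by
  classical
  obtain ⟨φ, h1, h2⟩ := Gem.ev_reduce hc
  set d := c + M.gem.dl φ with hd
  obtain ⟨s, hs⟩ := h1.shade
  have d2 : ∀ x, d 2 (M.σ 2 x) = d 2 x := h1.1 2
  have d0 : ∀ x, d 2 (M.σ 0 x) = d 2 x := by
    intro x
    have a1 := hs 1 2 (by decide) x
    have a2 := hs 1 2 (by decide) (M.σ 0 x)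
    have a3 := hs 1 0 (by decide) x
    have a4 := hs 1 0 (by decide) (M.σ 2 x)
    rw [h2 0 _ (by decide)] at a3 a4
    simp only [gem_σ, M.comm] at a1 a2 a3 a4
    rw [← a1, ← a2, z2e.1 a3, z2e.1 a4]
  let γ : Sym2 V → ZMod 2 := fun e => if h : ∃ x, M.fe x = e then d 2 h.choose else 0
  have hγ : ∀ x, γ (M.fe x) = d 2 x := by
    intro x
    have h : ∃ x', M.fe x' = M.fe x := ⟨x, rfl⟩
    simp only [γ, dif_pos h]
    rcases M.eorb' h.choose_spec with h' | h' | h' | h'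
    · rw [← h']
    · rw [congrArg (d 2) h', d0]
    · rw [congrArg (d 2) h', d2]
    · rw [congrArg (d 2) h', d0, d2]
  have he : M.emb γ = d := by
    ext k x
    by_cases hk : k = 2
    · subst hk; rw [emb2, hγ]
    · rw [M.emb_ne _ hk, h2 k x hk]
  refine ⟨γ, φ, M.isZ_of_ev ?_ (by rw [he]; exact h1), ?_⟩
  · intro e he
    simp only [γ]
    rw [dif_neg]
    rintro ⟨x, rfl⟩; exact he (M.fe_mem x)
  · rw [he, hd, add_assoc]
    ext k x
    simp only [Pi.add_apply, z2, add_zero]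

end
end Mp

end

section

open SimpleGraph Set

namespace Gem
variable {F N : Type*} [Fintype F] {M : Gem F N}

/-- far end of the edge of a corner -/
def Cor.out {Z : Set N} (p : M.Cor Z) : N := M.nd (th p.1.2.1 p.1.2.2) p.1.1
noncomputable def Cor.eps {Z : Set N} (p : M.Cor Z) : Ch F := M.ed p.1.2.2 p.1.1

theorem ed_ne {k j : Fin 3} {x y : F} : M.ed k x j y ≠ 0 ↔ j = k ∧ (y = x ∨ y = M.σ k x) := by
  unfold ed
  split_ifs with h <;> simp [h]

theorem ed_val {k j : Fin 3} {x y : F} (h : j = k ∧ (y = x ∨ y = M.σ k x)) : M.ed k x j y = 1 := z2n.1 (ed_ne.2 h)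

theorem Cor.sup_eps {Z : Set N} (p : M.Cor Z) {R : Set N} (h1 : M.nd p.1.2.1 p.1.1 ∈ R) (h2 : p.out ∈ R) : M.Sup p.eps R := by
  obtain ⟨⟨x, i, j⟩, h, h'⟩ := p
  simp only [Cor.out] at h1 h2
  simp only [ne_eq] at h
  have : (i = j + 1 ∧ th i j = j + 2) ∨ (i = j + 2 ∧ th i j = j + 1) := by
    clear h1 h2 h'
    revert i j; decide
  rcases this with ⟨e1, e2⟩ | ⟨e1, e2⟩
  · rw [e1] at h1; rw [e2] at h2; exact sup_ed h1 h2
  · rw [e1] at h1; rw [e2] at h2; exact sup_ed h2 h1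

theorem Cor.bdy_eps {Z : Set N} (p : M.Cor Z) : M.Bdy p.eps p.out (M.nd p.1.2.1 p.1.1) := by
  obtain ⟨⟨x, i, j⟩, h, h'⟩ := p
  refine ⟨isCh_ed _ _, fun y => ?_⟩
  show M.pr (M.ed j x) (M.cob y) = y (M.nd (th i j) x) + y (M.nd i x)
  rw [pr_ed _ _ _ (isCh_cob y j x), cob_th y h, add_comm]

theorem Cor.of_ad {Z : Set N} {a b : N} (hb : b ∈ Z) (h : M.Ad a b) : ∃ p : M.Cor Z, p.out = a := by
  obtain ⟨i, j, x, hij, h1, h2⟩ := h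
  refine ⟨⟨(x, j, th j i), (th_spec hij.symm).1.symm, h2 ▸ hb⟩, ?_⟩
  show M.nd (th j (th j i)) x = a
  rw [th_th.1, h1]

theorem Tree.cross {Z : Set N} {z0 : N} {T : Fin 3 → F → Prop} (hT : M.Tree Z z0 T) {m : ℕ} {e : ℕ → M.Cor Z}
    (he : ∀ l, e (l+1) = cra (hT.b (e l))) (hinj : ∀ l < m, ∀ k < m, e l = e k → l = k)
    (hnb : ∀ l k, e l ≠ hT.b (e k)) {qa qb qc qd : M.Cor Z} {a b c d : ℕ}
    (ha : e a = qa ∨ e a = hT.b qa) (hb : e b = qb ∨ e b = hT.b qb) (hc : e c = qc ∨ e c = hT.b qc)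
    (hd : e d = qd ∨ e d = hT.b qd) (hac : a < c) (hcb : c < b) (hbd : b < d) (hdm : d < m)
    {P1 P2 : Set N} (hP : Disjoint P1 P2) (h1Z : Disjoint P1 Z) (h2Z : Disjoint P2 Z)
    (oa : qa.out ∈ P1) (ob : qb.out ∈ P1) (oc : qc.out ∈ P2) (od : qd.out ∈ P2)
    {p1 p2 t1 t2 : Ch F} (s1 : M.Sup p1 P1) (s2 : M.Sup p2 P2) (ht1 : ∀ k x, t1 k x ≠ 0 → T k x)
    (ht2 : ∀ k x, t2 k x ≠ 0 → T k x) {n w : Ch F}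
    (en : n = p1 + qa.eps + qb.eps + t1) (ew : w = p2 + qc.eps + qd.eps + t2) (hn : M.Ev n) (hw : M.Ev w) :
    ¬ M.Perp n w := by
  classical
  have bb : ∀ p, hT.b (hT.b p) = p := by
    intro p
    by_cases h : T p.1.2.2 p.1.1
    · have h1 := hT.b_pos p h
      apply Subtype.ext
      rw [hT.b_pos _ (by rw [h1]; exact h), h1, th_th.2]
    · have h1 := hT.b_neg p h
      apply Subtype.ext
      rw [hT.b_neg _ (by rw [h1]; exact hT.not_inv h), h1]
      simp only [M.inv]
  have nZ1 : ∀ z ∈ P1, z ∉ Z := fun z hz hz' => h1Z.le_bot ⟨hz, hz'⟩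
  have nZ2 : ∀ z ∈ P2, z ∉ Z := fun z hz hz' => h2Z.le_bot ⟨hz, hz'⟩
  have nP2 : ∀ z ∈ P2, z ∉ P1 := fun z hz hz' => hP.le_bot ⟨hz', hz⟩
  have outT : ∀ q : M.Cor Z, q.out ∉ Z → ¬ T q.1.2.2 q.1.1 := fun q hq hT' =>
    hq (hT.ends _ _ hT' _ (th_spec q.2.1).2)
  have supn : M.Sup n (Z ∪ P1) := by
    rw [en]
    refine ((Sup.add (s1.mono subset_union_right) ?_).add ?_).add ?_
    · exact qa.sup_eps (Or.inl qa.2.2) (Or.inr oa)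
    · exact qb.sup_eps (Or.inl qb.2.2) (Or.inr ob)
    · intro k x h i hi; exact Or.inl (hT.ends k x (ht1 k x h) i hi)
  obtain ⟨s, hs, hst, hs0⟩ := hT.shade hn supn
  have hs0 : ∀ i x, M.nd i x ∈ P2 → s i x = 0 := fun i x h =>
    hs0 i x (fun h' => h'.elim (nZ2 _ h) (nP2 _ h)) (nZ2 _ h)
  -- value at a corner
  let S : M.Cor Z → ZMod 2 := fun p => s p.1.2.1 p.1.1
  -- value of n at non tree edges
  have nval : ∀ q p : M.Cor Z, q.out ∉ Z → (q.eps p.1.2.2 p.1.1 ≠ 0 ↔ p = q ∨ p = hT.b q) := by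
    intro q p hq
    have hb := hT.b_neg q (outT q hq)
    obtain ⟨⟨x, i, j⟩, h, h'⟩ := p
    obtain ⟨⟨x', i', j'⟩, g, g'⟩ := q
    simp only [Cor.eps, ed_ne, Subtype.ext_iff, hb, Prod.mk.injEq]
    simp only [Cor.out] at hq
    simp only at h h' g g'
    constructor
    · rintro ⟨rfl, hx⟩
      have : i = i' := by
        by_contra hii
        have : i = th i' j := by clear * - h g hii; revert i j i'; decide
        rw [this] at h'
        rcases hx with rfl | rfl
        · exact hq h'
        · rw [M.nd_eq _ _ _ (th_spec g).2] at h'; exact hq h'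
      rcases hx with rfl | rfl
      · left; exact ⟨rfl, this, rfl⟩
      · right; exact ⟨rfl, this, rfl⟩
    · rintro (⟨rfl, rfl, rfl⟩ | ⟨rfl, rfl, rfl⟩)
      · exact ⟨rfl, Or.inl rfl⟩
      · exact ⟨rfl, Or.inr rfl⟩
  have pos : ∀ q : M.Cor Z, ∀ l < m, (e l = q ∨ e l = hT.b q) → ∀ k < m, (e k = q ∨ e k = hT.b q) → k = l := by
    intro q l hl h k hk h'
    rcases h with h | h <;> rcases h' with h' | h'
    · exact hinj _ hk _ hl (h'.trans h.symm)
    · exact absurd (by rw [h', h]) (hnb k l)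
    · exact absurd (by rw [h', h]) (hnb l k)
    · exact hinj _ hk _ hl (h'.trans h.symm)
  have p1z : ∀ p : M.Cor Z, p1 p.1.2.2 p.1.1 = 0 := by
    intro p; by_contra h
    exact nZ1 _ (s1 _ _ h _ p.2.1) p.2.2
  have epsv : ∀ q : M.Cor Z, q.out ∉ Z → ∀ l < m, (e l = q ∨ e l = hT.b q) → ∀ k < m,
      q.eps (e k).1.2.2 (e k).1.1 = if k = l then 1 else 0 := by
    intro q hq l hl h k hk
    split_ifs with hkl
    · rw [hkl]; exact z2n.1 ((nval q _ hq).2 h)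
    · by_contra h'
      exact hkl (pos q l hl h k hk ((nval q _ hq).1 h'))
  have step : ∀ k < m, S (e (k+1)) = S (e k) + ((if k = a then 1 else 0) + if k = b then 1 else 0) := by
    intro k hk
    rw [he]
    apply hT.step hs hst
    have e1 := epsv qa (nZ1 _ oa) a (by omega) ha k hk
    have e2 := epsv qb (nZ1 _ ob) b (by omega) hb k hk
    by_cases h : T (e k).1.2.2 (e k).1.1
    · left
      refine ⟨h, ?_⟩
      have f1 : qa.eps (e k).1.2.2 (e k).1.1 = 0 := by
        by_contra h'
        rcases (nval qa _ (nZ1 _ oa)).1 h' with h'' | h''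
        · rw [h''] at h; exact outT _ (nZ1 _ oa) h
        · rw [h'', hT.b_neg _ (outT _ (nZ1 _ oa))] at h; exact hT.not_inv (outT _ (nZ1 _ oa)) h
      have f2 : qb.eps (e k).1.2.2 (e k).1.1 = 0 := by
        by_contra h'
        rcases (nval qb _ (nZ1 _ ob)).1 h' with h'' | h''
        · rw [h''] at h; exact outT _ (nZ1 _ ob) h
        · rw [h'', hT.b_neg _ (outT _ (nZ1 _ ob))] at h; exact hT.not_inv (outT _ (nZ1 _ ob)) h
      rw [← e1, ← e2, f1, f2, add_zero]
    · right
      refine ⟨h, ?_⟩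
      have f3 : t1 (e k).1.2.2 (e k).1.1 = 0 := by
        by_contra h'; exact h (ht1 _ _ h')
      rw [en]
      simp only [Pi.add_apply, p1z, e1, e2, f3, zero_add, add_zero]
  have const1 : ∀ k, c ≤ k → k ≤ b → S (e k) = S (e c) := by
    intro k hk
    induction k, hk using Nat.le_induction with
    | base => intro _; rfl
    | succ k hk ih =>
      intro hkb
      rw [step k (by omega), ih (by omega), if_neg (by omega), if_neg (by omega)]; simp
  have const2 : ∀ k, b + 1 ≤ k → k ≤ d → S (e k) = S (e c) + 1 := by
    intro k hk
    induction k, hk using Nat.le_induction with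
    | base => intro _; rw [step b (by omega), const1 b (by omega) le_rfl, if_neg (by omega), if_pos rfl]; simp
    | succ k hk ih =>
      intro hkb
      rw [step k (by omega), ih (by omega), if_neg (by omega), if_neg (by omega)]; simp
  have cd := const2 d (by omega) le_rfl
  -- corner value of c, d
  have Sq : ∀ q : M.Cor Z, q.out ∈ P2 → ∀ l < m, (e l = q ∨ e l = hT.b q) → M.pr q.eps (tt s) = S (e l) := by
    intro q hq l hl h
    have h1 : M.pr q.eps (tt s) = S q := by
      show M.pr (M.ed _ _) _ = _
      rw [pr_ed _ _ _ (hs.isCh_tt _ _), tt_th s q.2.1, hs0 _ _ hq, add_zero]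
    rw [h1]
    rcases h with h | h
    · rw [h]
    · rw [h]
      show s _ _ = s _ _
      rw [hT.b_neg _ (outT _ (nZ2 _ hq))]
      have := hs q.1.2.1 q.1.2.2 q.2.1 q.1.1
      have n0 : n q.1.2.2 q.1.1 = 0 := by
        by_contra h'
        rcases supn _ _ h' _ (th_spec q.2.1).2 with h'' | h''
        · exact nZ2 _ hq h''
        · exact nP2 _ hq h''
      rw [n0] at this
      exact z2e.1 this
  intro hperp
  have := hperp s hs
  rw [ew, pr_add_left, pr_add_left, pr_add_left, Sq qc oc c (by omega) hc, Sq qd od d hdm hd, cd,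
    pr_zero_of (c := t2) (fun k x h => hst k x (ht2 k x h)),
    pr_zero_of (c := p2) (fun k x h => by
      rw [tt, hs0 _ _ (s2 _ _ h _ (k1 k)), hs0 _ _ (s2 _ _ h _ (k2 k)), add_zero])] at this
  have h2 := z2 (S (e c))
  have : (1 : ZMod 2) = 0 := by linear_combination this - h2
  exact absurd this (by decide)

end Gem

end

section

open SimpleGraph Set

namespace Gem
variable {F N : Type*} [Fintype F] {M : Gem F N}
theorem pr_smul_left (a : ZMod 2) (c t : Ch F) : M.pr (a • c) t = a * M.pr c t := by
  simp [pr, Finset.mul_sum, mul_assoc]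
theorem IsCh.smul {c : Ch F} (h : M.IsCh c) (a : ZMod 2) : M.IsCh (a • c) := fun k x => by
  simp only [Pi.smul_apply, h k x]
theorem isCh_sum {ι : Type*} (s : Finset ι) {c : ι → Ch F} (h : ∀ i, M.IsCh (c i)) : M.IsCh (∑ i ∈ s, c i) := by
  classical
  induction s using Finset.induction with
  | empty => simpa using isCh_zero
  | insert a s ha ih => rw [Finset.sum_insert ha]; exact (h a).add ih
theorem sup_sum {ι : Type*} (s : Finset ι) {c : ι → Ch F} {R : Set N} (h : ∀ i, M.Sup (c i) R) : M.Sup (∑ i ∈ s, c i) R := by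
  classical
  induction s using Finset.induction with
  | empty => simpa using sup_zero
  | insert a s ha ih => rw [Finset.sum_insert ha]; exact (h a).add ih
end Gem

open Gem

variable {V F : Type*} [Fintype V] [Fintype F] {G : SimpleGraph V}

/-- `e` meets `K` -/
def Mt (K : Set V) (e : Sym2 V) : Prop := ∃ v ∈ e, v ∈ K

/-- allowed nodes for a vertex set -/
def Nb (F : Type*) (Y : Set V) : Set (Nd V F) := fun n => match n with
  | .v a => a ∈ Y
  | .e a => Mt Y a
  | .f _ => True

theorem Nb_mono {Y Y' : Set V} (h : Y ⊆ Y') : Nb F Y ⊆ Nb F Y' := by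
  rintro (a | a | a) ha
  · exact h ha
  · obtain ⟨v, h1, h2⟩ := ha; exact ⟨v, h1, h h2⟩
  · trivial

structure Stp (M : Mp G F) (r : ℕ) (K X : Set V) (Z : Set (Nd V F)) (z0 : Nd V F) (T : Fin 3 → F → Prop)
    (q : V → M.gem.Cor Z) : Prop where
  hr : 1 ≤ r
  Kcn : Cn G.Adj K
  Xd : ∀ v, v ∈ X ↔ v ∉ K ∧ ∃ u ∈ K, G.Adj u v
  Xcard : X.ncard = 4 * r
  tree : M.gem.Tree Z z0 T
  ZK : ∀ v ∈ K, Nd.v v ∉ Z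
  ZX : ∀ v ∈ X, Nd.v v ∉ Z
  Ze : ∀ e, Mt K e → Nd.e e ∉ Z
  hq : ∀ x ∈ X, (q x).out = .v x
  star : ∀ Y : Set V, Y.ncard ≤ 4 * r → ∀ γ, IsZ G γ →
    ∃ γ' β, IsZ G γ' ∧ M.IsB β ∧ γ = γ' + β ∧ ∀ e, Mt Y e → γ' e = 0
  full : ∀ γ, IsZ G γ → ∃ γ' β, IsZ G γ' ∧ M.IsB β ∧ γ = γ' + β ∧ ∀ e, γ' e ≠ 0 → ∀ v ∈ e, v ∈ K

theorem dg_add (γ γ' : Sym2 V → ZMod 2) (v : V) : dg (γ + γ') v = dg γ v + dg γ' v := by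
  classical
  simp only [dg, ← Finset.sum_add_distrib]
  apply Finset.sum_congr rfl
  intro e _
  split_ifs <;> simp

theorem dg_zero {γ : Sym2 V → ZMod 2} {v : V} (h : ∀ e, v ∈ e → γ e = 0) : dg γ v = 0 := by
  classical
  apply Finset.sum_eq_zero
  intro e _
  split_ifs with h1
  · exact h e h1
  · rfl

theorem dg_congr {γ γ' : Sym2 V → ZMod 2} {v : V} (h : ∀ e, v ∈ e → γ e = γ' e) : dg γ v = dg γ' v := by
  classical
  apply Finset.sum_congr rfl
  intro e _
  split_ifs with h1
  · exact h e h1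
  · rfl

namespace Stp
variable {M : Mp G F} {r : ℕ} {K X : Set V} {Z : Set (Nd V F)} {z0 : Nd V F} {T : Fin 3 → F → Prop} {q : V → M.gem.Cor Z}

theorem theta (S : Stp M r K X Z z0 T q) : ∃ t : V → Ch F, (∀ v k x, t v k x ≠ 0 → T k x) ∧
    ∀ v, M.gem.Bdy ((q v).eps + t v) (q v).out z0 := by
  have : ∀ v, ∃ t : Ch F, M.gem.Bdy t (M.gem.nd (q v).1.2.1 (q v).1.1) z0 ∧ ∀ k x, t k x ≠ 0 → T k x :=
    fun v => S.tree.conn _ (q v).2.2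
  choose t h1 h2 using this
  exact ⟨t, h2, fun v => (q v).bdy_eps.add (h1 v)⟩

theorem perp_all (S : Stp M r K X Z z0 T q) {c v : Ch F} (hv : M.gem.Ev v)
    (h : M.gem.Sup v {a | ¬ ((∃ u ∈ K, a = .v u) ∨ ∃ e, Mt K e ∧ a = .e e)}) (hc : M.gem.Ev c) : M.gem.Perp v c := by
  obtain ⟨γ, φ, hγ, rfl⟩ := M.ev_reduce hc
  obtain ⟨γ', β, h1, h2, rfl, h4⟩ := S.full γ hγ
  obtain ⟨φ', h5⟩ := M.emb_B h2
  rw [M.emb_add, h5]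
  refine Perp.add_right (Perp.add_right ?_ (perp_dl' _ hv)) (perp_dl' _ hv)
  refine perp_of_disj hv (M.ev_emb h1) h ?_
  intro k x hne i hi
  have hk : k = 2 := by by_contra hk; exact hne (M.emb_ne _ hk x)
  subst hk
  rw [M.emb2] at hne
  have := h4 _ hne
  intro hn
  apply hn
  fin_cases i
  · left; exact ⟨M.fv x, this _ (M.fv_mem x), rfl⟩
  · right; exact ⟨M.fe x, ⟨M.fv x, M.fv_mem x, this _ (M.fv_mem x)⟩, rfl⟩
  · exact absurd rfl hi

theorem lemN (S : Stp M r K X Z z0 T q) {n : Ch F} (hn : M.gem.Ev n) {Y0 : Set V} (hs : M.gem.Sup n (Z ∪ Nb F Y0))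
    (h1 : (Y0 \ X).ncard ≤ 2 * r - 1) (h2 : (Y0 ∩ X).ncard ≤ 2) {c : Ch F} (hc : M.gem.Ev c) : M.gem.Perp n c := by
  classical
  obtain ⟨s, hsh, hsT, hs0⟩ := S.tree.shade hn hs
  have hs0 : ∀ i x, M.nd i x ∉ Z → M.nd i x ∉ Nb F Y0 → s i x = 0 := fun i x a b => hs0 i x (fun h => h.elim a b) a
  obtain ⟨t, ht, hth⟩ := S.theta
  let θ : V → Ch F := fun v => (q v).eps + t v
  let cc : V → ZMod 2 := fun v => M.gem.pr (θ v) (tt s)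
  have hY : ∃ Y : Set V, Y0 ⊆ Y ∧ Y.ncard ≤ 4 * r ∧ ∃ c0, ∀ x ∈ X, x ∉ Y → cc x = c0 := by
    have hX := S.Xcard
    have hr := S.hr
    let A : ZMod 2 → Set V := fun a => {x | x ∈ X ∧ x ∉ Y0 ∧ cc x = a}
    have hA : (A 0).ncard + (A 1).ncard + (Y0 ∩ X).ncard = 4 * r := by
      rw [← hX, ← Set.ncard_union_eq, ← Set.ncard_union_eq]
      · congr 1; ext x; simp only [A, mem_union, mem_setOf_eq, mem_inter_iff]
        constructor
        · tauto
        · intro h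
          by_cases h' : cc x = 0
          · tauto
          · have := z2n.1 h'; tauto
      · rw [Set.disjoint_left]; rintro x (h | h) h'
        · exact h.2.1 h'.1
        · exact h.2.1 h'.1
      · rw [Set.disjoint_left]; rintro x h h'
        have := h.2.2.symm.trans h'.2.2
        exact absurd this (by decide)
    have key : ∀ a b, (∀ z : ZMod 2, z ≠ a → z = b) → (A a).ncard ≤ (A b).ncard → ∃ Y : Set V, Y0 ⊆ Y ∧ Y.ncard ≤ 4 * r ∧ ∃ c0, ∀ x ∈ X, x ∉ Y → cc x = c0 := by
      intro a b hab hle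
      have hA' : (A a).ncard + (A b).ncard + (Y0 ∩ X).ncard = 4 * r := by
        by_cases h0 : a = 0
        · have : b = 1 := (hab 1 (by rw [h0]; decide)).symm
          rw [h0, this]; exact hA
        · have h1 := z2n.1 h0
          have : b = 0 := (hab 0 (by rw [h1]; decide)).symm
          rw [h1, this]; omega
      refine ⟨Y0 ∪ A a, subset_union_left, ?_, b, fun x hx hxY => ?_⟩
      · have e1 := Set.ncard_union_le Y0 (A a)
        have e2 := Set.ncard_inter_add_ncard_diff_eq_ncard Y0 X (toFinite _)
        omega
      · apply hab; intro h; exact hxY (Or.inr ⟨hx, fun h => hxY (Or.inl h), h⟩)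
    rcases le_total (A 0).ncard (A 1).ncard with h | h
    · exact key 0 1 (by decide) h
    · exact key 1 0 (by decide) h
  obtain ⟨Y, hY0, hYc, c0, hc0⟩ := hY
  obtain ⟨w, φ, hw, rfl⟩ := M.ev_reduce hc
  refine Perp.add_right ?_ (perp_dl' _ hn)
  obtain ⟨w', β, hw', hβ, rfl, hav⟩ := S.star Y hYc w hw
  obtain ⟨φ', h5⟩ := M.emb_B hβ
  rw [M.emb_add, h5]
  refine Perp.add_right ?_ (perp_dl' _ hn)
  apply perp_of hsh (M.ev_emb hw')
  let wK : Sym2 V → ZMod 2 := fun e => if Mt K e then w' e else 0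
  let wr : Sym2 V → ZMod 2 := fun e => if Mt K e then 0 else w' e
  have hKr : w' = wK + wr := by
    ext e; simp only [wK, wr, Pi.add_apply]; split_ifs <;> simp
  have sK : ∀ e, e ∉ G.edgeSet → wK e = 0 := fun e he => by simp [wK, hw'.1 e he]
  have sr : ∀ e, e ∉ G.edgeSet → wr e = 0 := fun e he => by simp [wr, hw'.1 e he]
  have dX : ∀ v, dg wK v ≠ 0 → v ∈ X ∧ v ∉ Y := by
    intro v hv
    have hvK : v ∉ K := by
      intro hvK
      apply hv
      rw [← hw'.2 v]
      exact dg_congr fun e he => by simp only [wK]; rw [if_pos ⟨v, he, hvK⟩]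
    have : ∃ e, v ∈ e ∧ wK e ≠ 0 := by
      by_contra h; push Not at h; exact hv (dg_zero h)
    obtain ⟨e, hve, hne⟩ := this
    have hm : Mt K e := by by_contra h; simp [wK, h] at hne
    have hne' : w' e ≠ 0 := by simpa [wK, hm] using hne
    have heG : e ∈ G.edgeSet := by by_contra h; exact hne (sK e h)
    constructor
    · rw [S.Xd]
      refine ⟨hvK, ?_⟩
      obtain ⟨u, hu, huK⟩ := hm
      refine ⟨u, huK, ?_⟩
      have huv : u ≠ v := fun h => hvK (h ▸ huK)
      have : e = s(u, v) := ((Sym2.mem_and_mem_iff huv).1 ⟨hu, hve⟩)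
      rw [this] at heG; exact heG
    · intro hvY; exact hne' (hav e ⟨v, hve, hvY⟩)
  have sum0 : ∑ v, dg wK v = 0 := by
    have := M.pr_emb sK (fun _ => 1)
    have e : M.gem.cob (fun _ => (1 : ZMod 2)) = 0 := by ext k x; exact z2 1
    rw [e, pr_zero_right] at this
    simpa using this.symm
  let Θ : Ch F := ∑ v, dg wK v • θ v
  have prΘ : ∀ t', M.gem.pr Θ t' = ∑ v, dg wK v * M.gem.pr (θ v) t' := by
    intro t'; simp only [Θ, pr_sum_left, pr_smul_left]
  have chΘ : M.gem.IsCh Θ := isCh_sum _ fun v => (hth v).1.smul _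
  have evv : M.gem.Ev (M.emb wr + Θ) := by
    refine ⟨(M.isCh_emb _).add chΘ, fun y => ?_⟩
    rw [pr_add_left, M.pr_emb sr, prΘ]
    have : ∀ v, dg wK v * M.gem.pr (θ v) (M.gem.cob y) = dg wK v * y (.v v) + dg wK v * y z0 := by
      intro v
      by_cases hv : dg wK v = 0
      · simp [hv]
      · rw [(hth v).2, S.hq v (dX v hv).1]; ring
    simp only [this, Finset.sum_add_distrib]
    rw [← Finset.sum_mul, sum0, zero_mul, add_zero, ← Finset.sum_add_distrib]
    apply Finset.sum_eq_zero
    intro v _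
    have := hw'.2 v
    rw [hKr, dg_add] at this
    rw [← add_mul, add_comm, this, zero_mul]
  have supv : M.gem.Sup (M.emb wr + Θ) {a | ¬ ((∃ u ∈ K, a = .v u) ∨ ∃ e, Mt K e ∧ a = .e e)} := by
    apply Sup.add
    · intro k x hne i hi
      have hk : k = 2 := by by_contra hk; exact hne (M.emb_ne _ hk x)
      subst hk
      rw [M.emb2] at hne
      have hm : ¬ Mt K (M.fe x) := by intro h; simp [wr, h] at hne
      fin_cases i
      · rintro (⟨u, hu, h⟩ | ⟨e, he, h⟩)
        · simp at h; subst h; exact hm ⟨_, M.fv_mem x, hu⟩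
        · simp at h
      · rintro (⟨u, hu, h⟩ | ⟨e, he, h⟩)
        · simp at h
        · simp at h; subst h; exact hm he
      · exact absurd rfl hi
    · have hZ : Z ⊆ {a | ¬ ((∃ u ∈ K, a = .v u) ∨ ∃ e, Mt K e ∧ a = .e e)} := by
        rintro z hz (⟨u, hu, rfl⟩ | ⟨e, he, rfl⟩)
        · exact S.ZK u hu hz
        · exact S.Ze e he hz
      apply sup_sum
      intro v
      by_cases hv : dg wK v = 0
      · rw [hv, zero_smul]; exact sup_zero
      · have h1 : dg wK v = 1 := z2n.1 hv
        rw [h1, one_smul]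
        refine Sup.add ((q v).sup_eps (hZ (q v).2.2) ?_) (fun k x hne i hi => hZ (S.tree.ends k x (ht v k x hne) i hi))
        rw [S.hq v (dX v hv).1]
        have := ((S.Xd v).1 (dX v hv).1).1
        rintro (⟨u, hu, h⟩ | ⟨e, he, h⟩)
        · simp at h; exact this (h ▸ hu)
        · simp at h
  have pv := (S.perp_all evv supv hn).symm evv s hsh
  have pK : M.gem.pr (M.emb wK) (tt s) = 0 := by
    apply pr_zero_of
    intro k x hne
    have hk : k = 2 := by by_contra hk; exact hne (M.emb_ne _ hk x)
    subst hk
    rw [M.emb2] at hne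
    have hm : Mt K (M.fe x) := by by_contra h; simp [wK, h] at hne
    have hne' : w' (M.fe x) ≠ 0 := by simpa [wK, hm] using hne
    have hnY : ¬ Mt Y (M.fe x) := fun h => hne' (hav _ h)
    have hnY0 : ¬ Mt Y0 (M.fe x) := fun ⟨v, h1, h2⟩ => hnY ⟨v, h1, hY0 h2⟩
    have a1 : s 1 x = 0 := hs0 1 x (S.Ze _ hm) hnY0
    have a0 : s 0 x = 0 := by
      apply hs0 0 x
      · by_cases hK : M.fv x ∈ K
        · exact S.ZK _ hK
        · apply S.ZX
          rw [S.Xd]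
          refine ⟨hK, ?_⟩
          obtain ⟨u, hu, huK⟩ := hm
          refine ⟨u, huK, ?_⟩
          have huv : u ≠ M.fv x := fun h => hK (h ▸ huK)
          have : M.fe x = s(u, M.fv x) := ((Sym2.mem_and_mem_iff huv).1 ⟨hu, M.fv_mem x⟩)
          have h3 := M.fe_mem x
          rw [this] at h3; exact h3
      · intro h; exact hnY0 ⟨_, M.fv_mem x, h⟩
    show s 0 x + s 1 x = 0
    rw [a0, a1, add_zero]
  have pΘ : M.gem.pr Θ (tt s) = 0 := by
    rw [prΘ]
    have : ∀ v, dg wK v * M.gem.pr (θ v) (tt s) = dg wK v * c0 := by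
      intro v
      by_cases hv : dg wK v = 0
      · simp [hv]
      · congr 1
        exact hc0 v (dX v hv).1 (dX v hv).2
    simp only [this]
    rw [← Finset.sum_mul, sum0, zero_mul]
  rw [hKr, M.emb_add, pr_add_left, pK, zero_add]
  rw [pr_add_left, pΘ, add_zero] at pv
  exact pv

end Stp

end

section

open SimpleGraph Set Gem

variable {V F : Type*} [Fintype V] [Fintype F] {G : SimpleGraph V}

namespace Mp
variable (M : Mp G F)

def ball (K X : Set V) : ℕ → Set V
  | 0 => X
  | m+1 => ball K X m ∪ {v | v ∈ K ∧ ∃ x y, M.fv x = v ∧ M.fv y ∈ ball K X m ∧ M.fc x = M.fc y}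

theorem ball_mono {K X : Set V} {m n : ℕ} (h : m ≤ n) : M.ball K X m ⊆ M.ball K X n := by
  induction n, h using Nat.le_induction with
  | base => exact Subset.rfl
  | succ n h ih => exact ih.trans subset_union_left

theorem ball_sub {K X : Set V} {m : ℕ} : M.ball K X m ⊆ K ∪ X := by
  induction m with
  | zero => exact subset_union_right
  | succ m ih => exact union_subset ih fun v hv => Or.inl hv.1

/-- nodes near a vertex set -/
def Tc (B : Set V) : Set (Nd V F) := fun n => match n with
  | .v a => a ∈ B
  | .e a => ∃ y, M.fv y ∈ B ∧ M.fe y = a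
  | .f a => ∃ y, M.fv y ∈ B ∧ M.fc y = a

theorem Tc_mono {B B' : Set V} (h : B ⊆ B') : M.Tc B ⊆ M.Tc B' := by
  rintro (a | a | a) ha
  · exact h ha
  · obtain ⟨y, h1, h2⟩ := ha; exact ⟨y, h h1, h2⟩
  · obtain ⟨y, h1, h2⟩ := ha; exact ⟨y, h h1, h2⟩

theorem nd_Tc {B : Set V} {x : F} (h : M.fv x ∈ B) (i : Fin 3) : M.nd i x ∈ M.Tc B := by
  fin_cases i
  · exact h
  · exact ⟨x, h, rfl⟩
  · exact ⟨x, h, rfl⟩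

theorem Tc_fv {B : Set V} {i : Fin 3} {x : F} (h : M.nd i x ∈ M.Tc B) : ∃ y, M.fv y ∈ B ∧ M.nd i y = M.nd i x := by
  fin_cases i
  · exact ⟨x, h, rfl⟩
  · obtain ⟨y, h1, h2⟩ := h; exact ⟨y, h1, by show Nd.e _ = Nd.e _; rw [h2]⟩
  · obtain ⟨y, h1, h2⟩ := h; exact ⟨y, h1, by show Nd.f _ = Nd.f _; rw [h2]⟩
end Mp

/-- good path from `a` to the root -/
structure GT (M : Mp G F) (X : Set V) (Z : Set (Nd V F)) (z0 : Nd V F) (R : Set (Nd V F)) (m : ℕ) (a : Nd V F)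
    (Θ : Ch F) (Y : Set V) : Prop where
  bdy : M.gem.Bdy Θ a z0
  sup : M.gem.Sup Θ (Z ∪ Nb F Y)
  supR : M.gem.Sup Θ R
  mem : a ∈ Z ∪ Nb F Y
  c1 : (Y \ X).ncard ≤ m
  c2 : (Y ∩ X).ncard ≤ 1

theorem sup_of_ad {N : Type*} {M : Gem F N} {a b : N} (h : M.Ad a b) : ∃ p, M.Bdy p a b ∧ ∀ R : Set N, a ∈ R → b ∈ R → M.Sup p R := by
  obtain ⟨k, x, h1, h2⟩ := h.bdy
  refine ⟨_, h1, fun R ha hb => ?_⟩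
  rcases h2 with ⟨rfl, rfl⟩ | ⟨rfl, rfl⟩
  · exact sup_ed ha hb
  · exact sup_ed hb ha

theorem GT.mono {M : Mp G F} {X : Set V} {Z : Set (Nd V F)} {z0 : Nd V F} {R R' : Set (Nd V F)} {m m' : ℕ} {a : Nd V F}
    {Θ : Ch F} {Y : Set V} (h : GT M X Z z0 R m a Θ Y) (hR : R ⊆ R') (hm : m ≤ m') : GT M X Z z0 R' m' a Θ Y :=
  ⟨h.bdy, h.sup, h.supR.mono hR, h.mem, h.c1.trans hm, h.c2⟩

/-- prepend an edge -/
theorem GT.step {M : Mp G F} {X : Set V} {Z : Set (Nd V F)} {z0 : Nd V F} {R : Set (Nd V F)} {m : ℕ} {a b : Nd V F}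
    {Θ : Ch F} {Y : Set V} (h : GT M X Z z0 R m a Θ Y) (hab : M.gem.Ad b a) (hb : b ∈ Z ∪ Nb F Y) (hbR : b ∈ R) (haR : a ∈ R) :
    ∃ Θ', GT M X Z z0 R m b Θ' Y := by
  obtain ⟨p, h1, h2⟩ := sup_of_ad hab
  exact ⟨p + Θ, h1.add h.bdy, (h2 _ hb h.mem).add h.sup, (h2 _ hbR haR).add h.supR, hb, h.c1, h.c2⟩

theorem GT.enlarge {M : Mp G F} {X : Set V} {Z : Set (Nd V F)} {z0 : Nd V F} {R : Set (Nd V F)} {m : ℕ} {a : Nd V F}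
    {Θ : Ch F} {Y : Set V} (h : GT M X Z z0 R m a Θ Y) {v : V} (hv : v ∉ X) : GT M X Z z0 R (m+1) a Θ (insert v Y) := by
  have hs : Z ∪ Nb F Y ⊆ Z ∪ Nb F (insert v Y) := union_subset_union_right _ (Nb_mono (subset_insert _ _))
  refine ⟨h.bdy, h.sup.mono hs, h.supR, hs h.mem, ?_, ?_⟩
  · rw [insert_diff_of_notMem _ hv]
    exact (ncard_insert_le _ _).trans (Nat.add_le_add_right h.c1 1)
  · rw [insert_inter_of_notMem hv]; exact h.c2

namespace Stp
variable {M : Mp G F} {r : ℕ} {K X : Set V} {Z : Set (Nd V F)} {z0 : Nd V F} {T : Fin 3 → F → Prop} {q : V → M.gem.Cor Z}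

theorem KX (S : Stp M r K X Z z0 T q) {v : V} (h : v ∈ K) : v ∉ X := fun h' => ((S.Xd v).1 h').1 h

theorem gtV (S : Stp M r K X Z z0 T q) (m : ℕ) : ∀ v ∈ M.ball K X m,
    ∃ Θ Y, GT M X Z z0 (Z ∪ M.Tc (M.ball K X m)) m (.v v) Θ Y ∧ v ∈ Y := by
  induction m with
  | zero =>
    intro v hv
    obtain ⟨t, h1, h2⟩ := S.theta
    have h2 := h2 v
    rw [S.hq v hv] at h2
    have hs : ∀ R : Set (Nd V F), .v v ∈ R → M.gem.Sup ((q v).eps + t v) (Z ∪ R) := by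
      intro R hR
      refine Sup.add ((q v).sup_eps (Or.inl (q v).2.2) ?_) (fun k x h i hi => Or.inl (S.tree.ends k x (h1 v k x h) i hi))
      rw [S.hq v hv]; exact Or.inr hR
    refine ⟨_, {v}, ⟨h2, hs _ rfl, hs _ hv, Or.inr rfl, ?_, ?_⟩, rfl⟩
    · rw [diff_eq_empty.2 (singleton_subset_iff.2 (show v ∈ X from hv))]; simp
    · exact (ncard_le_ncard inter_subset_left (toFinite _)).trans (by simp)
  | succ m ih =>
    have hRR : Z ∪ M.Tc (M.ball K X m) ⊆ Z ∪ M.Tc (M.ball K X (m+1)) := union_subset_union_right _ (M.Tc_mono (M.ball_mono (Nat.le_succ m)))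
    rintro v (hv | ⟨hvK, x, y, hx, hy, hxy⟩)
    · obtain ⟨Θ, Y, h, h'⟩ := ih v hv
      exact ⟨Θ, Y, h.mono hRR (Nat.le_succ m), h'⟩
    · obtain ⟨Θ, Y, h, h'⟩ := ih _ hy
      have h := (h.mono hRR le_rfl).enlarge (S.KX hvK)
      have hv : v ∈ M.ball K X (m+1) := Or.inr ⟨hvK, x, y, hx, hy, hxy⟩
      have hf : Nd.f (M.fc y) ∈ Z ∪ M.Tc (M.ball K X (m+1)) := Or.inr ⟨y, Or.inl hy, rfl⟩
      obtain ⟨Θ1, g1⟩ := h.step (b := .f (M.fc y)) ⟨2, 0, y, by decide, rfl, rfl⟩ (Or.inr trivial) hf (Or.inr (Or.inl hy))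
      obtain ⟨Θ2, g2⟩ := g1.step (b := .v v) ⟨0, 2, x, by decide, by simp [hx], by simp [hxy]⟩ (Or.inr (mem_insert _ _)) (Or.inr hv) hf
      exact ⟨Θ2, _, g2, mem_insert _ _⟩

theorem gt (S : Stp M r K X Z z0 T q) {m : ℕ} {a : Nd V F} (ha : a ∈ Z ∪ M.Tc (M.ball K X m)) :
    ∃ Θ Y, GT M X Z z0 (Z ∪ M.Tc (M.ball K X m)) m a Θ Y := by
  rcases ha with ha | ha
  · obtain ⟨t, h1, h2⟩ := S.tree.conn a ha
    have hs : ∀ R : Set (Nd V F), M.gem.Sup t (Z ∪ R) := fun R k x h i hi => Or.inl (S.tree.ends k x (h2 k x h) i hi)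
    exact ⟨t, ∅, h1, hs _, hs _, Or.inl ha, by simp, by simp⟩
  · match a, ha with
    | .v a, ha => obtain ⟨Θ, Y, h, _⟩ := S.gtV m a ha; exact ⟨Θ, Y, h⟩
    | .e a, ⟨y, h1, h2⟩ =>
      obtain ⟨Θ, Y, h, h'⟩ := S.gtV m _ h1
      obtain ⟨Θ', h3⟩ := h.step (b := .e a) ⟨1, 0, y, by decide, by simp [h2], rfl⟩ (Or.inr ⟨_, h2 ▸ M.fv_mem y, h'⟩)
        (Or.inr ⟨y, h1, h2⟩) (Or.inr h1)
      exact ⟨Θ', Y, h3⟩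
    | .f a, ⟨y, h1, h2⟩ =>
      obtain ⟨Θ, Y, h, h'⟩ := S.gtV m _ h1
      obtain ⟨Θ', h3⟩ := h.step (b := .f a) ⟨2, 0, y, by decide, by simp [h2], rfl⟩ (Or.inr trivial)
        (Or.inr ⟨y, h1, h2⟩) (Or.inr h1)
      exact ⟨Θ', Y, h3⟩

theorem lemN2 (S : Stp M r K X Z z0 T q) {R R' : Set (Nd V F)} {m m' : ℕ} {a b : Nd V F} {Θ Θ' : Ch F} {Y Y' : Set V}
    (h : GT M X Z z0 R m a Θ Y) (h' : GT M X Z z0 R' m' b Θ' Y') (hm : m + m' ≤ 2 * r - 1) {p : Ch F} (hp : M.gem.Bdy p a b)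
    (hs : M.gem.Sup p (Z ∪ Nb F (Y ∪ Y'))) {w s : Ch F} (hsw : M.gem.Shade s w) :
    M.gem.pr p (tt s) = M.gem.pr Θ (tt s) + M.gem.pr Θ' (tt s) := by
  have ev : M.gem.Ev (p + Θ' + Θ) := ((hp.add h'.bdy).add h.bdy.symm).ev
  have m1 : Z ∪ Nb F Y ⊆ Z ∪ Nb F (Y ∪ Y') := union_subset_union_right _ (Nb_mono subset_union_left)
  have m2 : Z ∪ Nb F Y' ⊆ Z ∪ Nb F (Y ∪ Y') := union_subset_union_right _ (Nb_mono subset_union_right)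
  have := S.lemN ev ((hs.add (h'.sup.mono m2)).add (h.sup.mono m1)) ?_ ?_ hsw.ev
  · have := this.symm ev s hsw
    rw [pr_add_left, pr_add_left] at this
    have h2 := z2 (M.gem.pr Θ (tt s)); have h3 := z2 (M.gem.pr Θ' (tt s))
    linear_combination this - h2 - h3
  · rw [union_diff_distrib]
    exact (ncard_union_le _ _).trans ((add_le_add h.c1 h'.c1).trans hm)
  · rw [union_inter_distrib_right]
    exact (ncard_union_le _ _).trans ((add_le_add h.c2 h'.c2))

/-- even chains in the region are orthogonal to everything -/
theorem region (S : Stp M r K X Z z0 T q) {m : ℕ} (hm : m + 1 ≤ r) {n : Ch F} (hn : M.gem.Ev n)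
    (hs : M.gem.Sup n (Z ∪ M.Tc (M.ball K X m))) {w : Ch F} (hw : M.gem.Ev w) : M.gem.Perp n w := by
  classical
  obtain ⟨s, hsw⟩ := hw.shade
  have hch : ∀ a, ∃ Θ Y, a ∈ Z ∪ M.Tc (M.ball K X m) → GT M X Z z0 (Z ∪ M.Tc (M.ball K X m)) m a Θ Y := by
    intro a
    by_cases ha : a ∈ Z ∪ M.Tc (M.ball K X m)
    · obtain ⟨Θ, Y, h⟩ := S.gt ha; exact ⟨Θ, Y, fun _ => h⟩
    · exact ⟨0, ∅, fun h => absurd h ha⟩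
  choose Θ Y hΘ using hch
  refine Perp.symm hw (perp_of hsw hn ?_)
  rw [pr_congr (t' := M.gem.cob fun a => M.gem.pr (Θ a) (tt s)), hn.2]
  intro k x hne
  have ha := hs k x hne _ (k1 k)
  have hb := hs k x hne _ (k2 k)
  have := S.lemN2 (hΘ _ ha) (hΘ _ hb) (by omega) (bdy_ed k x)
    (sup_ed (union_subset_union_right _ (Nb_mono subset_union_left) (hΘ _ ha).mem)
      (union_subset_union_right _ (Nb_mono subset_union_right) (hΘ _ hb).mem)) hsw
  rw [pr_ed _ _ _ (hsw.isCh_tt _ _)] at this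
  exact this

end Stp

end

section

open SimpleGraph Set Gem

variable {V F : Type*} [Fintype V] [Fintype F] {G : SimpleGraph V}

/-- chains along connected sets -/
theorem chain_of_cn {V N : Type*} {M : Gem F N} {R : V → V → Prop} {A : Set V} (h : Cn R A) (f : V → N) {Φ : Ch F → Prop}
    (h0 : Φ 0) (hadd : ∀ p p', Φ p → Φ p' → Φ (p + p'))
    (he : ∀ u ∈ A, ∀ v ∈ A, R u v → ∃ p, M.Bdy p (f u) (f v) ∧ Φ p) {a b : V} (ha : a ∈ A) (hb : b ∈ A) :
    ∃ p, M.Bdy p (f a) (f b) ∧ Φ p := by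
  refine h.2 {v | ∃ p, M.Bdy p (f a) (f v) ∧ Φ p} ⟨a, ha, 0, bdy_zero _, h0⟩ ?_ hb
  rintro x hx y hy hxy ⟨p, h1, h2⟩
  obtain ⟨p', h3, h4⟩ := he x hx y hy hxy
  exact ⟨p + p', h1.add h3, hadd _ _ h2 h4⟩

namespace Mp
variable (M : Mp G F)

/-- the face of `x` touches `B` -/
def Fk (B : Set V) (x : F) : Prop := ∃ y, M.fv y ∈ B ∧ M.fc y = M.fc x

theorem Fk0 (B : Set V) (x : F) : M.Fk B (M.σ 0 x) ↔ M.Fk B x := by unfold Fk; rw [M.fc0]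
theorem Fk1 (B : Set V) (x : F) : M.Fk B (M.σ 1 x) ↔ M.Fk B x := by unfold Fk; rw [M.fc1]
theorem Fk_self {B : Set V} {x : F} (h : M.fv x ∈ B) : M.Fk B x := ⟨x, h, rfl⟩
theorem Fk_self' {B : Set V} {x : F} (h : M.fv (M.σ 0 x) ∈ B) : M.Fk B x := ⟨_, h, M.fc0 x⟩

theorem bdy_edge (x : F) : M.gem.Bdy (M.gem.ed 2 x + M.gem.ed 2 (M.σ 0 x)) (.v (M.fv x)) (.v (M.fv (M.σ 0 x))) := by
  have h1 := bdy_ed (M := M.gem) 2 x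
  have h2 := (bdy_ed (M := M.gem) 2 (M.σ 0 x)).symm
  have e : M.gem.nd (2+2) (M.σ 0 x) = M.gem.nd (2+2) x := M.gem.nd_eq _ _ _ (by decide)
  rw [e] at h2
  exact h1.add h2

end Mp

namespace Stp
variable {M : Mp G F} {r : ℕ} {K X : Set V} {Z : Set (Nd V F)} {z0 : Nd V F} {T : Fin 3 → F → Prop} {q : V → M.gem.Cor Z}

theorem lemD (S : Stp M r K X Z z0 T q) {m : ℕ} (hm : m + 1 ≤ r) {C : Set V} (hCK : C ⊆ K) (hCB : ∀ v ∈ C, v ∉ M.ball K X m)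
    (hC : Cn G.Adj C) (hcl : ∀ u ∈ C, ∀ v ∈ K, v ∉ M.ball K X m → G.Adj u v → v ∈ C)
    (hne : (C ∩ M.ball K X (m+1)).Nonempty) :
    Cn (fun u v => ∃ x, M.fv x = u ∧ M.fv (M.σ 0 x) = v ∧ M.Fk (M.ball K X m) x) (C ∩ M.ball K X (m+1)) := by
  classical
  set B := M.ball K X m with hB
  refine ⟨hne, fun A ⟨v1, hv1, hv1A⟩ hA v2 hv2 => ?_⟩
  by_contra hv2A
  have hF : ∀ x, M.Fk B x → M.fv x ∈ C → M.fv x ∈ M.ball K X (m+1) := fun x ⟨y, h1, h2⟩ h3 =>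
    Or.inr ⟨hCK h3, x, y, rfl, h1, h2.symm⟩
  have spec : ∀ x, M.Fk B x → M.fv x ∈ C → M.fv (M.σ 0 x) ∈ C → (M.fv x ∈ A ↔ M.fv (M.σ 0 x) ∈ A) := by
    intro x hx h1 h2
    have hx' := (M.Fk0 B x).2 hx
    have a1 := hA _ ⟨h1, hF x hx h1⟩ _ ⟨h2, hF _ hx' h2⟩ ⟨x, rfl, rfl, hx⟩
    have a2 := hA _ ⟨h2, hF _ hx' h2⟩ _ ⟨h1, hF x hx h1⟩ ⟨_, rfl, by rw [M.inv], hx'⟩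
    exact ⟨a1, a2⟩
  have other : ∀ x, M.fv x ∈ C → M.fv (M.σ 0 x) ∉ C → M.fv (M.σ 0 x) ∈ B := by
    intro x h1 h2
    by_contra h3
    apply h2
    refine hcl _ h1 _ ?_ h3 (M.adj x)
    by_contra h4
    exact h3 (M.ball_mono (Nat.zero_le m) ((S.Xd _).2 ⟨h4, _, hCK h1, M.adj x⟩))
  let F2 : Set V := C \ A
  let φ : F → ZMod 2 := fun x => if M.Fk B x ∧ M.fv x ∈ F2 then 1 else 0
  let s' : Ch F := fun i x => match i with
    | 0 => 0
    | 1 => if M.Fk B x ∧ M.fv x ∈ F2 ∧ M.fv (M.σ 0 x) ∉ F2 then 1 else 0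
    | 2 => φ x
  let n : Ch F := fun k x => if k = 0 then φ x + φ (M.σ 0 x) else 0
  have cr : ∀ x, M.fv x ∈ F2 → M.fv (M.σ 0 x) ∉ F2 → (M.Fk B x ∨ M.Fk B (M.σ 2 x)) → M.fv (M.σ 0 x) ∈ B := by
    intro x h1 h2 hx
    by_cases h3 : M.fv (M.σ 0 x) ∈ C
    · exfalso
      have h4 : M.fv (M.σ 0 x) ∈ A := by by_contra h; exact h2 ⟨h3, h⟩
      rcases hx with hx | hx
      · exact h1.2 ((spec x hx h1.1 h3).2 h4)
      · have := spec (M.σ 2 x) hx (by rw [M.fv2]; exact h1.1) (by rw [M.comm, M.fv2]; exact h3)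
        rw [M.fv2, M.comm, M.fv2] at this
        exact h1.2 (this.2 h4)
    · exact other x h1.1 h3
  have hsh : M.gem.Shade s' n := by
    intro i k hik x
    fin_cases i <;> fin_cases k <;> first | exact absurd rfl hik | skip
    · show (0 : ZMod 2) + 0 = _; simp [n]
    · show (0 : ZMod 2) + 0 = _; simp [n]
    · show (if M.Fk B x ∧ M.fv x ∈ F2 ∧ M.fv (M.σ 0 x) ∉ F2 then 1 else 0) +
        (if M.Fk B (M.σ 0 x) ∧ M.fv (M.σ 0 x) ∈ F2 ∧ M.fv (M.σ 0 (M.σ 0 x)) ∉ F2 then 1 else 0) = n 0 x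
      simp only [n, φ, M.Fk0, M.inv]
      by_cases h1 : M.Fk B x <;> by_cases h2 : M.fv x ∈ F2 <;> by_cases h3 : M.fv (M.σ 0 x) ∈ F2 <;> simp [h1, h2, h3, z2]
    · show (if M.Fk B x ∧ M.fv x ∈ F2 ∧ M.fv (M.σ 0 x) ∉ F2 then 1 else 0) +
        (if M.Fk B (M.σ 2 x) ∧ M.fv (M.σ 2 x) ∈ F2 ∧ M.fv (M.σ 0 (M.σ 2 x)) ∉ F2 then 1 else 0) = n 2 x
      simp only [M.fv2, M.comm]
      by_cases h2 : M.fv x ∈ F2 <;> by_cases h3 : M.fv (M.σ 0 x) ∈ F2 <;> try (simp [h2, h3, n]; done)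
      have := cr x h2 h3
      by_cases h4 : M.Fk B x ∨ M.Fk B (M.σ 2 x)
      · have := cr x h2 h3 h4
        have e1 : M.Fk B x := M.Fk_self' this
        have e2 : M.Fk B (M.σ 2 x) := M.Fk_self' (by rw [M.comm, M.fv2]; exact this)
        simp [e1, e2, h2, h3, z2, n]
      · rw [not_or] at h4; simp [h4.1, h4.2, n]
    · show φ x + φ (M.σ 0 x) = n 0 x
      simp [n]
    · show φ x + φ (M.σ 1 x) = n 1 x
      simp only [φ, M.Fk1, M.fv1, z2]; simp [n]
  have hsup : M.gem.Sup n (Z ∪ M.Tc B) := by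
    intro k x hne i hi
    have hk : k = 0 := by by_contra h; simp [n, h] at hne
    subst hk
    have hx : M.Fk B x := by
      by_contra h; simp [n, φ, M.Fk0, h] at hne
    have hh : M.fv x ∈ B ∨ M.fv (M.σ 0 x) ∈ B := by
      by_cases h2 : M.fv x ∈ F2 <;> by_cases h3 : M.fv (M.σ 0 x) ∈ F2
      · simp [n, φ, M.Fk0, h2, h3, z2] at hne
      · exact Or.inr (cr x h2 h3 (Or.inl hx))
      · left
        have := cr (M.σ 0 x) h3 (by rw [M.inv]; exact h2) (Or.inl ((M.Fk0 B x).2 hx))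
        rwa [M.inv] at this
      · simp [n, φ, M.Fk0, h2, h3] at hne
    right
    fin_cases i
    · exact absurd rfl hi
    · rcases hh with h | h
      · exact ⟨x, h, rfl⟩
      · exact ⟨M.σ 0 x, h, M.fe0 x⟩
    · exact hx
  let s : Ch F := s' + fun _ => φ
  have hts : tt s = tt s' := by rw [tt_add, tt_const, add_zero]
  have s2 : ∀ x, s 2 x = 0 := fun x => z2 _
  have s0 : ∀ x, s 0 x = if M.Fk B x ∧ M.fv x ∈ F2 then 1 else 0 := fun x => zero_add _
  have s1 : ∀ x, s 1 x = if M.Fk B x ∧ M.fv x ∈ F2 ∧ M.fv (M.σ 0 x) ∈ F2 then 1 else 0 := by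
    intro x
    show (if M.Fk B x ∧ M.fv x ∈ F2 ∧ M.fv (M.σ 0 x) ∉ F2 then 1 else 0) + φ x = _
    simp only [φ]
    by_cases h1 : M.Fk B x <;> by_cases h2 : M.fv x ∈ F2 <;> by_cases h3 : M.fv (M.σ 0 x) ∈ F2 <;> simp [h1, h2, h3, z2]
  have zR : ∀ i x, M.nd i x ∈ Z ∪ M.Tc B → s i x = 0 := by
    intro i x h
    fin_cases i
    · show s 0 x = 0
      rw [s0, if_neg]
      rintro ⟨-, h2⟩
      rcases h with h | h
      · exact S.ZK _ (hCK h2.1) h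
      · exact hCB _ h2.1 h
    · show s 1 x = 0
      rw [s1, if_neg]
      rintro ⟨-, h2, h3⟩
      rcases h with h | h
      · exact S.Ze _ ⟨_, M.fv_mem x, hCK h2.1⟩ h
      · obtain ⟨y, h4, h5⟩ := h
        have : M.fv y ∈ M.fe x := by rw [← h5]; exact M.fv_mem y
        rcases Sym2.mem_iff.1 this with h6 | h6
        · rw [h6] at h4; exact hCB _ h2.1 h4
        · rw [h6] at h4; exact hCB _ h3.1 h4
    · exact s2 x
  have zR' : ∀ Θ, M.gem.Sup Θ (Z ∪ M.Tc B) → M.gem.pr Θ (tt s) = 0 := fun Θ h => pr_zero_of fun k x hne => by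
    rw [tt, zR _ _ (h k x hne _ (k1 k)), zR _ _ (h k x hne _ (k2 k)), add_zero]
  have hch : M.gem.IsCh (tt s) := by rw [hts]; exact hsh.isCh_tt
  have e2 : ∀ x, M.gem.pr (M.gem.ed 2 x) (tt s) = s 0 x + s 1 x := fun x => pr_ed _ _ _ (hch 2 x)
  have e1 : ∀ x, M.gem.pr (M.gem.ed 1 x) (tt s) = s 2 x + s 0 x := fun x => pr_ed _ _ _ (hch 1 x)
  obtain ⟨p, hp, hp0⟩ := chain_of_cn (M := M.gem) hC Nd.v (Φ := fun p => M.gem.pr p (tt s) = 0) (pr_zero_left _)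
    (fun p p' h h' => by rw [pr_add_left, h, h', add_zero]) (by
      intro u hu v hv huv
      obtain ⟨x, rfl, rfl⟩ := M.esurj u v huv
      refine ⟨_, M.bdy_edge x, ?_⟩
      rw [pr_add_left, e2, e2, s0, s0, s1, s1, M.inv]
      simp only [M.Fk0]
      by_cases hx : M.Fk B x
      · have := spec x hx hu hv
        by_cases h1 : M.fv x ∈ A
        · have h2 := this.1 h1
          simp [F2, h1, h2]
        · have h2 : M.fv (M.σ 0 x) ∉ A := fun h => h1 (this.2 h)
          simp [F2, h1, h2, hu, hv, hx, z2]
      · simp [hx]) hv1.1 hv2.1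
  have face : ∀ v ∈ C ∩ M.ball K X (m+1), ∃ x, M.fv x = v ∧ M.Fk B x := by
    rintro v ⟨hvC, h | ⟨-, x, y, h1, h2, h3⟩⟩
    · exact absurd h (hCB v hvC)
    · exact ⟨x, h1, y, h2, h3.symm⟩
  obtain ⟨x1, rfl, hx1⟩ := face v1 hv1
  obtain ⟨x2, rfl, hx2⟩ := face v2 hv2
  obtain ⟨Θ1, Y1, g1⟩ := S.gt (m := m) (a := .f (M.fc x1)) (Or.inr hx1)
  obtain ⟨Θ2, Y2, g2⟩ := S.gt (m := m) (a := .f (M.fc x2)) (Or.inr hx2)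
  have b1 : M.gem.Bdy (M.gem.ed 1 x1) (.f (M.fc x1)) (.v (M.fv x1)) := bdy_ed 1 x1
  have b2 : M.gem.Bdy (M.gem.ed 1 x2) (.f (M.fc x2)) (.v (M.fv x2)) := bdy_ed 1 x2
  have hw := ((((hp.add b2.symm).add g2.bdy).add g1.bdy.symm).add b1).ev
  have := S.region hm hsh.ev hsup hw s' hsh
  rw [← hts] at this
  simp only [pr_add_left, hp0, e1, zR' _ g1.supR, zR' _ g2.supR, s2, s0] at this
  rw [if_pos ⟨hx2, hv2.1, hv2A⟩, if_neg (fun h => h.2.2 hv1A)] at this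
  simp at this

end Stp

end

section

open SimpleGraph Set Gem

variable {V F : Type*} [Fintype V] [Fintype F] {G : SimpleGraph V}

/-- edges meeting `K` -/
def HK (G : SimpleGraph V) (K : Set V) : SimpleGraph V where
  Adj u v := G.Adj u v ∧ (u ∈ K ∨ v ∈ K)
  symm := ⟨fun _ _ h => ⟨h.1.symm, h.2.symm⟩⟩
  loopless := ⟨fun _ h => h.1.ne rfl⟩

/-- edges meeting `K` near `X` -/
def Mp.H0 (M : Mp G F) (K X : Set V) (r : ℕ) : SimpleGraph V where
  Adj u v := (u ∈ K ∨ v ∈ K) ∧ ∃ x, M.fv x = u ∧ M.fv (M.σ 0 x) = v ∧ M.Fk (M.ball K X (r-1)) x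
  symm := ⟨fun u v ⟨h1, x, h2, h3, h4⟩ => ⟨h1.symm, M.σ 0 x, h3, by rw [M.inv]; exact h2, (M.Fk0 _ x).2 h4⟩⟩
  loopless := ⟨fun u ⟨_, x, h2, h3, _⟩ => (M.adj x).ne (h2.trans h3.symm)⟩

theorem Mp.H0_le (M : Mp G F) (K X : Set V) (r : ℕ) : M.H0 K X r ≤ HK G K := fun u v ⟨h, x, h1, h2, _⟩ =>
  ⟨h1 ▸ h2 ▸ M.adj x, h⟩

namespace Stp
variable {M : Mp G F} {r : ℕ} {K X : Set V} {Z : Set (Nd V F)} {z0 : Nd V F} {T : Fin 3 → F → Prop} {q : V → M.gem.Cor Z}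

theorem hk_mem (S : Stp M r K X Z z0 T q) {u v : V} (h : (HK G K).Adj u v) : u ∈ K ∪ X := by
  by_cases hu : u ∈ K
  · exact Or.inl hu
  · exact Or.inr ((S.Xd u).2 ⟨hu, v, h.2.resolve_left hu, h.1.symm⟩)

theorem h0_ball (S : Stp M r K X Z z0 T q) {u v : V} (h : (M.H0 K X r).Adj u v) : u ∈ M.ball K X r := by
  rcases S.hk_mem (M.H0_le _ _ _ h) with hu | hu
  · obtain ⟨_, x, h2, h3, y, h4, h5⟩ := h
    have hr := S.hr
    obtain ⟨m, rfl⟩ : ∃ m, r = m + 1 := ⟨r - 1, by omega⟩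
    exact Or.inr ⟨hu, x, y, h2, h4, h5.symm⟩
  · exact M.ball_mono (Nat.zero_le r) hu

/-- the value of a special edge is a potential difference -/
theorem edge_val (S : Stp M r K X Z z0 T q) {w s : Ch F} (hsw : M.gem.Shade s w) {Θ : V → Ch F} {Y : V → Set V}
    (hΘ : ∀ v ∈ M.ball K X r, GT M X Z z0 (Z ∪ M.Tc (M.ball K X r)) r (.v v) (Θ v) (Y v)) {x : F}
    (h1 : M.fv x ∈ M.ball K X r) (h2 : M.fv (M.σ 0 x) ∈ M.ball K X r) (hx : M.Fk (M.ball K X (r-1)) x) :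
    M.gem.pr (M.gem.ed 2 x + M.gem.ed 2 (M.σ 0 x)) (tt s) =
      M.gem.pr (Θ (M.fv x)) (tt s) + M.gem.pr (Θ (M.fv (M.σ 0 x))) (tt s) := by
  have hr := S.hr
  obtain ⟨Θf, Yf, hf⟩ := S.gt (m := r-1) (a := .f (M.fc x)) (Or.inr hx)
  have key : ∀ y, M.fv y ∈ M.ball K X r → M.fc y = M.fc x → tt s 1 y = M.gem.pr Θf (tt s) + M.gem.pr (Θ (M.fv y)) (tt s) := by
    intro y hy hyx
    have hb := bdy_ed (M := M.gem) 1 y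
    have e1 : M.gem.nd (1+1) y = .f (M.fc x) := by show Nd.f (M.fc y) = _; rw [hyx]
    have e2 : M.gem.nd (1+2) y = .v (M.fv y) := rfl
    rw [e1, e2] at hb
    have := S.lemN2 hf (hΘ _ hy) (by omega) hb (sup_ed (by rw [e1]; exact Or.inr trivial)
      (by rw [e2]; exact union_subset_union_right _ (Nb_mono subset_union_right) (hΘ _ hy).mem)) hsw
    rwa [pr_ed _ _ _ (hsw.isCh_tt _ _)] at this
  have k1 := key x h1 rfl
  have k2 := key _ h2 (M.fc0 x)
  rw [pr_add_left, pr_ed _ _ _ (hsw.isCh_tt _ _), pr_ed _ _ _ (hsw.isCh_tt _ _)]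
  have t3 : ∀ y, tt s 2 y = tt s 0 y + tt s 1 y := fun y => by
    show s 0 y + s 1 y = (s 1 y + s 2 y) + (s 2 y + s 0 y)
    have := z2 (s 2 y); linear_combination -this
  have e0 : tt s 0 (M.σ 0 x) = tt s 0 x := hsw.isCh_tt 0 x
  rw [t3, t3, e0, k1, k2]
  have := z2 (tt s 0 x); have := z2 (M.gem.pr Θf (tt s))
  grind

/-- nodes for a connected set -/
def nodes (K A : Set V) : Set (Nd V F) := fun n => match n with
  | .v a => a ∈ A
  | .e a => Mt K a ∧ ∀ v ∈ a, v ∈ A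
  | .f _ => False

theorem nodes_disj {A C : Set V} (h : Disjoint A C) : Disjoint (nodes (F := F) K A) (nodes K C) := by
  rw [Set.disjoint_left]
  rintro (a | a | a) h1 h2
  · exact Set.disjoint_left.1 h h1 h2
  · obtain ⟨⟨v, hv, _⟩, h1⟩ := h1
    exact Set.disjoint_left.1 h (h1 v hv) (h2.2 v hv)
  · exact h1

theorem nodes_Z (S : Stp M r K X Z z0 T q) {A : Set V} (h : A ⊆ K ∪ X) : Disjoint (nodes K A) Z := by
  rw [Set.disjoint_left]
  rintro (a | a | a) h1 h2
  · rcases h h1 with h | h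
    · exact S.ZK a h h2
    · exact S.ZX a h h2
  · exact S.Ze a h1.1 h2
  · exact h1

theorem cn_sub (S : Stp M r K X Z z0 T q) {A : Set V} (hA : Cn (M.H0 K X r).Adj A) {x : V} (hx : x ∈ A) (hxX : x ∈ X) :
    A ⊆ M.ball K X r :=
  hA.2 (M.ball K X r) ⟨x, hx, M.ball_mono (Nat.zero_le r) hxX⟩ fun u _ v _ h _ => S.h0_ball h.symm

theorem sup_edge {A : Set V} {x : F} (h1 : M.fv x ∈ A) (h2 : M.fv (M.σ 0 x) ∈ A) (hK : M.fv x ∈ K ∨ M.fv (M.σ 0 x) ∈ K) :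
    M.gem.Sup (M.gem.ed 2 x + M.gem.ed 2 (M.σ 0 x)) (nodes K A) := by
  have e : ∀ v ∈ M.fe x, v = M.fv x ∨ v = M.fv (M.σ 0 x) := fun v hv => Sym2.mem_iff.1 hv
  have hm : Mt K (M.fe x) ∧ ∀ v ∈ M.fe x, v ∈ A := by
    constructor
    · rcases hK with h | h
      · exact ⟨_, Sym2.mem_mk_left _ _, h⟩
      · exact ⟨_, Sym2.mem_mk_right _ _, h⟩
    · intro v hv; rcases e v hv with rfl | rfl <;> assumption
  refine Sup.add (sup_ed h1 ?_) (sup_ed h2 ?_)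
  · exact hm
  · show Mt K (M.fe (M.σ 0 x)) ∧ ∀ v ∈ M.fe (M.σ 0 x), v ∈ A
    rw [M.fe0]; exact hm

/-- non-crossing in `H0` with respect to the contour -/
theorem noncross (S : Stp M r K X Z z0 T q) {m : ℕ} {e : ℕ → M.gem.Cor Z} (he : ∀ l, e (l+1) = cra (S.tree.b (e l)))
    (hinj : ∀ l < m, ∀ k < m, e l = e k → l = k) (hnb : ∀ l k, e l ≠ S.tree.b (e k))
    {xa xb xc xd : V} (ha : xa ∈ X) (hb : xb ∈ X) (hc : xc ∈ X) (hd : xd ∈ X) {a b c d : ℕ}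
    (ea : e a = q xa ∨ e a = S.tree.b (q xa)) (eb : e b = q xb ∨ e b = S.tree.b (q xb))
    (ec : e c = q xc ∨ e c = S.tree.b (q xc)) (ed : e d = q xd ∨ e d = S.tree.b (q xd))
    (hac : a < c) (hcb : c < b) (hbd : b < d) (hdm : d < m) {A C : Set V} (hA : Cn (M.H0 K X r).Adj A)
    (hC : Cn (M.H0 K X r).Adj C) (hAC : Disjoint A C) (haA : xa ∈ A) (hbA : xb ∈ A) (hcC : xc ∈ C) (hdC : xd ∈ C) : False := by
  classical
  obtain ⟨t, ht, hbt⟩ := S.theta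
  have hch : ∀ v, ∃ Θ Y, v ∈ M.ball K X r → GT M X Z z0 (Z ∪ M.Tc (M.ball K X r)) r (.v v) Θ Y := by
    intro a
    by_cases ha : a ∈ M.ball K X r
    · obtain ⟨Θ, Y, h, _⟩ := S.gtV r a ha; exact ⟨Θ, Y, fun _ => h⟩
    · exact ⟨0, ∅, fun h => absurd h ha⟩
  choose Θ Y hΘ using hch
  have hAb := S.cn_sub hA haA ha
  have hCb := S.cn_sub hC hcC hc
  -- the path in C
  obtain ⟨p2, hp2, hs2⟩ := chain_of_cn (M := M.gem) hC (fun v => Nd.v v) (Φ := fun p => M.gem.Sup p (nodes K C)) sup_zero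
    (fun p p' h h' => h.add h') (by
      rintro u hu v hv ⟨hK, x, rfl, rfl, hx⟩
      exact ⟨_, M.bdy_edge x, sup_edge hu hv hK⟩) hcC hdC
  have bd : ∀ x ∈ X, M.gem.Bdy ((q x).eps + t x) (.v x) z0 := fun x hx => by
    have := hbt x; rwa [S.hq x hx] at this
  have hw : M.gem.Ev (p2 + (q xc).eps + (q xd).eps + (t xc + t xd)) := by
    have := ((hp2.add (bd xd hd)).add (bd xc hc).symm).ev
    convert this using 1; abel
  obtain ⟨s, hsw⟩ := hw.shade
  have gt0 : ∀ x ∈ X, M.gem.pr ((q x).eps + t x) (tt s) = M.gem.pr (Θ x) (tt s) := by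
    intro v hv
    have hs : ∀ R : Set (Nd V F), .v v ∈ R → M.gem.Sup ((q v).eps + t v) (Z ∪ R) := by
      intro R hR
      refine Sup.add ((q v).sup_eps (Or.inl (q v).2.2) ?_) (fun k x h i hi => Or.inl (S.tree.ends k x (ht v k x h) i hi))
      rw [S.hq v hv]; exact Or.inr hR
    have g0 : GT M X Z z0 (Z ∪ M.Tc X) 0 (.v v) ((q v).eps + t v) {v} := by
      refine ⟨bd v hv, hs _ rfl, hs _ hv, Or.inr rfl, ?_, ?_⟩
      · rw [diff_eq_empty.2 (singleton_subset_iff.2 (show v ∈ X from hv))]; simp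
      · exact (ncard_le_ncard inter_subset_left (toFinite _)).trans (by simp)
    have := S.lemN2 g0 (hΘ v (M.ball_mono (Nat.zero_le r) hv)) (by have := S.hr; omega) (bdy_zero _) sup_zero hsw
    rw [pr_zero_left] at this
    exact z2e.1 this.symm
  obtain ⟨p1, hp1, hs1, hv1⟩ := chain_of_cn (M := M.gem) hA (fun v => Nd.v v)
    (Φ := fun p => M.gem.Sup p (nodes K A) ∧ M.gem.pr p (tt s) = M.gem.pr p (M.gem.cob fun n => match n with
      | .v v => M.gem.pr (Θ v) (tt s)
      | _ => 0)) ⟨sup_zero, by simp⟩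
    (fun p p' h h' => ⟨h.1.add h'.1, by rw [pr_add_left, pr_add_left, h.2, h'.2]⟩) (by
      rintro u hu v hv ⟨hK, x, rfl, rfl, hx⟩
      refine ⟨_, M.bdy_edge x, sup_edge hu hv hK, ?_⟩
      rw [(M.bdy_edge x).2]
      exact S.edge_val hsw hΘ (hAb hu) (hAb hv) hx) haA hbA
  have hn : M.gem.Ev (p1 + (q xa).eps + (q xb).eps + (t xa + t xb)) := by
    have := ((hp1.add (bd xb hb)).add (bd xa ha).symm).ev
    convert this using 1; abel
  rw [hp1.2] at hv1
  refine Tree.cross S.tree he hinj hnb ea eb ec ed hac hcb hbd hdm (nodes_disj (K := K) hAC)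
    (S.nodes_Z (hAb.trans M.ball_sub)) (S.nodes_Z (hCb.trans M.ball_sub))
    (by rw [S.hq _ ha]; exact haA) (by rw [S.hq _ hb]; exact hbA) (by rw [S.hq _ hc]; exact hcC) (by rw [S.hq _ hd]; exact hdC)
    hs1 hs2 (t1 := t xa + t xb) (t2 := t xc + t xd) ?_ ?_ rfl rfl hn hw ?_
  · intro k x h
    by_cases h0 : t xa k x = 0
    · exact ht xb k x (by rwa [Pi.add_apply, Pi.add_apply, h0, zero_add] at h)
    · exact ht xa k x h0
  · intro k x h
    by_cases h0 : t xc k x = 0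
    · exact ht xd k x (by rwa [Pi.add_apply, Pi.add_apply, h0, zero_add] at h)
    · exact ht xc k x h0
  · refine Perp.symm hw (perp_of hsw hn ?_)
    have g1 := gt0 xa ha
    have g2 := gt0 xb hb
    rw [pr_add_left] at g1 g2
    simp only [pr_add_left]
    simp only at hv1
    rw [hv1, ← g1, ← g2]
    have := z2 (M.gem.pr (q xa).eps (tt s)); have := z2 (M.gem.pr (q xb).eps (tt s))
    have := z2 (M.gem.pr (t xa) (tt s)); have := z2 (M.gem.pr (t xb) (tt s))
    grind

end Stp

end

section

open SimpleGraph Set Gem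

variable {V F : Type*} [Fintype V] [Fintype F] {G : SimpleGraph V}

theorem HasMinor.mono {V W : Type*} {G G' : SimpleGraph V} {H : SimpleGraph W} (hle : G ≤ G') (h : HasMinor G H) : HasMinor G' H := by
  obtain ⟨φ, h1, h2, h3⟩ := h
  refine ⟨φ, fun w => (cn_iff_induce _ _).1 (((cn_iff_induce _ _).2 (h1 w)).mono fun x _ y _ h => hle h), h2, ?_⟩
  intro a b hab
  obtain ⟨x, hx, y, hy, h⟩ := h3 hab
  exact ⟨x, hx, y, hy, hle h⟩

/-- an empty layer -/
theorem exists_layer {V : Type*} [Finite V] (B : ℕ → Set V) (hB : ∀ m n, m ≤ n → B m ⊆ B n) (Y : Set V) (r : ℕ) (h : Y.ncard < r) :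
    ∃ m, m < r ∧ ∀ v ∈ Y, v ∈ B (m+1) → v ∈ B m := by
  classical
  by_contra hc
  push Not at hc
  have : ∀ m : Fin r, ∃ v, v ∈ Y ∧ v ∈ B (m+1) ∧ v ∉ B m := fun m => hc m m.2
  choose f h1 h2 h3 using this
  have hf : Function.Injective f := by
    intro a b hab
    by_contra hne
    rcases lt_or_gt_of_ne hne with h | h
    · exact h3 b (hB _ _ (show (a:ℕ) + 1 ≤ b from h) (hab ▸ h2 a))
    · exact h3 a (hB _ _ (show (b:ℕ) + 1 ≤ a from h) (hab ▸ h2 b))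
  have := ncard_le_ncard (s := range f) (t := Y) (by rintro _ ⟨m, rfl⟩; exact h1 m) (toFinite _)
  rw [← Nat.card_coe_set_eq, Nat.card_range_of_injective hf] at this
  simp at this
  omega

namespace Stp
variable {M : Mp G F} {r : ℕ} {K X : Set V} {Z : Set (Nd V F)} {z0 : Nd V F} {T : Fin 3 → F → Prop} {q : V → M.gem.Cor Z}

theorem labels (S : Stp M r K X Z z0 T q) : ∃ lb : ℕ → V, (∀ i < 4 * r, lb i ∈ X) ∧
    (∀ i < 4 * r, ∀ j < 4 * r, lb i = lb j → i = j) ∧ NCx (M.H0 K X r) (4 * r) lb := by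
  classical
  have hr := S.hr
  have hne : X.Nonempty := by
    rw [← ncard_pos (toFinite _), S.Xcard]; omega
  obtain ⟨x0, hx0⟩ := hne
  obtain ⟨m, e, he, hsurj, hinj, hnb⟩ := S.tree.contour (q x0)
  choose pos hpm hpe using fun x => hsurj (q x)
  have hT : ∀ x ∈ X, ¬ T (q x).1.2.2 (q x).1.1 := fun x hx h =>
    S.ZX x hx (S.hq x hx ▸ S.tree.ends _ _ h _ (th_spec (q x).2.1).2)
  have hout : ∀ x ∈ X, (e (pos x)).out = .v x := by
    intro x hx
    rcases hpe x with h | h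
    · rw [h, S.hq x hx]
    · rw [h, ← S.hq x hx]
      unfold Cor.out
      rw [S.tree.b_neg _ (hT x hx)]
      exact M.gem.nd_eq _ _ _ (th_spec (q x).2.1).2
  have pinj : ∀ x ∈ X, ∀ y ∈ X, pos x = pos y → x = y := by
    intro x hx y hy h
    have h1 := hout x hx
    rw [h, hout y hy] at h1
    injection h1 with h1; exact h1.symm
  have hcard : (X.toFinset.image pos).card = 4 * r := by
    rw [Finset.card_image_of_injOn, ← S.Xcard, ncard_eq_toFinset_card']
    intro x hx y hy; simp at hx hy; exact pinj x hx y hy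
  let em := (X.toFinset.image pos).orderEmbOfFin hcard
  have hg : ∀ i : Fin (4*r), ∃ x ∈ X, pos x = em i := fun i => by
    obtain ⟨x, hx, hxp⟩ := Finset.mem_image.1 (Finset.orderEmbOfFin_mem _ hcard i)
    exact ⟨x, by simpa using hx, hxp⟩
  choose g hgX hgp using hg
  refine ⟨fun i => if h : i < 4 * r then g ⟨i, h⟩ else x0, ?_, ?_, ?_⟩
  · intro i hi; simp only [dif_pos hi]; exact hgX _
  · intro i hi j hj h
    simp only [dif_pos hi, dif_pos hj] at h
    have := congrArg pos h
    rw [hgp, hgp] at this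
    simpa using em.injective this
  · intro a c b d hac hcb hbd hd A C hA hC hAC haA hbA hcC hdC
    have hb : b < 4 * r := hbd.trans hd
    have hc : c < 4 * r := hcb.trans hb
    have ha : a < 4 * r := hac.trans hc
    simp only [dif_pos ha, dif_pos hb, dif_pos hc, dif_pos hd] at haA hbA hcC hdC
    have mono : ∀ i j (hi : i < 4 * r) (hj : j < 4 * r), i < j → pos (g ⟨i, hi⟩) < pos (g ⟨j, hj⟩) := by
      intro i j hi hj hij
      rw [hgp, hgp]
      exact em.strictMono hij
    exact S.noncross he hinj hnb (hgX _) (hgX _) (hgX _) (hgX _) (hpe _) (hpe _) (hpe _) (hpe _)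
      (mono _ _ ha hc hac) (mono _ _ hc hb hcb) (mono _ _ hb hd hbd) (hpm _) hA hC hAC haA hbA hcC hdC

theorem reroute (S : Stp M r K X Z z0 T q) {Y P : Set V} (hY : Y.ncard < r) (hP : Cn (HK G K).Adj P) (hPX : (P ∩ X).Nonempty)
    (hd : Disjoint P Y) : ∃ P', Cn (M.H0 K X r).Adj P' ∧ P ∩ X ⊆ P' ∧ Disjoint P' Y := by
  classical
  obtain ⟨m, hm, hlay⟩ := exists_layer (M.ball K X) (fun _ _ h => M.ball_mono h) Y r hY
  set B := M.ball K X m with hB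
  have hXB : X ⊆ B := M.ball_mono (Nat.zero_le m)
  have hBr : B ⊆ M.ball K X (r-1) := M.ball_mono (by omega)
  have hPKX : P ⊆ K ∪ X := by
    obtain ⟨x, hx, hxX⟩ := hPX
    exact hP.2 _ ⟨x, hx, Or.inr hxX⟩ fun u _ v _ h _ => S.hk_mem h.symm
  have hPK : ∀ v ∈ P, v ∉ B → v ∈ K := fun v hv hvB => (hPKX hv).resolve_right fun h => hvB (hXB h)
  have hs : ∀ a b, G.Adj a b → G.Adj b a := fun _ _ h => h.symm
  let C : V → Set V := fun v => cpt G.Adj (K \ B) v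
  have hCs : ∀ v, v ∈ K → v ∉ B → C v ⊆ K \ B := fun v h h' => cpt_sub ⟨h, h'⟩
  let Fv : V → Set V := fun v => C v ∩ M.ball K X (m+1)
  have near : ∀ u v, G.Adj u v → u ∈ K → v ∈ B → u ∈ M.ball K X (m+1) := by
    intro u v h hu hv
    obtain ⟨x, h1, h2⟩ := M.esurj u v h
    exact Or.inr ⟨hu, x, _, h1, h2.symm ▸ hv, (M.fc0 x).symm⟩
  have hadj : ∀ u v, (HK G K).Adj u v → u ∈ B → (M.H0 K X r).Adj u v := by
    intro u v h hu
    obtain ⟨x, h1, h2⟩ := M.esurj u v h.1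
    exact ⟨h.2, x, h1, h2, M.Fk_self (hBr (h1.symm ▸ hu))⟩
  have hFne : ∀ v ∈ P, v ∉ B → (Fv v).Nonempty := by
    intro v hv hvB
    by_contra hem
    rw [not_nonempty_iff_eq_empty] at hem
    have : P ⊆ C v := by
      refine hP.2 _ ⟨v, hv, mem_cpt_self v⟩ fun a ha b hb hab haC => ?_
      have haK := hCs v (hPK v hv hvB) hvB haC
      by_cases hbB : b ∈ B
      · exact absurd (show a ∈ Fv v from ⟨haC, near a b hab.1 haK.1 hbB⟩) (by rw [hem]; simp)
      · exact cpt_closed ⟨hPK v hv hvB, hvB⟩ haC ⟨hPK b hb hbB, hbB⟩ hab.1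
    obtain ⟨x, hx, hxX⟩ := hPX
    exact (hCs v (hPK v hv hvB) hvB (this hx)).2 (hXB hxX)
  have hFcn : ∀ v ∈ P, v ∉ B → Cn (M.H0 K X r).Adj (Fv v) := by
    intro v hv hvB
    have hvK : v ∈ K \ B := ⟨hPK v hv hvB, hvB⟩
    have := S.lemD (m := m) (C := C v) (by omega) (fun a ha => (hCs v hvK.1 hvB ha).1) (fun a ha => (hCs v hvK.1 hvB ha).2)
      (cpt_cn hs v) (fun a ha b hb hbB hab => cpt_closed hvK ha ⟨hb, hbB⟩ hab) (hFne v hv hvB)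
    refine this.mono ?_
    rintro a ha b hb ⟨x, h1, h2, y, h3, h4⟩
    exact ⟨Or.inl (hCs v hvK.1 hvB ha.1).1, x, h1, h2, y, hBr h3, h4⟩
  refine ⟨{z | (z ∈ P ∧ z ∈ B) ∨ ∃ p ∈ P, p ∉ B ∧ z ∈ Fv p}, ⟨?_, ?_⟩, ?_, ?_⟩
  · obtain ⟨x, hx, hxX⟩ := hPX
    exact ⟨x, Or.inl ⟨hx, hXB hxX⟩⟩
  · rintro Q ⟨u, hu, huQ⟩ hQ
    have hFQ : ∀ p ∈ P, p ∉ B → (∃ z ∈ Fv p, z ∈ Q) → Fv p ⊆ Q := fun p hp hpB h =>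
      (hFcn p hp hpB).2 Q h fun a ha b hb hab => hQ a (Or.inr ⟨p, hp, hpB, ha⟩) b (Or.inr ⟨p, hp, hpB, hb⟩) hab
    have key : P ⊆ {v | (v ∈ B ∧ v ∈ Q) ∨ (v ∉ B ∧ Fv v ⊆ Q)} := by
      refine hP.2 _ ?_ ?_
      · rcases hu with hu | ⟨p, hp, hpB, hu⟩
        · exact ⟨u, hu.1, Or.inl ⟨hu.2, huQ⟩⟩
        · exact ⟨p, hp, Or.inr ⟨hpB, hFQ p hp hpB ⟨u, hu, huQ⟩⟩⟩
      · intro a ha b hb hab haS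
        by_cases haB : a ∈ B
        · have haQ : a ∈ Q := haS.elim (fun h => h.2) fun h => absurd haB h.1
          by_cases hbB : b ∈ B
          · exact Or.inl ⟨hbB, hQ a (Or.inl ⟨ha, haB⟩) b (Or.inl ⟨hb, hbB⟩) (hadj a b hab haB) haQ⟩
          · have hbF : b ∈ Fv b := ⟨mem_cpt_self b, near b a hab.1.symm (hPK b hb hbB) haB⟩
            exact Or.inr ⟨hbB, hFQ b hb hbB ⟨b, hbF, hQ a (Or.inl ⟨ha, haB⟩) b (Or.inr ⟨b, hb, hbB, hbF⟩) (hadj a b hab haB) haQ⟩⟩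
        · have haQ : Fv a ⊆ Q := haS.elim (fun h => absurd h.1 haB) fun h => h.2
          by_cases hbB : b ∈ B
          · have haF : a ∈ Fv a := ⟨mem_cpt_self a, near a b hab.1 (hPK a ha haB) hbB⟩
            exact Or.inl ⟨hbB, hQ a (Or.inr ⟨a, ha, haB, haF⟩) b (Or.inl ⟨hb, hbB⟩) (hadj b a hab.symm hbB).symm (haQ haF)⟩
          · refine Or.inr ⟨hbB, ?_⟩
            have haK : a ∈ K \ B := ⟨hPK a ha haB, haB⟩
            have : C b = C a := cpt_eq hs haK (cpt_closed haK (mem_cpt_self a) ⟨hPK b hb hbB, hbB⟩ hab.1)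
            show C b ∩ _ ⊆ Q
            rw [this]; exact haQ
    rintro z (⟨hz, hzB⟩ | ⟨p, hp, hpB, hz⟩)
    · exact (key hz).elim (fun h => h.2) fun h => absurd hzB h.1
    · exact (key hp).elim (fun h => absurd h.1 hpB) fun h => h.2 hz
  · rintro x ⟨hx, hxX⟩
    exact Or.inl ⟨hx, hXB hxX⟩
  · rw [Set.disjoint_left]
    rintro z (⟨hz, hzB⟩ | ⟨p, hp, hpB, hz⟩) hzY
    · exact Set.disjoint_left.1 hd hz hzY
    · exact (hCs p (hPK p hp hpB) hpB hz.1).2 (hlay z hzY hz.2)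

theorem concl (S : Stp M r K X Z z0 T q)
    (h : ∀ N N' : Set V, N ⊆ X → N' ⊆ X → N.ncard = r → N'.ncard = r → Disjoint N N' → ∀ Y : Set V, Y.ncard < r →
      ∃ P, Cn (HK G K).Adj P ∧ (P ∩ N).Nonempty ∧ (P ∩ N').Nonempty ∧ Disjoint P Y) : HasMinor G (gridGraph r) := by
  classical
  obtain ⟨lb, hlX, hli, hnc⟩ := S.labels
  let L : ℕ → Set V := fun k => (fun i => lb (k * r + i)) '' {i | i < r}
  have hlt : ∀ k < 4, ∀ i < r, k * r + i < 4 * r := by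
    intro k hk i hi
    have : (k + 1) * r ≤ 4 * r := Nat.mul_le_mul_right _ (by omega)
    linarith
  have hLX : ∀ k < 4, L k ⊆ X := by
    rintro k hk _ ⟨i, hi, rfl⟩
    exact hlX _ (hlt k hk i hi)
  have hLc : ∀ k < 4, (L k).ncard = r := by
    intro k hk
    rw [ncard_image_of_injOn]
    · have : {i | i < r} = ((Finset.range r : Finset ℕ) : Set ℕ) := by ext; simp
      rw [this, ncard_coe_finset, Finset.card_range]
    · intro i hi j hj hij
      have := hli _ (hlt k hk i hi) _ (hlt k hk j hj) hij
      omega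
  have hLd : ∀ k < 2, Disjoint (L k) (L (k+2)) := by
    intro k hk
    rw [Set.disjoint_left]
    rintro _ ⟨i, hi, rfl⟩ ⟨j, hj, hij⟩
    have := hli _ (hlt (k+2) (by omega) j hj) _ (hlt k (by omega) i hi) hij
    have hi : i < r := hi
    rw [add_mul] at this
    omega
  have hmen : ∀ k < 2, ∃ P : Fin r → Set V, (∀ i, Cn (M.H0 K X r).Adj (P i)) ∧ (∀ i, (P i ∩ L k).Nonempty) ∧
      (∀ i, (P i ∩ L (k+2)).Nonempty) ∧ Pairwise fun i j => Disjoint (P i) (P j) := by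
    intro k hk
    refine menger _ _ _ _ fun Y hY => ?_
    obtain ⟨P, h1, ⟨a, ha, haL⟩, ⟨b, hb, hbL⟩, h4⟩ := h (L k) (L (k+2)) (hLX k (by omega)) (hLX _ (by omega)) (hLc k (by omega)) (hLc _ (by omega)) (hLd k hk) Y hY
    obtain ⟨P', g1, g2, g3⟩ := S.reroute hY h1 ⟨a, ha, hLX k (by omega) haL⟩ h4
    exact ⟨P', g1, ⟨a, g2 ⟨ha, hLX k (by omega) haL⟩, haL⟩, ⟨b, g2 ⟨hb, hLX _ (by omega) hbL⟩, hbL⟩, g3⟩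
  obtain ⟨P, p1, p2, p3, p4⟩ := hmen 0 (by omega)
  obtain ⟨Q, q1, q2, q3, q4⟩ := hmen 1 (by omega)
  have ext : ∀ k (A : Set V), (A ∩ L k).Nonempty → ∃ i < r, lb (k * r + i) ∈ A := by
    rintro k A ⟨_, h, i, hi, rfl⟩; exact ⟨i, hi, h⟩
  refine HasMinor.mono ?_ (grid_of_links (M.H0 K X r) lb hnc P Q p1 (fun k => ?_) (fun k => ext 2 _ (p3 k)) p4 q1 (fun k => ?_) (fun k => ext 3 _ (q3 k)) q4)
  · exact fun u v huv => (M.H0_le _ _ _ huv).1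
  · simpa using ext 0 _ (p2 k)
  · simpa using ext 1 _ (q2 k)
end Stp

end

section

open SimpleGraph Set

namespace FlagSystem
variable (M : FlagSystem)

theorem orbit_ind {M : FlagSystem} {S : Set (Equiv.Perm M.F)} (hS : ∀ σ ∈ S, σ * σ = 1) (P : M.F → Prop)
    (hP : ∀ σ ∈ S, ∀ z, P z → P (σ z)) {x y : M.F} (h : M.SameOrbit S x y) (hx : P x) : P y := by
  obtain ⟨g, hg, rfl⟩ := h
  have : ∀ z, P z ↔ P (g z) := by
    induction hg using Subgroup.closure_induction with
    | mem σ h =>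
      intro z
      refine ⟨hP σ h z, fun h1 => ?_⟩
      have := hP σ h _ h1
      rwa [← Equiv.Perm.mul_apply, hS σ h] at this
    | one => intro z; rfl
    | mul a b _ _ h1 h2 => intro z; rw [Equiv.Perm.mul_apply, ← h1, ← h2]
    | inv a _ h1 => intro z; rw [h1 (a⁻¹ z)]; simp
  exact (this x).1 hx

theorem sameOrbit_gen {M : FlagSystem} {S : Set (Equiv.Perm M.F)} {σ : Equiv.Perm M.F} (h : σ ∈ S) (x : M.F) :
    M.SameOrbit S x (σ x) := ⟨σ, Subgroup.subset_closure h, rfl⟩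

/-- the quotient by orbits -/
abbrev Orb (S : Set (Equiv.Perm M.F)) := Quotient (MulAction.orbitRel (Subgroup.closure S) M.F)

theorem orb_eq {M : FlagSystem} {S : Set (Equiv.Perm M.F)} {x y : M.F} :
    (Quotient.mk _ x : M.Orb S) = Quotient.mk _ y ↔ M.SameOrbit S y x := by
  rw [Quotient.eq]
  constructor
  · rintro ⟨⟨g, hg⟩, h⟩; exact ⟨g, hg, h⟩
  · rintro ⟨g, hg, h⟩; exact ⟨⟨g, hg⟩, h⟩

/-- invariant functions -/
def Inv (S : Set (Equiv.Perm M.F)) : Submodule (ZMod 2) (M.F → ZMod 2) where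
  carrier := {φ | ∀ σ ∈ S, ∀ x, φ (σ x) = φ x}
  add_mem' := fun h h' σ hs x => by simp [h σ hs x, h' σ hs x]
  zero_mem' := fun σ hs x => rfl
  smul_mem' := fun a φ h σ hs x => by simp [h σ hs x]

theorem finrank_Inv {S : Set (Equiv.Perm M.F)} (hS : ∀ σ ∈ S, σ * σ = 1) : Module.finrank (ZMod 2) (M.Inv S) = M.numOrbits S := by
  classical
  haveI := M.fin
  let L : (M.Orb S → ZMod 2) →ₗ[ZMod 2] (M.F → ZMod 2) := LinearMap.funLeft _ _ (fun x => Quotient.mk _ x)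
  have hL : Function.Injective L := LinearMap.funLeft_injective_of_surjective _ _ _ Quotient.mk_surjective
  have hr : LinearMap.range L = M.Inv S := by
    ext φ
    constructor
    · rintro ⟨ψ, rfl⟩ σ hs x
      show ψ _ = ψ _
      congr 1
      exact (orb_eq.2 (sameOrbit_gen hs x))
    · intro h
      refine ⟨fun o => φ o.out, ?_⟩
      ext x
      show φ (Quotient.out (Quotient.mk _ x : M.Orb S)) = φ x
      have : M.SameOrbit S x (Quotient.out (Quotient.mk _ x : M.Orb S)) := orb_eq.1 (Quotient.out_eq _)
      exact orbit_ind hS (fun y => φ y = φ x) (fun σ hs z hz => by rw [h σ hs, hz]) this rfl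
  haveI : Finite (M.Orb S) := Quotient.finite _
  haveI : Fintype (M.Orb S) := Fintype.ofFinite _
  rw [← hr, LinearMap.finrank_range_of_inj hL, Module.finrank_fintype_fun_eq_card, numOrbits, Nat.card_eq_fintype_card]

theorem hS01 : ∀ σ ∈ ({M.σ₀, M.σ₁} : Set (Equiv.Perm M.F)), σ * σ = 1 := by
  rintro σ (rfl | rfl); exacts [M.inv₀, M.inv₁]
theorem hS02 : ∀ σ ∈ ({M.σ₀, M.σ₂} : Set (Equiv.Perm M.F)), σ * σ = 1 := by
  rintro σ (rfl | rfl); exacts [M.inv₀, M.inv₂]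
theorem hS12 : ∀ σ ∈ ({M.σ₁, M.σ₂} : Set (Equiv.Perm M.F)), σ * σ = 1 := by
  rintro σ (rfl | rfl); exacts [M.inv₁, M.inv₂]
theorem hS012 : ∀ σ ∈ ({M.σ₀, M.σ₁, M.σ₂} : Set (Equiv.Perm M.F)), σ * σ = 1 := by
  rintro σ (rfl | rfl | rfl); exacts [M.inv₀, M.inv₁, M.inv₂]

end FlagSystem

section
variable {V F : Type*} [Fintype V] [Fintype F] {G : SimpleGraph V}

theorem dg_add0 (γ γ' : Sym2 V → ZMod 2) (v : V) : dg (γ + γ') v = dg γ v + dg γ' v := by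
  classical
  simp only [dg, ← Finset.sum_add_distrib]
  apply Finset.sum_congr rfl
  intro e _
  split_ifs <;> simp

/-- the cycle space -/
def Zs (G : SimpleGraph V) : Submodule (ZMod 2) (Sym2 V → ZMod 2) where
  carrier := {γ | IsZ G γ}
  add_mem' := fun h h' => ⟨fun e he => by simp [h.1 e he, h'.1 e he], fun v => by rw [dg_add0, h.2, h'.2, add_zero]⟩
  zero_mem' := ⟨fun _ _ => rfl, fun v => by simp [dg]⟩
  smul_mem' := fun a γ h => ⟨fun e he => by simp [h.1 e he], fun v => by
    have := h.2 v
    simp only [dg, Pi.smul_apply, smul_eq_mul] at this ⊢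
    have h2 := congrArg (fun z => a * z) this
    simp only [Finset.mul_sum, mul_zero, mul_ite] at h2
    exact h2⟩

/-- the boundary space -/
def Mp.Bs (M : Mp G F) : Submodule (ZMod 2) (Sym2 V → ZMod 2) where
  carrier := {γ | M.IsB γ}
  add_mem' := by
    rintro γ γ' ⟨h, φ, h0, h1, h2⟩ ⟨h', φ', h0', h1', h2'⟩
    refine ⟨fun e he => by simp [h e he, h' e he], φ + φ', fun x => by simp [h0, h0'], fun x => by simp [h1, h1'], fun x => ?_⟩
    simp only [Pi.add_apply, h2, h2']; ring
  zero_mem' := ⟨fun _ _ => rfl, 0, fun _ => rfl, fun _ => rfl, fun _ => by simp⟩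
  smul_mem' := by
    rintro a γ ⟨h, φ, h0, h1, h2⟩
    refine ⟨fun e he => by simp [h e he], a • φ, fun x => by simp [h0], fun x => by simp [h1], fun x => ?_⟩
    simp only [Pi.smul_apply, h2, smul_add]

theorem Mp.Bs_le (M : Mp G F) : M.Bs ≤ Zs G := fun _ h => Mp.IsB.isZ M h
end

/-- dimension of the image of a subspace -/
theorem finrank_map_ker {U W : Type*} [AddCommGroup U] [Module (ZMod 2) U] [AddCommGroup W] [Module (ZMod 2) W]
    [FiniteDimensional (ZMod 2) U] (D : U →ₗ[ZMod 2] W) (A K : Submodule (ZMod 2) U) (hK : ∀ u ∈ A, D u = 0 → u ∈ K) :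
    Module.finrank (ZMod 2) A ≤ Module.finrank (ZMod 2) (A.map D) + Module.finrank (ZMod 2) K := by
  have h := LinearMap.finrank_range_add_finrank_ker (D.domRestrict A)
  rw [LinearMap.range_domRestrict] at h
  have : Module.finrank (ZMod 2) (LinearMap.ker (D.domRestrict A)) ≤ Module.finrank (ZMod 2) K := by
    refine LinearMap.finrank_le_finrank_of_injective (f := (A.subtype.domRestrict (LinearMap.ker (D.domRestrict A))).codRestrict K ?_) ?_
    · rintro ⟨⟨u, hu⟩, h⟩
      exact hK u hu h
    · rintro ⟨⟨a, ha⟩, h⟩ ⟨⟨b, hb⟩, h'⟩ hab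
      have := congrArg Subtype.val hab
      simpa using this
  omega

theorem finrank_le_of_inj {U W : Type*} [AddCommGroup U] [Module (ZMod 2) U] [AddCommGroup W] [Module (ZMod 2) W]
    [FiniteDimensional (ZMod 2) U] [FiniteDimensional (ZMod 2) W] (D : U →ₗ[ZMod 2] W) (A : Submodule (ZMod 2) U)
    (K : Submodule (ZMod 2) W) (hK : ∀ u ∈ A, D u ∈ K) (h0 : ∀ u ∈ A, D u = 0 → u = 0) :
    Module.finrank (ZMod 2) A ≤ Module.finrank (ZMod 2) K := by
  have h1 := finrank_map_ker D A ⊥ (fun u hu h => by simpa using h0 u hu h)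
  have h2 : A.map D ≤ K := by rintro _ ⟨u, hu, rfl⟩; exact hK u hu
  have h3 := Submodule.finrank_mono h2
  simp at h1
  omega

theorem FlagSystem.exists_mp {V : Type*} [Fintype V] {G : SimpleGraph V} (S : FlagSystem) (hS : S.Realizes G) :
    ∃ (_ : Fintype S.F) (M : Mp G S.F), S.nF ≤ Module.finrank (ZMod 2) M.Bs + S.nC ∧
      Module.finrank (ZMod 2) (Zs G) + S.nV ≤ S.nE + S.nC := by
  classical
  obtain ⟨fv, fe, hve, hv1, hv2, hv0, he0, he2, hvo, heo, hvs, hes⟩ := hS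
  haveI := S.fin
  have i0 : ∀ x, S.σ₀ (S.σ₀ x) = x := fun x => by rw [← Equiv.Perm.mul_apply, S.inv₀]; rfl
  have i1 : ∀ x, S.σ₁ (S.σ₁ x) = x := fun x => by rw [← Equiv.Perm.mul_apply, S.inv₁]; rfl
  have i2 : ∀ x, S.σ₂ (S.σ₂ x) = x := fun x => by rw [← Equiv.Perm.mul_apply, S.inv₂]; rfl
  have hfe : ∀ x, (fe x : Sym2 V) = s((fv x : V), (fv (S.σ₀ x) : V)) := by
    intro x
    have h1 := hve x
    have h2 := hve (S.σ₀ x)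
    rw [he0] at h2
    exact ((Sym2.mem_and_mem_iff (fun h => hv0 x (Subtype.ext h.symm))).1 ⟨h1, h2⟩)
  let M : Mp G S.F :=
    { σ := ![S.σ₀, S.σ₁, S.σ₂]
      inv := by intro k x; fin_cases k <;> simp [i0, i1, i2]
      fpf := by intro k x; fin_cases k <;> simp [S.fpf₀, S.fpf₁, S.fpf₂]
      comm := fun x => by
        show S.σ₀ (S.σ₂ x) = S.σ₂ (S.σ₀ x)
        rw [← Equiv.Perm.mul_apply, S.comm02]; rfl
      fv := fun x => (fv x : V)
      fv1 := fun x => congrArg Subtype.val (hv1 x)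
      fv2 := fun x => congrArg Subtype.val (hv2 x)
      adj := fun x => by
        have := (fe x).2
        rw [hfe] at this; exact this
      vorb := fun x y h P h1 h2 hx => by
        refine FlagSystem.orbit_ind S.hS12 P ?_ (hvo x y (Subtype.ext h)) hx
        rintro σ (rfl | rfl); exacts [h1, h2]
      eorb := fun x y h P h1 h2 hx => by
        refine FlagSystem.orbit_ind S.hS02 P ?_ (heo x y (Subtype.ext ?_)) hx
        · rintro σ (rfl | rfl); exacts [h1, h2]
        · rw [hfe, hfe]; exact h
      esurj := fun u v h => by
        obtain ⟨x, h1, h2⟩ := hes ⟨s(u, v), h⟩ u (Sym2.mem_mk_left _ _)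
        refine ⟨x, h2, ?_⟩
        have := hfe x
        rw [h1, h2] at this
        exact (Sym2.congr_right.1 this).symm }
  have hMfe : ∀ x, M.fe x = fe x := fun x => (hfe x).symm
  refine ⟨S.fin, M, ?_⟩
  -- boundaries
  have hB : S.nF ≤ Module.finrank (ZMod 2) M.Bs + S.nC := by
    let D : (S.F → ZMod 2) →ₗ[ZMod 2] (S.F → ZMod 2) := LinearMap.id + LinearMap.funLeft _ _ S.σ₂
    have hD : ∀ φ x, D φ x = φ x + φ (S.σ₂ x) := fun φ x => rfl
    let ρ : (Sym2 V → ZMod 2) →ₗ[ZMod 2] (S.F → ZMod 2) := LinearMap.funLeft _ _ M.fe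
    have h1 := finrank_map_ker D (S.Inv {S.σ₀, S.σ₁}) (S.Inv {S.σ₀, S.σ₁, S.σ₂}) (by
      intro φ h h0 σ hσ x
      rcases hσ with rfl | rfl | rfl
      · exact h _ (Or.inl rfl) x
      · exact h _ (Or.inr rfl) x
      · have := congrFun h0 x
        rw [hD] at this
        exact (z2e.1 this).symm)
    rw [S.finrank_Inv S.hS01, S.finrank_Inv S.hS012] at h1
    have h2 : (S.Inv {S.σ₀, S.σ₁}).map D ≤ M.Bs.map ρ := by
      rintro _ ⟨φ, hφ, rfl⟩
      have e0 : ∀ x, φ (S.σ₀ x) = φ x := fun x => hφ _ (Or.inl rfl) x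
      have e1 : ∀ x, φ (S.σ₁ x) = φ x := fun x => hφ _ (Or.inr rfl) x
      have hf : Function.FactorsThrough (D φ) M.fe := by
        intro x y hxy
        have c : S.σ₂ (S.σ₀ x) = S.σ₀ (S.σ₂ x) := (M.comm x).symm
        rcases M.eorb' hxy with rfl | h | h | h
        · rfl
        · have h : y = S.σ₀ x := h
          rw [h, hD, hD, c, e0, e0]
        · have h : y = S.σ₂ x := h
          rw [h, hD, hD, i2, add_comm]
        · have h : y = S.σ₀ (S.σ₂ x) := h
          rw [h, hD, hD, e0, ← c, i2, e0, add_comm]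
      refine ⟨Function.extend M.fe (D φ) 0, ⟨?_, φ, e0, e1, ?_⟩, ?_⟩
      · intro e he
        rw [Function.extend_apply']
        · rfl
        · rintro ⟨x, rfl⟩; exact he (M.fe_mem x)
      · intro x
        rw [hf.extend_apply]; rfl
      · ext x
        show Function.extend M.fe (D φ) 0 (M.fe x) = _
        rw [hf.extend_apply]
    have h3 := (Submodule.finrank_mono h2).trans (Submodule.finrank_map_le ρ M.Bs)
    exact h1.trans (Nat.add_le_add_right h3 _)
  -- cycles
  have hZ : Module.finrank (ZMod 2) (Zs G) + S.nV ≤ S.nE + S.nC := by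
    let A : Matrix G.edgeSet {v : V // ∃ e ∈ G.edgeSet, v ∈ e} (ZMod 2) := fun e v => if (v : V) ∈ (e : Sym2 V) then 1 else 0
    have cV : S.nV ≤ Fintype.card {v : V // ∃ e ∈ G.edgeSet, v ∈ e} := by
      rw [← Nat.card_eq_fintype_card]
      refine Nat.card_le_card_of_injective (fun o : S.Orb {S.σ₁, S.σ₂} => fv o.out) ?_
      intro a b hab
      have := hvo _ _ hab.symm
      have := FlagSystem.orb_eq.2 this
      rwa [Quotient.out_eq, Quotient.out_eq] at this
    have cE : Fintype.card G.edgeSet ≤ S.nE := by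
      rw [← Nat.card_eq_fintype_card]
      have : ∀ e : G.edgeSet, ∃ x, fe x = e := fun e => by
        obtain ⟨⟨a, b⟩, he⟩ := e
        obtain ⟨x, h, _⟩ := hes ⟨s(a, b), he⟩ a (Sym2.mem_mk_left _ _)
        exact ⟨x, h⟩
      choose fx hfx using this
      haveI : Finite (S.Orb {S.σ₀, S.σ₂}) := Quotient.finite _
      refine Nat.card_le_card_of_injective (fun e => (Quotient.mk _ (fx e) : S.Orb {S.σ₀, S.σ₂})) ?_
      intro a b hab
      have := FlagSystem.orb_eq.1 hab
      rw [← hfx a, ← hfx b]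
      refine FlagSystem.orbit_ind S.hS02 (fun y => fe y = fe (fx b)) ?_ this rfl
      rintro σ (rfl | rfl) z hz
      · rw [he0, hz]
      · rw [he2, hz]
    have k1 : Module.finrank (ZMod 2) (LinearMap.ker A.mulVecLin) ≤ S.nC := by
      rw [FlagSystem.nC, ← S.finrank_Inv S.hS012]
      let ρ : ({v : V // ∃ e ∈ G.edgeSet, v ∈ e} → ZMod 2) →ₗ[ZMod 2] (S.F → ZMod 2) := LinearMap.funLeft _ _ fv
      have hρ : Function.Injective ρ := LinearMap.funLeft_injective_of_surjective _ _ _ hvs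
      refine finrank_le_of_inj ρ _ _ (fun y hy => ?_) fun y _ h => hρ (by rw [h, map_zero])
      have hy : ∀ e, ∑ v, A e v * y v = 0 := fun e => congrFun (LinearMap.mem_ker.1 hy) e
      rintro σ (rfl | rfl | rfl) x
      · have h1 := hy (fe x)
        have h2 : ∀ v, A (fe x) v * y v = if v = fv x ∨ v = fv (S.σ₀ x) then y v else 0 := by
          intro v
          have : (v : V) ∈ (fe x : Sym2 V) ↔ (v = fv x ∨ v = fv (S.σ₀ x)) := by
            rw [hfe, Sym2.mem_iff, Subtype.ext_iff, Subtype.ext_iff]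
          simp [A, this]
        simp only [h2] at h1
        rw [← Finset.sum_filter] at h1
        have h3 : Finset.univ.filter (fun v => v = fv x ∨ v = fv (S.σ₀ x)) = {fv x, fv (S.σ₀ x)} := by ext v; simp
        rw [h3, Finset.sum_pair (hv0 x).symm] at h1
        exact (z2e.1 h1).symm
      · show y _ = y _
        rw [hv1]
      · show y _ = y _
        rw [hv2]
    have k2 : Module.finrank (ZMod 2) (Zs G) ≤ Module.finrank (ZMod 2) (LinearMap.ker A.transpose.mulVecLin) := by
      let ρ : (Sym2 V → ZMod 2) →ₗ[ZMod 2] (G.edgeSet → ZMod 2) := LinearMap.funLeft _ _ Subtype.val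
      refine finrank_le_of_inj ρ _ _ (fun γ hγ => ?_) fun γ hγ h => ?_
      · rw [LinearMap.mem_ker]
        ext v
        show ∑ e : G.edgeSet, A e v * γ e = 0
        rw [← hγ.2 v, dg]
        have : ∀ e : Sym2 V, (if (v : V) ∈ e then γ e else 0) = if e ∈ G.edgeSet then (if (v : V) ∈ e then γ e else 0) else 0 := by
          intro e
          by_cases he : e ∈ G.edgeSet
          · rw [if_pos he]
          · rw [if_neg he, hγ.1 e he, ite_self]
        rw [Finset.sum_congr rfl (fun e _ => this e), ← Finset.sum_filter, Finset.sum_subtype (p := fun e => e ∈ G.edgeSet) _ (by simp)]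
        apply Finset.sum_congr rfl
        intro e _
        simp [A]
      · ext e
        by_cases he : e ∈ G.edgeSet
        · exact congrFun h ⟨e, he⟩
        · exact hγ.1 e he
    have r1 := LinearMap.finrank_range_add_finrank_ker A.mulVecLin
    have r2 := LinearMap.finrank_range_add_finrank_ker A.transpose.mulVecLin
    have r3 := A.rank_transpose
    rw [Module.finrank_fintype_fun_eq_card] at r1 r2
    simp only [Matrix.rank] at r3
    omega
  exact ⟨hB, hZ⟩

end

section

open SimpleGraph Set
universe w

section
variable {V : Type*} [Fintype V] {G : SimpleGraph V}

theorem Mp.del_one {F : Type w} [Fintype F] (M : Mp G F) (e : Sym2 V) : ∃ (F' : Type w) (_ : Fintype F') (M' : Mp (G.deleteEdges {e}) F'),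
    ∀ γ, M.IsB γ → γ e = 0 → M'.IsB γ := by
  classical
  have two : ∀ y z, M.fe y = e → M.fe z = e → M.fv y = M.fv z → z = y ∨ z = M.σ 2 y := fun y z h1 h2 h3 =>
    M.vorb_eq (h1.trans h2.symm) h3
  have skip : ∀ x, M.fe x ≠ e → M.fe (M.σ 1 x) = e → M.fe (M.σ 1 (M.σ 2 (M.σ 1 x))) ≠ e := by
    intro x h1 h2 h3
    rcases two (M.σ 1 x) _ h2 h3 (by simp only [M.fv1, M.fv2]) with h | h
    · have h4 := congrArg (M.σ 1) h
      rw [M.inv, M.inv] at h4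
      apply h1; rw [← h4, M.fe2, h2]
    · exact M.fpf 1 _ h
  let s1 : F → F := fun x => if M.fe (M.σ 1 x) = e then M.σ 1 (M.σ 2 (M.σ 1 x)) else M.σ 1 x
  have s1p : ∀ x, M.fe (M.σ 1 x) = e → s1 x = M.σ 1 (M.σ 2 (M.σ 1 x)) := fun x h => if_pos h
  have s1n : ∀ x, M.fe (M.σ 1 x) ≠ e → s1 x = M.σ 1 x := fun x h => if_neg h
  have s1m : ∀ x, M.fe x ≠ e → M.fe (s1 x) ≠ e := by
    intro x hx
    by_cases h : M.fe (M.σ 1 x) = e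
    · rw [s1p x h]; exact skip x hx h
    · rw [s1n x h]; exact h
  have s1i : ∀ x, M.fe x ≠ e → s1 (s1 x) = x := by
    intro x hx
    by_cases h : M.fe (M.σ 1 x) = e
    · rw [s1p x h, s1p _ (by rw [M.inv, M.fe2, h]), M.inv, M.inv, M.inv]
    · rw [s1n x h, s1n _ (by rw [M.inv]; exact hx), M.inv]
  have s1v : ∀ x, M.fv (s1 x) = M.fv x := by
    intro x
    by_cases h : M.fe (M.σ 1 x) = e
    · rw [s1p x h, M.fv1, M.fv2, M.fv1]
    · rw [s1n x h, M.fv1]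
  have s1f : ∀ x, s1 x ≠ x := by
    intro x
    by_cases h : M.fe (M.σ 1 x) = e
    · rw [s1p x h]
      intro h'
      have := congrArg (M.σ 1) h'
      rw [M.inv] at this
      exact M.fpf 2 _ this
    · rw [s1n x h]; exact M.fpf 1 x
  let F' := {x : F // M.fe x ≠ e}
  let t0 : F' → F' := fun x => ⟨M.σ 0 x.1, by rw [M.fe0]; exact x.2⟩
  let t1 : F' → F' := fun x => ⟨s1 x.1, s1m _ x.2⟩
  let t2 : F' → F' := fun x => ⟨M.σ 2 x.1, by rw [M.fe2]; exact x.2⟩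
  let M' : Mp (G.deleteEdges {e}) F' :=
    { σ := ![t0, t1, t2]
      inv := by
        intro k x; apply Subtype.ext
        fin_cases k
        · exact M.inv 0 x.1
        · exact s1i x.1 x.2
        · exact M.inv 2 x.1
      fpf := by
        intro k x h
        have h := congrArg Subtype.val h
        fin_cases k
        · exact M.fpf 0 x.1 h
        · exact s1f x.1 h
        · exact M.fpf 2 x.1 h
      comm := fun x => Subtype.ext (M.comm x.1)
      fv := fun x => M.fv x.1
      fv1 := fun x => s1v x.1
      fv2 := fun x => M.fv2 x.1
      adj := fun x => by
        rw [deleteEdges_adj]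
        exact ⟨M.adj x.1, fun h => x.2 h⟩
      vorb := by
        intro x y hxy P h1 h2 hx
        have h1 : ∀ z, P z → P (t1 z) := h1
        have h2 : ∀ z, P z → P (t2 z) := h2
        let Q : F → Prop := fun z => (∀ h : M.fe z ≠ e, P ⟨z, h⟩) ∧ (M.fe z = e →
          (∀ h : M.fe (M.σ 1 z) ≠ e, P ⟨_, h⟩) ∧ (∀ h : M.fe (M.σ 1 (M.σ 2 z)) ≠ e, P ⟨_, h⟩))
        have := M.vorb x.1 y.1 hxy Q ?_ ?_ ⟨fun _ => hx, fun h => absurd h x.2⟩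
        · exact this.1 y.2
        · rintro z ⟨q1, q2⟩
          by_cases hz : M.fe z = e
          · obtain ⟨q3, q4⟩ := q2 hz
            refine ⟨fun h => q3 h, fun h => ?_⟩
            constructor
            · intro h'; exact absurd hz (by rwa [M.inv] at h')
            · intro h'
              rcases two z (M.σ 1 z) hz h (by rw [M.fv1]) with h3 | h3
              · exact absurd h3 (M.fpf 1 z)
              · rw [h3, M.inv, h3, M.fe2] at h'; exact absurd hz h'
          · refine ⟨fun h => ?_, fun h => ⟨fun h' => ?_, fun h' => ?_⟩⟩
            · have := h1 _ (q1 hz)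
              have e1 : t1 ⟨z, hz⟩ = ⟨M.σ 1 z, h⟩ := Subtype.ext (s1n z h)
              rwa [e1] at this
            · have e1 : (⟨M.σ 1 (M.σ 1 z), h'⟩ : F') = ⟨z, hz⟩ := Subtype.ext (M.inv 1 z)
              rw [e1]; exact q1 hz
            · have := h1 _ (q1 hz)
              have e1 : t1 ⟨z, hz⟩ = ⟨_, h'⟩ := Subtype.ext (s1p z h)
              rwa [e1] at this
        · rintro z ⟨q1, q2⟩
          by_cases hz : M.fe z = e
          · obtain ⟨q3, q4⟩ := q2 hz
            refine ⟨fun h => absurd hz (by rwa [M.fe2] at h), fun h => ⟨q4, fun h' => ?_⟩⟩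
            have e1 : (⟨M.σ 1 (M.σ 2 (M.σ 2 z)), h'⟩ : F') = ⟨M.σ 1 z, by rwa [M.inv] at h'⟩ := Subtype.ext (by simp only [M.inv])
            rw [e1]; exact q3 _
          · exact ⟨fun h => h2 _ (q1 hz), fun h => absurd (by rwa [M.fe2] at h) hz⟩
      eorb := by
        intro x y hxy P h1 h2 hx
        have h1 : ∀ z, P z → P (t0 z) := h1
        have h2 : ∀ z, P z → P (t2 z) := h2
        have := M.eorb x.1 y.1 hxy (fun z => ∀ h : M.fe z ≠ e, P ⟨z, h⟩) ?_ ?_ (fun _ => hx)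
        · exact this y.2
        · exact fun z hz h => h1 _ (hz (by rwa [M.fe0] at h))
        · exact fun z hz h => h2 _ (hz (by rwa [M.fe2] at h))
      esurj := by
        intro u v huv
        rw [deleteEdges_adj] at huv
        obtain ⟨x, h1, h2⟩ := M.esurj u v huv.1
        refine ⟨⟨x, fun h => huv.2 ?_⟩, h1, h2⟩
        rw [← h, Mp.fe, h1, h2]; rfl }
  refine ⟨F', inferInstance, M', ?_⟩
  rintro γ ⟨hγ, φ, h0, h1, h2⟩ he
  refine ⟨fun a ha => ?_, fun x => φ x.1, fun x => h0 x.1, fun x => ?_, fun x => h2 x.1⟩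
  · by_cases h : a ∈ G.edgeSet
    · rw [edgeSet_deleteEdges] at ha
      have : a = e := by by_contra h'; exact ha ⟨h, h'⟩
      rw [this, he]
    · exact hγ a h
  · show φ (s1 x.1) = φ x.1
    by_cases h : M.fe (M.σ 1 x.1) = e
    · rw [s1p _ h, h1]
      have := h2 (M.σ 1 x.1)
      rw [h, he] at this
      rw [← z2e.1 this.symm, h1]
    · rw [s1n _ h, h1]

theorem Mp.del {F : Type w} [Fintype F] (M : Mp G F) {G' : SimpleGraph V} (hle : G' ≤ G) :
    ∃ (F' : Type w) (_ : Fintype F') (M' : Mp G' F'),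
    ∀ γ, M.IsB γ → (∀ e, e ∉ G'.edgeSet → γ e = 0) → M'.IsB γ := by
  classical
  induction hn : (G.edgeSet \ G'.edgeSet).ncard generalizing G F with
  | zero =>
    rw [ncard_eq_zero (toFinite _), diff_eq_empty, edgeSet_subset_edgeSet] at hn
    obtain rfl := le_antisymm hle hn
    exact ⟨F, inferInstance, M, fun γ h _ => h⟩
  | succ n ih =>
    obtain ⟨e, he, he'⟩ : (G.edgeSet \ G'.edgeSet).Nonempty := by
      rw [← ncard_pos (toFinite _)]; omega
    obtain ⟨F1, i1, M1, h1⟩ := M.del_one e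
    have hle1 : G' ≤ G.deleteEdges {e} := by
      rw [← edgeSet_subset_edgeSet, edgeSet_deleteEdges]
      intro a ha
      exact ⟨edgeSet_subset_edgeSet.2 hle ha, fun h => he' (h ▸ ha)⟩
    obtain ⟨F2, i2, M2, h2⟩ := ih M1 hle1 (by
      rw [edgeSet_deleteEdges, diff_diff_comm, ncard_diff_singleton_of_mem (show e ∈ G.edgeSet \ G'.edgeSet from ⟨he, he'⟩), hn]; rfl)
    exact ⟨F2, i2, M2, fun γ hB hγ => h2 γ (h1 γ hB (hγ e he')) hγ⟩

theorem Mp.del_rank {F : Type w} [Fintype F] (M : Mp G F) {G' : SimpleGraph V} (hle : G' ≤ G) {h : ℕ}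
    (hh : Module.finrank (ZMod 2) (Zs G) ≤ Module.finrank (ZMod 2) M.Bs + h)
    (hz : ¬ ∀ γ, IsZ G γ → ∃ γ' β, IsZ G' γ' ∧ M.IsB β ∧ γ = γ' + β) :
    ∃ (F' : Type w) (_ : Fintype F') (M' : Mp G' F') (h' : ℕ), h' < h ∧
      Module.finrank (ZMod 2) (Zs G') ≤ Module.finrank (ZMod 2) M'.Bs + h' := by
  obtain ⟨F', i', M', h1⟩ := M.del hle
  have hZ : Zs G' ≤ Zs G := fun γ h => ⟨fun e he => h.1 e fun h' => he (edgeSet_subset_edgeSet.2 hle h'), h.2⟩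
  have hlt : Zs G' ⊔ M.Bs < Zs G := by
    refine lt_of_le_of_ne (sup_le hZ M.Bs_le) fun heq => hz fun γ hγ => ?_
    have : γ ∈ Zs G' ⊔ M.Bs := by rw [heq]; exact hγ
    obtain ⟨a, ha, b, hb, rfl⟩ := Submodule.mem_sup.1 this
    exact ⟨a, b, ha, hb, rfl⟩
  have h2 := Submodule.finrank_lt_finrank_of_lt hlt
  have h3 := Submodule.finrank_sup_add_finrank_inf_eq (Zs G') M.Bs
  have h4 : Zs G' ⊓ M.Bs ≤ M'.Bs := fun γ hγ => h1 γ hγ.2 hγ.1.1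
  have h5 := Submodule.finrank_mono h4
  have h6 := Submodule.finrank_mono M'.Bs_le
  refine ⟨F', i', M', Module.finrank (ZMod 2) (Zs G') - Module.finrank (ZMod 2) M'.Bs, ?_, ?_⟩ <;> omega
end

end

section

open SimpleGraph Set

section
variable {V : Type*} [Fintype V] {G : SimpleGraph V}

def Bq (θ : ℕ) (E A : Set (Sym2 V)) : Prop := A = ∅ ∨ Br θ E A

theorem bd_union {E A B : Set (Sym2 V)} {W : Set V} (h1 : bd E A ⊆ W) (h2 : bd E B ⊆ W) : bd E (A ∪ B) ⊆ W := by
  rintro v ⟨⟨e, he | he, hv⟩, e', ⟨h3, h4⟩, hv'⟩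
  · exact h1 ⟨⟨e, he, hv⟩, e', ⟨h3, fun h => h4 (Or.inl h)⟩, hv'⟩
  · exact h2 ⟨⟨e, he, hv⟩, e', ⟨h3, fun h => h4 (Or.inr h)⟩, hv'⟩

theorem Bq.union {θ : ℕ} {E A B : Set (Sym2 V)} (hA : Bq θ E A) (hB : Bq θ E B) (hd : Disjoint A B)
    (hb : (bd E (A ∪ B)).ncard ≤ θ) : Bq θ E (A ∪ B) := by
  rcases hA with rfl | hA
  · rwa [empty_union]
  · rcases hB with rfl | hB
    · rw [union_empty]; exact Or.inr hA
    · exact Or.inr (Br.union A B hd hA hB hb)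

theorem Bq.sUnion {θ : ℕ} {E : Set (Sym2 V)} (W : Set V) (hW : W.ncard ≤ θ) (P : Set (Set (Sym2 V)))
    (hP : ∀ A ∈ P, Bq θ E A) (hb : ∀ A ∈ P, bd E A ⊆ W) (hd : ∀ A ∈ P, ∀ B ∈ P, A ≠ B → Disjoint A B) :
    Bq θ E (⋃₀ P) := by
  classical
  have hf : ({A | A ∈ P ∧ A ≠ ∅} : Set (Set (Sym2 V))).Finite := toFinite _
  have hU : ⋃₀ P = ⋃ A ∈ hf.toFinset, A := by
    ext e
    simp only [mem_sUnion, mem_iUnion, Finite.mem_toFinset, mem_setOf_eq, exists_prop]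
    constructor
    · rintro ⟨A, h1, h2⟩; exact ⟨A, ⟨h1, Set.Nonempty.ne_empty ⟨e, h2⟩⟩, h2⟩
    · rintro ⟨A, h1, h2⟩; exact ⟨A, h1.1, h2⟩
  rw [hU]
  rcases hf.toFinset.eq_empty_or_nonempty with h | h
  · left; rw [h]; simp
  · right
    refine Br.iUnion (toFinite W) hW _ h (fun A => A) ?_ ?_ ?_
    · intro A hA
      have hA := hf.mem_toFinset.1 hA
      exact (hP A hA.1).resolve_left hA.2
    · intro A hA
      exact hb A (hf.mem_toFinset.1 hA).1
    · intro A hA B hB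
      exact hd A (hf.mem_toFinset.1 hA).1 B (hf.mem_toFinset.1 hB).1

theorem bd_sUnion {E : Set (Sym2 V)} {W : Set V} {P : Set (Set (Sym2 V))} (hb : ∀ A ∈ P, bd E A ⊆ W) : bd E (⋃₀ P) ⊆ W := by
  rintro v ⟨⟨e, ⟨A, hA, he⟩, hv⟩, e', ⟨h3, h4⟩, hv'⟩
  exact hb A hA ⟨⟨e, he, hv⟩, e', ⟨h3, fun h => h4 ⟨A, hA, h⟩⟩, hv'⟩

theorem bd_single {E : Set (Sym2 V)} (e : Sym2 V) : bd E {e} ⊆ {v | v ∈ e} := by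
  rintro v ⟨⟨e', rfl, hv⟩, _⟩; exact hv

theorem sym2_card (e : Sym2 V) : ({v | v ∈ e} : Set V).ncard ≤ 2 := by
  induction e with | _ a b =>
  have : ({v | v ∈ s(a, b)} : Set V) = {a, b} := by ext v; simp
  rw [this]; exact (ncard_insert_le _ _).trans (by rw [ncard_singleton])

theorem Bq.single {θ : ℕ} (hθ : 2 ≤ θ) {E : Set (Sym2 V)} {e : Sym2 V} (he : e ∈ E) : Bq θ E {e} :=
  Or.inr (Br.single e he (((ncard_le_ncard (bd_single e)).trans (sym2_card e)).trans hθ))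

theorem Bq.two {θ : ℕ} {E : Set (Sym2 V)} (W1 W2 : Set V) (h1 : W1.ncard ≤ θ) (h2 : W2.ncard ≤ θ) (P : Set (Set (Sym2 V)))
    (hP : ∀ A ∈ P, Bq θ E A) (hb : ∀ A ∈ P, bd E A ⊆ W1 ∨ bd E A ⊆ W2) (hd : ∀ A ∈ P, ∀ B ∈ P, A ≠ B → Disjoint A B)
    (hU : (bd E (⋃₀ P)).ncard ≤ θ) : Bq θ E (⋃₀ P) := by
  classical
  have e1 : ⋃₀ P = ⋃₀ {A ∈ P | bd E A ⊆ W1} ∪ ⋃₀ {A ∈ P | ¬ bd E A ⊆ W1} := by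
    rw [← sUnion_union]; congr 1; ext A
    by_cases h : bd E A ⊆ W1 <;> simp [h]
  rw [e1] at hU ⊢
  refine Bq.union (Bq.sUnion W1 h1 _ (fun A h => hP A h.1) (fun A h => h.2) fun A h B h' => hd A h.1 B h'.1)
    (Bq.sUnion W2 h2 _ (fun A h => hP A h.1) (fun A h => (hb A h.1).resolve_left h.2) fun A h B h' => hd A h.1 B h'.1) ?_ hU
  rw [disjoint_sUnion_left]
  intro A hA
  rw [disjoint_sUnion_right]
  intro B hB
  exact hd A hA.1 B hB.1 fun h => hB.2 (h ▸ hA.2)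

/-- Lemma AT -/
theorem Bq.attach {θ θ' r : ℕ} {E E' L : Set (Sym2 V)} {Y : Set V} (hE' : E' ⊆ L) (hL : L ⊆ E)
    (hm : ∀ e ∈ L, e ∉ E' → Mt Y e) (hb : bd E L ⊆ Y) (hY : Y.ncard ≤ 4 * r) (hθ : θ' + 4 * r ≤ θ) (h2 : 2 ≤ θ')
    (h : Bq θ' E' E') : Bq θ E L := by
  classical
  have key : ∀ e, ∃ k : Sym2 V, e ∈ L → (e ∈ E' → k = e) ∧ (∀ v ∈ e, v ∈ Y ∨ v ∈ k) ∧
      (∀ v ∈ e, v ∉ Y → (∃ e' ∈ E', v ∈ e') → k ∈ E') ∧ (∀ v ∈ e, v ∉ Y → (¬ ∃ e' ∈ E', v ∈ e') → k = s(v, v)) := by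
    intro e
    by_cases heL : e ∈ L
    swap
    · exact ⟨e, fun h => absurd h heL⟩
    by_cases he : e ∈ E'
    · exact ⟨e, fun _ => ⟨fun _ => rfl, fun v h => Or.inr h, fun _ _ _ _ => he, fun v h1 _ h2 => absurd ⟨e, he, h1⟩ h2⟩⟩
    have huniq : ∀ v ∈ e, v ∉ Y → ∀ w ∈ e, w ∉ Y → w = v := by
      intro v hv hvY w hw hwY
      by_contra hne
      obtain ⟨y, hy, hyY⟩ := hm e heL he
      have : e = s(v, w) := ((Sym2.mem_and_mem_iff (Ne.symm hne)).1 ⟨hv, hw⟩)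
      rw [this, Sym2.mem_iff] at hy
      rcases hy with rfl | rfl
      · exact hvY hyY
      · exact hwY hyY
    by_cases hv : ∃ v ∈ e, v ∉ Y
    · obtain ⟨v, hv, hvY⟩ := hv
      by_cases h' : ∃ e' ∈ E', v ∈ e'
      · obtain ⟨k, hk, hvk⟩ := h'
        refine ⟨k, fun _ => ⟨fun h => absurd h he, fun w hw => ?_, fun w hw hwY _ => hk, fun w hw hwY hn => ?_⟩⟩
        · by_cases hwY : w ∈ Y
          · exact Or.inl hwY
          · rw [huniq v hv hvY w hw hwY]; exact Or.inr hvk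
        · rw [huniq v hv hvY w hw hwY] at hn; exact absurd ⟨k, hk, hvk⟩ hn
      · refine ⟨s(v, v), fun _ => ⟨fun h => absurd h he, fun w hw => ?_, fun w hw hwY hn => ?_, fun w hw hwY hn => ?_⟩⟩
        · by_cases hwY : w ∈ Y
          · exact Or.inl hwY
          · rw [huniq v hv hvY w hw hwY]; exact Or.inr (Sym2.mem_mk_left _ _)
        · rw [huniq v hv hvY w hw hwY] at hn; exact absurd hn h'
        · rw [huniq v hv hvY w hw hwY]
    · push Not at hv
      exact ⟨e, fun _ => ⟨fun _ => rfl, fun v h => Or.inr h, fun v h1 h2 => absurd (hv v h1) h2, fun v h1 h2 => absurd (hv v h1) h2⟩⟩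
  choose κ hκ using key
  let up : Set (Sym2 V) → Set (Sym2 V) := fun A => {e | e ∈ L ∧ κ e ∈ A}
  have hfib : ∀ k, ((bd E (up {k})).ncard ≤ θ) → Bq θ E (up {k}) := by
    intro k _
    have : up {k} = ⋃₀ ((fun e => ({e} : Set (Sym2 V))) '' up {k}) := by
      rw [sUnion_image]; ext e; simp
    rw [this]
    refine Bq.sUnion (Y ∪ {v | v ∈ k}) ?_ _ ?_ ?_ ?_
    · have := ncard_union_le Y {v | v ∈ k}
      have := sym2_card k
      omega
    · rintro _ ⟨e, he, rfl⟩
      exact Bq.single (by omega) (hL he.1)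
    · rintro _ ⟨e, he, rfl⟩
      refine (bd_single e).trans fun v hv => ?_
      rcases (hκ e he.1).2.1 v hv with h | h
      · exact Or.inl h
      · right; have h' : κ e = k := he.2
        rw [h'] at h; exact h
    · rintro _ ⟨e, he, rfl⟩ _ ⟨e', he', rfl⟩ hne
      exact disjoint_singleton.2 fun h => hne (by rw [h])
  have hbd : ∀ A ⊆ E', bd E (up A) ⊆ bd E' A ∪ Y := by
    rintro A hA v ⟨⟨e, ⟨heL, heA⟩, hv⟩, e', ⟨he'E, he'⟩, hv'⟩
    by_cases hvY : v ∈ Y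
    · exact Or.inr hvY
    have he'L : e' ∈ L := by
      by_contra h'; exact hvY (hb ⟨⟨e, heL, hv⟩, e', ⟨he'E, h'⟩, hv'⟩)
    have h1 := ((hκ e heL).2.1 v hv).resolve_left hvY
    have h2 := ((hκ e' he'L).2.1 v hv').resolve_left hvY
    have h3 := (hκ e' he'L).2.2.1 v hv' hvY ⟨_, hA heA, h1⟩
    exact Or.inl ⟨⟨_, heA, h1⟩, _, ⟨h3, fun h => he' ⟨he'L, h⟩⟩, h2⟩
  have hcard : ∀ A ⊆ E', (bd E' A).ncard ≤ θ' → (bd E (up A)).ncard ≤ θ := by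
    intro A hA h
    have := ncard_le_ncard (hbd A hA)
    have := ncard_union_le (bd E' A) Y
    omega
  have hup : ∀ A, Br θ' E' A → Bq θ E (up A) := by
    intro A hA
    induction hA with
    | single e he hb => exact hfib e (hcard _ (by simpa using he) hb)
    | union A B hd hA hB hb ihA ihB =>
      have e1 : up (A ∪ B) = up A ∪ up B := by
        ext e; simp only [up, mem_setOf_eq, mem_union]; tauto
      have h3 := hcard _ (union_subset hA.sub hB.sub) hb
      rw [e1] at h3 ⊢
      refine ihA.union ihB ?_ h3
      rw [Set.disjoint_left] at hd ⊢
      exact fun e h1 h2 => hd h1.2 h2.2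
  have hE'up : Bq θ E (up E') := by
    rcases h with h | h
    · left; rw [h]; simp [up]
    · exact hup _ h
  have hbE : bd E (up E') ⊆ Y := by
    refine (hbd E' subset_rfl).trans (union_subset ?_ subset_rfl)
    rintro v ⟨_, e, he, _⟩; exact absurd he.1 he.2
  have hbk : ∀ k, k ∉ E' → bd E (up {k}) ⊆ Y := by
    rintro k hk v ⟨⟨e, ⟨heL, heA⟩, hv⟩, e', ⟨he'E, he'⟩, hv'⟩
    have heA : κ e = k := heA
    by_contra hvY
    have he'L : e' ∈ L := by
      by_contra h'; exact hvY (hb ⟨⟨e, heL, hv⟩, e', ⟨he'E, h'⟩, hv'⟩)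
    have h1 : ¬ ∃ e' ∈ E', v ∈ e' := fun h => hk (heA ▸ (hκ e heL).2.2.1 v hv hvY h)
    refine he' ⟨he'L, ?_⟩
    show κ e' = k
    rw [← heA, (hκ e heL).2.2.2 v hv hvY h1, (hκ e' he'L).2.2.2 v hv' hvY h1]
  have hUn : L = ⋃₀ (insert (up E') ((fun k => up {k}) '' {k | k ∉ E'})) := by
    ext e
    simp only [sUnion_insert, sUnion_image, mem_union, mem_iUnion, exists_prop, mem_setOf_eq, up, mem_singleton_iff]
    by_cases h : κ e ∈ E' <;> simp [h]
  have hYθ : Y.ncard ≤ θ := by omega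
  rw [hUn]
  have hdk : ∀ k, k ∉ E' → Disjoint (up E') (up {k}) := by
    intro k hk
    rw [Set.disjoint_left]
    rintro e h1 h2
    have h2 : κ e = k := h2.2
    exact hk (h2 ▸ h1.2)
  refine Bq.sUnion Y hYθ _ ?_ ?_ ?_
  · rintro A (rfl | ⟨k, hk, rfl⟩)
    · exact hE'up
    · exact hfib k ((ncard_le_ncard (hbk k hk)).trans hYθ)
  · rintro A (rfl | ⟨k, hk, rfl⟩)
    · exact hbE
    · exact hbk k hk
  · rintro A (rfl | ⟨k, hk, rfl⟩) B (rfl | ⟨k', hk', rfl⟩) hne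
    · exact absurd rfl hne
    · exact hdk _ hk'
    · exact (hdk _ hk).symm
    · rw [Set.disjoint_left]
      rintro e h1 h2
      have h1 : κ e = k := h1.2
      have h2 : κ e = k' := h2.2
      exact hne (by rw [← h1, ← h2])

def eK (G : SimpleGraph V) (K : Set V) : Set (Sym2 V) := {e | e ∈ G.edgeSet ∧ Mt K e}
def nK (G : SimpleGraph V) (K : Set V) : Set V := {v | v ∉ K ∧ ∃ u ∈ K, G.Adj u v}

theorem bd_eK (K : Set V) : bd G.edgeSet (eK G K) ⊆ nK G K := by
  rintro v ⟨⟨e, ⟨heG, u, hue, huK⟩, hv⟩, e', ⟨he', hn⟩, hv'⟩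
  have hvK : v ∉ K := fun h => hn ⟨he', v, hv', h⟩
  refine ⟨hvK, u, huK, ?_⟩
  have : e = s(u, v) := (Sym2.mem_and_mem_iff (show u ≠ v from fun h => hvK (h ▸ huK))).1 ⟨hue, hv⟩
  rw [this] at heG; exact heG

theorem Bq.split {θ : ℕ} (hθ : 2 ≤ θ) (K Y W1 W2 : Set V) (h1 : W1.ncard ≤ θ) (h2 : W2.ncard ≤ θ) (hX : (nK G K).ncard ≤ θ)
    (hc : ∀ u ∈ K \ Y, Bq θ G.edgeSet (eK G (cpt G.Adj (K \ Y) u)) ∧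
      (nK G (cpt G.Adj (K \ Y) u) ⊆ W1 ∨ nK G (cpt G.Adj (K \ Y) u) ⊆ W2))
    (he : ∀ e ∈ eK G K, ¬ Mt (K \ Y) e → (∀ v ∈ e, v ∈ W1) ∨ (∀ v ∈ e, v ∈ W2)) : Bq θ G.edgeSet (eK G K) := by
  have hs : ∀ a b, G.Adj a b → G.Adj b a := fun a b h => h.symm
  have hcl : ∀ u ∈ K \ Y, ∀ e ∈ eK G (cpt G.Adj (K \ Y) u), ∀ v ∈ e, v ∈ K \ Y → v ∈ cpt G.Adj (K \ Y) u := by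
    rintro u hu e ⟨heG, w, hwe, hw⟩ v hv hvK
    by_cases hne : w = v
    · exact hne ▸ hw
    have : e = s(w, v) := (Sym2.mem_and_mem_iff hne).1 ⟨hwe, hv⟩
    rw [this] at heG
    exact cpt_closed hu hw hvK heG
  let P : Set (Set (Sym2 V)) := (fun u => eK G (cpt G.Adj (K \ Y) u)) '' (K \ Y) ∪
    (fun e => {e}) '' {e | e ∈ eK G K ∧ ¬ Mt (K \ Y) e}
  have hU : eK G K = ⋃₀ P := by
    ext e
    constructor
    · intro h
      by_cases hm : Mt (K \ Y) e
      · obtain ⟨v, hv, hvK⟩ := hm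
        exact ⟨_, Or.inl ⟨v, hvK, rfl⟩, h.1, v, hv, mem_cpt_self v⟩
      · exact ⟨_, Or.inr ⟨e, ⟨h, hm⟩, rfl⟩, rfl⟩
    · rintro ⟨_, ⟨u, hu, rfl⟩ | ⟨e', he', rfl⟩, h⟩
      · obtain ⟨hG, w, hwe, hw⟩ := h
        exact ⟨hG, w, hwe, (cpt_sub hu hw).1⟩
      · rw [mem_singleton_iff.1 h]; exact he'.1
  rw [hU]
  refine Bq.two W1 W2 h1 h2 P ?_ ?_ ?_ ?_
  · rintro _ (⟨u, hu, rfl⟩ | ⟨e', he', rfl⟩)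
    · exact (hc u hu).1
    · exact Bq.single hθ he'.1.1
  · rintro _ (⟨u, hu, rfl⟩ | ⟨e', he', rfl⟩)
    · exact (hc u hu).2.imp (bd_eK _).trans (bd_eK _).trans
    · exact (he e' he'.1 he'.2).imp (bd_single e').trans (bd_single e').trans
  · have hx : ∀ u ∈ K \ Y, ∀ e', ¬ Mt (K \ Y) e' → Disjoint (eK G (cpt G.Adj (K \ Y) u)) {e'} := by
      intro u hu e' he'
      rw [disjoint_singleton_right]
      rintro ⟨_, w, hwe, hw⟩
      exact he' ⟨w, hwe, cpt_sub hu hw⟩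
    rintro _ (⟨u, hu, rfl⟩ | ⟨e, he, rfl⟩) _ (⟨u', hu', rfl⟩ | ⟨e', he', rfl⟩) hne
    · rw [Set.disjoint_left]
      intro e h1 h2
      obtain ⟨v, hv, hv2⟩ := h2.2
      have h3 := hcl u hu e h1 v hv (cpt_sub hu' hv2)
      apply hne
      show eK G _ = eK G _
      rw [← cpt_eq hs hu h3, ← cpt_eq hs hu' hv2]
    · exact hx u hu e' he'.2
    · exact (hx u' hu' e he.2).symm
    · exact disjoint_singleton.2 fun h => hne (by rw [h])
  · rw [← hU]
    exact (ncard_le_ncard (bd_eK K)).trans hX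
end

end

section

open SimpleGraph Set Gem

section
variable {V F : Type*} [Fintype V] [Fintype F] {G : SimpleGraph V}

theorem Mp.ad_vf (M : Mp G F) (x : F) : M.gem.Ad (.v (M.fv x)) (.f (M.fc x)) := ⟨0, 2, x, by decide, rfl, rfl⟩
theorem Mp.ad_ef (M : Mp G F) (x : F) : M.gem.Ad (.e (M.fe x)) (.f (M.fc x)) := ⟨1, 2, x, by decide, rfl, rfl⟩
theorem Mp.ad_ve (M : Mp G F) {e : Sym2 V} (he : e ∈ G.edgeSet) {v : V} (hv : v ∈ e) : M.gem.Ad (.v v) (.e e) := by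
  obtain ⟨x, h1, h2⟩ := M.fesurj he hv
  exact ⟨0, 1, x, by decide, by rw [← h2]; rfl, by rw [← h1]; rfl⟩

structure Gd (M : Mp G F) (r : ℕ) (K : Set V) (Z : Set (Nd V F)) : Prop where
  cn : Cn G.Adj K
  card : (nK G K).ncard ≤ 4 * r
  zcn : Cn M.gem.Ad Z
  zk : ∀ v ∈ K ∪ nK G K, Nd.v v ∉ Z
  ze : ∀ e, Mt K e → Nd.e e ∉ Z
  xad : ∀ x ∈ nK G K, ∃ z ∈ Z, M.gem.Ad (.v x) z
  ex : ∃ w ∈ K ∪ nK G K, ∃ z ∈ Z, M.gem.Ad (.v w) z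

theorem comp_facts {K Y : Set V} {u : V} (hu : u ∈ K \ Y) : cpt G.Adj (K \ Y) u ⊆ K \ Y ∧ Cn G.Adj (cpt G.Adj (K \ Y) u) ∧
    nK G (cpt G.Adj (K \ Y) u) ⊆ (Y ∩ K) ∪ nK G K := by
  refine ⟨cpt_sub hu, cpt_cn (fun a b h => G.symm.symm a b h) u, ?_⟩
  rintro v ⟨hv, w, hw, hwv⟩
  by_cases hvK : v ∈ K
  · by_cases hvY : v ∈ Y
    · exact Or.inl ⟨hvY, hvK⟩
    · exact absurd (cpt_closed hu hw ⟨hvK, hvY⟩ hwv) hv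
  · exact Or.inr ⟨hvK, w, (cpt_sub hu hw).1, hwv⟩

theorem Gd.grow {M : Mp G F} {r : ℕ} {K : Set V} {Z : Set (Nd V F)} (h : Gd M r K Z) :
    ∃ Z', Gd M r K Z' ∧ ∃ v ∈ K, ∃ z ∈ Z', M.gem.Ad (.v v) z := by
  classical
  let A : Set (Nd V F) := {n | (∀ v ∈ K ∪ nK G K, n ≠ .v v) ∧ ∀ e, Mt K e → n ≠ .e e}
  obtain ⟨w, hw, z, hz, hwz⟩ := h.ex
  have hs : ∀ a b, M.gem.Ad a b → M.gem.Ad b a := fun a b h => h.symm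
  have hZA : Z ⊆ A := fun n hn => ⟨fun v hv h' => h.zk v hv (h' ▸ hn), fun e he h' => h.ze e he (h' ▸ hn)⟩
  have hzA := hZA hz
  have hsub : Z ⊆ cpt M.gem.Ad A z := cn_sub_cpt h.zcn hZA hz
  have hAs := cpt_sub (R := M.gem.Ad) hzA
  have hgd : Gd M r K (cpt M.gem.Ad A z) :=
    { cn := h.cn
      card := h.card
      zcn := cpt_cn hs z
      zk := fun v hv h' => (hAs h').1 v hv rfl
      ze := fun e he h' => (hAs h').2 e he rfl
      xad := fun x hx => (h.xad x hx).imp fun z hz => ⟨hsub hz.1, hz.2⟩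
      ex := ⟨w, hw, z, hsub hz, hwz⟩ }
  refine ⟨_, hgd, ?_⟩
  by_contra hno
  push Not at hno
  rcases hw with hw | hw
  · exact hno w hw z (hsub hz) hwz
  have hfA : ∀ x, Nd.f (M.fc x) ∈ A := fun x => ⟨fun v _ h => by simp at h, fun v _ h => by simp at h⟩
  -- an initial flag
  obtain ⟨x0, hx0, hf0⟩ : ∃ x, M.fv x = w ∧ Nd.f (M.fc x) ∈ cpt M.gem.Ad A z := by
    obtain ⟨i, j, x, hij, h1, h2⟩ := hwz
    have hzz := mem_cpt_self (R := M.gem.Ad) (A := A) z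
    have hi : i = 0 := by
      fin_cases i
      · rfl
      · simp at h1
      · simp at h1
    subst hi
    have h1 : M.fv x = w := by simpa using h1
    refine ⟨x, h1, ?_⟩
    fin_cases j
    · simp at hij
    · have h2 : Nd.e (M.fe x) = z := h2
      exact cpt_closed hzA hzz (hfA x) (h2 ▸ M.ad_ef x)
    · have h2 : Nd.f (M.fc x) = z := h2
      exact h2 ▸ hzz
  obtain ⟨hwK, u, hu, huw⟩ := hw
  obtain ⟨y, hy1, hy2⟩ := M.esurj w u huw.symm
  have key := M.vorb x0 y (hx0.trans hy1.symm) (fun x => M.fv x = w ∧ Nd.f (M.fc x) ∈ cpt M.gem.Ad A z) ?_ ?_ ⟨hx0, hf0⟩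
  · refine hno u hu _ key.2 ?_
    have := M.ad_vf (M.σ 0 y)
    rwa [hy2, M.fc0] at this
  · rintro x ⟨h1, h2⟩
    rw [M.fv1, M.fc1]; exact ⟨h1, h2⟩
  · rintro x ⟨h1, h2⟩
    refine ⟨by rw [M.fv2, h1], ?_⟩
    have hne : ¬ Mt K (M.fe x) := by
      rintro ⟨v, hv, hvK⟩
      rw [Mp.fe, Sym2.mem_iff, h1] at hv
      rcases hv with rfl | rfl
      · exact hwK hvK
      · refine hno _ hvK _ h2 ?_
        have := M.ad_vf (M.σ 0 x)
        rwa [M.fc0] at this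
    have heA : Nd.e (M.fe x) ∈ A := ⟨fun v _ h => by simp at h, fun e he h => hne (by simp at h; rwa [h])⟩
    have h3 := cpt_closed hzA h2 heA (M.ad_ef x).symm
    refine cpt_closed hzA h3 (hfA _) ?_
    have := M.ad_ef (M.σ 2 x)
    rwa [M.fe2] at this

theorem Gd.claim1 {M : Mp G F} {r θ : ℕ} {K : Set V} {Z : Set (Nd V F)} (h : Gd M r K Z) (hr : 1 ≤ r) (hθ : 4 * r ≤ θ)
    (ih : ∀ K' Z', K'.ncard < K.ncard → Gd M r K' Z' → Bq θ G.edgeSet (eK G K')) (hlt : (nK G K).ncard < 4 * r) :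
    Bq θ G.edgeSet (eK G K) := by
  obtain ⟨Z', h', v, hv, z, hz, hvz⟩ := h.grow
  have hW : (nK G K ∪ {v}).ncard ≤ 4 * r := by
    have := ncard_union_le (nK G K) {v}
    rw [ncard_singleton] at this; omega
  have hsub : ∀ u ∈ K \ {v}, nK G (cpt G.Adj (K \ {v}) u) ⊆ nK G K ∪ {v} := by
    intro u hu
    refine (comp_facts hu).2.2.trans ?_
    rintro a (⟨ha, _⟩ | ha)
    · exact Or.inr ha
    · exact Or.inl ha
  refine Bq.split (by omega) K {v} (nK G K ∪ {v}) (nK G K ∪ {v}) (hW.trans hθ) (hW.trans hθ) (h.card.trans hθ) ?_ ?_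
  · intro u hu
    obtain ⟨c1, c2, c3⟩ := comp_facts (G := G) hu
    have had : ∀ x ∈ nK G (cpt G.Adj (K \ {v}) u), ∃ z ∈ Z', M.gem.Ad (.v x) z := by
      intro x hx
      rcases hsub u hu hx with hx | rfl
      · exact h'.xad x hx
      · exact ⟨z, hz, hvz⟩
    refine ⟨ih _ Z' ?_ ?_, Or.inl (hsub u hu)⟩
    · exact ncard_lt_ncard ⟨fun a ha => (c1 ha).1, fun hn => (c1 (hn hv)).2 rfl⟩ (toFinite _)
    · refine ⟨c2, (ncard_le_ncard (hsub u hu)).trans hW, h'.zcn, ?_, ?_, had, ?_⟩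
      · rintro a (ha | ha)
        · exact h'.zk a (Or.inl (c1 ha).1)
        · rcases hsub u hu ha with ha | rfl
          · exact h'.zk a (Or.inr ha)
          · exact h'.zk _ (Or.inl hv)
      · rintro e ⟨a, ha, haC⟩
        exact h'.ze e ⟨a, ha, (c1 haC).1⟩
      · obtain ⟨a, ha, b, hb, hab⟩ := h.cn.cross (cpt G.Adj (K \ {v}) u) ⟨u, hu.1, mem_cpt_self u⟩ ⟨v, hv, fun hn => (c1 hn).2 rfl⟩
        have hbn : b ∈ nK G (cpt G.Adj (K \ {v}) u) := ⟨hb.2, a, ha.2, hab⟩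
        exact ⟨b, Or.inr hbn, had b hbn⟩
  · rintro e ⟨heG, a, hae, haK⟩ hn
    left
    have hav : a = v := by
      by_contra h'
      exact hn ⟨a, hae, haK, h'⟩
    subst hav
    intro b hb
    by_cases hba : b = a
    · exact Or.inr hba
    · left
      refine ⟨fun hbK => hn ⟨b, hb, hbK, hba⟩, a, haK, ?_⟩
      have : e = s(a, b) := (Sym2.mem_and_mem_iff (Ne.symm hba)).1 ⟨hae, hb⟩
      rw [this] at heG; exact heG
end

end

section

open SimpleGraph Set Gem

section
variable {V F : Type*} [Fintype V] [Fintype F] {G : SimpleGraph V}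

def RR (G : SimpleGraph V) (K Y S : Set V) : Set V :=
  {v | ∃ P, Cn (HK G K).Adj P ∧ v ∈ P ∧ (P ∩ S).Nonempty ∧ Disjoint P Y}

theorem RR.step {K Y S : Set V} {v w : V} (h : v ∈ RR G K Y S) (hw : w ∉ Y) (hvw : (HK G K).Adj v w) : w ∈ RR G K Y S := by
  obtain ⟨P, h1, h2, h3, h4⟩ := h
  have hs : ∀ a b, (HK G K).Adj a b → (HK G K).Adj b a := fun a b h => h.symm
  refine ⟨insert w P, h1.insert_adj hs h2 hvw, mem_insert _ _, ?_, ?_⟩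
  · exact h3.mono (inter_subset_inter_left _ (subset_insert _ _))
  · rw [Set.disjoint_left] at h4 ⊢
    rintro a (rfl | ha)
    · exact hw
    · exact h4 ha

theorem RR.notY {K Y S : Set V} {v : V} (h : v ∈ RR G K Y S) : v ∉ Y := by
  obtain ⟨P, h1, h2, h3, h4⟩ := h
  exact Set.disjoint_left.1 h4 h2

theorem RR.self {K Y S : Set V} {v : V} (h : v ∈ S) (hY : v ∉ Y) : v ∈ RR G K Y S :=
  ⟨{v}, Cn.sing v, rfl, ⟨v, rfl, h⟩, by rwa [Set.disjoint_singleton_left]⟩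

theorem Gd.half {M : Mp G F} {r : ℕ} {K : Set V} {Z : Set (Nd V F)} (h : Gd M r K Z) (hX : (nK G K).ncard = 4 * r)
    {S Y : Set V} (hS : S ⊆ nK G K) (hSr : S.ncard = r) (hY : Y.ncard < r)
    (hmin : ∀ y ∈ Y, y ∈ S ∨ ∃ w ∈ RR G K Y S, (HK G K).Adj y w) {u : V} (hu : u ∈ K \ Y)
    (hC : ∀ c ∈ cpt G.Adj (K \ Y) u, c ∉ RR G K Y S) : ∃ Z', (cpt G.Adj (K \ Y) u).ncard < K.ncard ∧
      Gd M r (cpt G.Adj (K \ Y) u) Z' ∧ nK G (cpt G.Adj (K \ Y) u) ⊆ Y ∪ (nK G K \ S) := by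
  classical
  have hs : ∀ a b, M.gem.Ad a b → M.gem.Ad b a := fun a b h => h.symm
  obtain ⟨c1, c2, c3⟩ := comp_facts (G := G) hu
  set C := cpt G.Adj (K \ Y) u with hCdef
  have hadj : ∀ c ∈ C, ∀ w ∈ RR G K Y S, ¬ G.Adj c w := by
    intro c hc w hw hcw
    refine hC c hc (RR.step hw (c1 hc).2 ⟨hcw.symm, Or.inr (c1 hc).1⟩)
  have hnR : ∀ x ∈ nK G C, x ∉ RR G K Y S := by
    rintro x ⟨_, c, hc, hcx⟩ hx
    exact hadj c hc x hx hcx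
  have hnS : nK G C ⊆ Y ∪ (nK G K \ S) := by
    intro x hx
    by_cases hxY : x ∈ Y
    · exact Or.inl hxY
    rcases c3 hx with hx' | hx'
    · exact absurd hx'.1 hxY
    · exact Or.inr ⟨hx', fun hxS => hnR x hx (RR.self hxS hxY)⟩
  have hdc : (nK G K \ S).ncard = 4 * r - r := by
    rw [ncard_diff hS, hX, hSr]
  have hcard : (nK G C).ncard ≤ 4 * r - 1 := by
    have h1 := ncard_le_ncard hnS
    have h2 := ncard_union_le Y (nK G K \ S)
    omega
  have hCK : C ⊂ K := by
    refine ssubset_iff_subset_ne.2 ⟨fun a ha => (c1 ha).1, fun he => ?_⟩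
    rw [he, hX] at hcard
    omega
  let Z' : Set (Nd V F) := Z ∪ {n | (∃ v ∈ RR G K Y S, n = .v v) ∨ ∃ e ∈ G.edgeSet, Mt (RR G K Y S) e ∧ n = .e e}
  have hZZ : Z ⊆ Z' := subset_union_left
  have hvZ : ∀ v ∈ RR G K Y S, Nd.v v ∈ Z' := fun v hv => Or.inr (Or.inl ⟨v, hv, rfl⟩)
  have heZ : ∀ e ∈ G.edgeSet, Mt (RR G K Y S) e → Nd.e e ∈ Z' := fun e he hm => Or.inr (Or.inr ⟨e, he, hm, rfl⟩)
  have hZcn : Cn M.gem.Ad Z' := by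
    obtain ⟨z0, hz0⟩ := h.zcn.1
    have hz0' := hZZ hz0
    have hsub : Z ⊆ cpt M.gem.Ad Z' z0 := cn_sub_cpt h.zcn hZZ hz0
    have hv : ∀ v ∈ RR G K Y S, Nd.v v ∈ cpt M.gem.Ad Z' z0 := by
      rintro v ⟨P, p1, p2, ⟨s, hsP, hsS⟩, p4⟩
      by_contra hv
      have hPR : ∀ a ∈ P, a ∈ RR G K Y S := fun a ha => ⟨P, p1, ha, ⟨s, hsP, hsS⟩, p4⟩
      obtain ⟨z, hz, hsz⟩ := h.xad s (hS hsS)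
      have hs0 : Nd.v s ∈ cpt M.gem.Ad Z' z0 := cpt_closed hz0' (hsub hz) (hvZ s (hPR s hsP)) hsz.symm
      obtain ⟨a, ⟨ha, ha'⟩, b, ⟨hb, hb'⟩, hab⟩ := p1.cross {a | Nd.v a ∈ cpt M.gem.Ad Z' z0} ⟨s, hsP, hs0⟩ ⟨v, p2, hv⟩
      have hedge : s(a, b) ∈ G.edgeSet := hab.1
      have h1 := cpt_closed hz0' ha' (heZ s(a, b) hedge ⟨a, Sym2.mem_mk_left _ _, hPR a ha⟩) (M.ad_ve hedge (Sym2.mem_mk_left _ _))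
      exact hb' (cpt_closed hz0' h1 (hvZ b (hPR b hb)) (M.ad_ve hedge (Sym2.mem_mk_right _ _)).symm)
    have : Z' = cpt M.gem.Ad Z' z0 := by
      apply Subset.antisymm _ (cpt_sub hz0')
      rintro n (hn | ⟨v, hvR, rfl⟩ | ⟨e, he, ⟨v, hve, hvR⟩, rfl⟩)
      · exact hsub hn
      · exact hv v hvR
      · exact cpt_closed hz0' (hv v hvR) (heZ e he ⟨v, hve, hvR⟩) (M.ad_ve he hve)
    rw [this]; exact cpt_cn hs z0
  have had : ∀ x ∈ nK G C, ∃ z ∈ Z', M.gem.Ad (.v x) z := by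
    intro x hx
    rcases c3 hx with hx' | hx'
    · rcases hmin x hx'.1 with hxS | ⟨w, hw, hxw⟩
      · obtain ⟨z, hz, h'⟩ := h.xad x (hS hxS)
        exact ⟨z, hZZ hz, h'⟩
      · have hedge : s(x, w) ∈ G.edgeSet := hxw.1
        exact ⟨_, heZ s(x, w) hedge ⟨w, Sym2.mem_mk_right _ _, hw⟩, M.ad_ve hedge (Sym2.mem_mk_left _ _)⟩
    · obtain ⟨z, hz, h'⟩ := h.xad x hx'
      exact ⟨z, hZZ hz, h'⟩
  refine ⟨Z', ncard_lt_ncard hCK (toFinite _), ⟨c2, hcard.trans (by omega), hZcn, ?_, ?_, had, ?_⟩, hnS⟩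
  · rintro v hv (hn | ⟨w, hw, hvw⟩ | ⟨e, he, _, hve⟩)
    · refine h.zk v ?_ hn
      rcases hv with hv | hv
      · exact Or.inl (c1 hv).1
      · rcases c3 hv with hv | hv
        · exact Or.inl hv.2
        · exact Or.inr hv
    · have hvw : v = w := by simpa using hvw
      subst hvw
      rcases hv with hv | hv
      · exact hC v hv hw
      · exact hnR v hv hw
    · simp at hve
  · rintro e ⟨a, hae, haC⟩ (hn | ⟨w, hw, hvw⟩ | ⟨e', he, ⟨w, hwe, hw⟩, hve⟩)
    · exact h.ze e ⟨a, hae, (c1 haC).1⟩ hn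
    · simp at hvw
    · have hve : e = e' := by simpa using hve
      subst hve
      have hne : a ≠ w := fun h => hC a haC (h ▸ hw)
      have : e = s(a, w) := (Sym2.mem_and_mem_iff hne).1 ⟨hae, hwe⟩
      rw [this] at he
      exact hadj a haC w hw he
  · obtain ⟨k, hk, hkC⟩ := exists_of_ssubset hCK
    obtain ⟨a, ha, b, hb, hab⟩ := h.cn.cross C ⟨u, hu.1, mem_cpt_self u⟩ ⟨k, hk, hkC⟩
    have hbn : b ∈ nK G C := ⟨hb.2, a, ha.2, hab⟩
    exact ⟨b, Or.inr hbn, had b hbn⟩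

/-- separation -/
theorem Gd.claim3 {M : Mp G F} {r θ : ℕ} {K : Set V} {Z : Set (Nd V F)} (h : Gd M r K Z) (hr : 1 ≤ r) (hθ : 4 * r ≤ θ)
    (hX : (nK G K).ncard = 4 * r)
    (ih : ∀ K' Z', K'.ncard < K.ncard → Gd M r K' Z' → Bq θ G.edgeSet (eK G K'))
    {N S : Set V} (hN : N ⊆ nK G K) (hS : S ⊆ nK G K) (hNr : N.ncard = r) (hSr : S.ncard = r) (hNS : Disjoint N S)
    {Y0 : Set V} (hY0 : Y0.ncard < r)
    (hsep0 : ¬ ∃ P, Cn (HK G K).Adj P ∧ (P ∩ N).Nonempty ∧ (P ∩ S).Nonempty ∧ Disjoint P Y0) :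
    Bq θ G.edgeSet (eK G K) := by
  classical
  have hs : ∀ a b, (HK G K).Adj a b → (HK G K).Adj b a := fun a b h => h.symm
  obtain ⟨Y, ⟨hY, hsep⟩, hmin⟩ : ∃ Y : Set V, (Y.ncard < r ∧
      ¬ ∃ P, Cn (HK G K).Adj P ∧ (P ∩ N).Nonempty ∧ (P ∩ S).Nonempty ∧ Disjoint P Y) ∧
      ∀ y ∈ Y, ∃ P, Cn (HK G K).Adj P ∧ (P ∩ N).Nonempty ∧ (P ∩ S).Nonempty ∧ Disjoint P (Y \ {y}) := by
    obtain ⟨Y, hY, hm⟩ := exists_min_image {Y : Set V | Y.ncard < r ∧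
      ¬ ∃ P, Cn (HK G K).Adj P ∧ (P ∩ N).Nonempty ∧ (P ∩ S).Nonempty ∧ Disjoint P Y} ncard (toFinite _) ⟨Y0, hY0, hsep0⟩
    refine ⟨Y, hY, fun y hy => ?_⟩
    by_contra hn
    have h1 := ncard_diff_singleton_lt_of_mem hy (toFinite _)
    have h2 := hm (Y \ {y}) ⟨h1.trans hY.1, hn⟩
    omega
  have hm : ∀ T : Set V, (∀ y ∈ Y, ∃ P, Cn (HK G K).Adj P ∧ (P ∩ T).Nonempty ∧ Disjoint P (Y \ {y}) ∧ ¬ Disjoint P Y) →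
      ∀ y ∈ Y, y ∈ T ∨ ∃ w ∈ RR G K Y T, (HK G K).Adj y w := by
    intro T hT y hy
    obtain ⟨P, p1, ⟨t, htP, htT⟩, p3, p4⟩ := hT y hy
    by_cases hyT : y ∈ T
    · exact Or.inl hyT
    right
    have hPy : ∀ a ∈ P, a ∈ Y → a = y := by
      intro a ha haY
      by_contra hne
      exact Set.disjoint_left.1 p3 ha ⟨haY, hne⟩
    have hyP : y ∈ P := by
      obtain ⟨a, ha, haY⟩ := Set.not_disjoint_iff.1 p4
      exact hPy a ha haY ▸ ha
    have ht : t ∈ P \ {y} := ⟨htP, fun h => hyT (mem_singleton_iff.1 h ▸ htT)⟩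
    have hCs := cpt_sub (R := (HK G K).Adj) ht
    obtain ⟨a, ⟨_, ha⟩, b, ⟨hb, hb'⟩, hab⟩ := p1.cross (cpt (HK G K).Adj (P \ {y}) t) ⟨t, htP, mem_cpt_self t⟩
      ⟨y, hyP, fun h => (hCs h).2 rfl⟩
    have hby : b = y := by
      by_contra hne
      exact hb' (cpt_closed ht ha ⟨hb, hne⟩ hab)
    subst hby
    refine ⟨a, ⟨_, cpt_cn hs t, ha, ⟨t, mem_cpt_self t, htT⟩, ?_⟩, hab.symm⟩
    rw [Set.disjoint_left]
    intro c hc hcY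
    exact (hCs hc).2 (hPy c (hCs hc).1 hcY)
  have hndis : ∀ y ∈ Y, ∃ P, Cn (HK G K).Adj P ∧ (P ∩ N).Nonempty ∧ (P ∩ S).Nonempty ∧ Disjoint P (Y \ {y}) ∧ ¬ Disjoint P Y := by
    intro y hy
    obtain ⟨P, p1, p2, p3, p4⟩ := hmin y hy
    exact ⟨P, p1, p2, p3, p4, fun h => hsep ⟨P, p1, p2, p3, h⟩⟩
  have hmN := hm N fun y hy => by
    obtain ⟨P, p1, p2, p3, p4, p5⟩ := hndis y hy; exact ⟨P, p1, p2, p4, p5⟩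
  have hmS := hm S fun y hy => by
    obtain ⟨P, p1, p2, p3, p4, p5⟩ := hndis y hy; exact ⟨P, p1, p3, p4, p5⟩
  have hW : ∀ T ⊆ nK G K, T.ncard = r → (Y ∪ (nK G K \ T)).ncard ≤ θ := by
    intro T hT hTr
    have h1 := ncard_union_le Y (nK G K \ T)
    have h2 : (nK G K \ T).ncard = 4 * r - r := by rw [ncard_diff hT, hX, hTr]
    omega
  refine Bq.split (by omega) K Y (Y ∪ (nK G K \ S)) (Y ∪ (nK G K \ N)) (hW S hS hSr) (hW N hN hNr) (by omega) ?_ ?_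
  · intro u hu
    obtain ⟨c1, c2, c3⟩ := comp_facts (G := G) hu
    by_cases hC : ∀ c ∈ cpt G.Adj (K \ Y) u, c ∉ RR G K Y S
    · obtain ⟨Z', h1, h2, h3⟩ := h.half hX hS hSr hY hmS hu hC
      exact ⟨ih _ Z' h1 h2, Or.inl h3⟩
    · push Not at hC
      obtain ⟨c, hc, P, p1, p2, p3, p4⟩ := hC
      obtain ⟨Z', h1, h2, h3⟩ := h.half hX hN hNr hY hmN hu (by
        rintro d hd ⟨Q, q1, q2, q3, q4⟩
        apply hsep
        have hCc : Cn (HK G K).Adj (cpt G.Adj (K \ Y) u) := c2.mono fun x hx y hy hxy => ⟨hxy, Or.inl (c1 hx).1⟩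
        refine ⟨(Q ∪ cpt G.Adj (K \ Y) u) ∪ P, (q1.union hCc ⟨d, q2, hd⟩).union p1 ⟨c, Or.inr hc, p2⟩, ?_, ?_, ?_⟩
        · exact q3.mono (inter_subset_inter_left _ (subset_union_left.trans subset_union_left))
        · exact p3.mono (inter_subset_inter_left _ subset_union_right)
        · rw [Set.disjoint_left]
          rintro a ((ha | ha) | ha)
          · exact Set.disjoint_left.1 q4 ha
          · exact (c1 ha).2
          · exact Set.disjoint_left.1 p4 ha)
      exact ⟨ih _ Z' h1 h2, Or.inr h3⟩
  · rintro e ⟨heG, a, hae, haK⟩ hn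
    have hY' : ∀ b ∈ e, b ∈ K → b ∈ Y := fun b hb hbK => by
      by_contra hbY; exact hn ⟨b, hb, hbK, hbY⟩
    have hX' : ∀ b ∈ e, b ∉ K → b ∈ nK G K := by
      intro b hb hbK
      refine ⟨hbK, a, haK, ?_⟩
      have : e = s(a, b) := (Sym2.mem_and_mem_iff (show a ≠ b from fun h => hbK (h ▸ haK))).1 ⟨hae, hb⟩
      rw [this] at heG; exact heG
    by_cases hex : ∃ b ∈ e, b ∈ S
    · right
      obtain ⟨b, hb, hbS⟩ := hex
      intro c hc
      by_cases hcK : c ∈ K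
      · exact Or.inl (hY' c hc hcK)
      · refine Or.inr ⟨hX' c hc hcK, fun hcN => ?_⟩
        have hab : a ≠ b := fun h => (hS hbS).1 (h ▸ haK)
        have : e = s(a, b) := (Sym2.mem_and_mem_iff hab).1 ⟨hae, hb⟩
        rw [this, Sym2.mem_iff] at hc
        rcases hc with rfl | rfl
        · exact hcK haK
        · exact Set.disjoint_left.1 hNS hcN hbS
    · left
      push Not at hex
      intro c hc
      by_cases hcK : c ∈ K
      · exact Or.inl (hY' c hc hcK)
      · exact Or.inr ⟨hX' c hc hcK, hex c hc⟩
end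

end

section

open SimpleGraph Set Gem
universe w

section
variable {V : Type*} [Fintype V] {G : SimpleGraph V}

theorem main_br (r : ℕ) (hr : 1 ≤ r) (h : ℕ) : ∀ (G : SimpleGraph V) (F : Type w) (_ : Fintype F) (M : Mp G F),
    Module.finrank (ZMod 2) (Zs G) ≤ Module.finrank (ZMod 2) M.Bs + h → ¬ HasMinor G (gridGraph r) →
    Bq (4 * r * (h + 1)) G.edgeSet G.edgeSet := by
  classical
  induction h using Nat.strong_induction_on with
  | _ h IH =>
  intro G F _ M hrank hmin
  by_contra hB
  set θ := 4 * r * (h + 1) with hθdef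
  have hθ : 4 * r ≤ θ := Nat.le_mul_of_pos_right _ (by omega)
  -- deletion
  have hdel : ∀ (G' : SimpleGraph V), G' ≤ G → (¬ ∀ γ, IsZ G γ → ∃ γ' β, IsZ G' γ' ∧ M.IsB β ∧ γ = γ' + β) →
      ∃ θ', θ' + 4 * r ≤ θ ∧ 2 ≤ θ' ∧ Bq θ' G'.edgeSet G'.edgeSet := by
    intro G' hle hz
    obtain ⟨F', i', M', h', hlt, hr'⟩ := M.del_rank hle hrank hz
    refine ⟨4 * r * (h' + 1), ?_, ?_, IH h' hlt G' F' i' M' hr' fun hh => hmin (hh.mono hle)⟩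
    · rw [hθdef, ← Nat.mul_succ]; exact Nat.mul_le_mul_left _ (by omega)
    · have : 4 * r ≤ 4 * r * (h' + 1) := Nat.le_mul_of_pos_right _ (by omega)
      omega
  have hstar : ∀ Y : Set V, Y.ncard ≤ 4 * r → ∀ γ, IsZ G γ →
    ∃ γ' β, IsZ G γ' ∧ M.IsB β ∧ γ = γ' + β ∧ ∀ e, Mt Y e → γ' e = 0 := by
    intro Y hY
    let G' := G.deleteEdges {e | Mt Y e}
    have hle : G' ≤ G := deleteEdges_le _
    have hE : G'.edgeSet = G.edgeSet \ {e | Mt Y e} := edgeSet_deleteEdges _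
    by_contra hn
    obtain ⟨θ', h1, h2, h3⟩ := hdel G' hle fun hz => hn fun γ hγ => by
      obtain ⟨γ', β, z1, z2, z3⟩ := hz γ hγ
      refine ⟨γ', β, ⟨fun e he => z1.1 e fun h' => he (edgeSet_subset_edgeSet.2 hle h'), z1.2⟩, z2, z3, fun e he => z1.1 e ?_⟩
      rw [hE]; exact fun h' => h'.2 he
    refine hB (Bq.attach (E' := G'.edgeSet) (Y := Y) (r := r) (edgeSet_subset_edgeSet.2 hle) subset_rfl ?_ ?_ hY h1 h2 h3)
    · intro e he he'
      by_contra hm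
      exact he' (by rw [hE]; exact ⟨he, hm⟩)
    · rintro v ⟨_, e, he, _⟩; exact absurd he.1 he.2
  have hfull : ∀ K : Set V, (nK G K).ncard ≤ 4 * r → Bq θ G.edgeSet (eK G K) ∨ ∀ γ, IsZ G γ →
      ∃ γ' β, IsZ G γ' ∧ M.IsB β ∧ γ = γ' + β ∧ ∀ e, γ' e ≠ 0 → ∀ v ∈ e, v ∈ K := by
    intro K hK
    let G' := G.deleteEdges {e | ∃ v ∈ e, v ∉ K}
    have hle : G' ≤ G := deleteEdges_le _
    have hE : G'.edgeSet = G.edgeSet \ {e | ∃ v ∈ e, v ∉ K} := edgeSet_deleteEdges _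
    by_contra hn
    push Not at hn
    obtain ⟨hn1, γ, hγ, hn2⟩ := hn
    obtain ⟨θ', h1, h2, h3⟩ := hdel G' hle fun hz => by
      obtain ⟨γ', β, z1, z2, z3⟩ := hz γ hγ
      obtain ⟨e, he, v, hv, hvK⟩ := hn2 γ' β ⟨fun e he => z1.1 e fun h' => he (edgeSet_subset_edgeSet.2 hle h'), z1.2⟩ z2 z3
      refine he (z1.1 e ?_)
      rw [hE]; exact fun h' => h'.2 ⟨v, hv, hvK⟩
    refine hn1 (Bq.attach (E' := G'.edgeSet) (Y := nK G K) (r := r) ?_ (fun e he => he.1) ?_ (bd_eK K) hK h1 h2 h3)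
    · intro e he
      rw [hE] at he
      obtain ⟨he1, he2⟩ := he
      refine ⟨he1, ?_⟩
      induction e with | _ a b =>
      refine ⟨a, Sym2.mem_mk_left _ _, ?_⟩
      by_contra ha
      exact he2 ⟨a, Sym2.mem_mk_left _ _, ha⟩
    · rintro e ⟨he, a, hae, haK⟩ he'
      have : ∃ v ∈ e, v ∉ K := by
        by_contra hm
        exact he' (by rw [hE]; exact ⟨he, hm⟩)
      obtain ⟨b, hb, hbK⟩ := this
      refine ⟨b, hb, hbK, a, haK, ?_⟩
      have : e = s(a, b) := (Sym2.mem_and_mem_iff (show a ≠ b from fun h => hbK (h ▸ haK))).1 ⟨hae, hb⟩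
      rw [this] at he; exact he
  have hall : ∀ n, ∀ K Z, K.ncard = n → Gd M r K Z → Bq θ G.edgeSet (eK G K) := by
    intro n
    induction n using Nat.strong_induction_on with
    | _ n ih =>
    intro K Z hKn hG
    have ih' : ∀ K' Z', K'.ncard < K.ncard → Gd M r K' Z' → Bq θ G.edgeSet (eK G K') :=
      fun K' Z' hlt h' => ih _ (hKn ▸ hlt) K' Z' rfl h'
    by_contra hnB
    have hX : (nK G K).ncard = 4 * r := by
      by_contra hne
      exact hnB (hG.claim1 hr hθ ih' (lt_of_le_of_ne hG.card hne))
    have hf := (hfull K hG.card).resolve_left hnB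
    obtain ⟨z0, hz0⟩ := hG.zcn.1
    obtain ⟨T, hT⟩ := M.gem.exists_tree hG.zcn hz0
    have hcor : ∀ x ∈ nK G K, ∃ p : M.gem.Cor Z, p.out = .v x := fun x hx => by
      obtain ⟨z, hz, hxz⟩ := hG.xad x hx
      exact Cor.of_ad hz hxz
    obtain ⟨x0, hx0⟩ : (nK G K).Nonempty := by
      rw [← ncard_pos (toFinite _)]; omega
    obtain ⟨p0, _⟩ := hcor x0 hx0
    have hq : ∀ x, ∃ p : M.gem.Cor Z, x ∈ nK G K → p.out = .v x := fun x => by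
      by_cases hx : x ∈ nK G K
      · obtain ⟨p, hp⟩ := hcor x hx; exact ⟨p, fun _ => hp⟩
      · exact ⟨p0, fun h => absurd h hx⟩
    choose q hq using hq
    have S : Stp M r K (nK G K) Z z0 T q :=
      { hr := hr
        Kcn := hG.cn
        Xd := fun v => Iff.rfl
        Xcard := hX
        tree := hT
        ZK := fun v hv => hG.zk v (Or.inl hv)
        ZX := fun v hv => hG.zk v (Or.inr hv)
        Ze := hG.ze
        hq := hq
        star := hstar
        full := hf }
    refine hmin (S.concl fun N N' hN hN' hNr hN'r hd Y hY => ?_)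
    by_contra hP
    exact hnB (hG.claim3 hr hθ hX ih' hN hN' hNr hN'r hd hY hP)
  have hs : ∀ a b, G.Adj a b → G.Adj b a := fun a b h => h.symm
  apply hB
  have hEE : G.edgeSet = eK G univ := by
    ext e
    refine ⟨fun he => ⟨he, ?_⟩, fun he => he.1⟩
    induction e with | _ a b => exact ⟨a, Sym2.mem_mk_left _ _, trivial⟩
  have hn0 : ∀ u, nK G (cpt G.Adj (univ \ ∅) u) = ∅ := by
    intro u
    rw [eq_empty_iff_forall_notMem]
    intro v hv
    rcases (comp_facts (G := G) (K := univ) (Y := ∅) (u := u) ⟨trivial, fun h => h⟩).2.2 hv with h | h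
    · exact h.1
    · exact h.1 trivial
  have hnu : nK G univ = ∅ := by
    rw [eq_empty_iff_forall_notMem]; exact fun v hv => hv.1 trivial
  have hfin : Bq θ G.edgeSet (eK G univ) := by
    refine Bq.split (by omega) univ ∅ ∅ ∅ (by simp) (by simp) (by simp [hnu]) ?_ ?_
    · intro u hu
      refine ⟨?_, Or.inl (by rw [hn0])⟩
      obtain ⟨c1, c2, c3⟩ := comp_facts (G := G) hu
      by_cases hne : eK G (cpt G.Adj (univ \ ∅) u) = ∅
      · exact Or.inl hne
      obtain ⟨e, he, v, hve, hvC⟩ := nonempty_iff_ne_empty.2 hne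
      obtain ⟨x, hx1, hx2⟩ := M.fesurj he hve
      refine hall _ _ {Nd.f (M.fc x)} rfl ⟨c2, by rw [hn0]; simp, Cn.sing _, ?_, ?_, ?_, ?_⟩
      · intro a _ h'; simp at h'
      · intro a _ h'; simp at h'
      · rw [hn0]; intro a ha; exact absurd ha (notMem_empty a)
      · exact ⟨v, Or.inl hvC, _, rfl, hx2 ▸ M.ad_vf x⟩
    · rintro e ⟨heG, a, hae, _⟩ hn
      exact absurd ⟨a, hae, trivial, fun h => h⟩ hn
  rwa [← hEE] at hfin
end

end

section

open SimpleGraph Set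
universe w

theorem rot_exists (α : Type*) [Fintype α] : ∃ ρ : Equiv.Perm α, ∀ P : α → Prop, (∀ x, P x → P (ρ x)) → ∀ a b, P a → P b := by
  classical
  obtain ⟨n, hn⟩ : ∃ n, n = Fintype.card α := ⟨_, rfl⟩
  rcases n with _ | m
  · haveI := Fintype.card_eq_zero_iff.1 hn.symm
    exact ⟨1, fun P _ a => isEmptyElim a⟩
  · let e : α ≃ ZMod (m + 1) := Fintype.equivOfCardEq (by rw [ZMod.card, ← hn])
    refine ⟨e.symm.permCongr (Equiv.addRight 1), fun P hP a b ha => ?_⟩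
    have h1 : ∀ k : ℕ, P (e.symm (e a + (k : ZMod (m + 1)))) := by
      intro k
      induction k with
      | zero => simpa using ha
      | succ k ih =>
        have := hP _ ih
        simp only [Equiv.permCongr_apply, Equiv.symm_symm, Equiv.apply_symm_apply, Equiv.coe_addRight] at this
        rwa [add_assoc, ← Nat.cast_succ] at this
    have := h1 (e b - e a).val
    rw [ZMod.natCast_zmod_val] at this
    simpa using this

theorem rot_fib {D V : Type*} [Fintype D] (p : D → V) : ∃ ρ : Equiv.Perm D, (∀ d, p (ρ d) = p d) ∧
    ∀ P : D → Prop, (∀ x, P x → P (ρ x)) → ∀ a b, p a = p b → P a → P b := by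
  classical
  choose R hR using fun v => rot_exists {d : D // p d = v}
  let ρ : Equiv.Perm D := (Equiv.sigmaFiberEquiv p).permCongr (Equiv.sigmaCongrRight R)
  have hρ : ∀ d, ρ d = (R (p d) ⟨d, rfl⟩).1 := fun d => rfl
  refine ⟨ρ, fun d => ?_, fun P hP a b hab ha => ?_⟩
  · rw [hρ]; exact (R (p d) ⟨d, rfl⟩).2
  · refine hR (p a) (fun x => P x.1) ?_ ⟨a, rfl⟩ ⟨b, hab.symm⟩ ha
    rintro ⟨d, hd⟩ h
    have h2 := hP d h
    rw [hρ] at h2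
    have : ∀ v (hv : p d = v), (R v ⟨d, hv⟩).1 = (R (p d) ⟨d, rfl⟩).1 := by
      rintro v rfl; rfl
    show P (R (p a) ⟨d, hd⟩).1
    rw [this]; exact h2

theorem exists_mp_graph {V : Type w} [Fintype V] (G : SimpleGraph V) :
    ∃ (D : Type w) (_ : Fintype D), Nonempty (Mp G D) := by
  classical
  let A := {p : V × V // G.Adj p.1 p.2}
  haveI : Fintype A := Fintype.ofFinite _
  obtain ⟨ρ, h1, h2⟩ := rot_fib (fun a : A => a.1.1)
  let sw : A → A := fun a => ⟨(a.1.2, a.1.1), a.2.symm⟩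
  let t0 : A × Bool → A × Bool := fun x => (sw x.1, x.2)
  let t2 : A × Bool → A × Bool := fun x => (x.1, !x.2)
  let t1 : A × Bool → A × Bool := fun x => if x.2 then (ρ x.1, false) else (ρ.symm x.1, true)
  have h1' : ∀ d, (ρ.symm d).1.1 = d.1.1 := fun d => by
    have := h1 (ρ.symm d)
    simp only [Equiv.apply_symm_apply] at this
    exact this.symm
  refine ⟨A × Bool, inferInstance, ⟨
    { σ := ![t0, t1, t2]
      inv := by
        intro k x
        obtain ⟨a, b⟩ := x
        fin_cases k
        · rfl
        · cases b <;> simp [t1]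
        · simp [t2]
      fpf := by
        intro k x
        obtain ⟨a, b⟩ := x
        fin_cases k
        · intro h
          have h : (sw a, b) = (a, b) := h
          have := congrArg (fun z : A × Bool => z.1.1.1) h
          exact a.2.ne this.symm
        · cases b <;> simp [t1]
        · simp [t2]
      comm := fun x => rfl
      fv := fun x => x.1.1.1
      fv1 := by
        rintro ⟨a, b⟩
        cases b
        · exact h1' a
        · exact h1 a
      fv2 := fun x => rfl
      adj := fun x => x.1.2
      vorb := by
        rintro ⟨a, b⟩ ⟨a', b'⟩ hab P p1 p2 hx
        have p1 : ∀ z, P z → P (t1 z) := p1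
        have p2 : ∀ z, P z → P (t2 z) := p2
        have hb : ∀ a b b', P (a, b) → P (a, b') := by
          intro a b b' h
          have := p2 _ h
          simp only [t2] at this
          cases b <;> cases b' <;> simp_all
        refine hb a' true b' (h2 (fun a => P (a, true)) ?_ a a' hab (hb a b true hx))
        intro c hc
        exact hb _ _ _ (p1 _ hc)
      eorb := by
        rintro ⟨a, b⟩ ⟨a', b'⟩ hab P p1 p2 hx
        have p1 : ∀ z, P z → P (t0 z) := p1
        have p2 : ∀ z, P z → P (t2 z) := p2
        have hb : ∀ a b b', P (a, b) → P (a, b') := by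
          intro a b b' h
          have := p2 _ h
          simp only [t2] at this
          cases b <;> cases b' <;> simp_all
        apply hb a' b b'
        have hab : s(a.1.1, a.1.2) = s(a'.1.1, a'.1.2) := hab
        rw [Sym2.eq_iff] at hab
        rcases hab with ⟨q1, q2⟩ | ⟨q1, q2⟩
        · have : a' = a := Subtype.ext (Prod.ext q1.symm q2.symm)
          rw [this]; exact hx
        · have : a' = sw a := Subtype.ext (Prod.ext q2.symm q1.symm)
          rw [this]; exact p1 _ hx
      esurj := fun u v h => ⟨((⟨(u, v), h⟩ : A), true), rfl, rfl⟩ }⟩⟩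

theorem sameOrbit_of (S : FlagSystem) (T : Set (Equiv.Perm S.F)) (x y : S.F)
    (h : ∀ P : S.F → Prop, (∀ σ ∈ T, ∀ z, P z → P (σ z)) → P x → P y) : S.SameOrbit T x y := by
  refine h (fun y => S.SameOrbit T x y) ?_ ⟨1, Subgroup.one_mem _, rfl⟩
  rintro σ hσ z ⟨g, hg, rfl⟩
  exact ⟨σ * g, Subgroup.mul_mem _ (Subgroup.subset_closure hσ) hg, rfl⟩

theorem Mp.realize {V D : Type*} [Fintype V] [Fintype D] {G : SimpleGraph V} (M : Mp G D) : ∃ S : FlagSystem, S.Realizes G := by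
  classical
  let e := Fintype.equivFin D
  let s : Fin 3 → Equiv.Perm (Fin (Fintype.card D)) := fun k =>
    { toFun := fun x => e (M.σ k (e.symm x))
      invFun := fun x => e (M.σ k (e.symm x))
      left_inv := fun x => by simp [M.inv]
      right_inv := fun x => by simp [M.inv] }
  have hs : ∀ k x, s k x = e (M.σ k (e.symm x)) := fun k x => rfl
  have hinv : ∀ k, s k * s k = 1 := fun k => Equiv.ext fun x => by
    rw [Equiv.Perm.mul_apply, hs, hs]; simp [M.inv]
  have hfpf : ∀ k x, s k x ≠ x := fun k x h => M.fpf k (e.symm x) (by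
    have := congrArg e.symm h
    rwa [hs, Equiv.symm_apply_apply] at this)
  let S : FlagSystem :=
    { F := Fin (Fintype.card D)
      fin := inferInstance
      σ₀ := s 0
      σ₁ := s 1
      σ₂ := s 2
      inv₀ := hinv 0
      inv₁ := hinv 1
      inv₂ := hinv 2
      fpf₀ := hfpf 0
      fpf₁ := hfpf 1
      fpf₂ := hfpf 2
      comm02 := Equiv.ext fun x => by
        simp only [Equiv.Perm.mul_apply, hs, Equiv.symm_apply_apply, M.comm]
      fpf02 := fun x h => by
        simp only [Equiv.Perm.mul_apply, hs, Equiv.symm_apply_apply, M.comm] at h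
        have h := congrArg e.symm h
        rw [Equiv.symm_apply_apply] at h
        have h := congrArg M.fv h
        rw [M.fv2] at h
        exact (M.adj _).ne h.symm }
  refine ⟨S, fun x => ⟨M.fv (e.symm x), M.fe (e.symm x), M.fe_mem _, M.fv_mem _⟩, fun x => ⟨M.fe (e.symm x), M.fe_mem _⟩,
    fun x => M.fv_mem _, fun x => Subtype.ext ?_, fun x => Subtype.ext ?_, fun x h => ?_, fun x => Subtype.ext ?_,
    fun x => Subtype.ext ?_, fun x y h => ?_, fun x y h => ?_, ?_, ?_⟩
  · show M.fv (e.symm (s 1 x)) = _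
    rw [hs, Equiv.symm_apply_apply, M.fv1]
  · show M.fv (e.symm (s 2 x)) = _
    rw [hs, Equiv.symm_apply_apply, M.fv2]
  · have h : M.fv (e.symm (s 0 x)) = M.fv (e.symm x) := congrArg Subtype.val h
    rw [hs, Equiv.symm_apply_apply] at h
    exact (M.adj _).ne h.symm
  · show M.fe (e.symm (s 0 x)) = _
    rw [hs, Equiv.symm_apply_apply, M.fe0]
  · show M.fe (e.symm (s 2 x)) = _
    rw [hs, Equiv.symm_apply_apply, M.fe2]
  · have h : M.fv (e.symm x) = M.fv (e.symm y) := congrArg Subtype.val h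
    apply sameOrbit_of
    intro P hP hx
    have := M.vorb _ _ h (fun z => P (e z)) (fun z hz => ?_) (fun z hz => ?_) (by simpa using hx)
    · simpa using this
    · have := hP _ (Or.inl rfl) _ hz
      have h2 : s 1 (e z) = e (M.σ 1 z) := by rw [hs, Equiv.symm_apply_apply]
      exact h2 ▸ this
    · have := hP _ (Or.inr rfl) _ hz
      have h2 : s 2 (e z) = e (M.σ 2 z) := by rw [hs, Equiv.symm_apply_apply]
      exact h2 ▸ this
  · have h : M.fe (e.symm x) = M.fe (e.symm y) := congrArg Subtype.val h
    apply sameOrbit_of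
    intro P hP hx
    have := M.eorb _ _ h (fun z => P (e z)) (fun z hz => ?_) (fun z hz => ?_) (by simpa using hx)
    · simpa using this
    · have := hP _ (Or.inl rfl) _ hz
      have h2 : s 0 (e z) = e (M.σ 0 z) := by rw [hs, Equiv.symm_apply_apply]
      exact h2 ▸ this
    · have := hP _ (Or.inr rfl) _ hz
      have h2 : s 2 (e z) = e (M.σ 2 z) := by rw [hs, Equiv.symm_apply_apply]
      exact h2 ▸ this
  · rintro ⟨v, a, ha, hv⟩
    obtain ⟨x, h1, h2⟩ := M.fesurj ha hv
    exact ⟨e x, Subtype.ext (by show M.fv (e.symm (e x)) = v; rw [Equiv.symm_apply_apply, h2])⟩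
  · rintro ⟨a, ha⟩ v hv
    obtain ⟨x, h1, h2⟩ := M.fesurj ha hv
    refine ⟨e x, Subtype.ext ?_, ?_⟩
    · show M.fe (e.symm (e x)) = a
      rw [Equiv.symm_apply_apply, h1]
    · show M.fv (e.symm (e x)) = v
      rw [Equiv.symm_apply_apply, h2]

theorem genus_nonempty {V : Type*} [Fintype V] (G : SimpleGraph V) :
    ∃ (S : FlagSystem) (g : ℕ), S.Realizes G ∧ g + S.nV + S.nF = 2 * S.nC + S.nE := by
  obtain ⟨D, i, ⟨M0⟩⟩ := exists_mp_graph G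
  obtain ⟨S, hS⟩ := M0.realize
  obtain ⟨i, M, h1, h2⟩ := S.exists_mp hS
  have h3 := Submodule.finrank_mono M.Bs_le
  exact ⟨S, 2 * S.nC + S.nE - S.nV - S.nF, hS, by omega⟩

end

/-- (Demaine–Fomin–Hajiaghayi–Thilikos) If `G` has Euler genus `g` and
`bw(G) > 4r(g+1)`, then `G` contains the `(r × r)`-grid as a minor. -/
theorem grid_minor_of_branchwidth_genus {V : Type u} [Fintype V] (G : SimpleGraph V)
    (r g : ℕ) (hr : 1 ≤ r) (hg : eulerGenus G = g)
    (hbw : 4 * r * (g + 1) < branchwidth G) :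
    HasMinor G (gridGraph r) := by
  by_contra hm
  subst hg
  obtain ⟨S0, g0, hS0, hg0⟩ := genus_nonempty G
  have hmem : eulerGenus G ∈ {g | ∃ M : FlagSystem, M.Realizes G ∧ g + M.nV + M.nF = 2 * M.nC + M.nE} :=
    Nat.sInf_mem ⟨g0, S0, hS0, hg0⟩
  obtain ⟨S, hS, heq⟩ := hmem
  obtain ⟨i, M, h1, h2⟩ := S.exists_mp hS
  rcases main_br r hr (eulerGenus G) G S.F i M (by omega) hm with h | h
  · rw [branchwidth_of_empty h] at hbw
    exact absurd hbw (Nat.not_lt_zero _)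
  · exact absurd hbw (not_lt.2 h.branchwidth_le)
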